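/- Let M be a positive integer and let ρ : ℕ → ℝ be a nonnegative, completely multiplicative function (ρ(1)=1 and ρ(mn)=ρ(m)ρ(n) for all m,n) which is frobenian with mean m(ρ) ≠ 0. Then there exist constants c > 0 and x₀ (depending on ρ and M) such that for all x ≥ x₀ one has ∑_{n ≤ x, n ≡ 1 (mod M)} ρ(n) ≥ c · x · (log x)^{m(ρ) − 1}. -/

import Mathlib

open NumberField

/-- `σ` is a Frobenius element at the rational prime `p`: there is a maximal ideal
`P` of the ring of integers of `K` containing `p` such that `σ(x) ≡ x^p (mod P)`
for all integers `x` of `K`. -/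
def IsFrobeniusAt (K : Type*) [Field K] [NumberField K] (σ : K ≃ₐ[ℚ] K) (p : ℕ) : Prop :=
  ∃ P : Ideal (𝓞 K), P.IsMaximal ∧ (p : 𝓞 K) ∈ P ∧
    ∀ x : 𝓞 K, ∃ y : 𝓞 K,
      algebraMap (𝓞 K) K y = σ (algebraMap (𝓞 K) K x) ∧ y - x ^ p ∈ P

set_option linter.unusedSectionVars false

section

open MeasureTheory Module Pointwise NumberField NumberField.InfinitePlace NumberField.Units
  NumberField.Units.dirichletUnitTheorem
open scoped Classical NNReal ENNReal nonZeroDivisors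

section LatticeCount

open Finset Fintype

variable {V : Type*} [NormedAddCommGroup V] [NormedSpace ℝ V] [FiniteDimensional ℝ V]
  [MeasurableSpace V] [BorelSpace V] (μ : Measure V) [μ.IsAddHaarMeasure]
  {ι : Type*} [Fintype ι] (b : Basis ι ℝ V)

lemma coset_preimage_eq (v p : V) (hp : p - v ∈ Submodule.span ℤ (Set.range b)) :
    {z : V | v + (ZSpan.floor b (z - v) : V) = p} = p +ᵥ ZSpan.fundamentalDomain b := by
  ext z
  rw [Set.mem_vadd_set_iff_neg_vadd_mem, vadd_eq_add, ← ZSpan.fract_eq_self]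
  have h1 : ZSpan.fract b (-p + z) = ZSpan.fract b (z - v) := by
    have : -p + z = -(p - v) + (z - v) := by abel
    rw [this, ZSpan.fract_zSpan_add b _ (neg_mem hp)]
  rw [h1, ZSpan.fract_apply]
  grind

variable {K : Set V}

lemma coset_zspan_finite (hKb : Bornology.IsBounded K) (v : V) :
    {x ∈ K | x - v ∈ Submodule.span ℤ (Set.range b)}.Finite := by
  have : (((fun x => x - v) '' K) ∩ Submodule.span ℤ (Set.range b)).Finite := by
    refine ZSpan.setFinite_inter b ?_
    have := hKb.vadd (-v)
    convert this using 1
    ext x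
    simp only [Set.mem_image, Set.mem_vadd_set, vadd_eq_add, sub_eq_add_neg, add_comm]
  refine Set.Finite.of_finite_image (f := fun x => x - v) (this.subset ?_) ?_
  · rintro _ ⟨x, ⟨hx, hx'⟩, rfl⟩
    exact ⟨⟨x, hx, rfl⟩, hx'⟩
  · simpa using h

/-- Counting points of a coset of a lattice in a symmetric convex body, in terms of a fundamental
domain contained in a small multiple of the body. -/
lemma coset_zspan_count (hKc : Convex ℝ K) (hKs : ∀ x ∈ K, -x ∈ K)
    (hKb : Bornology.IsBounded K) {δ : ℝ} (hδ : 0 ≤ δ)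
    (hF : ZSpan.fundamentalDomain b ⊆ δ • K) (v : V) :
    (1 - δ * finrank ℝ V) * μ.real K ≤
      {x ∈ K | x - v ∈ Submodule.span ℤ (Set.range b)}.ncard * μ.real (ZSpan.fundamentalDomain b) ∧
    {x ∈ K | x - v ∈ Submodule.span ℤ (Set.range b)}.ncard * μ.real (ZSpan.fundamentalDomain b) ≤
      (1 + δ) ^ finrank ℝ V * μ.real K := by
  classical
  set S := {x ∈ K | x - v ∈ Submodule.span ℤ (Set.range b)} with hS
  have hfin : S.Finite := coset_zspan_finite b hKb v
  set r : V → V := fun z => v + (ZSpan.floor b (z - v) : V) with hr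
  set U := ⋃ p ∈ hfin.toFinset, (p +ᵥ ZSpan.fundamentalDomain b) with hU
  have hUpre : ∀ p ∈ hfin.toFinset, r ⁻¹' {p} = p +ᵥ ZSpan.fundamentalDomain b := by
    intro p hp
    have hp' : p ∈ S := by simpa using hp
    exact coset_preimage_eq b v p hp'.2
  have hFm : MeasurableSet (ZSpan.fundamentalDomain b) := ZSpan.fundamentalDomain_measurableSet b
  have hFb : Bornology.IsBounded (ZSpan.fundamentalDomain b) := ZSpan.fundamentalDomain_isBounded b
  have hmeas : μ.real U = S.ncard * μ.real (ZSpan.fundamentalDomain b) := by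
    rw [hU, measureReal_biUnion_finset (h := fun p _ => (hFb.vadd p).measure_lt_top.ne)]
    · rw [sum_congr rfl (g := fun _ => μ.real (ZSpan.fundamentalDomain b))]
      · rw [sum_const, nsmul_eq_mul, Set.ncard_eq_toFinset_card S hfin]
      · simp [Measure.real]
    · intro p hp q hq hpq
      grind
    · intro p _
      exact hFm.const_vadd p
  have hscale : ∀ c : ℝ, 0 ≤ c → μ.real (c • K) = c ^ finrank ℝ V * μ.real K := by
    intro c hc
    rw [Measure.real, Measure.addHaar_smul, ENNReal.toReal_mul, abs_of_nonneg (by positivity),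
      ENNReal.toReal_ofReal (by positivity), Measure.real]
  have hfinite : ∀ c : ℝ, μ (c • K) ≠ ⊤ := fun c => (hKb.smul₀ c).measure_lt_top.ne
  have hUb : U ⊆ (1 + δ) • K := by
    rw [hKc.add_smul zero_le_one hδ]
    intro z hz
    simp only [hU, Set.mem_iUnion] at hz
    obtain ⟨p, hp, hz⟩ := hz
    obtain ⟨y, hy, rfl⟩ := hz
    have hp' : p ∈ S := by simpa using hp
    exact Set.add_mem_add (by simpa using hp'.1) (hF hy)
  rw [← hmeas]
  constructor
  · rcases le_or_gt δ 1 with h1 | h1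
    · have hsub : (1 - δ) • K ⊆ U := by
        intro z hz
        have hp : r z - v ∈ Submodule.span ℤ (Set.range b) := by simp [hr]
        have hrz : r z = z - ZSpan.fract b (z - v) := by
          simp only [hr, ZSpan.fract_apply]; abel
        have hpK : r z ∈ K := by
          have h2 : K = (1 - δ) • K + δ • K := by
            rw [← hKc.add_smul (by linarith) hδ]; simp
          rw [h2]
          rw [hrz, sub_eq_add_neg z]
          refine Set.add_mem_add hz ?_
          obtain ⟨y, hy, hy'⟩ := hF (ZSpan.fract_mem_fundamentalDomain b (z - v))
          refine ⟨-y, hKs y hy, ?_⟩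
          simp only [smul_neg]
          exact congrArg Neg.neg hy'
        have hpS : r z ∈ hfin.toFinset := hfin.mem_toFinset.mpr ⟨hpK, hp⟩
        simp only [hU, Set.mem_iUnion]
        grind
      calc (1 - δ * finrank ℝ V) * μ.real K ≤ (1 - δ) ^ finrank ℝ V * μ.real K := by
            have := one_add_mul_le_pow (a := -δ) (by linarith) (finrank ℝ V)
            gcongr
            grind
        _ = μ.real ((1 - δ) • K) := (hscale _ (by linarith)).symm
        _ ≤ μ.real U := measureReal_mono hsub
            (ne_top_of_le_ne_top (hfinite _) (measure_mono hUb))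
    · rcases Nat.eq_zero_or_pos (finrank ℝ V) with h0 | h0
      · have hV : Subsingleton V := finrank_zero_iff.mp h0
        rcases K.eq_empty_or_nonempty with hK | ⟨k, hk⟩
        · simp [hK]
        · simp only [h0, Nat.cast_zero, mul_zero, sub_zero, one_mul]
          refine measureReal_mono ?_ (ne_top_of_le_ne_top (hfinite _) (measure_mono hUb))
          intro z _
          have hpS : r z ∈ hfin.toFinset := by
            have : r z ∈ S := ⟨by rwa [Subsingleton.elim (r z) k], by simp [hr]⟩
            simpa using this
          simp only [hU, Set.mem_iUnion]
          grind
      · have : (1 : ℝ) ≤ finrank ℝ V := by exact_mod_cast h0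
        have h3 : (1 - δ * finrank ℝ V) ≤ 0 := by nlinarith
        exact (mul_nonpos_of_nonpos_of_nonneg h3 measureReal_nonneg).trans measureReal_nonneg
  · rw [← hscale _ (by linarith)]
    exact measureReal_mono hUb (hfinite _)

lemma measureReal_fundamentalDomain_eq_index (L : Submodule ℤ V)
    [DiscreteTopology L] [IsZLattice ℝ L] (h : Submodule.span ℤ (Set.range b) ≤ L) :
    μ.real (ZSpan.fundamentalDomain b) =
      ((Submodule.span ℤ (Set.range b)).toAddSubgroup.relIndex L.toAddSubgroup) *
        ZLattice.covolume L μ := by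
  classical
  let b₂' := Module.Free.chooseBasis ℤ L
  let e : Module.Free.ChooseBasisIndex ℤ L ≃ ι :=
    (b₂'.ofZLatticeBasis ℝ L).indexEquiv b
  let b₂ := b₂'.reindex e
  let b₁ := b.restrictScalars ℤ
  rw [AddSubgroup.relIndex_eq_natAbs_det (Submodule.span ℤ (Set.range b)).toAddSubgroup
    L.toAddSubgroup h b₁ b₂, Nat.cast_natAbs, Int.cast_abs,
    ZLattice.covolume_eq_measure_fundamentalDomain L μ (ZLattice.isAddFundamentalDomain b₂ μ),
    ZSpan.measureReal_fundamentalDomain b μ (b₂.ofZLatticeBasis ℝ L)]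
  congr 2
  change _ = ((b₂.det (fun i => (⟨(b₁ i : V), h (b₁ i).2⟩ : L)) : ℤ) : ℝ)
  rw [Basis.det_apply, Basis.det_apply, Int.cast_det]
  congr; ext i j
  rw [Matrix.map_apply, Basis.toMatrix_apply, Basis.toMatrix_apply]
  have := (b₂.ofZLatticeBasis_repr_apply ℝ L ⟨b₁ j, h (b₁ j).2⟩ i)
  rw [← this]
  simp [b₁]

lemma coset_lattice_count (hKc : Convex ℝ K) (hKs : ∀ x ∈ K, -x ∈ K)
    (hKb : Bornology.IsBounded K) {δ : ℝ} (hδ : 0 ≤ δ)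
    (hF : ZSpan.fundamentalDomain b ⊆ δ • K) (L : Submodule ℤ V)
    [DiscreteTopology L] [IsZLattice ℝ L] (h : Submodule.span ℤ (Set.range b) ≤ L) (v : V) :
    {x ∈ K | x - v ∈ L}.Finite ∧
    (1 - δ * finrank ℝ V) * μ.real K ≤ {x ∈ K | x - v ∈ L}.ncard * ZLattice.covolume L μ ∧
    {x ∈ K | x - v ∈ L}.ncard * ZLattice.covolume L μ ≤ (1 + δ) ^ finrank ℝ V * μ.real K := by
  classical
  set L' := Submodule.span ℤ (Set.range b) with hL'
  set A := L'.toAddSubgroup.addSubgroupOf L.toAddSubgroup with hA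
  have hidx := measureReal_fundamentalDomain_eq_index μ b L h
  have hFpos : μ.real (ZSpan.fundamentalDomain b) ≠ 0 :=
    (measureReal_ne_zero_iff (ZSpan.fundamentalDomain_isBounded b).measure_lt_top.ne).mpr
      (ZSpan.measure_fundamentalDomain_ne_zero b)
  have hk0 : A.index ≠ 0 := by
    intro h0
    apply hFpos
    rw [hidx, AddSubgroup.relIndex, h0]; simp
  have : A.FiniteIndex := ⟨hk0⟩
  have : Fintype (L.toAddSubgroup ⧸ A) := ofFinite _
  have hk : (card (L.toAddSubgroup ⧸ A)) = A.index := by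
    rw [AddSubgroup.index, Nat.card_eq_fintype_card]
  let T : (L.toAddSubgroup ⧸ A) → Set V := fun q => {x ∈ K | x - (v + (q.out : V)) ∈ L'}
  have hTfin : ∀ q, (T q).Finite := fun q => coset_zspan_finite b hKb _
  have hST : {x ∈ K | x - v ∈ L} = ⋃ q, T q := by
    ext x
    simp only [T, Set.mem_iUnion, Set.mem_ofPred_eq]
    constructor
    · rintro ⟨hx, hxL⟩
      refine ⟨(QuotientAddGroup.mk (⟨x - v, hxL⟩ : L.toAddSubgroup)), hx, ?_⟩
      have h1 := Quotient.out_eq (QuotientAddGroup.mk (s := A) (⟨x - v, hxL⟩ : L.toAddSubgroup))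
      have h2 := QuotientAddGroup.eq.mp h1
      have h3 : x - (v + ((QuotientAddGroup.mk (s := A)
        (⟨x - v, hxL⟩ : L.toAddSubgroup)).out : V)) = -((QuotientAddGroup.mk (s := A)
        (⟨x - v, hxL⟩ : L.toAddSubgroup)).out : V) + (x - v) := by abel
      rw [h3]
      exact h2
    · rintro ⟨q, hx, hq⟩
      refine ⟨hx, ?_⟩
      have h3 : x - v = (x - (v + (q.out : V))) + (q.out : V) := by abel
      rw [h3]
      exact L.add_mem (h hq) q.out.2
  have hfin : {x ∈ K | x - v ∈ L}.Finite := by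
    rw [hST]; exact Set.finite_iUnion hTfin
  have hcard : {x ∈ K | x - v ∈ L}.ncard = ∑ q, (T q).ncard := by
    have h1 : hfin.toFinset = univ.biUnion fun q => (hTfin q).toFinset := by
      ext x
      simp_all
    rw [Set.ncard_eq_toFinset_card _ hfin, h1, card_biUnion]
    · exact sum_congr rfl fun q _ => (Set.ncard_eq_toFinset_card _ (hTfin q)).symm
    · intro q _ q' _ hqq
      refine disjoint_left.mpr ?_
      intro x hx hx'
      simp only [Set.Finite.mem_toFinset, T, Set.mem_ofPred_eq] at hx hx'
      apply hqq
      rw [← Quotient.out_eq q, ← Quotient.out_eq q']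
      refine QuotientAddGroup.eq.mpr ?_
      have h3 : (-(q.out : V) + (q'.out : V)) = (x - (v + (q.out : V))) -
        (x - (v + (q'.out : V))) := by abel
      change (-(q.out : V) + (q'.out : V)) ∈ L'
      rw [h3]
      exact L'.sub_mem hx.2 hx'.2
  refine ⟨hfin, ?_⟩
  have hcount := fun q : (L.toAddSubgroup ⧸ A) =>
    (coset_zspan_count μ b hKc hKs hKb hδ hF (v + (q.out : V)) :
      _ ≤ ((T q).ncard : ℝ) * _ ∧ ((T q).ncard : ℝ) * _ ≤ _)
  have hF' : μ.real (ZSpan.fundamentalDomain b) =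
      card (L.toAddSubgroup ⧸ A) * ZLattice.covolume L μ := by
    rw [hk, hidx, AddSubgroup.relIndex]
  have hkpos : (0 : ℝ) < card (L.toAddSubgroup ⧸ A) := by
    positivity
  have hsum1 := sum_le_sum fun q (_ : q ∈ univ) => (hcount q).1
  have hsum2 := sum_le_sum fun q (_ : q ∈ univ) => (hcount q).2
  rw [sum_const, ← sum_mul, card_univ, nsmul_eq_mul, ← Nat.cast_sum,
    ← hcard, hF'] at hsum1
  rw [← sum_mul, sum_const, card_univ, nsmul_eq_mul, ← Nat.cast_sum,
    ← hcard, hF'] at hsum2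
  constructor
  · nlinarith
  nlinarith

end LatticeCount

section BoxCount

open Finset Real Fintype

variable {E : Type*} [Field E] [NumberField E] {ι : Type*} [Fintype ι]

open NumberField.mixedEmbedding

lemma span_mixedEmbedding_eq_top (θ : Basis ι ℚ E) :
    ⊤ ≤ Submodule.span ℝ (Set.range fun i => mixedEmbedding E (θ i)) := by
  rw [← (latticeBasis E).span_eq, Submodule.span_le]
  rintro _ ⟨j, rfl⟩
  rw [latticeBasis_apply]
  set x : E := integralBasis E j
  rw [← θ.sum_repr x, map_sum]
  refine Submodule.sum_mem _ fun i _ => ?_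
  rw [Algebra.smul_def, map_mul]
  have h1 : mixedEmbedding E (algebraMap ℚ E (θ.repr x i)) = algebraMap ℝ _ ((θ.repr x i : ℚ) : ℝ) := by
    bound
  rw [h1, ← Algebra.smul_def]
  bound

/-- The real basis of the mixed space given by a rational basis of the number field. -/
noncomputable def mixedBasis (θ : Basis ι ℚ E) : Basis ι ℝ (mixedSpace E) :=
  basisOfTopLeSpanOfCardEqFinrank (fun i => mixedEmbedding E (θ i))
    (span_mixedEmbedding_eq_top θ)
    (by rw [mixedEmbedding.finrank, Module.finrank_eq_card_basis θ])

lemma mixedBasis_apply (θ : Basis ι ℚ E) (i : ι) : mixedBasis θ i = mixedEmbedding E (θ i) := by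
  simp [mixedBasis]

lemma mem_convexBodyLT_iff (f : InfinitePlace E → NNReal) (x : mixedSpace E) :
    x ∈ convexBodyLT E f ↔ ∀ w, normAtPlace w x < f w := by
  constructor
  · rintro h w
    rcases isReal_or_isComplex w with hw | hw
    · rw [normAtPlace_apply_of_isReal hw]
      simpa using h.1 ⟨w, hw⟩ trivial
    · rw [normAtPlace_apply_of_isComplex hw]
      simpa using h.2 ⟨w, hw⟩ trivial
  · intro h
    refine ⟨fun w _ => ?_, fun w _ => ?_⟩
    · have := h w.1
      rw [normAtPlace_apply_of_isReal w.2] at this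
      simpa using this
    · have := h w.1
      rw [normAtPlace_apply_of_isComplex w.2] at this
      simpa using this

lemma smul_convexBodyLT (f : InfinitePlace E → NNReal) {δ : NNReal} (hδ : δ ≠ 0) :
    convexBodyLT E (fun w => δ * f w) = (δ : ℝ) • convexBodyLT E f := by
  ext x
  have hδ' : (0 : ℝ) < δ := by positivity
  rw [Set.mem_smul_set_iff_inv_smul_mem₀ hδ'.ne', mem_convexBodyLT_iff, mem_convexBodyLT_iff]
  refine forall_congr' fun w => ?_
  rw [normAtPlace_smul, abs_of_pos (by positivity), inv_mul_lt_iff₀ hδ', NNReal.coe_mul]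

lemma convexBodyLT_isBounded (f : InfinitePlace E → NNReal) :
    Bornology.IsBounded (convexBodyLT E f) := by
  refine Bornology.IsBounded.prod ?_ ?_ <;>
  exact Bornology.IsBounded.pi fun i => Metric.isBounded_ball

lemma normAtPlace_sum_le {κ : Type*} (w : InfinitePlace E) (s : Finset κ) (x : κ → mixedSpace E) :
    normAtPlace w (∑ i ∈ s, x i) ≤ ∑ i ∈ s, normAtPlace w (x i) := by
  classical
  induction s using Finset.induction_on with
  | empty => simp
  | insert a s ha ih =>
    rw [sum_insert ha, sum_insert ha]
    exact (normAtPlace_add_le _ _ _).trans (by gcongr)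

lemma fundamentalDomain_subset_convexBodyLT (θ : Basis ι ℚ E) (g : InfinitePlace E → NNReal)
    (hg : ∀ w, ∑ i, w (θ i) < g w) :
    ZSpan.fundamentalDomain (mixedBasis θ) ⊆ convexBodyLT E g := by
  intro x hx
  rw [mem_convexBodyLT_iff]
  intro w
  refine lt_of_le_of_lt ?_ (hg w)
  rw [← (mixedBasis θ).sum_repr x]
  refine (normAtPlace_sum_le _ _ _).trans (sum_le_sum fun i _ => ?_)
  rw [normAtPlace_smul, mixedBasis_apply, normAtPlace_apply]
  have h := hx i
  rw [abs_of_nonneg h.1]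
  exact mul_le_of_le_one_left (apply_nonneg _ _) h.2.le

lemma convexBodyLT_real_volume (f : InfinitePlace E → NNReal) :
    volume.real (convexBodyLT E f) =
      (convexBodyLTFactor E : ℝ) * ∏ w, (f w : ℝ) ^ w.mult := by
  rw [Measure.real, convexBodyLT_volume, ENNReal.toReal_mul]
  simp

lemma ncard_basis_pos (θ : Basis ι ℚ E) : 0 < card ι := by
  rw [← Module.finrank_eq_card_basis θ]; exact Module.finrank_pos

lemma basis_bound_pos (θ : Basis ι ℚ E) {T : ℝ} (hT : ∀ i, ∀ w : InfinitePlace E, w (θ i) ≤ T) :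
    0 < T := by
  obtain ⟨i⟩ : Nonempty ι := card_pos_iff.mp (ncard_basis_pos θ)
  obtain ⟨w⟩ : Nonempty (InfinitePlace E) := inferInstance
  exact lt_of_lt_of_le (InfinitePlace.pos_iff.mpr (θ.ne_zero i)) (hT i w)

lemma covolume_integerLattice_le (θ : Basis ι ℚ E) (hθ : ∀ i, IsIntegral ℤ (θ i)) {T : ℝ}
    (hT : ∀ i, ∀ w : InfinitePlace E, w (θ i) ≤ T) :
    ZLattice.covolume (mixedEmbedding.integerLattice E) ≤
      convexBodyLTFactor E * (2 * Module.finrank ℚ E * T) ^ Module.finrank ℚ E := by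
  have hTpos := basis_bound_pos θ hT
  have hcard := Module.finrank_eq_card_basis θ
  have hdpos : 0 < Module.finrank ℚ E := Module.finrank_pos
  have hle : Submodule.span ℤ (Set.range (mixedBasis θ)) ≤ mixedEmbedding.integerLattice E := by
    rw [Submodule.span_le]
    rintro _ ⟨i, rfl⟩
    rw [mixedBasis_apply]
    exact ⟨(⟨θ i, hθ i⟩ : 𝓞 E), rfl⟩
  have hidx := measureReal_fundamentalDomain_eq_index volume (mixedBasis θ)
    (mixedEmbedding.integerLattice E) hle
  have hFpos : volume.real (ZSpan.fundamentalDomain (mixedBasis θ)) ≠ 0 :=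
    (measureReal_ne_zero_iff
      (ZSpan.fundamentalDomain_isBounded (mixedBasis θ)).measure_lt_top.ne).mpr
      (ZSpan.measure_fundamentalDomain_ne_zero (mixedBasis θ))
  set k := (Submodule.span ℤ (Set.range (mixedBasis θ))).toAddSubgroup.relIndex
    (mixedEmbedding.integerLattice E).toAddSubgroup with hk
  have hk0 : k ≠ 0 := by
    intro h0; apply hFpos; rw [hidx, h0]; simp
  have hk1 : (1 : ℝ) ≤ k := by exact_mod_cast Nat.one_le_iff_ne_zero.mpr hk0
  have hcpos : 0 < ZLattice.covolume (mixedEmbedding.integerLattice E) :=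
    ZLattice.covolume_pos _ _
  calc ZLattice.covolume (mixedEmbedding.integerLattice E)
      ≤ k * ZLattice.covolume (mixedEmbedding.integerLattice E) :=
        le_mul_of_one_le_left hcpos.le hk1
    _ = volume.real (ZSpan.fundamentalDomain (mixedBasis θ)) := hidx.symm
    _ ≤ volume.real (convexBodyLT E fun _ => toNNReal (2 * Module.finrank ℚ E * T)) := by
        refine measureReal_mono (fundamentalDomain_subset_convexBodyLT θ _ fun w => ?_)
          (convexBodyLT_isBounded _).measure_lt_top.ne
        rw [coe_toNNReal _ (by positivity)]
        calc ∑ i, w (θ i) ≤ ∑ _i : ι, T := sum_le_sum fun i _ => hT i w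
          _ = Module.finrank ℚ E * T := by rw [sum_const, hcard]; simp
          _ < _ := by
            simp_all
    _ = _ := by
        rw [convexBodyLT_real_volume, prod_pow_eq_pow_sum, InfinitePlace.sum_mult_eq,
          coe_toNNReal _ (by positivity)]

end BoxCount

section BoxCount

open Finset Real Ideal

variable {E : Type*} [Field E] [NumberField E] {ι : Type*} [Fintype ι]

open NumberField.mixedEmbedding

lemma covolume_idealLattice_mk0 (J : (Ideal (𝓞 E))⁰) :
    ZLattice.covolume (idealLattice E (FractionalIdeal.mk0 E J)) =
      absNorm (J : Ideal (𝓞 E)) * ZLattice.covolume (mixedEmbedding.integerLattice E) := by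
  rw [covolume_idealLattice, covolume_integerLattice, FractionalIdeal.coe_mk0,
    FractionalIdeal.coeIdeal_absNorm, Rat.cast_natCast, mul_assoc]

lemma exists_mem_ideal_lt_of_covolume (J : (Ideal (𝓞 E))⁰) (f : InfinitePlace E → ℝ≥0)
    (h : absNorm (J : Ideal (𝓞 E)) * ZLattice.covolume (mixedEmbedding.integerLattice E) *
      2 ^ finrank ℚ E < convexBodyLTFactor E * ∏ w, (f w : ℝ) ^ w.mult) :
    ∃ α ∈ (J : Ideal (𝓞 E)), α ≠ 0 ∧ ∀ w : InfinitePlace E, w (α : E) < f w := by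
  have hb : minkowskiBound E (FractionalIdeal.mk0 E J) < volume (convexBodyLT E f) := by
    have h1 : minkowskiBound E (FractionalIdeal.mk0 E J) =
        ENNReal.ofReal (absNorm (J : Ideal (𝓞 E)) *
          ZLattice.covolume (mixedEmbedding.integerLattice E) * 2 ^ finrank ℚ E) := by
      rw [minkowskiBound, ENNReal.ofReal_mul (by have := ZLattice.covolume_pos (mixedEmbedding.integerLattice E) volume; positivity), mixedEmbedding.finrank,
        ← covolume_idealLattice_mk0, ZLattice.covolume_eq_measure_fundamentalDomain _ _
        (fundamentalDomain_idealLattice E (FractionalIdeal.mk0 E J)), measureReal_def,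
        ENNReal.ofReal_toReal (ZSpan.fundamentalDomain_isBounded _).measure_lt_top.ne]
      simp [ENNReal.ofReal_pow]
    rw [h1, ← ENNReal.ofReal_toReal (convexBodyLT_isBounded f).measure_lt_top.ne,
      ← measureReal_def, convexBodyLT_real_volume]
    have h0 : 0 < convexBodyLTFactor E * ∏ w, (f w : ℝ) ^ w.mult :=
      lt_of_le_of_lt (by have := ZLattice.covolume_pos (mixedEmbedding.integerLattice E) volume; positivity) h
    exact (ENNReal.ofReal_lt_ofReal_iff h0).mpr h
  obtain ⟨a, ha, ha0, haw⟩ := exists_ne_zero_mem_ideal_lt E (FractionalIdeal.mk0 E J) hb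
  obtain ⟨x, hx, rfl⟩ := ha
  exact ⟨x, hx, by rintro rfl; simp at ha0, haw⟩

/-- Density constant of the lattice of integers with respect to the boxes `convexBodyLT`. -/
noncomputable def boxDensity (E : Type*) [Field E] [NumberField E] : ℝ :=
  convexBodyLTFactor E / ZLattice.covolume (mixedEmbedding.integerLattice E)

lemma boxDensity_pos : 0 < boxDensity E :=
  div_pos (by have := one_le_convexBodyLTFactor E; positivity) (ZLattice.covolume_pos _ volume)

lemma box_count (θ : Basis ι ℚ E) (hθ : ∀ i, IsIntegral ℤ (θ i)) {T : ℝ}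
    (hT : ∀ i, ∀ w : InfinitePlace E, w (θ i) ≤ T) {J : Ideal (𝓞 E)} (hJ : J ≠ ⊥)
    {Q : ℕ} (hQ : 0 < Q) (f : InfinitePlace E → ℝ≥0) (hf : ∀ w, f w ≠ 0) (β : 𝓞 E) {X : ℝ}
    (hX : X * absNorm J = ∏ w, (f w : ℝ) ^ w.mult) :
    {α : 𝓞 E | (∀ w : InfinitePlace E, w (α : E) < f w) ∧
        α - β ∈ span {(Q : 𝓞 E)} * J}.Finite ∧
    |({α : 𝓞 E | (∀ w : InfinitePlace E, w (α : E) < f w) ∧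
        α - β ∈ span {(Q : 𝓞 E)} * J}.ncard : ℝ) -
        boxDensity E * X / Q ^ finrank ℚ E| ≤
      boxDensity E * X / Q ^ finrank ℚ E *
        ((1 + 6 * finrank ℚ E ^ 2 * T ^ 2 * Q * X ^ (-(1 / finrank ℚ E : ℝ))) ^ finrank ℚ E - 1) := by
  set d := finrank ℚ E with hd
  have hdpos : 0 < d := Module.finrank_pos
  have hTpos := basis_bound_pos θ hT
  have hcard : Fintype.card ι = d := (Module.finrank_eq_card_basis θ).symm
  have hNJ : 0 < (absNorm J : ℝ) := by
    exact_mod_cast Nat.pos_of_ne_zero (absNorm_eq_zero_iff.not.mpr hJ)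
  have hprod : 0 < ∏ w, (f w : ℝ) ^ w.mult :=
    prod_pos fun w _ => pow_pos (NNReal.coe_pos.mpr (pos_iff_ne_zero.mpr (hf w))) _
  have hXpos : 0 < X := by
    nlinarith
  have hcov : 0 < ZLattice.covolume (mixedEmbedding.integerLattice E) := ZLattice.covolume_pos _ volume
  have hfac : 0 < (convexBodyLTFactor E : ℝ) := by
    have := one_le_convexBodyLTFactor E; positivity
  set Y : ℝ := X ^ (-(1 / d : ℝ)) with hY
  have hYpos : 0 < Y := rpow_pos_of_pos hXpos _
  have hYd : Y ^ d * X = 1 := by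
    rw [hY, ← rpow_natCast, ← rpow_mul hXpos.le]
    have : -(1 / (d : ℝ)) * d = -1 := by field_simp
    rw [this, rpow_neg_one, inv_mul_cancel₀ hXpos.ne']
  set r : ℝ≥0 := toNNReal (6 * d * T * Y) with hr
  have hrr : (r : ℝ) = 6 * d * T * Y := coe_toNNReal _ (by positivity)
  obtain ⟨α₀, hα₀, hα₀0, hα₀w⟩ := exists_mem_ideal_lt_of_covolume
    ⟨J, mem_nonZeroDivisors_of_ne_zero hJ⟩ (fun w => r * f w) (by
      have h1 : ∏ w : InfinitePlace E, (((r * f w : ℝ≥0)) : ℝ) ^ w.mult =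
          (6 * d * T) ^ d * absNorm J := by
        simp_rw [NNReal.coe_mul, mul_pow]
        rw [prod_mul_distrib, prod_pow_eq_pow_sum, InfinitePlace.sum_mult_eq, ← hX,
          hrr, mul_pow, ← hd]
        linear_combination (6 * d * T) ^ d * absNorm J * hYd
      rw [h1]
      have h2 := covolume_integerLattice_le θ hθ hT
      have h3 : (2 * d * T : ℝ) ^ d * 2 ^ d < (6 * d * T) ^ d := by
        rw [← mul_pow]
        refine pow_lt_pow_left₀ ?_ (by positivity) hdpos.ne'
        have : (0 : ℝ) < d * T := by positivity
        nlinarith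
      calc _ ≤ (absNorm J : ℝ) * (convexBodyLTFactor E * (2 * d * T) ^ d) * 2 ^ d := by
            gcongr
        _ = (convexBodyLTFactor E * absNorm J) * ((2 * d * T : ℝ) ^ d * 2 ^ d) := by ring
        _ < (convexBodyLTFactor E * absNorm J) * (6 * d * T) ^ d := by gcongr
        _ = _ := by ring)
  have hqE : ((Q : E) * (α₀ : E)) ≠ 0 := mul_ne_zero (by exact_mod_cast hQ.ne')
    (by simpa using hα₀0)
  let θ' : Basis ι ℚ E := θ.map (LinearEquiv.ofBijective (LinearMap.mulLeft ℚ ((Q : E) * α₀))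
    ⟨mul_right_injective₀ hqE, mul_left_surjective₀ hqE⟩)
  have hθ' : ∀ i, θ' i = (Q : E) * α₀ * θ i := fun i => rfl
  have hQ0 : (Q : 𝓞 E) ≠ 0 := by exact_mod_cast hQ.ne'
  have hI : span {(Q : 𝓞 E)} * J ≠ ⊥ := by
    rw [Ne, mul_eq_bot, not_or]
    exact ⟨by simpa using hQ0, hJ⟩
  set I : (Ideal (𝓞 E))⁰ := ⟨span {(Q : 𝓞 E)} * J, mem_nonZeroDivisors_of_ne_zero hI⟩ with hIdef
  have hmemL : ∀ x : 𝓞 E, mixedEmbedding E (x : E) ∈ idealLattice E (FractionalIdeal.mk0 E I) ↔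
      x ∈ span {(Q : 𝓞 E)} * J := by
    intro x
    rw [mem_idealLattice]
    constructor
    · rintro ⟨y, hy, hyx⟩
      rw [(mixedEmbedding_injective E) hyx] at hy
      simpa using hy
    · intro hx
      exact ⟨x, by simpa using hx, rfl⟩
  have hle : Submodule.span ℤ (Set.range (mixedBasis θ')) ≤
      idealLattice E (FractionalIdeal.mk0 E I) := by
    rw [Submodule.span_le]
    rintro _ ⟨i, rfl⟩
    rw [mixedBasis_apply, hθ']
    set z : 𝓞 E := ⟨θ i, hθ i⟩ with hz
    have : (Q : E) * α₀ * θ i = algebraMap (𝓞 E) E ((Q : 𝓞 E) * (α₀ * z)) := by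
      rw [map_mul, map_mul, map_natCast, mul_assoc]
      rfl
    rw [this, SetLike.mem_coe, hmemL]
    exact mul_mem_mul (mem_span_singleton_self _) (J.mul_mem_right _ hα₀)
  set δ : ℝ := 6 * d ^ 2 * T ^ 2 * Q * Y with hδ
  have hδpos : 0 < δ := by positivity
  set δn : ℝ≥0 := toNNReal δ with hδn
  have hδnn : (δn : ℝ) = δ := coe_toNNReal _ hδpos.le
  have hF : ZSpan.fundamentalDomain (mixedBasis θ') ⊆ δ • convexBodyLT E f := by
    rw [← hδnn, ← smul_convexBodyLT f (by positivity)]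
    refine fundamentalDomain_subset_convexBodyLT θ' _ fun w => ?_
    calc ∑ i, w (θ' i) ≤ ∑ _i : ι, Q * w (α₀ : E) * T := by
          refine sum_le_sum fun i _ => ?_
          rw [hθ', map_mul, map_mul, InfinitePlace.map_natCast]
          gcongr
          exact hT i w
      _ = d * T * Q * w (α₀ : E) := by
          rw [sum_const, card_univ, hcard]; ring
      _ < d * T * Q * ((r * f w : ℝ≥0) : ℝ) := by
          gcongr
          exact hα₀w w
      _ = _ := by
          rw [NNReal.coe_mul, NNReal.coe_mul, hrr, hδnn, hδ]; ring
  obtain ⟨hfin, hlo, hhi⟩ := coset_lattice_count volume (mixedBasis θ')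
    (convexBodyLT_convex E f) (fun x hx => convexBodyLT_neg_mem E f x hx)
    (convexBodyLT_isBounded f) hδpos.le hF (idealLattice E (FractionalIdeal.mk0 E I)) hle
    (mixedEmbedding E (β : E))
  have himg : {x ∈ convexBodyLT E f | x - mixedEmbedding E (β : E) ∈
      idealLattice E (FractionalIdeal.mk0 E I)} = (fun α : 𝓞 E => mixedEmbedding E (α : E)) ''
      {α : 𝓞 E | (∀ w : InfinitePlace E, w (α : E) < f w) ∧
        α - β ∈ span {(Q : 𝓞 E)} * J} := by
    ext x
    constructor
    · rintro ⟨hxK, hxL⟩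
      obtain ⟨y, hy, hyx⟩ := (mem_idealLattice E _).mp hxL
      have hy' : y ∈ ((span {(Q : 𝓞 E)} * J : Ideal (𝓞 E)) : FractionalIdeal (𝓞 E)⁰ E) := hy
      obtain ⟨z, hz, rfl⟩ := (FractionalIdeal.mem_coeIdeal _).mp hy'
      have hxz : x = mixedEmbedding E ((β + z : 𝓞 E) : E) := by
        push_cast
        rw [map_add, hyx]; abel
      refine ⟨β + z, ⟨?_, by simpa using hz⟩, hxz.symm⟩
      rw [hxz] at hxK
      exact (convexBodyLT_mem E f).mp hxK
    · rintro ⟨α, ⟨hα, hαβ⟩, rfl⟩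
      refine ⟨(convexBodyLT_mem E f).mpr hα, ?_⟩
      rw [← map_sub]
      exact (hmemL (α - β)).mpr hαβ
  have hinj : Function.Injective (fun α : 𝓞 E => mixedEmbedding E (α : E)) :=
    (mixedEmbedding_injective E).comp RingOfIntegers.coe_injective
  rw [himg] at hfin hlo hhi
  rw [Set.ncard_image_of_injective _ hinj] at hlo hhi
  have hfin' := hfin.of_finite_image hinj.injOn
  refine ⟨hfin', ?_⟩
  set N := {α : 𝓞 E | (∀ w : InfinitePlace E, w (α : E) < f w) ∧
        α - β ∈ span {(Q : 𝓞 E)} * J}.ncard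
  rw [convexBodyLT_real_volume, ← hX, mixedEmbedding.finrank, ← hd] at hlo hhi
  rw [covolume_idealLattice_mk0] at hlo hhi
  have hnorm : (absNorm (I : Ideal (𝓞 E)) : ℝ) = Q ^ d * absNorm J := by
    rw [hIdef]
    simp only [map_mul, Nat.cast_mul]
    rw [absNorm_span_singleton, ← map_natCast (algebraMap ℤ (𝓞 E)), Algebra.norm_algebraMap,
      Int.natAbs_pow, RingOfIntegers.rank]
    simp [hd]
  rw [hnorm] at hlo hhi
  have hmain : boxDensity E * X / Q ^ d = (convexBodyLTFactor E * (X * absNorm J)) /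
      (Q ^ d * absNorm J * ZLattice.covolume (mixedEmbedding.integerLattice E)) := by
    rw [boxDensity]; field_simp
  have hD : 0 < (Q : ℝ) ^ d * absNorm J * ZLattice.covolume (mixedEmbedding.integerLattice E) := by
    positivity
  rw [hmain]
  set V := (convexBodyLTFactor E : ℝ) * (X * absNorm J)
  set D := (Q : ℝ) ^ d * absNorm J * ZLattice.covolume (mixedEmbedding.integerLattice E)
  have e1 : (1 - δ * d) * (V / D) ≤ N := by
    rw [← mul_div_assoc, div_le_iff₀ hD]; exact hlo
  have e2 : (N : ℝ) ≤ (1 + δ) ^ d * (V / D) := by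
    rw [← mul_div_assoc, le_div_iff₀ hD]; exact hhi
  have hbern := one_add_mul_le_pow (by linarith : (-2 : ℝ) ≤ δ) d
  have hVD : 0 < V / D := by positivity
  rw [abs_le]
  constructor
  · have : 0 ≤ (V / D) * ((1 + δ) ^ d - 1 - δ * d) := mul_nonneg hVD.le (by linarith)
    linarith
  · linarith

end BoxCount

section SimplexVolume

open Finset Real Ideal Fintype

variable {κ : Type*} [Fintype κ]

/-- The open simplex of size `R`. -/
def openSimplex (κ : Type*) [Fintype κ] (R : ℝ) : Set (κ → ℝ) := {z | (∀ i, 0 < z i) ∧ ∑ i, z i < R}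

lemma openSimplex_isOpen (R : ℝ) : IsOpen (openSimplex κ R) := by
  have h1 : IsOpen {z : κ → ℝ | ∀ i, 0 < z i} := by
    simp only [Set.ofPred_forall]
    exact isOpen_iInter_of_finite fun i => isOpen_lt continuous_const (continuous_apply i)
  have h2 : IsOpen {z : κ → ℝ | ∑ i, z i < R} := isOpen_lt (by fun_prop) continuous_const
  exact h1.inter h2

lemma openSimplex_empty {R : ℝ} (hR : R ≤ 0) : openSimplex κ R = ∅ := by
  ext z
  simp only [openSimplex, Set.mem_ofPred_eq, Set.mem_empty_iff_false, iff_false, not_and, not_lt]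
  exact fun h => hR.trans (sum_nonneg fun i _ => (h i).le)

lemma openSimplex_smul {R : ℝ} (hR : 0 < R) : openSimplex κ R = R • openSimplex κ 1 := by
  ext z
  rw [Set.mem_smul_set_iff_inv_smul_mem₀ hR.ne']
  simp only [openSimplex, Set.mem_ofPred_eq, Pi.smul_apply, smul_eq_mul]
  rw [← mul_sum, inv_mul_lt_iff₀ hR, mul_one]
  simp_all

lemma volume_openSimplex_one_pos : 0 < volume (openSimplex κ 1) := by
  refine (openSimplex_isOpen 1).measure_pos volume ⟨fun _ => 1 / (card κ + 1), ?_, ?_⟩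
  · intro i; positivity
  · rw [sum_const, card_univ, nsmul_eq_mul, mul_one_div, div_lt_one (by positivity)]
    linarith

lemma volume_openSimplex_lt_top : volume (openSimplex κ 1) < ⊤ := by
  refine Bornology.IsBounded.measure_lt_top ((Metric.isBounded_Icc (0 : κ → ℝ) 1).subset ?_)
  rintro z ⟨h1, h2⟩
  refine ⟨fun i => (h1 i).le, fun i => ?_⟩
  exact (Finset.single_le_sum (f := z) (fun j _ => (h1 j).le) (Finset.mem_univ i)).trans h2.le

lemma volume_openSimplex (R : ℝ) :
    volume (openSimplex κ R) =
      (if 0 < R then ENNReal.ofReal (R ^ Fintype.card κ) else 0) * volume (openSimplex κ 1) := by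
  split_ifs with h
  · rw [openSimplex_smul h, Measure.addHaar_smul, abs_of_pos (by positivity),
      Module.finrank_fintype_fun_eq_card]
  · rw [openSimplex_empty (not_lt.mp h)]; simp

end SimplexVolume

section LogBox

variable {E : Type*} [Field E] [NumberField E]

/-- Side lengths of the box parametrized by a point of the logarithmic space. -/
noncomputable def logBox (t : ℝ) (y : logSpace E) (w : InfinitePlace E) : ℝ≥0 :=
  Real.toNNReal (t * Real.exp ((if h : w ≠ w₀ then y ⟨w, h⟩ else -∑ i, y i) / w.mult))

lemma logBox_coe {t : ℝ} (ht : 0 < t) (y : logSpace E) (w : InfinitePlace E) :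
    (logBox t y w : ℝ) =
      t * Real.exp ((if h : w ≠ w₀ then y ⟨w, h⟩ else -∑ i, y i) / w.mult) :=
  Real.coe_toNNReal _ (by positivity)

lemma logBox_ne_zero {t : ℝ} (ht : 0 < t) (y : logSpace E) (w : InfinitePlace E) :
    logBox t y w ≠ 0 := by
  rw [← NNReal.coe_ne_zero, logBox_coe ht]; positivity

lemma logBox_prod {t : ℝ} (ht : 0 < t) (y : logSpace E) :
    ∏ w, (logBox t y w : ℝ) ^ w.mult = t ^ finrank ℚ E := by
  simp_rw [logBox_coe ht, mul_pow, ← Real.exp_nat_mul]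
  rw [Finset.prod_mul_distrib, Finset.prod_pow_eq_pow_sum, InfinitePlace.sum_mult_eq,
    ← Real.exp_sum]
  have : ∀ w : InfinitePlace E, (w.mult : ℝ) * ((if h : w ≠ w₀ then y ⟨w, h⟩ else -∑ i, y i) / w.mult)
      = (if h : w ≠ w₀ then y ⟨w, h⟩ else -∑ i, y i) := fun w => by
    field_simp
  simp_rw [this]
  rw [Fintype.sum_eq_add_sum_subtype_ne _ (w₀ : InfinitePlace E)]
  have : ∑ i : {w : InfinitePlace E // w ≠ w₀}, (if h : (i : InfinitePlace E) ≠ w₀ then y ⟨i, h⟩ else -∑ i, y i) = ∑ i, y i :=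
    Finset.sum_congr rfl fun i _ => by rw [dif_pos i.2]
  rw [this]
  simp

/-- The set of points of the logarithmic space whose box contains `α`. -/
def logRegion (t : ℝ) (α : 𝓞 E) : Set (logSpace E) :=
  {y | ∀ w : InfinitePlace E, w (α : E) < logBox t y w}

lemma logRegion_eq {t : ℝ} (ht : 0 < t) {α : 𝓞 E} (hα : α ≠ 0) :
    logRegion t α = (fun y => y + fun w => -((w.1.mult : ℝ) * (Real.log (w.1 (α : E)) - Real.log t))) ⁻¹'
      openSimplex _ (finrank ℚ E * Real.log t - Real.log (|Algebra.norm ℚ (α : E)| : ℚ)) := by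
  have hα' : (α : E) ≠ 0 := by simpa using hα
  have hsum : Real.log (|Algebra.norm ℚ (α : E)| : ℚ) =
      ∑ w : InfinitePlace E, (w.mult : ℝ) * Real.log (w (α : E)) := by
    rw [← InfinitePlace.prod_eq_abs_norm, Real.log_prod]
    · simp
    simp_all
  have hd : (finrank ℚ E : ℝ) * Real.log t = ∑ w : InfinitePlace E, (w.mult : ℝ) * Real.log t := by
    rw [← Finset.sum_mul, ← InfinitePlace.sum_mult_eq]; push_cast; rfl
  have hR : (finrank ℚ E : ℝ) * Real.log t - Real.log (|Algebra.norm ℚ (α : E)| : ℚ) =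
      -∑ w : InfinitePlace E, (w.mult : ℝ) * (Real.log (w (α : E)) - Real.log t) := by
    rw [hsum, hd, ← Finset.sum_sub_distrib, ← Finset.sum_neg_distrib]
    grind
  rw [hR]
  have key : ∀ (w : InfinitePlace E) (z : ℝ), w (α : E) < t * Real.exp (z / w.mult) ↔
      (w.mult : ℝ) * (Real.log (w (α : E)) - Real.log t) < z := by
    intro w z
    have hm : (0 : ℝ) < w.mult := by exact_mod_cast mult_pos
    have hw := InfinitePlace.pos_iff (w := w).mpr hα'
    rw [← Real.log_lt_log_iff hw (by positivity), Real.log_mul ht.ne' (Real.exp_ne_zero _),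
      Real.log_exp, ← lt_div_iff₀' hm, sub_lt_iff_lt_add']
  ext y
  simp only [logRegion, Set.mem_ofPred_eq, openSimplex, Set.mem_preimage, logBox_coe ht, key,
    Pi.add_apply]
  rw [Fintype.sum_eq_add_sum_subtype_ne _ (w₀ : InfinitePlace E), Finset.sum_add_distrib,
    Finset.sum_neg_distrib]
  grind

lemma logRegion_measurableSet {t : ℝ} (ht : 0 < t) {α : 𝓞 E} (hα : α ≠ 0) :
    MeasurableSet (logRegion t α) := by
  rw [logRegion_eq ht hα]
  exact (openSimplex_isOpen _).measurableSet.preimage (by fun_prop)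

/-- The truncated power `x ↦ (log x)_+ ^ r`. -/
noncomputable def logPow (r : ℕ) (x : ℝ) : ℝ := if 1 < x then Real.log x ^ r else 0

lemma logPow_nonneg (r : ℕ) (x : ℝ) : 0 ≤ logPow r x := by
  rw [logPow]; bound

lemma card_subtype_ne_w₀ : Fintype.card {w : InfinitePlace E // w ≠ w₀} = Units.rank E := by
  simp [Units.rank, Fintype.card_subtype_compl]

/-- The volume of the unit simplex in the logarithmic space. -/
noncomputable def simplexVolume (E : Type*) [Field E] [NumberField E] : ℝ≥0∞ :=
  volume (openSimplex {w : InfinitePlace E // w ≠ w₀} 1)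

lemma volume_logRegion {t : ℝ} (ht : 0 < t) {α : 𝓞 E} (hα : α ≠ 0) :
    volume (logRegion t α) = ENNReal.ofReal
      (logPow (Units.rank E) (t ^ finrank ℚ E / Ideal.absNorm (Ideal.span {α}))) * simplexVolume E := by
  have hn : ((|Algebra.norm ℚ (α : E)| : ℚ) : ℝ) = Ideal.absNorm (Ideal.span {α}) := by
    rw [Ideal.absNorm_span_singleton, ← Algebra.coe_norm_int, ← Int.cast_abs, Int.abs_eq_natAbs]
    simp
  have hpos : 0 < (Ideal.absNorm (Ideal.span {α}) : ℝ) := by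
    simp_all
  rw [logRegion_eq ht hα, measure_preimage_add_right, volume_openSimplex, card_subtype_ne_w₀, hn]
  have hlog : (finrank ℚ E : ℝ) * Real.log t - Real.log (Ideal.absNorm (Ideal.span {α})) =
      Real.log (t ^ finrank ℚ E / Ideal.absNorm (Ideal.span {α})) := by
    rw [Real.log_div (by positivity) hpos.ne', Real.log_pow]
  rw [hlog, simplexVolume, logPow]
  have : 0 < Real.log (t ^ finrank ℚ E / Ideal.absNorm (Ideal.span {α})) ↔
      1 < t ^ finrank ℚ E / Ideal.absNorm (Ideal.span {α}) :=
    Real.log_pos_iff (by positivity)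
  simp only [this]
  split_ifs <;> simp

lemma logRegion_unit_mul {t : ℝ} (ht : 0 < t) (u : (𝓞 E)ˣ) {α : 𝓞 E} (hα : α ≠ 0) :
    logRegion t ((u : 𝓞 E) * α) = logEmbedding E (Additive.ofMul u) +ᵥ logRegion t α := by
  have hα' : (α : E) ≠ 0 := by simpa using hα
  have hu : ∀ w : InfinitePlace E, 0 < w (u : E) := Units.pos_at_place u
  rw [logRegion_eq ht hα, logRegion_eq ht (mul_ne_zero u.ne_zero hα)]
  ext y
  rw [Set.mem_vadd_set_iff_neg_vadd_mem, Set.mem_preimage, Set.mem_preimage]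
  have h1 : |Algebra.norm ℚ (((u : 𝓞 E) * α : 𝓞 E) : E)| = |Algebra.norm ℚ (α : E)| := by
    simp
  rw [h1]
  refine iff_of_eq (congrArg₂ _ rfl ?_)
  ext w
  simp only [Pi.add_apply, vadd_eq_add, Pi.neg_apply, logEmbedding_component]
  push_cast
  rw [map_mul, Real.log_mul (hu _).ne' (InfinitePlace.pos_iff.mpr hα').ne']
  ring

end LogBox

section UnitSum

open Ideal

variable {E : Type*} [Field E] [NumberField E]

/-- A fundamental domain for the unit lattice. -/
noncomputable def unitDomain (E : Type*) [Field E] [NumberField E] : Set (logSpace E) :=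
  ZSpan.fundamentalDomain ((Free.chooseBasis ℤ (unitLattice E)).ofZLatticeBasis ℝ (unitLattice E))

lemma isAddFundamentalDomain_unitDomain :
    IsAddFundamentalDomain (unitLattice E) (unitDomain E) volume :=
  ZLattice.isAddFundamentalDomain _ volume

lemma unitDomain_volume_ne_zero : volume (unitDomain E) ≠ 0 :=
  ZSpan.measure_fundamentalDomain_ne_zero _

lemma unitDomain_volume_ne_top : volume (unitDomain E) ≠ ⊤ :=
  (ZSpan.fundamentalDomain_isBounded _).measure_lt_top.ne

lemma tsum_units_eq (F : logSpace E → ℝ≥0∞) :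
    ∑' u : (𝓞 E)ˣ, F (logEmbedding E (Additive.ofMul u)) =
      torsionOrder E * ∑' l : unitLattice E, F l := by
  rw [← (Subgroup.groupEquivQuotientProdSubgroup (s := torsion E)).symm.tsum_eq]
  have h1 : ∀ c : ((𝓞 E)ˣ ⧸ torsion E) × torsion E,
      F (logEmbedding E (Additive.ofMul (Subgroup.groupEquivQuotientProdSubgroup.symm c))) =
        F (logEmbeddingEquiv E (Additive.ofMul c.1)) := by
    intro c
    obtain ⟨x, rfl⟩ := (Subgroup.groupEquivQuotientProdSubgroup (s := torsion E)).surjective c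
    rw [Equiv.symm_apply_apply]
    rfl
  simp_rw [h1]
  rw [ENNReal.tsum_prod']
  simp only [ENNReal.tsum_const]
  rw [ENNReal.tsum_mul_left]
  congr 1
  · simp [torsionOrder, ENat.card_eq_coe_natCard]
  · exact ((Additive.ofMul.trans (logEmbeddingEquiv E).toEquiv).tsum_eq (fun l : unitLattice E => F l))

lemma tsum_units_volume {A : Set (logSpace E)} :
    ∑' u : (𝓞 E)ˣ, volume ((logEmbedding E (Additive.ofMul u) +ᵥ A) ∩ unitDomain E) =
      torsionOrder E * volume A := by
  rw [tsum_units_eq (fun l => volume ((l +ᵥ A) ∩ unitDomain E))]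
  congr 1
  have : VAddInvariantMeasure (unitLattice E) (logSpace E) volume :=
    inferInstanceAs (VAddInvariantMeasure (unitLattice E).toAddSubgroup (logSpace E) volume)
  exact ((isAddFundamentalDomain_unitDomain (E := E)).measure_eq_tsum A).symm

lemma tsum_generators (W : 𝓞 E → ℝ≥0∞) (hW : ∀ (u : (𝓞 E)ˣ) α, W (u * α) = W α)
    {t : ℝ} (ht : 0 < t) {β : 𝓞 E} (hβ : β ≠ 0) :
    ∑' α : {α : 𝓞 E // span {α} = span {β}},
      W α * volume (logRegion t (α : 𝓞 E) ∩ unitDomain E) =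
      W β * (torsionOrder E * volume (logRegion t β)) := by
  have hbij : Function.Bijective (fun u : (𝓞 E)ˣ => (⟨u * β, by
      rw [span_singleton_eq_span_singleton]
      simp⟩ :
      {α : 𝓞 E // span {α} = span {β}})) := by
    constructor
    · intro u v huv
      have := congrArg Subtype.val huv
      exact Units.ext (mul_right_cancel₀ hβ this)
    · rintro ⟨α, hα⟩
      obtain ⟨u, hu⟩ := span_singleton_eq_span_singleton.mp hα.symm
      exact ⟨u, Subtype.ext ((mul_comm _ _).trans hu)⟩
  rw [← (Equiv.ofBijective _ hbij).tsum_eq]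
  simp only [Equiv.ofBijective_apply, hW, logRegion_unit_mul ht _ hβ]
  rw [ENNReal.tsum_mul_left, tsum_units_volume]

/-- The unit-averaged sum over elements of an ideal is a sum over ideals in a fixed class. -/
lemma tsum_unfold {J : Ideal (𝓞 E)} (hJ : J ≠ ⊥) (g : ℕ → ℝ≥0∞) {t : ℝ} (ht : 0 < t) :
    ∑' α : {α : 𝓞 E // α ≠ 0 ∧ α ∈ J},
      g (absNorm (span {(α : 𝓞 E)}) / absNorm J) *
        volume (logRegion t (α : 𝓞 E) ∩ unitDomain E) =
    torsionOrder E * simplexVolume E *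
      ∑' I : {I : Ideal (𝓞 E) // I ≠ ⊥ ∧ (I * J).IsPrincipal},
        g (absNorm (I : Ideal (𝓞 E))) * ENNReal.ofReal (logPow (Units.rank E)
          (t ^ finrank ℚ E / absNorm J / absNorm (I : Ideal (𝓞 E)))) := by
  have hNJ : absNorm J ≠ 0 := absNorm_eq_zero_iff.not.mpr hJ
  have hex : ∀ α : {α : 𝓞 E // α ≠ 0 ∧ α ∈ J}, ∃ I : Ideal (𝓞 E),
      (I ≠ ⊥ ∧ (I * J).IsPrincipal) ∧ I * J = span {(α : 𝓞 E)} := by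
    rintro ⟨α, hα0, hα⟩
    obtain ⟨I, hI⟩ := dvd_iff_le.mpr ((span_singleton_le_iff_mem J).mpr hα)
    rw [mul_comm] at hI
    refine ⟨I, ⟨?_, ?_⟩, hI.symm⟩
    · rintro rfl
      simp at hI
      exact hα0 hI
    · rw [← hI]; exact ⟨α, rfl⟩
  choose I hI1 hI2 using hex
  let Φ : {α : 𝓞 E // α ≠ 0 ∧ α ∈ J} → {I : Ideal (𝓞 E) // I ≠ ⊥ ∧ (I * J).IsPrincipal} :=
    fun α => ⟨I α, hI1 α⟩
  rw [← (Equiv.sigmaFiberEquiv Φ).tsum_eq, ENNReal.tsum_sigma', ← ENNReal.tsum_mul_left]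
  refine tsum_congr ?_
  rintro ⟨K, hK0, hKp⟩
  obtain ⟨β, hβ⟩ := hKp
  rw [submodule_span_eq] at hβ
  have hβ0 : β ≠ 0 := by
    rintro rfl
    simp_all
  have hcancel : ∀ K' : Ideal (𝓞 E), K' * J = K * J → K' = K := fun K' h =>
    mul_right_cancel₀ (by simpa using hJ) h
  have hiff : ∀ α : {α : 𝓞 E // α ≠ 0 ∧ α ∈ J}, Φ α = ⟨K, hK0, ⟨β, hβ⟩⟩ ↔
      span {(α : 𝓞 E)} = span {β} := by
    grind
  let e : {α // Φ α = ⟨K, hK0, ⟨β, hβ⟩⟩} ≃ {α : 𝓞 E // span {α} = span {β}} :=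
    { toFun := fun α => ⟨α.1.1, (hiff α.1).mp α.2⟩
      invFun := fun α => ⟨⟨α.1, by
          rintro h
          have := α.2
          rw [h, span_singleton_eq_bot.mpr rfl, eq_comm, span_singleton_eq_bot] at this
          exact hβ0 this, by
          have : span {α.1} ≤ J := by rw [α.2, ← hβ]; exact mul_le_right (I := K) (J := J)
          bound⟩, (hiff _).mpr α.2⟩
      left_inv := fun α => rfl
      right_inv := fun α => rfl }
  have hstep : ∑' c : {α // Φ α = ⟨K, hK0, ⟨β, hβ⟩⟩},
      g (absNorm (span {((Equiv.sigmaFiberEquiv Φ ⟨⟨K, hK0, ⟨β, hβ⟩⟩, c⟩ : {α : 𝓞 E // α ≠ 0 ∧ α ∈ J}) : 𝓞 E)}) / absNorm J) *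
        volume (logRegion t ((Equiv.sigmaFiberEquiv Φ ⟨⟨K, hK0, ⟨β, hβ⟩⟩, c⟩ : {α : 𝓞 E // α ≠ 0 ∧ α ∈ J}) : 𝓞 E) ∩ unitDomain E) =
      ∑' α : {α : 𝓞 E // span {α} = span {β}},
      g (absNorm (span {(α : 𝓞 E)}) / absNorm J) *
        volume (logRegion t (α : 𝓞 E) ∩ unitDomain E) :=
    e.tsum_eq (fun α : {α : 𝓞 E // span {α} = span {β}} =>
      g (absNorm (span {(α : 𝓞 E)}) / absNorm J) *
        volume (logRegion t (α : 𝓞 E) ∩ unitDomain E))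
  rw [hstep, tsum_generators (fun α => g (absNorm (span {α}) / absNorm J)) ?_ ht hβ0,
    volume_logRegion ht hβ0, ← hβ, map_mul, Nat.mul_div_cancel _ (Nat.pos_of_ne_zero hNJ)]
  · rw [show t ^ finrank ℚ E / ((absNorm K * absNorm J : ℕ) : ℝ) =
        t ^ finrank ℚ E / absNorm J / absNorm K by
      grind]
    ring
  · intro u α
    have : span {(u : 𝓞 E) * α} = span {α} := by
      rw [span_singleton_eq_span_singleton]
      exact associated_unit_mul_left _ _ u.isUnit
    simp only [this]

end UnitSum

section NormMod

universe uE

variable {E : Type uE} [Field E] [NumberField E]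

/-- The index of `α 𝓞` in the ideal `J ∋ α`. -/
noncomputable def relNorm (J : Ideal (𝓞 E)) (α : 𝓞 E) : ℕ :=
  Ideal.absNorm (Ideal.span {α}) / Ideal.absNorm J

/-- The matrix of multiplication by `α` from the ring of integers to an ideal `J`. -/
lemma exists_matrix_relNorm {J : Ideal (𝓞 E)} (hJ : J ≠ ⊥) :
    ∃ (n : Type uE) (_ : Fintype n) (_ : DecidableEq n) (A : J →+ Matrix n n ℤ),
      ∀ α : J, relNorm J α = (A α).det.natAbs := by
  classical
  let b := RingOfIntegers.basis E
  let bJ := Ideal.selfBasis b J hJ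
  let ι := Free.ChooseBasisIndex ℤ (𝓞 E)
  let A : J →+ Matrix ι ι ℤ :=
    { toFun := fun α => Matrix.of fun i j => bJ.repr ⟨(α : 𝓞 E) * b j, J.mul_mem_right _ α.2⟩ i
      map_zero' := by
        ext i j
        have : (⟨((0 : J) : 𝓞 E) * b j, J.mul_mem_right _ (0 : J).2⟩ : J) = 0 := by
          simp
        simp only [Matrix.of_apply, this]; simp
      map_add' := by
        intro x y
        ext i j
        have : (⟨((x + y : J) : 𝓞 E) * b j, J.mul_mem_right _ (x + y).2⟩ : J) =
            ⟨(x : 𝓞 E) * b j, J.mul_mem_right _ x.2⟩ + ⟨(y : 𝓞 E) * b j, J.mul_mem_right _ y.2⟩ := by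
          simp [add_mul]
        rw [Matrix.of_apply, this, map_add]; rfl }
  refine ⟨ι, inferInstance, inferInstance, A, fun α => ?_⟩
  have h2 : Algebra.leftMulMatrix b (α : 𝓞 E) =
      b.toMatrix ((↑) ∘ bJ : ι → 𝓞 E) * A α := by
    ext i j
    rw [Algebra.leftMulMatrix_eq_repr_mul, Matrix.mul_apply]
    have h3 : (α : 𝓞 E) * b j = ∑ k, (A α) k j • ((bJ k : J) : 𝓞 E) := by
      have := congrArg Subtype.val (bJ.sum_repr ⟨(α : 𝓞 E) * b j, J.mul_mem_right _ α.2⟩)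
      simp only [Submodule.coe_sum, Submodule.coe_smul_of_tower] at this
      exact this.symm
    rw [h3, map_sum, Finsupp.finsetSum_apply]
    refine Finset.sum_congr rfl fun k _ => ?_
    rw [map_smul, Finsupp.smul_apply, smul_eq_mul, Basis.toMatrix_apply, mul_comm]
    rfl
  have h4 := congrArg (fun M : Matrix ι ι ℤ => M.det.natAbs) h2
  simp only [Matrix.det_mul, Int.natAbs_mul] at h4
  rw [← Algebra.norm_eq_matrix_det b, ← Basis.det_apply, Ideal.natAbs_det_basis_change b J bJ] at h4
  rw [relNorm, Ideal.absNorm_span_singleton, h4]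
  exact Nat.mul_div_cancel_left _ (Nat.pos_of_ne_zero (Ideal.absNorm_eq_zero_iff.not.mpr hJ))

lemma relNorm_modEq {J : Ideal (𝓞 E)} (hJ : J ≠ ⊥) {Q : ℕ} {α β : 𝓞 E} (hα : α ∈ J)
    (hβ : β ∈ J) (h : α - β ∈ Ideal.span {(Q : 𝓞 E)} * J) :
    (relNorm J α : ZMod Q) = relNorm J β ∨ (relNorm J α : ZMod Q) = -relNorm J β := by
  obtain ⟨n, _, _, A, hA⟩ := exists_matrix_relNorm hJ
  obtain ⟨γ, hγ, hγe⟩ := Ideal.mem_span_singleton_mul.mp h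
  have h1 : (⟨α, hα⟩ : J) = ⟨β, hβ⟩ + Q • ⟨γ, hγ⟩ := by
    simp_all
  have hdet : ((A ⟨α, hα⟩).det : ZMod Q) = (A ⟨β, hβ⟩).det := by
    have h2 : ∀ M : Matrix n n ℤ, ((M.det : ℤ) : ZMod Q) = (M.map (Int.castRingHom (ZMod Q))).det :=
      fun M => by
        rw [← RingHom.mapMatrix_apply, ← RingHom.map_det]; rfl
    rw [h2, h2, h1, map_add, map_nsmul]
    congr 1
    ext i j
    rw [Matrix.map_apply, Matrix.map_apply, Matrix.add_apply, Matrix.smul_apply, nsmul_eq_mul]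
    simp
  have hnat : ∀ z : ℤ, ((z.natAbs : ℕ) : ZMod Q) = z ∨ ((z.natAbs : ℕ) : ZMod Q) = -z := by
    intro z
    rcases Int.natAbs_eq z with hz | hz
    · left; conv_rhs => rw [hz]
      simp
    · conv_rhs => rw [hz]
      simp
  have e1 : relNorm J α = (A ⟨α, hα⟩).det.natAbs := hA ⟨α, hα⟩
  have e2 : relNorm J β = (A ⟨β, hβ⟩).det.natAbs := hA ⟨β, hβ⟩
  rw [e1, e2]
  rcases hnat (A ⟨α, hα⟩).det with h3 | h3 <;> rcases hnat (A ⟨β, hβ⟩).det with h4 | h4 <;>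
    rw [h3, h4, hdet] <;> simp

lemma relNorm_mul_ideal {J B : Ideal (𝓞 E)} (hJ : J ≠ ⊥) {α : 𝓞 E}
    (hα : α ∈ J * B) : relNorm J α = Ideal.absNorm B * relNorm (J * B) α := by
  have h1 : Ideal.absNorm (J * B) ∣ Ideal.absNorm (Ideal.span {α}) :=
    Ideal.absNorm_dvd_absNorm_of_le ((Ideal.span_singleton_le_iff_mem _).mpr hα)
  rw [relNorm, relNorm]
  obtain ⟨k, hk⟩ := h1
  rw [map_mul] at hk ⊢
  have hNJ : 0 < Ideal.absNorm J := Nat.pos_of_ne_zero (Ideal.absNorm_eq_zero_iff.not.mpr hJ)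
  rw [hk, mul_assoc, Nat.mul_div_cancel_left _ hNJ, ← mul_assoc]
  rcases Nat.eq_zero_or_pos (Ideal.absNorm B) with hB | hB
  · simp [hB]
  simp_all

end NormMod

section ClassCount

open Finset Real Ideal Fintype

variable {E : Type*} [Field E] [NumberField E]

/-- A function on `ℕ` that is even and `Q`-periodic. -/
def IsEvenMod {R : Type*} (Q : ℕ) (g : ℕ → R) : Prop :=
  ∀ a b : ℕ, ((a : ZMod Q) = b ∨ (a : ZMod Q) = -b) → g a = g b

instance finite_quotient_level (Q : ℕ) [NeZero Q] (J : Ideal (𝓞 E)) [NeZero J] :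
    Finite (𝓞 E ⧸ (span {(Q : 𝓞 E)} * J)) := by
  refine finiteQuotientOfFreeOfNeBot _ ?_
  rw [Ne, mul_eq_bot, not_or]
  refine ⟨?_, NeZero.ne J⟩
  have : (Q : 𝓞 E) ≠ 0 := by exact_mod_cast NeZero.ne Q
  simpa using this

noncomputable instance fintype_quotient_level (Q : ℕ) [NeZero Q] (J : Ideal (𝓞 E)) [NeZero J] :
    Fintype (𝓞 E ⧸ (span {(Q : 𝓞 E)} * J)) := ofFinite _

/-- The weight of a residue class modulo `Q J`. -/
noncomputable def classWeight {R : Type*} [Zero R] (Q : ℕ) (J : Ideal (𝓞 E)) (g : ℕ → R)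
    (c : 𝓞 E ⧸ (span {(Q : 𝓞 E)} * J)) : R :=
  if Quotient.out c ∈ J then g (relNorm J (Quotient.out c)) else 0

lemma out_sub_mem (I : Ideal (𝓞 E)) (α : 𝓞 E) :
    α - Quotient.out (Ideal.Quotient.mk I α) ∈ I := by
  rw [← Ideal.Quotient.eq]
  simp

lemma classWeight_mk {R : Type*} [Zero R] {Q : ℕ} {J : Ideal (𝓞 E)} (hJ : J ≠ ⊥) {g : ℕ → R}
    (hg : IsEvenMod Q g) (α : 𝓞 E) :
    classWeight Q J g (Ideal.Quotient.mk _ α) = if α ∈ J then g (relNorm J α) else 0 := by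
  have h := out_sub_mem (Ideal.span {(Q : 𝓞 E)} * J) α
  have hJ' : α - Quotient.out (Ideal.Quotient.mk (Ideal.span {(Q : 𝓞 E)} * J) α) ∈ J :=
    Ideal.mul_le_right h
  have hiff : Quotient.out (Ideal.Quotient.mk (Ideal.span {(Q : 𝓞 E)} * J) α) ∈ J ↔ α ∈ J := by
    constructor
    · intro h1; simpa using J.add_mem hJ' h1
    · intro h1; simpa using J.sub_mem h1 hJ'
  rw [classWeight]
  simp only [hiff]
  split_ifs with h1
  · exact (hg _ _ (relNorm_modEq hJ h1 (hiff.mpr h1) h)).symm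
  · rfl

lemma classWeight_one_sum {R : Type*} [Semiring R] (Q : ℕ) [NeZero Q] (J : Ideal (𝓞 E)) [NeZero J] :
    ∑ c, classWeight Q J (fun _ => (1 : R)) c = (Q : R) ^ finrank ℚ E := by
  have hJ : J ≠ ⊥ := NeZero.ne J
  set I := span {(Q : 𝓞 E)} * J with hI
  have hle : I ≤ J := mul_le_right
  have h1 := Submodule.card_quotient_mul_card_quotient J I hle
  have hNJ : 0 < absNorm J := Nat.pos_of_ne_zero (absNorm_eq_zero_iff.not.mpr hJ)
  have hcI : Nat.card (𝓞 E ⧸ I) = absNorm I := by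
    bound
  have hcJ : Nat.card (𝓞 E ⧸ J) = absNorm J := by
    bound
  have hQn : absNorm (span {(Q : 𝓞 E)}) = Q ^ finrank ℚ E := by
    rw [absNorm_span_singleton, ← map_natCast (algebraMap ℤ (𝓞 E)), Algebra.norm_algebraMap,
      Int.natAbs_pow, RingOfIntegers.rank]
    simp
  rw [hcI, hcJ, hI, map_mul, hQn] at h1
  have h2 : Nat.card (Submodule.map I.mkQ J) = Q ^ finrank ℚ E :=
    Nat.eq_of_mul_eq_mul_right hNJ h1
  have h3 : ∀ c : 𝓞 E ⧸ I, classWeight Q J (fun _ => (1 : R)) c =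
      if c ∈ Submodule.map I.mkQ J then 1 else 0 := by
    intro c
    obtain ⟨α, rfl⟩ := Ideal.Quotient.mk_surjective c
    rw [classWeight_mk hJ (fun _ _ _ => rfl)]
    congr 1
    refine propext ⟨fun h => ⟨α, h, rfl⟩, ?_⟩
    rintro ⟨β, hβ, hβα⟩
    have : β - α ∈ I := Ideal.Quotient.eq.mp hβα
    have := J.sub_mem hβ (hle this)
    simpa using this
  simp_rw [h3]
  rw [sum_ite, sum_const_zero, add_zero, sum_const, nsmul_one, ← Nat.cast_pow,
    ← h2, Nat.card_eq_fintype_card, Fintype.card_subtype]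

/-- The mean value of `g` over residue classes. -/
noncomputable def classMean (Q : ℕ) [NeZero Q] (J : Ideal (𝓞 E)) [NeZero J] {R : Type*} [Field R]
    (g : ℕ → R) : R := (∑ c, classWeight Q J g c) / Q ^ finrank ℚ E

lemma classWeight_nonneg {Q : ℕ} {J : Ideal (𝓞 E)} {g : ℕ → ℝ} (hg : ∀ n, 0 ≤ g n)
    (c) : 0 ≤ classWeight Q J g c := by
  rw [classWeight]; split_ifs
  · exact hg _
  · rfl

lemma classMean_nonneg {Q : ℕ} [NeZero Q] {J : Ideal (𝓞 E)} [NeZero J] {g : ℕ → ℝ}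
    (hg : ∀ n, 0 ≤ g n) : 0 ≤ classMean Q J g :=
  div_nonneg (sum_nonneg fun c _ => classWeight_nonneg hg c) (by positivity)

lemma classMean_le_one {Q : ℕ} [NeZero Q] {J : Ideal (𝓞 E)} [NeZero J] {g : ℕ → ℝ}
    (hg : ∀ n, g n ≤ 1) : classMean Q J g ≤ 1 := by
  have hQ : (0 : ℝ) < Q := by exact_mod_cast Nat.pos_of_ne_zero (NeZero.ne Q)
  rw [classMean, div_le_one (by positivity), ← classWeight_one_sum Q J]
  refine sum_le_sum fun c _ => ?_
  rw [classWeight, classWeight]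
  split_ifs
  · exact hg _
  · rfl

variable {ι : Type*} [Fintype ι]

lemma weighted_box_count (θ : Basis ι ℚ E) (hθ : ∀ i, IsIntegral ℤ (θ i)) {T : ℝ}
    (hT : ∀ i, ∀ w : InfinitePlace E, w (θ i) ≤ T) (J : Ideal (𝓞 E)) [NeZero J]
    (Q : ℕ) [NeZero Q] {g : ℕ → ℝ} (hg : IsEvenMod Q g) (hg0 : ∀ n, 0 ≤ g n) (hg1 : ∀ n, g n ≤ 1)
    (f : InfinitePlace E → ℝ≥0) (hf : ∀ w, f w ≠ 0) {X : ℝ}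
    (hX : X * absNorm J = ∏ w, (f w : ℝ) ^ w.mult) :
    ∃ s : Finset (𝓞 E), (∀ α, α ∈ s ↔ (∀ w : InfinitePlace E, w (α : E) < f w) ∧ α ∈ J) ∧
    |∑ α ∈ s, g (relNorm J α) - boxDensity E * X * classMean Q J g| ≤
      boxDensity E * X *
        ((1 + 6 * finrank ℚ E ^ 2 * T ^ 2 * Q * X ^ (-(1 / finrank ℚ E : ℝ))) ^ finrank ℚ E - 1) := by
  have hJ : J ≠ ⊥ := NeZero.ne J
  have hQ : 0 < Q := Nat.pos_of_ne_zero (NeZero.ne Q)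
  set d := finrank ℚ E with hd
  set I := span {(Q : 𝓞 E)} * J with hI
  set D := ((1 + 6 * d ^ 2 * T ^ 2 * Q * X ^ (-(1 / d : ℝ))) ^ d - 1) with hD
  have hcount := fun c : 𝓞 E ⧸ I => box_count θ hθ hT hJ hQ f hf (Quotient.out c) hX
  set A : (𝓞 E ⧸ I) → Set (𝓞 E) := fun c => {α : 𝓞 E | (∀ w : InfinitePlace E, w (α : E) < f w) ∧
        α - Quotient.out c ∈ I} with hA
  have hmemA : ∀ c α, α ∈ A c ↔ (∀ w : InfinitePlace E, w (α : E) < f w) ∧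
      Ideal.Quotient.mk I α = c := by
    intro c α
    rw [hA]
    simp only [Set.mem_ofPred_eq]
    rw [← Ideal.Quotient.eq]
    simp
  have hfin : {α : 𝓞 E | ∀ w : InfinitePlace E, w (α : E) < f w}.Finite := by
    refine (Set.finite_iUnion (fun c => (hcount c).1)).subset fun α hα => ?_
    simp_all
  set s₀ := hfin.toFinset with hs₀
  have hs₀m : ∀ α, α ∈ s₀ ↔ ∀ w : InfinitePlace E, w (α : E) < f w := fun α => by
    rw [hs₀, Set.Finite.mem_toFinset]; rfl
  refine ⟨s₀.filter (· ∈ J), fun α => by rw [mem_filter, hs₀m], ?_⟩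
  have h1 : ∑ α ∈ s₀.filter (· ∈ J), g (relNorm J α) =
      ∑ c : 𝓞 E ⧸ I, classWeight Q J g c * (A c).ncard := by
    rw [sum_filter]
    simp_rw [← classWeight_mk hJ hg]
    rw [← Finset.sum_fiberwise s₀ (Ideal.Quotient.mk I)]
    refine sum_congr rfl fun c _ => ?_
    have hAc : A c = ((s₀.filter fun α => Ideal.Quotient.mk I α = c : Finset (𝓞 E)) : Set (𝓞 E)) := by
      ext α
      rw [hmemA, mem_coe, mem_filter, hs₀m]
    rw [hAc, Set.ncard_coe_finset, mul_comm (classWeight Q J g c), ← nsmul_eq_mul]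
    exact sum_eq_card_nsmul
      fun α hα => congrArg (classWeight Q J g) (mem_filter.mp hα).2
  rw [h1]
  have hXpos : 0 < X := by
    have hprod : 0 < ∏ w, (f w : ℝ) ^ w.mult :=
      prod_pos fun w _ => pow_pos (NNReal.coe_pos.mpr (pos_iff_ne_zero.mpr (hf w))) _
    nlinarith
  have hDn : 0 ≤ D := by
    bound
  have hκ := boxDensity_pos (E := E)
  have h2 : ∑ c : 𝓞 E ⧸ I, classWeight Q J g c * (A c).ncard - boxDensity E * X * classMean Q J g =
      ∑ c : 𝓞 E ⧸ I, classWeight Q J g c * ((A c).ncard - boxDensity E * X / Q ^ d) := by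
    simp_rw [mul_sub]
    rw [sum_sub_distrib, ← sum_mul, classMean]
    ring
  rw [h2]
  calc _ ≤ ∑ c : 𝓞 E ⧸ I, classWeight Q J g c * (boxDensity E * X / Q ^ d * D) := by
        refine (abs_sum_le_sum_abs _ _).trans (sum_le_sum fun c _ => ?_)
        rw [abs_mul, abs_of_nonneg (classWeight_nonneg hg0 c)]
        exact mul_le_mul_of_nonneg_left (hcount c).2 (classWeight_nonneg hg0 c)
    _ = classMean Q J g * (boxDensity E * X * D) := by
        rw [← sum_mul, classMean]; ring
    _ ≤ 1 * (boxDensity E * X * D) := by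
        gcongr
        exact classMean_le_one hg1
    _ = _ := one_mul _

/-- The sum over ideals in a class of weighted truncated powers. -/
noncomputable def classSum (J : Ideal (𝓞 E)) (g : ℕ → ℝ) (X : ℝ) : ℝ≥0∞ :=
  ∑' I : {I : Ideal (𝓞 E) // I ≠ ⊥ ∧ (I * J).IsPrincipal},
    ENNReal.ofReal (g (absNorm (I : Ideal (𝓞 E))) *
      logPow (Units.rank E) (X / absNorm (I : Ideal (𝓞 E))))

lemma classSum_estimate (θ : Basis ι ℚ E) (hθ : ∀ i, IsIntegral ℤ (θ i)) {T : ℝ}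
    (hT : ∀ i, ∀ w : InfinitePlace E, w (θ i) ≤ T) (J : Ideal (𝓞 E)) [NeZero J]
    (Q : ℕ) [NeZero Q] {g : ℕ → ℝ} (hg : IsEvenMod Q g) (hg0 : ∀ n, 0 ≤ g n) (hg1 : ∀ n, g n ≤ 1)
    {X : ℝ} (hX : 0 < X) :
    classSum J g X ≠ ⊤ ∧
    |torsionOrder E * (simplexVolume E).toReal * (classSum J g X).toReal -
        (volume (unitDomain E)).toReal * (boxDensity E * X * classMean Q J g)| ≤
      (volume (unitDomain E)).toReal * (boxDensity E * X *
        ((1 + 6 * finrank ℚ E ^ 2 * T ^ 2 * Q * X ^ (-(1 / finrank ℚ E : ℝ))) ^ finrank ℚ E - 1) + 1) := by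
  have hJ : J ≠ ⊥ := NeZero.ne J
  set d := finrank ℚ E with hd
  have hdpos : 0 < d := Module.finrank_pos
  have hNJ : 0 < (absNorm J : ℝ) := by
    exact_mod_cast Nat.pos_of_ne_zero (absNorm_eq_zero_iff.not.mpr hJ)
  set t : ℝ := (X * absNorm J) ^ (1 / d : ℝ) with ht
  have htpos : 0 < t := rpow_pos_of_pos (by positivity) _
  have htd : t ^ d = X * absNorm J := by
    rw [ht, ← rpow_natCast, ← rpow_mul (by positivity)]
    have : (1 / (d : ℝ)) * d = 1 := by field_simp
    rw [this, rpow_one]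
  set err := boxDensity E * X *
        ((1 + 6 * d ^ 2 * T ^ 2 * Q * X ^ (-(1 / d : ℝ))) ^ d - 1) + 1 with herr
  set M := boxDensity E * X * classMean Q J g with hM
  set R := volume (unitDomain E) with hR
  have hRtop : R ≠ ⊤ := unitDomain_volume_ne_top
  have hunf := tsum_unfold hJ (fun n => ENNReal.ofReal (g n)) htpos
  have hcs : ∑' I : {I : Ideal (𝓞 E) // I ≠ ⊥ ∧ (I * J).IsPrincipal},
        ENNReal.ofReal (g (absNorm (I : Ideal (𝓞 E)))) * ENNReal.ofReal (logPow (Units.rank E)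
          (t ^ finrank ℚ E / absNorm J / absNorm (I : Ideal (𝓞 E)))) = classSum J g X := by
    refine tsum_congr fun I => ?_
    rw [← ENNReal.ofReal_mul (hg0 _), ← hd, htd, mul_div_cancel_right₀ _ hNJ.ne']
  rw [hcs] at hunf
  set c : logSpace E → ℝ≥0∞ := fun y => ∑' α : {α : 𝓞 E // α ≠ 0 ∧ α ∈ J},
    (logRegion t (α : 𝓞 E)).indicator (fun _ => ENNReal.ofReal (g (relNorm J α))) y with hc
  have hint : ∫⁻ y in unitDomain E, c y = torsionOrder E * simplexVolume E * classSum J g X := by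
    have : Countable (𝓞 E) := (RingOfIntegers.basis E).equivFun.injective.countable
    rw [← hunf, lintegral_tsum fun α => (measurable_const.indicator
      (logRegion_measurableSet htpos α.2.1)).aemeasurable]
    refine tsum_congr fun α => ?_
    rw [lintegral_indicator_const (logRegion_measurableSet htpos α.2.1),
      Measure.restrict_apply (logRegion_measurableSet htpos α.2.1)]
    rfl
  have hbound : ∀ y, ∃ C : ℝ, c y = ENNReal.ofReal C ∧ |C - M| ≤ err := by
    intro y
    obtain ⟨s, hs, hse⟩ := weighted_box_count θ hθ hT J Q hg hg0 hg1 (logBox t y)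
      (logBox_ne_zero htpos y) (X := X) (by rw [logBox_prod htpos, ← hd, htd])
    refine ⟨∑ α ∈ s.erase 0, g (relNorm J α), ?_, ?_⟩
    · rw [ENNReal.ofReal_sum_of_nonneg fun _ _ => hg0 _]
      have h3 : ∀ α : {α : 𝓞 E // α ≠ 0 ∧ α ∈ J},
          (logRegion t (α : 𝓞 E)).indicator (fun _ => ENNReal.ofReal (g (relNorm J α))) y =
          (fun α : 𝓞 E => if α ∈ s.erase 0 then ENNReal.ofReal (g (relNorm J α)) else 0) α := by
        rintro ⟨α, hα0, hαJ⟩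
        simp only [Set.indicator_apply, mem_erase, hs, ne_eq, hα0, not_false_eq_true,
          true_and, hαJ, and_true]
        exact if_congr Iff.rfl rfl rfl
      rw [hc]
      simp only [h3]
      have h4 : ∑ α ∈ s.erase 0, ENNReal.ofReal (g (relNorm J α)) =
          ∑' α : 𝓞 E, if α ∈ s.erase 0 then ENNReal.ofReal (g (relNorm J α)) else 0 := by
        rw [tsum_eq_sum (s := s.erase 0) fun α hα => if_neg hα]
        exact sum_congr rfl fun α hα => (if_pos hα).symm
      rw [h4]
      exact tsum_subtype_eq_of_support_subset (s := {α : 𝓞 E | α ≠ 0 ∧ α ∈ J})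
        (f := fun α : 𝓞 E => if α ∈ s.erase 0 then ENNReal.ofReal (g (relNorm J α)) else 0) (by
        intro α hα
        have : α ∈ s.erase 0 := by
          by_contra h; exact hα (if_neg h)
        rw [mem_erase, hs] at this
        exact ⟨this.1, this.2.2⟩)
    · have h0 : (0 : 𝓞 E) ∈ s := by
        rw [hs]
        refine ⟨fun w => ?_, J.zero_mem⟩
        simpa using pos_iff_ne_zero.mpr (logBox_ne_zero htpos y w)
      rw [← add_sum_erase _ _ h0, abs_le] at hse
      grind
  have hlo : ENNReal.ofReal (M - err) * R ≤ torsionOrder E * simplexVolume E * classSum J g X := by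
    rw [← hint, hR, ← setLIntegral_const]
    refine lintegral_mono fun y => ?_
    obtain ⟨C, hC, hCb⟩ := hbound y
    rw [hC]
    exact ENNReal.ofReal_le_ofReal (by linarith [(abs_le.mp hCb).1])
  have hhi : torsionOrder E * simplexVolume E * classSum J g X ≤ ENNReal.ofReal (M + err) * R := by
    rw [← hint, hR, ← setLIntegral_const]
    refine lintegral_mono fun y => ?_
    obtain ⟨C, hC, hCb⟩ := hbound y
    rw [hC]
    exact ENNReal.ofReal_le_ofReal (by linarith [(abs_le.mp hCb).2])
  have hhitop : ENNReal.ofReal (M + err) * R ≠ ⊤ := ENNReal.mul_ne_top ENNReal.ofReal_ne_top hRtop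
  have hv0 : simplexVolume E ≠ 0 := volume_openSimplex_one_pos.ne'
  have hw0 : (torsionOrder E : ℝ≥0∞) ≠ 0 := by exact_mod_cast (torsionOrder_pos E).ne'
  have hStop : classSum J g X ≠ ⊤ := by
    intro h
    rw [h, ENNReal.mul_top (mul_ne_zero hw0 hv0)] at hhi
    exact hhitop (top_le_iff.mp hhi)
  refine ⟨hStop, ?_⟩
  have hmid := ne_top_of_le_ne_top hhitop hhi
  have e1 := ENNReal.toReal_mono hmid hlo
  have e2 := ENNReal.toReal_mono hhitop hhi
  rw [ENNReal.toReal_mul, ENNReal.toReal_mul, ENNReal.toReal_mul, ENNReal.toReal_natCast] at e1 e2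
  have e3 : M - err ≤ (ENNReal.ofReal (M - err)).toReal := by
    exact le_max_left _ _
  have hMe : 0 ≤ M + err := by
    obtain ⟨C, hC, hCb⟩ := hbound 0
    have hDn : 0 ≤ ((1 + 6 * d ^ 2 * T ^ 2 * Q * X ^ (-(1 / d : ℝ))) ^ d - 1) := by
      bound
    have hκ := boxDensity_pos (E := E)
    have := classMean_nonneg (Q := Q) (J := J) hg0
    positivity
  rw [ENNReal.toReal_ofReal hMe] at e2
  have hR0 : 0 ≤ R.toReal := ENNReal.toReal_nonneg
  have e4 := mul_le_mul_of_nonneg_right e3 hR0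
  rw [abs_le]
  constructor <;> linarith

end ClassCount

section Tauberian

open Finset Real

lemma add_pow_ge_linear {a h : ℝ} (ha : 0 ≤ a) (hh : 0 ≤ h) (k : ℕ) :
    a ^ (k + 1) + (k + 1) * h * a ^ k ≤ (a + h) ^ (k + 1) := by
  induction k with
  | zero => simp
  | succ k ih =>
    have h1 := mul_le_mul_of_nonneg_right ih (add_nonneg ha hh)
    have h2 : 0 ≤ h * a ^ k * h := by positivity
    refine le_trans ?_ h1
    push_cast
    have : 0 ≤ (k : ℝ) * (h * a ^ k * h) := by positivity
    ring_nf at this h2 ⊢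
    nlinarith

lemma pow_sub_pow_le_linear {a b : ℝ} (hb : 0 ≤ b) (hab : b ≤ a) (k : ℕ) :
    a ^ (k + 1) - b ^ (k + 1) ≤ (k + 1) * (a - b) * a ^ k := by
  induction k with
  | zero => simp
  | succ k ih =>
    have ha := hb.trans hab
    have h1 := mul_le_mul_of_nonneg_right ih ha
    have h2 := mul_le_mul_of_nonneg_left (pow_le_pow_left₀ hb hab (k + 1)) (sub_nonneg.mpr hab)
    push_cast
    calc a ^ (k + 1 + 1) - b ^ (k + 1 + 1)
        = (a ^ (k + 1) - b ^ (k + 1)) * a + (a - b) * b ^ (k + 1) := by ring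
      _ ≤ (k + 1) * (a - b) * a ^ k * a + (a - b) * a ^ (k + 1) := add_le_add h1 h2
      _ = _ := by ring

lemma logPow_of_le_one {x : ℝ} (hx : x ≤ 1) (k : ℕ) : logPow k x = 0 := by
  rw [logPow, if_neg (not_lt.mpr hx)]

lemma logPow_of_one_lt {x : ℝ} (hx : 1 < x) (k : ℕ) : logPow k x = log x ^ k := by
  rw [logPow, if_pos hx]

lemma logPow_forward {x h : ℝ} (hh : 0 ≤ h) (k : ℕ) :
    (k + 1) * h * logPow k x ≤ logPow (k + 1) (x * exp h) - logPow (k + 1) x := by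
  rcases le_or_gt x 1 with h1 | h1
  · rw [logPow_of_le_one h1, logPow_of_le_one h1, mul_zero, sub_zero]
    exact logPow_nonneg _ _
  · have h2 : 1 < x * exp h := by nlinarith [one_le_exp hh]
    rw [logPow_of_one_lt h1, logPow_of_one_lt h1, logPow_of_one_lt h2,
      log_mul (by positivity) (exp_ne_zero _), log_exp]
    linarith [add_pow_ge_linear (log_nonneg h1.le) hh k]

lemma logPow_backward {x h : ℝ} (hh : 0 ≤ h) (k : ℕ) :
    logPow (k + 1) x - logPow (k + 1) (x * exp (-h)) ≤ (k + 1) * h * logPow k x := by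
  rcases le_or_gt x 1 with h1 | h1
  · have h2 : x * exp (-h) ≤ 1 := by
      rcases le_or_gt x 0 with h0 | h0
      · nlinarith [exp_pos (-h)]
      · nlinarith [exp_pos (-h), exp_le_one_iff.mpr (neg_nonpos.mpr hh)]
    rw [logPow_of_le_one h1, logPow_of_le_one h1, logPow_of_le_one h2, mul_zero, sub_zero]
  · have hx := log_pos h1
    rw [logPow_of_one_lt h1, logPow_of_one_lt h1]
    rcases le_or_gt (x * exp (-h)) 1 with h2 | h2
    · rw [logPow_of_le_one h2, sub_zero]
      have h3 : log x ≤ h := by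
        have := log_le_log (by positivity) h2
        rw [log_mul (by positivity) (exp_ne_zero _), log_exp, log_one] at this
        linarith
      have h4 : 0 ≤ log x ^ k := by positivity
      have h5 : 0 ≤ (k : ℝ) * h * log x ^ k := by positivity
      rw [pow_succ]
      nlinarith
    · rw [logPow_of_one_lt h2]
      have h3 := log_pos h2
      rw [log_mul (by positivity) (exp_ne_zero _), log_exp] at h3 ⊢
      have := pow_sub_pow_le_linear h3.le (by linarith : log x + -h ≤ log x) k
      simpa using this

/-- The weighted sum of `a` with truncated powers of logarithms. -/
noncomputable def logSum (a : ℕ → ℝ) (k : ℕ) (X : ℝ) : ℝ :=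
  ∑ n ∈ Icc 1 ⌊X⌋₊, a n * logPow k (X / n)

lemma logSum_eq (a : ℕ → ℝ) (k : ℕ) {X : ℝ} (hX : 0 ≤ X) {N : ℕ} (hN : ⌊X⌋₊ ≤ N) :
    logSum a k X = ∑ n ∈ Icc 1 N, a n * logPow k (X / n) := by
  refine sum_subset (Icc_subset_Icc_right hN) fun n hn hn' => ?_
  have hn1 := (mem_Icc.mp hn).1
  have h1 : ⌊X⌋₊ < n := by
    grind
  have h2 : X < n := (Nat.floor_lt hX).mp h1
  rw [logPow_of_le_one, mul_zero]
  bound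

lemma logSum_forward {a : ℕ → ℝ} (ha : ∀ n, 0 ≤ a n) {X h : ℝ} (hX : 0 ≤ X) (hh : 0 ≤ h) (k : ℕ) :
    (k + 1) * h * logSum a k X ≤ logSum a (k + 1) (X * exp h) - logSum a (k + 1) X := by
  have hle : X ≤ X * exp h := le_mul_of_one_le_right hX (one_le_exp hh)
  rw [logSum_eq a k hX (Nat.floor_le_floor hle), logSum_eq a (k + 1) hX (Nat.floor_le_floor hle),
    logSum, ← sum_sub_distrib, mul_sum]
  refine sum_le_sum fun n _ => ?_
  have := mul_le_mul_of_nonneg_left (logPow_forward (x := X / n) hh k) (ha n)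
  rw [div_mul_eq_mul_div] at this
  linarith

lemma logSum_backward {a : ℕ → ℝ} (ha : ∀ n, 0 ≤ a n) {X h : ℝ} (hX : 0 ≤ X) (hh : 0 ≤ h) (k : ℕ) :
    logSum a (k + 1) X - logSum a (k + 1) (X * exp (-h)) ≤ (k + 1) * h * logSum a k X := by
  have hle : X * exp (-h) ≤ X :=
    mul_le_of_le_one_right hX (exp_le_one_iff.mpr (neg_nonpos.mpr hh))
  have h0 : 0 ≤ X * exp (-h) := by positivity
  rw [logSum_eq a (k + 1) h0 (Nat.floor_le_floor hle), logSum, logSum, ← sum_sub_distrib,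
    mul_sum]
  refine sum_le_sum fun n _ => ?_
  have := mul_le_mul_of_nonneg_left (logPow_backward (x := X / n) hh k) (ha n)
  rw [div_mul_eq_mul_div] at this
  linarith

lemma tauberian_step {a : ℕ → ℝ} (ha : ∀ n, 0 ≤ a n) {k : ℕ} {M B e : ℝ} (hM : 0 ≤ M)
    (hMB : M ≤ B) (he : 0 ≤ e) (he1 : e ≤ 1)
    (hS : ∀ X, 0 < X → |logSum a (k + 1) X - M * X| ≤ B * X ^ (1 - e)) :
    ∀ X, 0 < X → |logSum a k X - M / (k + 1) * X| ≤ 7 * B * X ^ (1 - e / 2) := by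
  intro X hX
  have hB : 0 ≤ B := hM.trans hMB
  have hk : (0 : ℝ) < k + 1 := by positivity
  rcases lt_or_ge X 1 with h1 | h1
  · have h2 : logSum a k X = 0 := by
      rw [logSum, Nat.floor_eq_zero.mpr h1]; rfl
    rw [h2, zero_sub, abs_neg, abs_of_nonneg (by positivity)]
    have h3 : X ≤ X ^ (1 - e / 2) := by
      conv_lhs => rw [← rpow_one X]
      bound
    have h4 : M / (k + 1) ≤ M := div_le_self hM (by linarith [Nat.cast_nonneg (α := ℝ) k])
    nlinarith
  · set h := X ^ (-(e / 2)) with hh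
    have hpos : 0 < h := rpow_pos_of_pos hX _
    have hle1 : h ≤ 1 := rpow_le_one_of_one_le_of_nonpos h1 (by linarith)
    have hsplit : X ^ (1 - e) = h * X ^ (1 - e / 2) := by
      rw [hh, ← rpow_add hX]; ring_nf
    have hXh : X * h = X ^ (1 - e / 2) := by
      nth_rewrite 1 [← rpow_one X]; rw [← rpow_add hX]; ring_nf
    have hexp : exp h ≤ 1 + h + h ^ 2 := by
      have := abs_exp_sub_one_sub_id_le (x := h) (by rw [abs_of_pos hpos]; exact hle1)
      linarith [(abs_le.mp this).2]
    have hexpn : exp (-h) ≤ 1 - h + h ^ 2 := by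
      have := abs_exp_sub_one_sub_id_le (x := -h) (by rw [abs_neg, abs_of_pos hpos]; exact hle1)
      linarith [(abs_le.mp this).2]
    have hA := abs_le.mp (hS X hX)
    have hP := abs_le.mp (hS (X * exp h) (by positivity))
    have hN := abs_le.mp (hS (X * exp (-h)) (by positivity))
    set Y := X ^ (1 - e / 2) with hY
    have hYp : 0 < Y := rpow_pos_of_pos hX _
    have hPe : (X * exp h) ^ (1 - e) ≤ 3 * (h * Y) := by
      rw [mul_rpow hX.le (exp_pos _).le, hsplit, mul_comm]
      gcongr
      calc exp h ^ (1 - e) ≤ exp h ^ (1 : ℝ) :=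
            rpow_le_rpow_of_exponent_le (one_le_exp hpos.le) (by linarith)
        _ ≤ 3 := by rw [rpow_one]; nlinarith
    have hNe : (X * exp (-h)) ^ (1 - e) ≤ h * Y := by
      rw [← hsplit]
      refine rpow_le_rpow (by positivity) ?_ (by linarith)
      exact mul_le_of_le_one_right hX.le (exp_le_one_iff.mpr (by linarith))
    rw [hsplit] at hA
    have f1 := logSum_forward ha hX.le hpos.le k
    have f2 := logSum_backward ha hX.le hpos.le k
    set S := logSum a k X
    have u1 := mul_le_mul_of_nonneg_left hPe hB
    have u2 := mul_le_mul_of_nonneg_left hNe hB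
    have u3 := mul_le_mul_of_nonneg_left (mul_le_mul_of_nonneg_left hexp hX.le) hM
    have u4 := mul_le_mul_of_nonneg_left (mul_le_mul_of_nonneg_left hexpn hX.le) hM
    have v1 : (k + 1) * h * S ≤ h * (M * X + 5 * B * Y) := by
      have : h * (M * Y) ≤ h * (B * Y) := by gcongr
      nlinarith
    have v2 : h * (M * X - 5 * B * Y) ≤ (k + 1) * h * S := by
      have : h * (M * Y) ≤ h * (B * Y) := by gcongr
      nlinarith
    have w1 : (k + 1) * S ≤ M * X + 5 * B * Y := by
      rw [mul_comm ((k : ℝ) + 1) h, mul_assoc] at v1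
      exact le_of_mul_le_mul_left v1 hpos
    have w2 : M * X - 5 * B * Y ≤ (k + 1) * S := by
      rw [mul_comm ((k : ℝ) + 1) h, mul_assoc h] at v2
      exact le_of_mul_le_mul_left v2 hpos
    have hd : (k + 1) * (S - M / (k + 1) * X) = (k + 1) * S - M * X := by field_simp
    have hfin : (k + 1) * |S - M / (k + 1) * X| ≤ 5 * B * Y := by
      rw [← abs_of_pos hk, ← abs_mul, abs_of_pos hk, hd, abs_le]
      constructor <;> linarith
    have hBY : 0 ≤ B * Y := by positivity
    nlinarith [abs_nonneg (S - M / (k + 1) * X), Nat.cast_nonneg (α := ℝ) k,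
      mul_nonneg (Nat.cast_nonneg (α := ℝ) k) (abs_nonneg (S - M / (k + 1) * X))]

lemma tauberian {a : ℕ → ℝ} (ha : ∀ n, 0 ≤ a n) {r : ℕ} {M B e : ℝ} (hM : 0 ≤ M)
    (hMB : M ≤ B) (he : 0 ≤ e) (he1 : e ≤ 1)
    (hS : ∀ X, 0 < X → |logSum a r X - M * X| ≤ B * X ^ (1 - e)) :
    ∀ X, 0 < X → |logSum a 0 X - M / r.factorial * X| ≤ 7 ^ r * B * X ^ (1 - e / 2 ^ r) := by
  induction r generalizing M B e with
  | zero => simpa using hS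
  | succ r ih =>
    have h1 := tauberian_step ha hM hMB he he1 hS
    have h2 := ih (M := M / (r + 1)) (B := 7 * B) (e := e / 2) (by positivity)
      ((div_le_self hM (by linarith [Nat.cast_nonneg (α := ℝ) r])).trans (by linarith))
      (by linarith) (by linarith) h1
    intro X hX
    refine le_trans (le_of_eq ?_) ((h2 X hX).trans (le_of_eq ?_))
    · rw [Nat.factorial_succ]; push_cast; rw [div_div]
    · ring

end Tauberian

section ClassMean

open Finset Fintype

variable {E : Type*} [Field E] [NumberField E]

/-- Representatives in `𝓞 E` of `J / Q J`. -/
noncomputable def levelReps (Q : ℕ) [NeZero Q] (J : Ideal (𝓞 E)) [NeZero J] :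
    Finset (𝓞 E ⧸ (Ideal.span {(Q : 𝓞 E)} * J)) :=
  univ.filter fun c => Quotient.out c ∈ J

lemma sum_classWeight {R : Type*} [Semiring R] (Q : ℕ) [NeZero Q] (J : Ideal (𝓞 E)) [NeZero J]
    (g : ℕ → R) :
    ∑ c, classWeight Q J g c = ∑ c ∈ levelReps Q J, g (relNorm J (Quotient.out c)) := by
  rw [levelReps, sum_filter]; rfl

lemma card_levelReps (Q : ℕ) [NeZero Q] (J : Ideal (𝓞 E)) [NeZero J] :
    (levelReps Q J).card = Q ^ finrank ℚ E := by
  have h := classWeight_one_sum (R := ℕ) Q J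
  rw [sum_classWeight] at h
  simpa using h

lemma out_mk_mem_iff {Q : ℕ} {J : Ideal (𝓞 E)} (α : 𝓞 E) :
    Quotient.out (Ideal.Quotient.mk (Ideal.span {(Q : 𝓞 E)} * J) α) ∈ J ↔ α ∈ J := by
  have hJ' : α - Quotient.out (Ideal.Quotient.mk (Ideal.span {(Q : 𝓞 E)} * J) α) ∈ J :=
    Ideal.mul_le_right (out_sub_mem (Ideal.span {(Q : 𝓞 E)} * J) α)
  constructor
  · intro h1; simpa using J.add_mem hJ' h1
  · intro h1; simpa using J.sub_mem h1 hJ'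

lemma classMean_transfer {R : Type*} [Field R] {Q : ℕ} [NeZero Q] {J₁ J₂ : Ideal (𝓞 E)} [NeZero J₁]
    [NeZero J₂] {g : ℕ → R} (hg : IsEvenMod Q g) (x : 𝓞 E) (s : R)
    (hmap : ∀ α ∈ J₁, x * α ∈ J₂)
    (hinj : ∀ α ∈ J₁, x * α ∈ Ideal.span {(Q : 𝓞 E)} * J₂ → α ∈ Ideal.span {(Q : 𝓞 E)} * J₁)
    (hval : ∀ α ∈ J₁, g (relNorm J₂ (x * α)) = s * g (relNorm J₁ α)) :
    classMean Q J₂ g = s * classMean Q J₁ g := by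
  rw [classMean, classMean, sum_classWeight, sum_classWeight, ← mul_div_assoc, mul_sum]
  congr 1
  set ψ : (𝓞 E ⧸ (Ideal.span {(Q : 𝓞 E)} * J₁)) → (𝓞 E ⧸ (Ideal.span {(Q : 𝓞 E)} * J₂)) :=
    fun c => Ideal.Quotient.mk _ (x * Quotient.out c) with hψ
  have hmaps : Set.MapsTo ψ (levelReps Q J₁) (levelReps Q J₂) := by
    intro c hc
    rw [mem_coe, levelReps, mem_filter] at hc ⊢
    exact ⟨mem_univ _, (out_mk_mem_iff _).mpr (hmap _ hc.2)⟩
  have hinjOn : Set.InjOn ψ (levelReps Q J₁ : Set _) := by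
    intro c hc c' hc' h
    rw [mem_coe, levelReps, mem_filter] at hc hc'
    have h1 := Ideal.Quotient.eq.mp h
    rw [← mul_sub] at h1
    have h2 := Ideal.Quotient.eq.mpr (hinj _ (J₁.sub_mem hc.2 hc'.2) h1)
    have e1 : Ideal.Quotient.mk (Ideal.span {(Q : 𝓞 E)} * J₁) (Quotient.out c) = c :=
      Quotient.out_eq c
    have e2 : Ideal.Quotient.mk (Ideal.span {(Q : 𝓞 E)} * J₁) (Quotient.out c') = c' :=
      Quotient.out_eq c'
    rw [← e1, ← e2, h2]
  refine (sum_nbij ψ hmaps hinjOn (surjOn_of_injOn_of_card_le ψ hmaps hinjOn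
    (by rw [card_levelReps, card_levelReps])) fun c hc => ?_).symm
  rw [levelReps, mem_filter] at hc
  rw [← hval _ hc.2]
  have hJ₂ : J₂ ≠ ⊥ := NeZero.ne J₂
  have hx := hmap _ hc.2
  exact hg _ _ (relNorm_modEq hJ₂ hx ((out_mk_mem_iff _).mpr hx) (out_sub_mem _ _))

lemma classMean_span_mul {R : Type*} [Field R] {Q : ℕ} [NeZero Q] {J : Ideal (𝓞 E)} [NeZero J]
    {x : 𝓞 E} (hx : x ≠ 0) [NeZero (Ideal.span {x} * J)] {g : ℕ → R} (hg : IsEvenMod Q g) :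
    classMean Q (Ideal.span {x} * J) g = classMean Q J g := by
  have hxn : (0 : ℕ) < Ideal.absNorm (Ideal.span {x}) := by
    simpa using hx
  rw [classMean_transfer hg x 1 (J₁ := J), one_mul]
  · intro α hα
    exact Ideal.mul_mem_mul (Ideal.mem_span_singleton_self x) hα
  · intro α hα h
    rw [mul_left_comm, Ideal.mem_span_singleton_mul] at h
    simp_all
  · intro α hα
    rw [one_mul, relNorm, relNorm, ← Ideal.span_singleton_mul_span_singleton, map_mul, map_mul,
      Nat.mul_div_mul_left _ _ hxn]

lemma classMean_mul_ideal {R : Type*} [Field R] {Q : ℕ} [NeZero Q] {J : Ideal (𝓞 E)} [NeZero J]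
    {B : Ideal (𝓞 E)} [NeZero (J * B)] {g : ℕ → R} (hg : IsEvenMod Q g)
    (hB : (Ideal.absNorm B).Coprime Q) (hmul : ∀ n, g (Ideal.absNorm B * n) = g (Ideal.absNorm B) * g n) :
    classMean Q J g = g (Ideal.absNorm B) * classMean Q (J * B) g := by
  have hJ : J ≠ ⊥ := NeZero.ne J
  refine classMean_transfer hg 1 _ ?_ ?_ ?_
  · intro α hα
    rw [one_mul]
    exact (Ideal.mul_le_left : J * B ≤ J) hα
  · intro α hα h
    rw [one_mul] at h
    obtain ⟨u, hu, v, hv, huv⟩ : ∃ u ∈ B, ∃ v ∈ Ideal.span {(Q : 𝓞 E)}, u + v = 1 := by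
      obtain ⟨u, v, huv⟩ := Nat.isCoprime_iff_coprime.mpr hB
      refine ⟨u * (Ideal.absNorm B : 𝓞 E), Ideal.mul_mem_left _ _ (Ideal.absNorm_mem B),
        v * (Q : 𝓞 E), Ideal.mul_mem_left _ _ (Ideal.mem_span_singleton_self _), ?_⟩
      exact_mod_cast congrArg (Int.cast : ℤ → 𝓞 E) huv
    have h1 : α = u * α + v * α := by rw [← add_mul, huv, one_mul]
    rw [h1]
    refine Ideal.add_mem _ ?_ (Ideal.mul_mem_mul hv hα)
    have h2 := Ideal.mul_mem_mul hu h
    rwa [mul_left_comm B (Ideal.span {(Q : 𝓞 E)}) J, mul_comm B J] at h2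
  · intro α hα
    rw [one_mul, relNorm_mul_ideal hJ hα, hmul]

/-- An integral ideal representing an ideal class. -/
noncomputable def classRep (C : ClassGroup (𝓞 E)) : Ideal (𝓞 E) :=
  ((ClassGroup.mk0_surjective C).choose : Ideal (𝓞 E))

instance (C : ClassGroup (𝓞 E)) : NeZero (classRep C) :=
  ⟨nonZeroDivisors.ne_zero (ClassGroup.mk0_surjective C).choose.2⟩

lemma mk0_classRep (C : ClassGroup (𝓞 E)) (h : classRep C ∈ (Ideal (𝓞 E))⁰) :
    ClassGroup.mk0 ⟨classRep C, h⟩ = C :=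
  (ClassGroup.mk0_surjective C).choose_spec

lemma classMean_congr_class {R : Type*} [Field R] {Q : ℕ} [NeZero Q] {I J : Ideal (𝓞 E)} [NeZero I]
    [NeZero J] {g : ℕ → R} (hg : IsEvenMod Q g)
    (h : ClassGroup.mk0 ⟨I, mem_nonZeroDivisors_of_ne_zero (NeZero.ne I)⟩ =
      ClassGroup.mk0 ⟨J, mem_nonZeroDivisors_of_ne_zero (NeZero.ne J)⟩) :
    classMean Q I g = classMean Q J g := by
  obtain ⟨x, y, hx, hy, hxy⟩ := ClassGroup.mk0_eq_mk0_iff.mp h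
  have hx' : Ideal.span {x} ≠ (0 : Ideal (𝓞 E)) := by simpa using hx
  have hy' : Ideal.span {y} ≠ (0 : Ideal (𝓞 E)) := by simpa using hy
  have : NeZero (Ideal.span {x} * I) := ⟨mul_ne_zero hx' (NeZero.ne I)⟩
  have : NeZero (Ideal.span {y} * J) := ⟨mul_ne_zero hy' (NeZero.ne J)⟩
  have e1 := classMean_span_mul (J := I) hx hg
  have e2 := classMean_span_mul (J := J) hy hg
  rw [← e1, ← e2]
  congr 1

/-- The total mean over all ideal classes. -/
noncomputable def totalMean (E : Type*) [Field E] [NumberField E] (Q : ℕ) [NeZero Q] {R : Type*}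
    [Field R] (g : ℕ → R) : R := ∑ C : ClassGroup (𝓞 E), classMean Q (classRep C) g

lemma totalMean_eq_zero {R : Type*} [Field R] {Q : ℕ} [NeZero Q] {g : ℕ → R} (hg : IsEvenMod Q g)
    {B : Ideal (𝓞 E)} (hB0 : B ≠ ⊥) (hB : (Ideal.absNorm B).Coprime Q)
    (hmul : ∀ n, g (Ideal.absNorm B * n) = g (Ideal.absNorm B) * g n)
    (hne : g (Ideal.absNorm B) ≠ 1) : totalMean E Q g = 0 := by
  have h : totalMean E Q g = g (Ideal.absNorm B) * totalMean E Q g := by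
    rw [totalMean, mul_sum]
    set β : ClassGroup (𝓞 E) := ClassGroup.mk0 ⟨B, mem_nonZeroDivisors_of_ne_zero hB0⟩ with hβ
    rw [← Equiv.sum_comp (Equiv.mulRight β) fun C => g (Ideal.absNorm B) * classMean Q (classRep C) g]
    refine sum_congr rfl fun C _ => ?_
    have : NeZero (classRep C * B) := ⟨mul_ne_zero (NeZero.ne _) hB0⟩
    rw [classMean_mul_ideal hg hB hmul]
    congr 1
    refine classMean_congr_class hg ?_
    rw [mk0_classRep, Equiv.coe_mulRight, hβ]
    have h1 := mk0_classRep C (mem_nonZeroDivisors_of_ne_zero (NeZero.ne _))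
    have h2 := map_mul ClassGroup.mk0
      (⟨classRep C, mem_nonZeroDivisors_of_ne_zero (NeZero.ne _)⟩ : (Ideal (𝓞 E))⁰)
      ⟨B, mem_nonZeroDivisors_of_ne_zero hB0⟩
    rw [h1] at h2
    exact h2
  grind

lemma totalMean_one (Q : ℕ) [NeZero Q] :
    totalMean E Q (fun _ => (1 : ℝ)) = Fintype.card (ClassGroup (𝓞 E)) := by
  have hQ : (0 : ℝ) < Q := by exact_mod_cast Nat.pos_of_ne_zero (NeZero.ne Q)
  rw [totalMean, Finset.sum_congr rfl fun C _ => ?_, Finset.sum_const, nsmul_eq_mul, mul_one]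
  · rfl
  · rw [classMean, classWeight_one_sum, div_self (by positivity)]

lemma totalMean_nonneg {Q : ℕ} [NeZero Q] {g : ℕ → ℝ} (hg : ∀ n, 0 ≤ g n) : 0 ≤ totalMean E Q g :=
  sum_nonneg fun _ _ => classMean_nonneg hg

lemma totalMean_le {Q : ℕ} [NeZero Q] {g : ℕ → ℝ} (hg : ∀ n, g n ≤ 1) :
    totalMean E Q g ≤ card (ClassGroup (𝓞 E)) := by
  refine (sum_le_sum fun C _ => classMean_le_one hg).trans ?_
  simp

lemma totalMean_half_add {Q : ℕ} [NeZero Q] (g : ℕ → ℝ) :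
    totalMean E Q (fun n => (1 + g n) / 2) =
      (totalMean E Q (fun _ => (1 : ℝ)) + totalMean E Q g) / 2 := by
  rw [totalMean, totalMean, totalMean, ← sum_add_distrib, sum_div]
  refine sum_congr rfl fun C _ => ?_
  rw [classMean, classMean, classMean, sum_classWeight, sum_classWeight, sum_classWeight,
    ← add_div, ← sum_add_distrib, div_right_comm]
  simp only [sum_div]

lemma totalMean_map {R S : Type*} [Field R] [Field S] {Q : ℕ} [NeZero Q] (g : ℕ → R) (f : R →+ S)
    (hf : ∀ (x : R) (n : ℕ), f (x / n) = f x / n) :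
    totalMean E Q (fun n => f (g n)) = f (totalMean E Q g) := by
  rw [totalMean, totalMean, map_sum]
  refine sum_congr rfl fun C _ => ?_
  rw [classMean, classMean, sum_classWeight, sum_classWeight, ← Nat.cast_pow, ← Nat.cast_pow, hf,
    map_sum]

end ClassMean

section IdealCount

open Finset Ideal

variable (E : Type*) [Field E] [NumberField E]

/-- The number of integral ideals of norm `n`. -/
noncomputable def idealCount (n : ℕ) : ℕ := Nat.card {I : Ideal (𝓞 E) // absNorm I = n}

variable {E}

lemma le_of_selfBasis_eq {n : ℕ} {I J : Ideal (𝓞 E)} (hJ : absNorm J = n)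
    (hI0 : I ≠ ⊥) (hJ0 : J ≠ ⊥)
    (h : ∀ i, Ideal.Quotient.mk (Ideal.span {(n : 𝓞 E)})
        (selfBasis (RingOfIntegers.basis E) I hI0 i : 𝓞 E) =
      Ideal.Quotient.mk (Ideal.span {(n : 𝓞 E)})
        (selfBasis (RingOfIntegers.basis E) J hJ0 i : 𝓞 E)) : I ≤ J := by
  have hnJ : span {(n : 𝓞 E)} ≤ J := by
    rw [span_singleton_le_iff_mem, ← hJ]
    exact absNorm_mem J
  intro x hx
  set b := selfBasis (RingOfIntegers.basis E) I hI0 with hb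
  have h1 : x = ∑ i, (b.repr ⟨x, hx⟩ i) • (b i : 𝓞 E) := by
    have h2 := congrArg (Submodule.subtype I).toAddMonoidHom (b.sum_repr ⟨x, hx⟩)
    rw [map_sum] at h2
    exact h2.symm
  rw [h1]
  refine J.sum_mem fun i _ => ?_
  rw [zsmul_eq_mul]
  refine J.mul_mem_left _ ?_
  have h2 := hnJ (Ideal.Quotient.eq.mp (h i))
  simpa using J.add_mem h2 (selfBasis (RingOfIntegers.basis E) J hJ0 i).2

lemma idealCount_le {n : ℕ} (hn : n ≠ 0) : idealCount E n ≤ n ^ (finrank ℚ E ^ 2) := by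
  have hne : ∀ I : {I : Ideal (𝓞 E) // absNorm I = n}, (I : Ideal (𝓞 E)) ≠ ⊥ := by
    bound
  have hnz : (span {(n : 𝓞 E)}) ≠ ⊥ := by
    simp_all
  have : Finite (𝓞 E ⧸ span {(n : 𝓞 E)}) := finiteQuotientOfFreeOfNeBot _ hnz
  have hcard : Nat.card (𝓞 E ⧸ span {(n : 𝓞 E)}) = n ^ finrank ℚ E := by
    have h1 : absNorm (span {(n : 𝓞 E)}) = n ^ finrank ℚ E := by
      rw [absNorm_span_singleton, ← map_natCast (algebraMap ℤ (𝓞 E)), Algebra.norm_algebraMap,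
        Int.natAbs_pow, RingOfIntegers.rank]
      simp
    bound
  have hinj : Function.Injective (fun (I : {I : Ideal (𝓞 E) // absNorm I = n}) i =>
      Ideal.Quotient.mk (Ideal.span {(n : 𝓞 E)})
        (Ideal.selfBasis (RingOfIntegers.basis E) (I : Ideal (𝓞 E)) (hne I) i : 𝓞 E)) := by
    intro I J h
    have h' := fun i => congrFun h i
    exact Subtype.ext (le_antisymm (le_of_selfBasis_eq J.2 _ _ h')
      (le_of_selfBasis_eq I.2 _ _ fun i => (h' i).symm))
  refine (Nat.card_le_card_of_injective _ hinj).trans (le_of_eq ?_)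
  rw [Nat.card_fun, hcard, ← pow_mul, pow_two, Nat.card_eq_fintype_card, ← RingOfIntegers.rank E,
    Module.finrank_eq_card_chooseBasisIndex]

lemma idealCount_one : idealCount E 1 = 1 := by
  rw [idealCount]
  simp

lemma sum_classSum {g : ℕ → ℝ} (hg0 : ∀ n, 0 ≤ g n) {X : ℝ} (hX : 0 ≤ X) :
    ∑ C : ClassGroup (𝓞 E), classSum (classRep C) g X =
      ENNReal.ofReal (logSum (fun n => idealCount E n * g n) (Units.rank E) X) := by
  set F : Ideal (𝓞 E) → ℝ≥0∞ := fun I => ENNReal.ofReal (g (absNorm I) *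
      logPow (Units.rank E) (X / absNorm I)) with hF
  have h1 : ∀ C : ClassGroup (𝓞 E), classSum (classRep C) g X =
      ∑' I : Ideal (𝓞 E), if I ≠ ⊥ ∧ (I * classRep C).IsPrincipal then F I else 0 := by
    intro C
    refine (tsum_subtype {I : Ideal (𝓞 E) | I ≠ ⊥ ∧ (I * classRep C).IsPrincipal} F).trans ?_
    refine tsum_congr fun I => ?_
    rw [Set.indicator_apply]
    exact if_congr Iff.rfl rfl rfl
  simp_rw [h1]
  rw [← Summable.tsum_finsetSum fun _ _ => ENNReal.summable]
  have h2 : ∀ I : Ideal (𝓞 E), (∑ C : ClassGroup (𝓞 E),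
      if I ≠ ⊥ ∧ (I * classRep C).IsPrincipal then F I else 0) = if I ≠ ⊥ then F I else 0 := by
    intro I
    by_cases hI : I = ⊥
    · simp [hI]
    · have h3 : ∀ C : ClassGroup (𝓞 E), (I ≠ ⊥ ∧ (I * classRep C).IsPrincipal) ↔
          C = (ClassGroup.mk0 ⟨I, mem_nonZeroDivisors_of_ne_zero hI⟩)⁻¹ := by
        intro C
        have hC := mk0_classRep C (mem_nonZeroDivisors_of_ne_zero (NeZero.ne _))
        have h4 := map_mul ClassGroup.mk0
          (⟨I, mem_nonZeroDivisors_of_ne_zero hI⟩ : (Ideal (𝓞 E))⁰)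
          ⟨classRep C, mem_nonZeroDivisors_of_ne_zero (NeZero.ne _)⟩
        rw [hC] at h4
        rw [eq_inv_iff_mul_eq_one, mul_comm C, ← h4, and_iff_right hI]
        exact (ClassGroup.mk0_eq_one_iff _).symm
      simp_all
  simp_rw [h2]
  set s : Finset (Ideal (𝓞 E)) :=
    (finite_setOfPred_absNorm_le (S := 𝓞 E) ⌊X⌋₊).toFinset.filter (· ≠ ⊥) with hs
  have hms : ∀ I, I ∈ s ↔ absNorm I ∈ Icc 1 ⌊X⌋₊ := by
    intro I
    rw [hs, mem_filter, Set.Finite.mem_toFinset, mem_Icc, Nat.one_le_iff_ne_zero, Ne,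
      Ne, absNorm_eq_zero_iff, and_comm]
    rfl
  rw [tsum_eq_sum (s := s)]
  · have h5 : ∑ I ∈ s, (if I ≠ ⊥ then F I else 0) = ∑ I ∈ s, F I := by
      refine sum_congr rfl fun I hI => if_pos ?_
      grind
    rw [h5, hF, ← ENNReal.ofReal_sum_of_nonneg fun I _ => mul_nonneg (hg0 _) (logPow_nonneg _ _)]
    congr 1
    rw [logSum, ← sum_fiberwise_of_maps_to (g := absNorm) fun I hI => (hms I).mp hI]
    refine sum_congr rfl fun n hn => ?_
    have h6 : ∀ I ∈ s.filter (fun I => absNorm I = n), g (absNorm I) *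
        logPow (Units.rank E) (X / absNorm I) = g n * logPow (Units.rank E) (X / n) := by
      grind
    rw [sum_congr rfl h6, sum_const, nsmul_eq_mul, mul_assoc]
    rw [idealCount]
    have h7 : ∀ I, I ∈ s.filter (fun I => absNorm I = n) ↔ absNorm I = n := by
      grind
    rw [Nat.subtype_card _ h7]
  · intro I hI
    split_ifs with h
    · rw [hms, mem_Icc, not_and_or] at hI
      have hpos : 0 < absNorm I := Nat.pos_of_ne_zero (absNorm_eq_zero_iff.not.mpr h)
      have hlt : ⌊X⌋₊ < absNorm I := by omega
      have h2 := (Nat.floor_lt hX).mp hlt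
      rw [hF]
      simp only
      rw [logPow_of_le_one, mul_zero, ENNReal.ofReal_zero]
      bound
    · rfl

end IdealCount

section UniformCount

open NumberField.mixedEmbedding

open Finset Real Fintype

variable {E : Type*} [Field E] [NumberField E] {ι : Type*} [Fintype ι]

/-- The quantity controlling the implied constants in the count of ideals. -/
noncomputable def levelBound (d Q : ℕ) (T : ℝ) : ℝ := 4 * (1 + 6 * d ^ 2 * T ^ 2 * Q) ^ d

lemma four_le_levelBound (d Q : ℕ) (T : ℝ) : 4 ≤ levelBound d Q T := by
  rw [levelBound]
  bound

lemma one_add_mul_pow_sub_one_le {b u : ℝ} (hb : 0 ≤ b) (hu : 0 ≤ u) (hu1 : u ≤ 1) (d : ℕ) :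
    (1 + b * u) ^ d - 1 ≤ u * ((1 + b) ^ d - 1) := by
  induction d with
  | zero => simp
  | succ d ih =>
    have h1 : (1 + b * u) ^ d ≤ (1 + b) ^ d := by
      gcongr; nlinarith
    rw [pow_succ, pow_succ]
    have : b * u * (1 + b * u) ^ d ≤ b * u * (1 + b) ^ d := by gcongr
    nlinarith

lemma rank_le_finrank : Units.rank E ≤ finrank ℚ E := by
  have h1 := InfinitePlace.card_add_two_mul_card_eq_rank E
  have h2 := InfinitePlace.card_eq_nrRealPlaces_add_nrComplexPlaces E
  rw [Units.rank]
  omega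

lemma logSum_idealCount_le {X : ℝ} (hX : 1 ≤ X) :
    logSum (fun n => idealCount E n * 1) (Units.rank E) X ≤
      X * X ^ (finrank ℚ E ^ 2 + finrank ℚ E) := by
  set d := finrank ℚ E with hd
  rw [logSum]
  have hX0 : 0 ≤ X := by linarith
  calc _ ≤ ∑ n ∈ Icc 1 ⌊X⌋₊, X ^ (d ^ 2 + d) := by
        refine sum_le_sum fun n hn => ?_
        have hn1 := (mem_Icc.mp hn).1
        have hnX : (n : ℝ) ≤ X := (Nat.le_floor_iff hX0).mp (mem_Icc.mp hn).2
        have hn1' : (1 : ℝ) ≤ n := by exact_mod_cast hn1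
        rw [mul_one, pow_add]
        have h1 : (idealCount E n : ℝ) ≤ X ^ d ^ 2 := by
          calc (idealCount E n : ℝ) ≤ ((n ^ d ^ 2 : ℕ) : ℝ) := by
                exact_mod_cast idealCount_le (by omega)
            _ ≤ X ^ d ^ 2 := by push_cast; gcongr
        have h2 : logPow (Units.rank E) (X / n) ≤ X ^ d := by
          rw [logPow]
          split_ifs with h
          · have h3 : log (X / n) ≤ X :=
              (log_le_self (by positivity)).trans (div_le_self hX0 hn1')
            calc log (X / n) ^ Units.rank E ≤ X ^ Units.rank E := by
                  gcongr; exact log_nonneg h.le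
              _ ≤ X ^ d := pow_le_pow_right₀ hX rank_le_finrank
          · positivity
        exact mul_le_mul h1 h2 (logPow_nonneg _ _) (by positivity)
    _ = ⌊X⌋₊ * X ^ (d ^ 2 + d) := by simp
    _ ≤ _ := by
        gcongr
        exact Nat.floor_le hX0

lemma one_le_boxDensity_mul (θ : Basis ι ℚ E) (hθ : ∀ i, IsIntegral ℤ (θ i)) {T : ℝ} (hT1 : 1 ≤ T)
    (hT : ∀ i, ∀ w : InfinitePlace E, w (θ i) ≤ T) (Q : ℕ) [NeZero Q] :
    1 ≤ boxDensity E * (1 + 6 * (finrank ℚ E : ℝ) ^ 2 * T ^ 2 * Q) ^ finrank ℚ E := by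
  have h2 := covolume_integerLattice_le θ hθ hT
  have hdpos : 0 < finrank ℚ E := Module.finrank_pos
  generalize finrank ℚ E = d at *
  have hQ1 : (1 : ℝ) ≤ Q := by exact_mod_cast Nat.one_le_iff_ne_zero.mpr (NeZero.ne Q)
  have hd1 : (1 : ℝ) ≤ d := by exact_mod_cast hdpos
  have h3 : (2 * d * T) ^ d ≤ (1 + 6 * (d : ℝ) ^ 2 * T ^ 2 * Q) ^ d := by
    refine pow_le_pow_left₀ (by positivity) ?_ d
    have h4 : (1 : ℝ) * 1 ≤ d * T := mul_le_mul hd1 hT1 zero_le_one (by linarith)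
    have h6 : ((d : ℝ) * T) ^ 2 * 1 ≤ (d * T) ^ 2 * Q :=
      mul_le_mul_of_nonneg_left hQ1 (by positivity)
    nlinarith
  have hc : 0 < ZLattice.covolume (mixedEmbedding.integerLattice E) :=
    ZLattice.covolume_pos (mixedEmbedding.integerLattice E) (volume)
  rw [boxDensity, div_mul_eq_mul_div, le_div_iff₀ hc, one_mul]
  nlinarith

lemma weighted_ideal_count_raw (θ : Basis ι ℚ E) (hθ : ∀ i, IsIntegral ℤ (θ i)) {T : ℝ} (hT1 : 1 ≤ T)
    (hT : ∀ i, ∀ w : InfinitePlace E, w (θ i) ≤ T) (Q : ℕ) [NeZero Q] :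
    ∃ 𝒦 : ℝ, 0 < 𝒦 ∧ ∀ g : ℕ → ℝ, IsEvenMod Q g → (∀ n, 0 ≤ g n) → (∀ n, g n ≤ 1) →
      ∀ X : ℝ, 0 < X →
      |logSum (fun n => idealCount E n * g n) (Units.rank E) X -
          𝒦 * (totalMean E Q g / totalMean E Q (fun _ => (1 : ℝ))) * X| ≤
        𝒦 * (levelBound (finrank ℚ E) Q T / 2) * X ^ (1 - 1 / (finrank ℚ E : ℝ)) := by
  set d := finrank ℚ E with hd
  have hdpos : 0 < d := Module.finrank_pos
  set r := Units.rank E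
  set h : ℝ := ((card (ClassGroup (𝓞 E)) : ℕ) : ℝ) with hh
  have hhpos : 0 < h := by rw [hh]; exact_mod_cast Fintype.card_pos
  set W : ℝ := torsionOrder E * (simplexVolume E).toReal with hW
  have hWpos : 0 < W := mul_pos (by exact_mod_cast torsionOrder_pos E)
    (ENNReal.toReal_pos volume_openSimplex_one_pos.ne' volume_openSimplex_lt_top.ne)
  set R := (volume (unitDomain E)).toReal with hR
  have hRpos : 0 < R := ENNReal.toReal_pos unitDomain_volume_ne_zero unitDomain_volume_ne_top
  have hκ := boxDensity_pos (E := E)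
  set κ := boxDensity E with hκdef
  refine ⟨h * R * κ / W, by positivity, fun g hg hg0 hg1 X hX => ?_⟩
  rw [totalMean_one, ← hh]
  set A := logSum (fun n => idealCount E n * g n) r X with hA
  have hA0 : 0 ≤ A := sum_nonneg fun n _ =>
    mul_nonneg (mul_nonneg (Nat.cast_nonneg _) (hg0 n)) (logPow_nonneg _ _)
  set D := ((1 + 6 * d ^ 2 * T ^ 2 * Q * X ^ (-(1 / d : ℝ))) ^ d - 1) with hD
  have hest := fun C : ClassGroup (𝓞 E) => classSum_estimate θ hθ hT (classRep C) Q hg hg0 hg1 hX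
  have hsum : ∑ C : ClassGroup (𝓞 E), (classSum (classRep C) g X).toReal = A := by
    rw [← ENNReal.toReal_sum fun C _ => (hest C).1, sum_classSum hg0 hX.le, ENNReal.toReal_ofReal hA0]
  have h1 : |W * A - R * κ * X * totalMean E Q g| ≤ h * (R * (κ * X * D + 1)) := by
    have : W * A - R * κ * X * totalMean E Q g = ∑ C : ClassGroup (𝓞 E),
        (W * (classSum (classRep C) g X).toReal - R * (κ * X * classMean Q (classRep C) g)) := by
      rw [sum_sub_distrib, ← mul_sum, hsum, totalMean, mul_sum]
      grind
    rw [this]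
    calc _ ≤ ∑ C : ClassGroup (𝓞 E), R * (κ * X * D + 1) :=
          (abs_sum_le_sum_abs _ _).trans (sum_le_sum fun C _ => (hest C).2)
      _ = _ := by rw [sum_const, nsmul_eq_mul]; rfl
  have hY := four_le_levelBound d Q T
  rcases lt_or_ge X 1 with hX1 | hX1
  · have hAz : A = 0 := by rw [hA, logSum, Nat.floor_eq_zero.mpr hX1]; rfl
    have htm0 := totalMean_nonneg (E := E) (Q := Q) hg0
    have htm1 := totalMean_le (E := E) (Q := Q) hg1
    rw [hAz, zero_sub, abs_neg, abs_of_nonneg (by positivity)]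
    have h2 : X ≤ X ^ (1 - 1 / (d : ℝ)) := by
      conv_lhs => rw [← rpow_one X]
      exact rpow_le_rpow_of_exponent_ge hX hX1.le (by
        simp)
    have h3 : totalMean E Q g / h ≤ 1 := (div_le_one hhpos).mpr htm1
    have h4 : 1 ≤ levelBound d Q T / 2 := by linarith
    exact mul_le_mul (mul_le_mul_of_nonneg_left (h3.trans h4) (by positivity)) h2 hX.le
      (by positivity)
  · set b : ℝ := 6 * d ^ 2 * T ^ 2 * Q with hb
    have hQ1 : (1 : ℝ) ≤ Q := by exact_mod_cast Nat.one_le_iff_ne_zero.mpr (NeZero.ne Q)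
    have hd1 : (1 : ℝ) ≤ d := by exact_mod_cast hdpos
    have hb0 : 0 ≤ b := by positivity
    set u := X ^ (-(1 / d : ℝ)) with hu
    have hu0 : 0 < u := rpow_pos_of_pos hX _
    have hu1 : u ≤ 1 := rpow_le_one_of_one_le_of_nonpos hX1 (by
      simp)
    have hYb : levelBound d Q T = 4 * (1 + b) ^ d := rfl
    have hXu : X * u = X ^ (1 - 1 / (d : ℝ)) := by
      nth_rewrite 1 [← rpow_one X]; rw [← rpow_add hX]; ring_nf
    have hDle : D ≤ u * (1 + b) ^ d := by
      have := one_add_mul_pow_sub_one_le hb0 hu0.le hu1 d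
      nlinarith
    have hκinv : 1 ≤ κ * (1 + b) ^ d := one_le_boxDensity_mul θ hθ hT1 hT Q
    have hXu1 : 1 ≤ X * u := by
      rw [hXu]
      refine one_le_rpow hX1 ?_
      bound
    have h5 : κ * X * D + 1 ≤ κ * (levelBound d Q T / 2) * (X * u) := by
      have h6 : κ * X * D ≤ κ * X * (u * (1 + b) ^ d) := by gcongr
      rw [hYb]
      nlinarith
    rw [← hXu]
    have h8 : A - h * R * κ / W * (totalMean E Q g / h) * X =
        (W * A - R * κ * X * totalMean E Q g) / W := by field_simp
    rw [h8, abs_div, abs_of_pos hWpos, div_le_iff₀ hWpos]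
    refine h1.trans ?_
    calc h * (R * (κ * X * D + 1)) ≤ h * (R * (κ * (levelBound d Q T / 2) * (X * u))) := by gcongr
      _ = _ := by field_simp

/-- Count of ideals with weights depending on the norm modulo `Q`, uniform in the field. -/
theorem weighted_ideal_count (θ : Basis ι ℚ E) (hθ : ∀ i, IsIntegral ℤ (θ i)) {T : ℝ} (hT1 : 1 ≤ T)
    (hT : ∀ i, ∀ w : InfinitePlace E, w (θ i) ≤ T) (Q : ℕ) [NeZero Q] :
    ∃ κ : ℝ, 0 < κ ∧
      κ ≤ levelBound (finrank ℚ E) Q T ^ (finrank ℚ E ^ 3 + finrank ℚ E ^ 2 + 2 * finrank ℚ E + 2) ∧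
      ∀ g : ℕ → ℝ, IsEvenMod Q g → (∀ n, 0 ≤ g n) → (∀ n, g n ≤ 1) → ∀ X : ℝ, 1 ≤ X →
      |logSum (fun n => idealCount E n * g n) 0 X -
          κ * (totalMean E Q g / totalMean E Q (fun _ => (1 : ℝ))) * X| ≤
        levelBound (finrank ℚ E) Q T ^ (finrank ℚ E ^ 3 + finrank ℚ E ^ 2 + 2 * finrank ℚ E + 2) *
          X ^ (1 - 1 / (finrank ℚ E : ℝ) / 2 ^ finrank ℚ E) := by
  obtain ⟨𝒦, h𝒦, hest⟩ := weighted_ideal_count_raw θ hθ hT1 hT Q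
  set d := finrank ℚ E with hd
  have hdpos : 0 < d := Module.finrank_pos
  have hd1 : (1 : ℝ) ≤ d := by exact_mod_cast hdpos
  set r := Units.rank E
  have hrd : r ≤ d := rank_le_finrank
  set Y := levelBound d Q T with hYdef
  have hY : 4 ≤ Y := four_le_levelBound d Q T
  have hY1 : 1 ≤ Y := by linarith
  have hY0 : 0 < Y := by linarith
  have hh : (0 : ℝ) < totalMean E Q (fun _ => (1 : ℝ)) := by
    rw [totalMean_one]; exact_mod_cast Fintype.card_pos
  have h𝒦le : 𝒦 ≤ 2 * Y ^ (d ^ 3 + d ^ 2) := by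
    have hX1 : 1 ≤ Y ^ d := one_le_pow₀ hY1
    have h1 := hest (fun _ => 1) (fun _ _ _ => rfl) (fun _ => zero_le_one) (fun _ => le_rfl) (Y ^ d)
      (by positivity)
    have h2 := logSum_idealCount_le (E := E) hX1
    have h3 : (Y ^ d) ^ (1 - 1 / (d : ℝ)) * Y = Y ^ d := by
      have : (Y ^ d) ^ (1 - 1 / (d : ℝ)) = Y ^ ((d : ℝ) - 1) := by
        rw [← rpow_natCast, ← rpow_mul hY0.le]
        field_simp
      rw [this]
      nth_rewrite 2 [← rpow_one Y]
      rw [← rpow_add hY0, ← rpow_natCast]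
      ring
    rw [div_self hh.ne', mul_one] at h1
    have h4 := (abs_le.mp h1).1
    have h5 : 𝒦 * Y ^ d / 2 ≤ Y ^ d * (Y ^ d) ^ (d ^ 2 + d) := by
      nlinarith
    rw [← pow_mul, show d * (d ^ 2 + d) = d ^ 3 + d ^ 2 by ring] at h5
    nlinarith
  have hfac : (1 : ℝ) ≤ r.factorial := by exact_mod_cast r.factorial_pos
  have hbig : 7 ^ r * (𝒦 * (Y / 2)) ≤ Y ^ (d ^ 3 + d ^ 2 + 2 * d + 2) := by
    have h7 : (7 : ℝ) ^ r ≤ Y ^ (2 * d) := by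
      calc (7 : ℝ) ^ r ≤ (Y ^ 2) ^ r := by gcongr; nlinarith
        _ = Y ^ (2 * r) := by rw [pow_mul]
        _ ≤ _ := pow_le_pow_right₀ hY1 (by omega)
    calc 7 ^ r * (𝒦 * (Y / 2)) ≤ Y ^ (2 * d) * ((2 * Y ^ (d ^ 3 + d ^ 2)) * (Y / 2)) := by gcongr
      _ = Y ^ (d ^ 3 + d ^ 2 + 2 * d + 1) := by ring
      _ ≤ _ := pow_le_pow_right₀ hY1 (by omega)
  refine ⟨𝒦 / r.factorial, by positivity, ?_, fun g hg hg0 hg1 X hX => ?_⟩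
  · refine le_trans ?_ hbig
    have h7 : (1 : ℝ) ≤ 7 ^ r := one_le_pow₀ (by norm_num)
    calc 𝒦 / r.factorial ≤ 𝒦 := div_le_self h𝒦.le hfac
      _ ≤ 𝒦 * (Y / 2) := le_mul_of_one_le_right h𝒦.le (by linarith)
      _ ≤ _ := le_mul_of_one_le_left (by positivity) h7
  · have htm0 := totalMean_nonneg (E := E) (Q := Q) hg0
    have htm1 : totalMean E Q g ≤ totalMean E Q (fun _ => (1 : ℝ)) := by
      rw [totalMean_one]; exact totalMean_le hg1
    have hmean : totalMean E Q g / totalMean E Q (fun _ => (1 : ℝ)) ≤ 1 := (div_le_one hh).mpr htm1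
    have hMB : 𝒦 * (totalMean E Q g / totalMean E Q (fun _ => (1 : ℝ))) ≤ 𝒦 * (Y / 2) :=
      mul_le_mul_of_nonneg_left (hmean.trans (by linarith)) h𝒦.le
    have he1 : 1 / (d : ℝ) ≤ 1 := (div_le_one (by positivity)).mpr hd1
    have := tauberian (a := fun n => idealCount E n * g n)
      (fun n => mul_nonneg (Nat.cast_nonneg _) (hg0 n))
      (M := 𝒦 * (totalMean E Q g / totalMean E Q (fun _ => (1 : ℝ)))) (B := 𝒦 * (Y / 2))
      (e := 1 / (d : ℝ)) (by positivity) hMB (by positivity) he1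
      (hest g hg hg0 hg1) X (by linarith)
    rw [mul_div_right_comm] at this
    refine this.trans ?_
    have h2r : (2 : ℝ) ^ r ≤ 2 ^ d := pow_le_pow_right₀ (by norm_num) hrd
    gcongr

end UniformCount

section TwistCount

open Finset Real Ideal Complex

variable {E : Type*} [Field E] [NumberField E] {ι : Type*} [Fintype ι]

/-- The constant in the counting theorems for ideals. -/
noncomputable def countBound (d Q : ℕ) (T : ℝ) : ℝ :=
  12 * levelBound d Q T ^ (d ^ 3 + d ^ 2 + 2 * d + 2)

/-- The power saving in the counting theorems for ideals. -/
noncomputable def saving (d : ℕ) : ℝ := 1 / (d : ℝ) / 2 ^ d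

lemma saving_pos {d : ℕ} (hd : 0 < d) : 0 < saving d := by rw [saving]; positivity

lemma saving_lt_one {d : ℕ} (hd : 0 < d) : saving d < 1 := by
  have h1 : (1 : ℝ) ≤ d := by exact_mod_cast hd
  have h2 : (1 : ℝ) < 2 ^ d := one_lt_pow₀ (by norm_num) hd.ne'
  rw [saving, div_div, div_lt_one (by positivity)]
  nlinarith

lemma countBound_pos (d Q : ℕ) (T : ℝ) : 0 < countBound d Q T := by
  have := four_le_levelBound d Q T
  rw [countBound]; positivity

lemma logSum_zero_succ (a : ℕ → ℝ) (N : ℕ) : logSum a 0 (N + 1 : ℝ) = ∑ n ∈ Icc 1 N, a n := by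
  rw [logSum, show ((N : ℝ) + 1) = ((N + 1 : ℕ) : ℝ) by push_cast; rfl, Nat.floor_natCast,
    sum_Icc_succ_top (by omega)]
  rw [div_self (by positivity), logPow_of_le_one le_rfl, mul_zero, add_zero]
  refine sum_congr rfl fun n hn => ?_
  have h := mem_Icc.mp hn
  have hn0 : (0 : ℝ) < n := by exact_mod_cast h.1
  rw [logPow_of_one_lt, pow_zero, mul_one]
  rw [one_lt_div hn0]
  exact_mod_cast Nat.lt_succ_of_le h.2

lemma isEvenMod_dirichletCharacter {Q : ℕ} {χ : DirichletCharacter ℂ Q} (hχ : χ.Even) :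
    IsEvenMod Q (fun n => χ (n : ZMod Q)) := by
  rintro a b (h | h)
  · simp only [h]
  · simp only [h]; exact DirichletCharacter.Even.eval_neg χ _ hχ

lemma rpow_succ_le_two_mul {N : ℕ} (hN : 1 ≤ N) {c : ℝ} (hc0 : 0 ≤ c) (hc1 : c ≤ 1) :
    ((N : ℝ) + 1) ^ c ≤ 2 * (N : ℝ) ^ c := by
  have hN' : (1 : ℝ) ≤ N := by exact_mod_cast hN
  calc ((N : ℝ) + 1) ^ c ≤ (2 * N) ^ c := by gcongr; linarith
    _ = 2 ^ c * (N : ℝ) ^ c := mul_rpow (by norm_num) (by linarith)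
    _ ≤ 2 ^ (1 : ℝ) * (N : ℝ) ^ c := by
        gcongr
        norm_num
    _ = _ := by rw [rpow_one]

/-- Ideal counts in number fields, and their twists by Dirichlet characters, uniformly. -/
theorem ideal_count (θ : Basis ι ℚ E) (hθ : ∀ i, IsIntegral ℤ (θ i)) {T : ℝ} (hT1 : 1 ≤ T)
    (hT : ∀ i, ∀ w : InfinitePlace E, w (θ i) ≤ T) (Q : ℕ) [NeZero Q] :
    ∃ κ : ℝ, 0 < κ ∧ κ ≤ countBound (finrank ℚ E) Q T ∧
      (∀ N : ℕ, 1 ≤ N → |∑ n ∈ Icc 1 N, (idealCount E n : ℝ) - κ * N| ≤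
        countBound (finrank ℚ E) Q T * (N : ℝ) ^ (1 - saving (finrank ℚ E))) ∧
      ∀ χ : DirichletCharacter ℂ Q, χ.Even → (∃ B : Ideal (𝓞 E), B ≠ ⊥ ∧
        (absNorm B).Coprime Q ∧ χ (absNorm B : ZMod Q) ≠ 1) → ∀ N : ℕ, 1 ≤ N →
        ‖∑ n ∈ Icc 1 N, χ (n : ZMod Q) * (idealCount E n : ℂ)‖ ≤
          countBound (finrank ℚ E) Q T * (N : ℝ) ^ (1 - saving (finrank ℚ E)) := by
  obtain ⟨κ, hκ, hκle, hest⟩ := weighted_ideal_count θ hθ hT1 hT Q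
  have hdpos : 0 < finrank ℚ E := Module.finrank_pos
  rw [countBound]
  have hs0 := saving_pos hdpos
  have hs1 := saving_lt_one hdpos
  rw [← saving] at hest
  generalize finrank ℚ E = d at *
  have hY := four_le_levelBound d Q T
  set Z := levelBound d Q T ^ (d ^ 3 + d ^ 2 + 2 * d + 2) with hZ
  have hZ0 : 0 < Z := by positivity
  have hh : (0 : ℝ) < totalMean E Q (fun _ => (1 : ℝ)) := by
    rw [totalMean_one]; exact_mod_cast Fintype.card_pos
  have hsucc : ∀ N : ℕ, 1 ≤ N → ((N : ℝ) + 1) ^ (1 - saving d) ≤ 2 * (N : ℝ) ^ (1 - saving d) :=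
    fun N hN => rpow_succ_le_two_mul hN (by linarith) (by linarith)
  have hreal : ∀ f : ℕ → ℝ, IsEvenMod Q f → (∀ n, |f n| ≤ 1) → totalMean E Q f = 0 →
      ∀ N : ℕ, 1 ≤ N → |∑ n ∈ Icc 1 N, (idealCount E n : ℝ) * f n| ≤
        6 * Z * (N : ℝ) ^ (1 - saving d) := by
    intro f hf hf1 hf0 N hN
    have h1 := hest (fun n => (1 + f n) / 2) (fun a b hab => by simp only [hf a b hab])
      (fun n => by have := (abs_le.mp (hf1 n)).1; linarith)
      (fun n => by have := (abs_le.mp (hf1 n)).2; linarith) (N + 1) (by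
        linarith)
    have h2 := hest (fun _ => 1) (fun _ _ _ => rfl) (fun _ => zero_le_one) (fun _ => le_rfl)
      (N + 1) (by
        linarith)
    rw [totalMean_half_add, hf0, add_zero, div_right_comm, div_self hh.ne', logSum_zero_succ] at h1
    rw [div_self hh.ne', logSum_zero_succ] at h2
    have h3 : ∑ n ∈ Icc 1 N, (idealCount E n : ℝ) * f n =
        2 * (∑ n ∈ Icc 1 N, (idealCount E n : ℝ) * ((1 + f n) / 2) -
          κ * (1 / 2) * (N + 1)) - (∑ n ∈ Icc 1 N, (idealCount E n : ℝ) * 1 - κ * 1 * (N + 1)) := by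
      rw [mul_sub, mul_sum, sub_sub_eq_add_sub, ← sub_add_eq_add_sub,
        sub_add_eq_add_sub, ← sub_eq_zero]
      have : ∑ n ∈ Icc 1 N, (idealCount E n : ℝ) * f n =
        ∑ n ∈ Icc 1 N, 2 * ((idealCount E n : ℝ) * ((1 + f n) / 2)) -
          ∑ n ∈ Icc 1 N, (idealCount E n : ℝ) * 1 := by
        rw [← sum_sub_distrib]
        grind
      rw [this]; ring
    rw [h3]
    have h4 := hsucc N hN
    have h5 := abs_sub (2 * (∑ n ∈ Icc 1 N, (idealCount E n : ℝ) * ((1 + f n) / 2) -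
          κ * (1 / 2) * (N + 1))) (∑ n ∈ Icc 1 N, (idealCount E n : ℝ) * 1 - κ * 1 * (N + 1))
    rw [abs_mul, abs_two] at h5
    nlinarith [mul_le_mul_of_nonneg_left h4 hZ0.le]
  refine ⟨κ, hκ, by linarith, fun N hN => ?_, fun χ hχ ⟨B, hB0, hB, hne⟩ N hN => ?_⟩
  · have h2 := hest (fun _ => 1) (fun _ _ _ => rfl) (fun _ => zero_le_one) (fun _ => le_rfl)
      (N + 1) (by
        linarith)
    rw [div_self hh.ne', logSum_zero_succ] at h2
    simp only [mul_one] at h2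
    have h4 := hsucc N hN
    have h6 : (1 : ℝ) ≤ (N : ℝ) ^ (1 - saving d) :=
      one_le_rpow (by exact_mod_cast hN) (by linarith)
    have h7 : κ * 1 ≤ Z * (N : ℝ) ^ (1 - saving d) := mul_le_mul hκle h6 zero_le_one hZ0.le
    have h8 := abs_le.mp h2
    have h9 := mul_le_mul_of_nonneg_left h4 hZ0.le
    grind
  · have hev := isEvenMod_dirichletCharacter hχ
    have htm : totalMean E Q (fun n : ℕ => χ (n : ZMod Q)) = 0 :=
      totalMean_eq_zero hev hB0 hB (fun n => by push_cast; rw [map_mul]) hne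
    have hre := hreal (fun n => (χ (n : ZMod Q)).re) (fun a b hab => by simp only [hev a b hab])
      (fun n => (abs_re_le_norm _).trans (χ.norm_le_one _))
      ((totalMean_map (fun n : ℕ => χ (n : ZMod Q)) reAddGroupHom
          (fun x n => by simp [div_natCast_re])).trans (by rw [htm, map_zero])) N hN
    have him := hreal (fun n => (χ (n : ZMod Q)).im) (fun a b hab => by simp only [hev a b hab])
      (fun n => (abs_im_le_norm _).trans (χ.norm_le_one _))
      ((totalMean_map (fun n : ℕ => χ (n : ZMod Q)) imAddGroupHom
          (fun x n => by simp [div_natCast_im])).trans (by rw [htm, map_zero])) N hN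
    refine (norm_le_abs_re_add_abs_im _).trans ?_
    have h1 : (∑ n ∈ Icc 1 N, χ (n : ZMod Q) * (idealCount E n : ℂ)).re =
        ∑ n ∈ Icc 1 N, (idealCount E n : ℝ) * (χ (n : ZMod Q)).re := by
      rw [re_sum]
      exact sum_congr rfl fun n _ => by simp [mul_comm]
    have h2 : (∑ n ∈ Icc 1 N, χ (n : ZMod Q) * (idealCount E n : ℂ)).im =
        ∑ n ∈ Icc 1 N, (idealCount E n : ℝ) * (χ (n : ZMod Q)).im := by
      rw [im_sum]
      exact sum_congr rfl fun n _ => by simp [mul_comm]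
    rw [h1, h2]
    linarith

end TwistCount

end

section PartialSummation

open Finset Real Complex

lemma rpow_succ_sub_rpow_le (n : ℕ) {c : ℝ} (hc0 : 0 ≤ c) :
    ((n + 1 : ℕ) : ℝ) ^ (1 - c) - (n : ℝ) ^ (1 - c) ≤ ((n + 1 : ℕ) : ℝ) ^ (-c) := by
  have h1 : (0 : ℝ) < ((n + 1 : ℕ) : ℝ) := by positivity
  have h2 : (n : ℝ) * ((n + 1 : ℕ) : ℝ) ^ (-c) ≤ (n : ℝ) ^ (1 - c) := by
    rcases Nat.eq_zero_or_pos n with rfl | hn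
    · simp; positivity
    · have hn' : (0 : ℝ) < n := by exact_mod_cast hn
      rw [sub_eq_add_neg, rpow_add hn', rpow_one]
      exact mul_le_mul_of_nonneg_left
        (rpow_le_rpow_of_nonpos hn' (by push_cast; linarith) (by linarith)) hn'.le
  have h3 : ((n + 1 : ℕ) : ℝ) ^ (1 - c) = ((n + 1 : ℕ) : ℝ) * ((n + 1 : ℕ) : ℝ) ^ (-c) := by
    rw [sub_eq_add_neg, rpow_add h1, rpow_one]
  push_cast at *
  linarith

/-- Partial summation against an antitone weight. -/
lemma norm_sum_mul_antitone_le {f : ℕ → ℂ} {g : ℕ → ℝ} {B c : ℝ} (hc0 : 0 ≤ c) (hc1 : c ≤ 1) (hB : 0 ≤ B)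
    (hF : ∀ N : ℕ, 1 ≤ N → ‖∑ n ∈ Icc 1 N, f n‖ ≤ B * (N : ℝ) ^ (1 - c)) (M N : ℕ)
    (hg0 : ∀ n, M + 1 ≤ n → 0 ≤ g n) (hg : ∀ n, M + 1 ≤ n → g (n + 1) ≤ g n) :
    ‖∑ n ∈ Ioc M N, f n * g n‖ ≤ B * (2 * ((M + 1 : ℕ) : ℝ) ^ (1 - c) * g (M + 1) +
      ∑ n ∈ Ioc (M + 1) N, (n : ℝ) ^ (-c) * g n) := by
  have hM0 := hg0 (M + 1) le_rfl
  rcases Nat.lt_or_ge M N with hMN | hMN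
  swap
  · rw [Ioc_eq_empty (by omega), Ioc_eq_empty (by omega)]
    simp only [sum_empty, norm_zero, add_zero]
    positivity
  have key : ∀ N : ℕ, M + 1 ≤ N →
      ‖∑ n ∈ Ioc M N, f n * g n - (∑ n ∈ Icc 1 N, f n) * g N‖ ≤
        B * (2 * ((M + 1 : ℕ) : ℝ) ^ (1 - c) * g (M + 1) +
          ∑ n ∈ Ioc (M + 1) N, (n : ℝ) ^ (-c) * g n - (N : ℝ) ^ (1 - c) * g N) := by
    intro N hN
    induction N, hN using Nat.le_induction with
    | base =>
      rw [Ioc_self, sum_empty, add_zero, sum_Icc_succ_top (by omega)]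
      have : Ioc M (M + 1) = {M + 1} := by simp
      rw [this, sum_singleton, add_mul, sub_add_cancel_right, norm_neg, norm_mul,
        norm_real, norm_of_nonneg hM0]
      have h1 : ‖∑ n ∈ Icc 1 M, f n‖ ≤ B * ((M + 1 : ℕ) : ℝ) ^ (1 - c) := by
        rcases Nat.eq_zero_or_pos M with rfl | hM
        · simp_all
        · refine (hF M hM).trans (mul_le_mul_of_nonneg_left ?_ hB)
          bound
      nlinarith
    | succ N hN ih =>
      have h1 : ∑ n ∈ Ioc M (N + 1), f n * g n -
          (∑ n ∈ Icc 1 (N + 1), f n) * g (N + 1) =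
          (∑ n ∈ Ioc M N, f n * g n - (∑ n ∈ Icc 1 N, f n) * g N) +
            (∑ n ∈ Icc 1 N, f n) * ((g N - g (N + 1) : ℝ) : ℂ) := by
        rw [sum_Ioc_succ_top (by omega), sum_Icc_succ_top (by omega)]
        push_cast; ring
      rw [h1, sum_Ioc_succ_top (by omega)]
      refine (norm_add_le _ _).trans ?_
      rw [norm_mul, norm_real, norm_of_nonneg (sub_nonneg.mpr (hg N hN))]
      have h2 := mul_le_mul_of_nonneg_right (hF N (by omega)) (sub_nonneg.mpr (hg N hN))
      have h3 := mul_le_mul_of_nonneg_right (rpow_succ_sub_rpow_le N hc0) (hg0 (N + 1) (by omega))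
      nlinarith
  have h5 := key N hMN
  have h6 := mul_le_mul_of_nonneg_right (hF N (by omega)) (hg0 N hMN)
  calc _ = ‖(∑ n ∈ Ioc M N, f n * g n - (∑ n ∈ Icc 1 N, f n) * g N) +
        (∑ n ∈ Icc 1 N, f n) * g N‖ := by rw [sub_add_cancel]
    _ ≤ _ := norm_add_le _ _
    _ ≤ _ := by
      rw [norm_mul _ (g N : ℂ), norm_real, norm_of_nonneg (hg0 N hMN)]
      linarith

lemma rpow_neg_one_sub_le (n : ℕ) (hn : 1 ≤ n) {c : ℝ} (hc : 0 < c) :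
    ((n + 1 : ℕ) : ℝ) ^ (-1 - c) ≤ ((n : ℝ) ^ (-c) - ((n + 1 : ℕ) : ℝ) ^ (-c)) / c := by
  have h1 : (0 : ℝ) < ((n + 1 : ℕ) : ℝ) := by positivity
  rw [le_div_iff₀ hc, le_sub_iff_add_le, sub_eq_neg_add, rpow_add h1, rpow_neg_one]
  have h2 : (n : ℝ) ^ (-c) = ((n + 1 : ℕ) : ℝ) ^ (-c) * ((n : ℝ) / ((n + 1 : ℕ) : ℝ)) ^ (-c) := by
    rw [← mul_rpow h1.le (by positivity), mul_div_cancel₀ _ h1.ne']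
  have h3 : 1 + c / ((n + 1 : ℕ) : ℝ) ≤ ((n : ℝ) / ((n + 1 : ℕ) : ℝ)) ^ (-c) := by
    rw [rpow_def_of_pos (by positivity)]
    have h4 : Real.log ((n : ℝ) / ((n + 1 : ℕ) : ℝ)) ≤ (n : ℝ) / ((n + 1 : ℕ) : ℝ) - 1 :=
      log_le_sub_one_of_pos (by positivity)
    have h5 : (n : ℝ) / ((n + 1 : ℕ) : ℝ) - 1 = - (1 / ((n + 1 : ℕ) : ℝ)) := by
      field_simp; push_cast; ring
    have h6 := Real.add_one_le_exp (Real.log ((n : ℝ) / ((n + 1 : ℕ) : ℝ)) * -c)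
    have h7 : c / ((n + 1 : ℕ) : ℝ) = (1 / ((n + 1 : ℕ) : ℝ)) * c := by ring
    nlinarith
  rw [h2]
  have := mul_le_mul_of_nonneg_left h3 (rpow_nonneg h1.le (-c))
  refine le_trans (le_of_eq ?_) this
  ring

lemma sum_rpow_neg_le {M : ℕ} (hM : 1 ≤ M) (N : ℕ) {c : ℝ} (hc : 0 < c) :
    ∑ n ∈ Ioc M N, (n : ℝ) ^ (-1 - c) ≤ (M : ℝ) ^ (-c) / c := by
  rcases Nat.lt_or_ge N M with hMN | hMN
  · rw [Ioc_eq_empty (by omega), sum_empty]; positivity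
  have key : ∑ n ∈ Ioc M N, (n : ℝ) ^ (-1 - c) ≤ ((M : ℝ) ^ (-c) - (N : ℝ) ^ (-c)) / c := by
    induction N, hMN using Nat.le_induction with
    | base => simp
    | succ N hN ih =>
      rw [sum_Ioc_succ_top (by omega)]
      have := rpow_neg_one_sub_le N (by omega) hc
      grind
  refine key.trans ?_
  gcongr
  have : 0 ≤ (N : ℝ) ^ (-c) := by positivity
  linarith

lemma rpow_sub_one_le (n : ℕ) {c : ℝ} (hc : 0 < c) (hc1 : c ≤ 1) :
    ((n + 1 : ℕ) : ℝ) ^ (c - 1) ≤ (((n + 1 : ℕ) : ℝ) ^ c - (n : ℝ) ^ c) / c := by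
  have h1 : (0 : ℝ) < ((n + 1 : ℕ) : ℝ) := by positivity
  rw [le_div_iff₀ hc, le_sub_comm, rpow_sub_one h1.ne']
  have h2 : (n : ℝ) ^ c = ((n + 1 : ℕ) : ℝ) ^ c * (1 + -(1 / ((n + 1 : ℕ) : ℝ))) ^ c := by
    rw [← mul_rpow h1.le]
    · field_simp; push_cast; ring
    · rw [← sub_eq_add_neg, sub_nonneg, div_le_one h1]; simp
  have h3 := _root_.rpow_one_add_le_one_add_mul_self (s := -(1 / ((n + 1 : ℕ) : ℝ))) (p := c) (by
    bound) hc.le hc1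
  rw [h2]
  refine (mul_le_mul_of_nonneg_left h3 (by positivity)).trans (le_of_eq ?_)
  ring

lemma sum_rpow_sub_one_le (M N : ℕ) {c : ℝ} (hc : 0 < c) (hc1 : c ≤ 1) :
    ∑ n ∈ Ioc M N, (n : ℝ) ^ (c - 1) ≤ (N : ℝ) ^ c / c := by
  refine (sum_le_sum_of_subset_of_nonneg (Ioc_subset_Ioc_left (Nat.zero_le M))
    fun _ _ _ => by positivity).trans ?_
  induction N with
  | zero => positivity
  | succ N ih =>
    rw [sum_Ioc_succ_top (by omega)]
    calc _ ≤ (N : ℝ) ^ c / c + (((N + 1 : ℕ) : ℝ) ^ c - (N : ℝ) ^ c) / c := by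
          gcongr
          exact rpow_sub_one_le N hc hc1
      _ = _ := by ring

open ArithmeticFunction in
lemma exists_sum_vonMangoldt_rpow_le {c : ℝ} (hc : 0 < c) (hc1 : c ≤ 1) : ∃ C : ℝ, 0 < C ∧
    ∀ N : ℕ, ∑ n ∈ Finset.Icc 1 N, vonMangoldt n * (n : ℝ) ^ (c - 1) ≤ C * (N : ℝ) ^ c := by
  refine ⟨(Real.log 4 + 4) * (2 + 1 / c), by positivity, fun N => ?_⟩
  rcases Nat.eq_zero_or_pos N with rfl | hN
  · positivity
  have h1 := norm_sum_mul_antitone_le (f := fun n => (vonMangoldt n : ℂ))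
    (g := fun n => (n : ℝ) ^ (c - 1)) (B := Real.log 4 + 4) (c := 0) le_rfl zero_le_one (by positivity)
    (fun N hN => by
      rw [← ofReal_sum, norm_real, norm_of_nonneg
        (sum_nonneg fun _ _ => vonMangoldt_nonneg), sub_zero, Real.rpow_one]
      have := Chebyshev.psi_le_const_mul_self (x := N) (Nat.cast_nonneg N)
      rwa [Chebyshev.psi, Nat.floor_natCast] at this) 0 N (fun n _ => by positivity)
    (fun n hn => rpow_le_rpow_of_nonpos (by exact_mod_cast hn) (by push_cast; linarith)
      (by linarith))
  have h2 : ∑ n ∈ Icc 1 N, vonMangoldt n * (n : ℝ) ^ (c - 1) ≤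
      ‖∑ n ∈ Ioc 0 N, (vonMangoldt n : ℂ) * (((n : ℝ) ^ (c - 1) : ℝ) : ℂ)‖ := by
    simp only [← ofReal_mul]
    rw [← ofReal_sum, norm_real]
    exact le_norm_self _
  refine h2.trans (h1.trans ?_)
  rw [mul_assoc (Real.log 4 + 4)]
  refine mul_le_mul_of_nonneg_left ?_ (show (0 : ℝ) ≤ Real.log 4 + 4 by positivity)
  have h3 := sum_rpow_sub_one_le 1 N hc hc1
  have h4 : (1 : ℝ) ≤ (N : ℝ) ^ c := one_le_rpow (by exact_mod_cast hN) hc.le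
  simp only [neg_zero, rpow_zero, one_mul, zero_add, Nat.cast_one, one_rpow, mul_one]
  rw [add_mul, one_div_mul_eq_div]
  linarith

end PartialSummation

section Twisted

open Real Filter ArithmeticFunction

open Finset

lemma sum_sum_divisorsAntidiagonal_eq {R : Type*} [CommSemiring R] (F G : ℕ → R) (N : ℕ) :
    ∑ n ∈ Icc 1 N, ∑ x ∈ n.divisorsAntidiagonal, F x.1 * G x.2 =
      ∑ k ∈ Icc 1 N, F k * ∑ m ∈ Icc 1 (N / k), G m := by
  let F' : ArithmeticFunction R := ⟨fun n => if n = 0 then 0 else F n, by simp⟩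
  let G' : ArithmeticFunction R := ⟨fun n => if n = 0 then 0 else G n, by simp⟩
  have h := sum_Ioc_mul_eq_sum_sum F' G' N
  have hF : ∀ n : ℕ, n ≠ 0 → F' n = F n := fun n hn => if_neg hn
  have hG : ∀ n : ℕ, n ≠ 0 → G' n = G n := fun n hn => if_neg hn
  convert h using 1
  · refine sum_congr rfl fun n _ => ?_
    rw [mul_apply]
    refine sum_congr rfl fun x hx => ?_
    have := Nat.ne_zero_of_mem_divisorsAntidiagonal hx
    rw [hF _ this.1, hG _ this.2]
  · refine sum_congr rfl fun k hk => ?_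
    rw [hF _ (by simp at hk; omega)]
    congr 1
    refine sum_congr rfl fun m hm => ?_
    rw [hG _ (by simp at hm; omega)]

lemma sum_Icc_one_eq_add {R : Type*} [AddCommMonoid R] (f : ℕ → R) {M N : ℕ} (h : M ≤ N) :
    ∑ n ∈ Icc 1 N, f n = ∑ n ∈ Icc 1 M, f n + ∑ n ∈ Ioc M N, f n := by
  have : ∀ N : ℕ, Icc 1 N = Ioc 0 N := fun N => rfl
  rw [this, this, sum_Ioc_consecutive f (Nat.zero_le _) h]

section Single

variable {f : ℕ → ℂ} {B c : ℝ} (hc0 : 0 < c) (hc1 : c ≤ 1) (hB : 0 ≤ B)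
  (hF : ∀ N : ℕ, 1 ≤ N → ‖∑ n ∈ Icc 1 N, f n‖ ≤ B * (N : ℝ) ^ (1 - c))
include hc0 hc1 hB hF

lemma norm_sum_Ioc_rpow_neg_le {s : ℝ} (hs : 1 ≤ s) {M : ℕ} (hM : 1 ≤ M) (N : ℕ) :
    ‖∑ n ∈ Ioc M N, f n * (((n : ℝ) ^ (-s) : ℝ) : ℂ)‖ ≤ B * (2 + 1 / c) * (M : ℝ) ^ (-c) := by
  have h := norm_sum_mul_antitone_le (g := fun n => (n : ℝ) ^ (-s)) hc0.le hc1 hB hF M N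
    (fun n _ => by positivity)
    (fun n hn => rpow_le_rpow_of_nonpos (by norm_cast; omega) (by push_cast; linarith) (by linarith))
  refine h.trans ?_
  rw [mul_assoc B]
  refine mul_le_mul_of_nonneg_left ?_ hB
  have hM' : (0 : ℝ) < M := by exact_mod_cast hM
  have h1 : ((M + 1 : ℕ) : ℝ) ^ (1 - c) * ((M + 1 : ℕ) : ℝ) ^ (-s) ≤ (M : ℝ) ^ (-c) := by
    rw [← rpow_add (by positivity)]
    calc ((M + 1 : ℕ) : ℝ) ^ (1 - c + -s) ≤ ((M + 1 : ℕ) : ℝ) ^ (-c) :=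
          rpow_le_rpow_of_exponent_le (by push_cast; linarith) (by linarith)
      _ ≤ _ := rpow_le_rpow_of_nonpos hM' (by push_cast; linarith) (by linarith)
  have h2 : ∑ n ∈ Ioc (M + 1) N, (n : ℝ) ^ (-c) * (n : ℝ) ^ (-s) ≤ (M : ℝ) ^ (-c) / c := by
    refine (sum_le_sum_of_subset_of_nonneg (Ioc_subset_Ioc_left (Nat.le_succ M))
      fun _ _ _ => by positivity).trans ((sum_le_sum fun n hn => ?_).trans
        (sum_rpow_neg_le hM N hc0))
    have hn0 : 1 ≤ n := by simp at hn; omega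
    have hn' : (1 : ℝ) ≤ n := by exact_mod_cast hn0
    rw [← rpow_add (by linarith)]
    bound
  grind

lemma norm_le_of_partial_sum (n : ℕ) (hn : 1 ≤ n) : ‖f n‖ ≤ 2 * B * n := by
  have h1 : ‖∑ k ∈ Icc 1 n, f k‖ ≤ B * n := (hF n hn).trans (mul_le_mul_of_nonneg_left (by
    conv_rhs => rw [← rpow_one (n : ℝ)]
    bound) hB)
  have h2 : ‖∑ k ∈ Icc 1 (n - 1), f k‖ ≤ B * n := by
    rcases Nat.lt_or_ge 1 n with h | h
    · refine (hF (n - 1) (by omega)).trans (mul_le_mul_of_nonneg_left ?_ hB)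
      calc ((n - 1 : ℕ) : ℝ) ^ (1 - c) ≤ ((n : ℕ) : ℝ) ^ (1 - c) :=
            rpow_le_rpow (by positivity) (by exact_mod_cast Nat.sub_le _ _) (by linarith)
        _ ≤ (n : ℝ) ^ (1 : ℝ) :=
          rpow_le_rpow_of_exponent_le (by exact_mod_cast hn) (by linarith)
        _ = n := rpow_one _
    · obtain rfl : n = 1 := by omega
      simpa using hB
  obtain ⟨k, rfl⟩ : ∃ k, n = k + 1 := ⟨n - 1, by omega⟩
  rw [sum_Icc_succ_top (by omega)] at h1
  simp only [add_tsub_cancel_right] at h2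
  have := norm_sub_le (∑ k ∈ Icc 1 k, f k + f (k + 1)) (∑ k ∈ Icc 1 k, f k)
  rw [add_sub_cancel_left] at this
  linarith

lemma norm_sum_log_weight_le {g : ℕ → ℝ} {δ : ℝ} (hδ : 0 ≤ δ) (hg0 : ∀ n, 1 ≤ n → 0 ≤ g n)
    (hg : ∀ n, 3 ≤ n → g (n + 1) ≤ g n) (hle : ∀ n, 1 ≤ n → g n ≤ δ * (Real.log n / n)) (N : ℕ) :
    ‖∑ n ∈ Icc 1 N, f n * g n‖ ≤ B * (7 + 4 / c ^ 2) * δ := by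
  have hg1 : g 1 = 0 := le_antisymm (by simpa using hle 1 le_rfl) (hg0 1 le_rfl)
  have hl3 : Real.log 3 ≤ 1.1 := by
    rw [Real.log_le_iff_le_exp (by norm_num)]
    have := sum_le_exp_of_nonneg (x := 1.1) (by norm_num) 6
    linarith
  have hg2 : g 2 ≤ δ / 2 := by
    have := hle 2 (by norm_num)
    have h2 := Real.log_two_lt_d9
    nlinarith
  have hg3 : g 3 ≤ δ / 2 := by
    have := hle 3 (by norm_num)
    nlinarith
  have hf2 := norm_le_of_partial_sum hc0 hc1 hB hF 2 (by norm_num)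
  have hmain : ‖∑ n ∈ Ioc 2 N, f n * g n‖ ≤ B * (3 + 4 / c ^ 2) * δ := by
    refine (norm_sum_mul_antitone_le hc0.le hc1 hB hF 2 N (fun n hn => hg0 n (by omega)) hg).trans ?_
    rw [mul_assoc B]
    refine mul_le_mul_of_nonneg_left ?_ hB
    have h1 : 2 * ((2 + 1 : ℕ) : ℝ) ^ (1 - c) * g (2 + 1) ≤ 3 * δ := by
      have : ((2 + 1 : ℕ) : ℝ) ^ (1 - c) ≤ 3 := by
        calc ((2 + 1 : ℕ) : ℝ) ^ (1 - c) ≤ ((2 + 1 : ℕ) : ℝ) ^ (1 : ℝ) :=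
              rpow_le_rpow_of_exponent_le (by norm_num) (by linarith)
          _ = 3 := by norm_num
      have h0 := hg0 3 (by norm_num)
      nlinarith
    have h2 : ∑ n ∈ Ioc (2 + 1) N, (n : ℝ) ^ (-c) * g n ≤ 4 / c ^ 2 * δ := by
      have hc2 : 0 < c / 2 := by linarith
      calc ∑ n ∈ Ioc (2 + 1) N, (n : ℝ) ^ (-c) * g n
          ≤ ∑ n ∈ Ioc (2 + 1) N, 2 / c * δ * (n : ℝ) ^ (-1 - c / 2) := by
            refine sum_le_sum fun n hn => ?_
            have hn0 : 1 ≤ n := by simp at hn; omega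
            have hn' : (0 : ℝ) < n := by exact_mod_cast hn0
            have hlog := log_le_rpow_div hn'.le hc2
            have : (n : ℝ) ^ (-1 - c / 2) = (n : ℝ) ^ (-c) * ((n : ℝ) ^ (c / 2) / n) := by
              rw [← mul_div_assoc, ← rpow_add hn', ← Real.rpow_sub_one hn'.ne']
              ring
            rw [this]
            calc (n : ℝ) ^ (-c) * g n ≤ (n : ℝ) ^ (-c) * (δ * (((n : ℝ) ^ (c / 2) / (c / 2)) / n)) := by
                  refine mul_le_mul_of_nonneg_left ((hle n hn0).trans ?_) (by positivity)
                  gcongr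
              _ = _ := by field_simp
        _ ≤ ∑ n ∈ Ioc 1 N, 2 / c * δ * (n : ℝ) ^ (-1 - c / 2) :=
            sum_le_sum_of_subset_of_nonneg (Ioc_subset_Ioc_left (by norm_num))
              fun _ _ _ => by positivity
        _ ≤ 2 / c * δ * (((1 : ℕ) : ℝ) ^ (-(c / 2)) / (c / 2)) := by
            rw [← mul_sum]
            exact mul_le_mul_of_nonneg_left (sum_rpow_neg_le le_rfl N hc2) (by positivity)
        _ = 4 / c ^ 2 * δ := by simp; ring
    linarith [add_le_add h1 h2]
  have h12 : ∀ N ≤ 2, ‖∑ n ∈ Icc 1 N, f n * g n‖ ≤ 2 * B * δ := by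
    intro N hN
    have h0 : ‖f 2 * (g 2 : ℂ)‖ ≤ 2 * B * δ := by
      rw [norm_mul, Complex.norm_real, norm_of_nonneg (hg0 2 (by norm_num))]
      push_cast at hf2
      nlinarith [norm_nonneg (f 2), hg0 2 (by norm_num)]
    interval_cases N
    · simp; positivity
    · simp [hg1]; positivity
    · rw [show Icc 1 2 = {1, 2} from rfl, sum_pair (by norm_num), hg1]
      simpa using h0
  have hnn : 0 ≤ B * (3 + 4 / c ^ 2) * δ := by positivity
  rcases Nat.lt_or_ge N 3 with h | h
  · have := h12 N (by omega)
    nlinarith [mul_nonneg hB hδ]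
  · rw [sum_Icc_one_eq_add _ (show 2 ≤ N by omega)]
    refine (norm_add_le _ _).trans ?_
    have := h12 2 le_rfl
    nlinarith [mul_nonneg hB hδ]

/-- The value at `1` of the Dirichlet series, with tail estimates. -/
lemma exists_limit_sum_div : ∃ L : ℂ, ∀ N : ℕ, 1 ≤ N →
    ‖∑ n ∈ Icc 1 N, f n * (((n : ℝ) ^ (-1 : ℝ) : ℝ) : ℂ) - L‖ ≤ B * (7 + 4 / c ^ 2) * (N : ℝ) ^ (-c) := by
  have hcc : 2 + 1 / c ≤ 7 + 4 / c ^ 2 := by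
    have : 1 / c ≤ 1 / c ^ 2 := by
      apply one_div_le_one_div_of_le (by positivity); nlinarith
    have h4 : 4 / c ^ 2 = 4 * (1 / c ^ 2) := by ring
    have : 0 < 1 / c ^ 2 := by positivity
    linarith
  let S : ℕ → ℂ := fun N => ∑ n ∈ Icc 1 (N + 1), f n * (((n : ℝ) ^ (-1 : ℝ) : ℝ) : ℂ)
  have hS : ∀ n m : ℕ, n ≤ m → dist (S n) (S m) ≤ B * (2 + 1 / c) * ((n + 1 : ℕ) : ℝ) ^ (-c) := by
    intro n m hnm
    rw [dist_comm, dist_eq_norm]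
    simp only [S]
    rw [sum_Icc_one_eq_add _ (show n + 1 ≤ m + 1 by omega), add_sub_cancel_left]
    exact norm_sum_Ioc_rpow_neg_le hc0 hc1 hB hF le_rfl (by omega) _
  have ht : Tendsto (fun n : ℕ => B * (2 + 1 / c) * ((n + 1 : ℕ) : ℝ) ^ (-c)) atTop (nhds 0) := by
    have h := (tendsto_rpow_neg_atTop hc0).comp
      ((tendsto_natCast_atTop_atTop (R := ℝ)).comp (tendsto_add_atTop_nat 1))
    simpa using h.const_mul (B * (2 + 1 / c))
  obtain ⟨L, hL⟩ := cauchySeq_tendsto_of_complete (cauchySeq_of_le_tendsto_0' _ hS ht)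
  refine ⟨L, fun N hN => ?_⟩
  obtain ⟨n, rfl⟩ : ∃ n, N = n + 1 := ⟨N - 1, by omega⟩
  have h1 : dist (S n) L ≤ B * (2 + 1 / c) * ((n + 1 : ℕ) : ℝ) ^ (-c) :=
    le_of_tendsto (tendsto_const_nhds.dist hL)
      (eventually_atTop.mpr ⟨n, fun m hm => hS n m hm⟩)
  rw [dist_eq_norm] at h1
  exact h1.trans (by gcongr)

end Single

end Twisted

section LogDerivative

open Real Complex ArithmeticFunction

open Finset

lemma rpow_neg_one_sub_antitone {δ : ℝ} (hδ : 0 ≤ δ) (n : ℕ) (hn : 3 ≤ n) :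
    ((n + 1 : ℕ) : ℝ) ^ (-1 : ℝ) - ((n + 1 : ℕ) : ℝ) ^ (-(1 + δ)) ≤
      (n : ℝ) ^ (-1 : ℝ) - (n : ℝ) ^ (-(1 + δ)) := by
  have key : AntitoneOn (fun t : ℝ => Real.exp (-t) - Real.exp (-(1 + δ) * t)) (Set.Ici 1) := by
    have hd : ∀ t : ℝ, HasDerivAt (fun t : ℝ => Real.exp (-t) - Real.exp (-(1 + δ) * t))
        (Real.exp (-t) * (-1) - Real.exp (-(1 + δ) * t) * (-(1 + δ))) t := by
      intro t
      have h1 := (hasDerivAt_neg t).exp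
      have h2 : HasDerivAt (fun t : ℝ => Real.exp (-(1 + δ) * t))
          (Real.exp (-(1 + δ) * t) * (-(1 + δ))) t := by
        simpa using ((hasDerivAt_id t).const_mul (-(1 + δ))).exp
      exact h1.sub h2
    refine antitoneOn_of_deriv_nonpos (convex_Ici 1)
      (fun t _ => (hd t).continuousAt.continuousWithinAt)
      (fun t _ => (hd t).differentiableAt.differentiableWithinAt) fun t ht => ?_
    rw [(hd t).deriv]
    rw [interior_Ici] at ht
    have ht1 : 1 < t := ht
    have h1 : Real.exp (-t) = Real.exp (-(1 + δ) * t) * Real.exp (δ * t) := by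
      rw [← Real.exp_add]; ring_nf
    have h2 : 1 + δ ≤ Real.exp (δ * t) := by
      have := Real.add_one_le_exp (δ * t)
      nlinarith
    nlinarith [Real.exp_pos (-(1 + δ) * t)]
  have hl : ∀ m : ℕ, 3 ≤ m → (m : ℝ) ^ (-1 : ℝ) - (m : ℝ) ^ (-(1 + δ)) =
      Real.exp (-Real.log m) - Real.exp (-(1 + δ) * Real.log m) := by
    intro m hm
    have : (0 : ℝ) < m := by exact_mod_cast (by omega : 0 < m)
    rw [rpow_def_of_pos this, rpow_def_of_pos this]
    ring_nf
  have h1 : ∀ m : ℕ, 3 ≤ m → 1 ≤ Real.log m := by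
    intro m hm
    have : (3 : ℝ) ≤ m := by exact_mod_cast hm
    rw [le_log_iff_exp_le (by linarith)]
    linarith [exp_one_lt_d9]
  rw [hl _ hn, hl _ (by omega)]
  refine key (h1 _ hn) (h1 _ (by omega)) (Real.log_le_log ?_ (by push_cast; linarith))
  exact_mod_cast (by omega : 0 < n)

lemma log_mul_rpow_antitone (n : ℕ) (hn : 3 ≤ n) :
    Real.log (n + 1 : ℕ) / (n + 1 : ℕ) ≤ Real.log n / n := by
  have h3 : ∀ m : ℕ, 3 ≤ m → Real.exp 1 ≤ m := fun m hm => by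
    have : (3 : ℝ) ≤ m := by exact_mod_cast hm
    linarith [Real.exp_one_lt_d9]
  exact Real.log_div_self_antitoneOn (h3 _ hn) (h3 _ (by omega)) (by push_cast; linarith)

variable {f w : ℕ → ℂ} {B c d : ℝ}

/-- If `∑ f(n) / n` converges to `L ≠ 0` with power saving and `f log = w * f`, then the partial sums of
`∑ w(k) / k` are bounded. -/
lemma norm_limit_mul_sum_le (hc0 : 0 < c) (hc1 : c ≤ 1) (hB : 0 ≤ B)
    (hF : ∀ N : ℕ, 1 ≤ N → ‖∑ n ∈ Icc 1 N, f n‖ ≤ B * (N : ℝ) ^ (1 - c))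
    (hconv : ∀ n, 1 ≤ n → f n * Real.log n = ∑ x ∈ n.divisorsAntidiagonal, w x.1 * f x.2)
    (hw : ∀ n, ‖w n‖ ≤ d * vonMangoldt n) {CΛ : ℝ} (hd : 0 ≤ d)
    (hΛ : ∀ N : ℕ, ∑ n ∈ Icc 1 N, vonMangoldt n * (n : ℝ) ^ (c - 1) ≤ CΛ * (N : ℝ) ^ c)
    {L : ℂ} (hL : ∀ N : ℕ, 1 ≤ N →
      ‖∑ n ∈ Icc 1 N, f n * (((n : ℝ) ^ (-1 : ℝ) : ℝ) : ℂ) - L‖ ≤ B * (7 + 4 / c ^ 2) * (N : ℝ) ^ (-c))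
    (N : ℕ) :
    ‖L‖ * ‖∑ k ∈ Icc 1 N, w k * (((k : ℝ) ^ (-1 : ℝ) : ℝ) : ℂ)‖ ≤
      B * (7 + 4 / c ^ 2) * (1 + 2 * d * CΛ) := by
  set D := B * (7 + 4 / c ^ 2) with hD
  have hD0 : 0 ≤ D := by positivity
  have h1 : ‖∑ n ∈ Icc 1 N, f n * ((Real.log n / n : ℝ) : ℂ)‖ ≤ D := by
    have := norm_sum_log_weight_le hc0 hc1 hB hF (g := fun n => Real.log n / n) (δ := 1) zero_le_one
      (fun n hn => by positivity) log_mul_rpow_antitone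
      (fun n _ => by simp) N
    simpa [hD] using this
  have h2 : ∑ n ∈ Icc 1 N, f n * ((Real.log n / n : ℝ) : ℂ) =
      ∑ k ∈ Icc 1 N, (w k * (((k : ℝ) ^ (-1 : ℝ) : ℝ) : ℂ)) *
        ∑ m ∈ Icc 1 (N / k), f m * (((m : ℝ) ^ (-1 : ℝ) : ℝ) : ℂ) := by
    rw [← sum_sum_divisorsAntidiagonal_eq (fun k => w k * (((k : ℝ) ^ (-1 : ℝ) : ℝ) : ℂ))
      (fun m => f m * (((m : ℝ) ^ (-1 : ℝ) : ℝ) : ℂ))]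
    refine sum_congr rfl fun n hn => ?_
    have hn1 : 1 ≤ n := by simp at hn; omega
    rw [ofReal_div, ← mul_div_assoc, hconv n hn1, sum_div]
    refine sum_congr rfl fun x hx => ?_
    obtain ⟨rfl, -⟩ := Nat.mem_divisorsAntidiagonal.mp hx
    rw [rpow_neg_one, rpow_neg_one]
    push_cast
    ring
  have h3 : ‖∑ k ∈ Icc 1 N, (w k * (((k : ℝ) ^ (-1 : ℝ) : ℝ) : ℂ)) *
        (∑ m ∈ Icc 1 (N / k), f m * (((m : ℝ) ^ (-1 : ℝ) : ℝ) : ℂ) - L)‖ ≤ D * (2 * d * CΛ) := by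
    rcases Nat.eq_zero_or_pos N with rfl | hN
    · have hCΛ : 0 ≤ CΛ := by
        have := hΛ 1
        simp at this
        exact this
      simp; positivity
    have hN' : (0 : ℝ) < N := by exact_mod_cast hN
    calc _ ≤ ∑ k ∈ Icc 1 N, ‖(w k * (((k : ℝ) ^ (-1 : ℝ) : ℝ) : ℂ)) *
        (∑ m ∈ Icc 1 (N / k), f m * (((m : ℝ) ^ (-1 : ℝ) : ℝ) : ℂ) - L)‖ := norm_sum_le _ _
      _ ≤ ∑ k ∈ Icc 1 N, (D * (2 * d) * (N : ℝ) ^ (-c)) *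
          (vonMangoldt k * (k : ℝ) ^ (c - 1)) := by
        refine sum_le_sum fun k hk => ?_
        have hk1 : 1 ≤ k ∧ k ≤ N := by simpa using hk
        have hk0 : (0 : ℝ) < k := by exact_mod_cast hk1.1
        rw [norm_mul, norm_mul, norm_real, norm_of_nonneg (by positivity)]
        have hq : 1 ≤ N / k := (Nat.one_le_div_iff hk1.1).mpr hk1.2
        have hq' : (N : ℝ) / (2 * k) ≤ ((N / k : ℕ) : ℝ) := by
          have hlt : N < 2 * k * (N / k) := by
            have h5 := Nat.div_add_mod N k
            have h6 := Nat.mod_lt N hk1.1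
            nlinarith
          rw [div_le_iff₀ (by positivity)]
          have : (N : ℝ) < 2 * k * ((N / k : ℕ) : ℝ) := by exact_mod_cast hlt
          linarith
        have hpow : ((N / k : ℕ) : ℝ) ^ (-c) ≤ 2 * ((N : ℝ) ^ (-c) * (k : ℝ) ^ c) := by
          calc ((N / k : ℕ) : ℝ) ^ (-c) ≤ ((N : ℝ) / (2 * k)) ^ (-c) :=
                rpow_le_rpow_of_nonpos (by positivity) hq' (by linarith)
            _ = (2 : ℝ) ^ c * ((N : ℝ) ^ (-c) * (k : ℝ) ^ c) := by
                rw [div_rpow hN'.le (by positivity), mul_rpow (by norm_num) hk0.le,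
                  rpow_neg (by norm_num : (0 : ℝ) ≤ 2) c, rpow_neg hk0.le c]
                field_simp
            _ ≤ 2 * ((N : ℝ) ^ (-c) * (k : ℝ) ^ c) := by
                refine mul_le_mul_of_nonneg_right ?_ (by positivity)
                calc (2 : ℝ) ^ c ≤ (2 : ℝ) ^ (1 : ℝ) :=
                      rpow_le_rpow_of_exponent_le (by norm_num) hc1
                  _ = 2 := rpow_one 2
        calc _ ≤ (d * vonMangoldt k * (k : ℝ) ^ (-1 : ℝ)) *
              (D * (2 * ((N : ℝ) ^ (-c) * (k : ℝ) ^ c))) := by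
              refine mul_le_mul (mul_le_mul_of_nonneg_right (hw k) (by positivity))
                ((hL _ hq).trans (mul_le_mul_of_nonneg_left hpow hD0)) (norm_nonneg _) ?_
              positivity
          _ = _ := by
              rw [sub_eq_add_neg, rpow_add hk0]; ring
      _ ≤ (D * (2 * d) * (N : ℝ) ^ (-c)) * (CΛ * (N : ℝ) ^ c) := by
        rw [← mul_sum]
        bound
      _ = D * (2 * d * CΛ) * ((N : ℝ) ^ (-c) * (N : ℝ) ^ c) := by ring
      _ = _ := by rw [← rpow_add hN']; simp
  have h4 : L * ∑ k ∈ Icc 1 N, w k * (((k : ℝ) ^ (-1 : ℝ) : ℝ) : ℂ) =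
      ∑ n ∈ Icc 1 N, f n * ((Real.log n / n : ℝ) : ℂ) -
      ∑ k ∈ Icc 1 N, (w k * (((k : ℝ) ^ (-1 : ℝ) : ℝ) : ℂ)) *
        (∑ m ∈ Icc 1 (N / k), f m * (((m : ℝ) ^ (-1 : ℝ) : ℝ) : ℂ) - L) := by
    rw [h2, ← sum_sub_distrib, mul_sum]
    ring
  rw [← norm_mul, h4]
  refine (norm_sub_le _ _).trans ?_
  linarith

end LogDerivative

section LowerBound

open Real Complex Filter

open Finset

/-- `a` is a nonnegative arithmetic function with logarithmic derivative `v` bounded by a multiple of the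
von Mangoldt function. -/
structure IsLogFactor (a v : ℕ → ℝ) (d : ℝ) : Prop where
  nonneg : ∀ n, 0 ≤ a n
  one : a 1 = 1
  deriv_nonneg : ∀ n, 0 ≤ v n
  deriv_le : ∀ n, v n ≤ d * ArithmeticFunction.vonMangoldt n
  conv : ∀ n, 1 ≤ n → a n * Real.log n = ∑ x ∈ n.divisorsAntidiagonal, v x.1 * a x.2

/-- The arithmetic function agreeing with `f` away from `0`. -/
def arithOf (f : ℕ → ℂ) : ArithmeticFunction ℂ := ⟨fun n => if n = 0 then 0 else f n, by simp⟩

lemma arithOf_apply (f : ℕ → ℂ) {n : ℕ} (hn : n ≠ 0) : arithOf f n = f n := if_neg hn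

lemma mul_log_of_conv {F G V W : ArithmeticFunction ℂ}
    (hF : ∀ n : ℕ, 1 ≤ n → F n * Real.log n = (V * F) n)
    (hG : ∀ n : ℕ, 1 ≤ n → G n * Real.log n = (W * G) n) (n : ℕ) (hn : 1 ≤ n) :
    (F * G) n * Real.log n = ((V + W) * (F * G)) n := by
  have h1 : (F * G) n * Real.log n =
      ∑ x ∈ n.divisorsAntidiagonal, ((V * F) x.1 * G x.2 + F x.1 * (W * G) x.2) := by
    rw [ArithmeticFunction.mul_apply, sum_mul]
    refine sum_congr rfl fun x hx => ?_
    have hx0 := Nat.ne_zero_of_mem_divisorsAntidiagonal hx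
    obtain ⟨rfl, -⟩ := Nat.mem_divisorsAntidiagonal.mp hx
    rw [← hF _ (Nat.one_le_iff_ne_zero.mpr hx0.1), ← hG _ (Nat.one_le_iff_ne_zero.mpr hx0.2),
      Nat.cast_mul, Real.log_mul (by exact_mod_cast hx0.1) (by exact_mod_cast hx0.2)]
    push_cast
    ring
  rw [h1, sum_add_distrib, ← ArithmeticFunction.mul_apply, ← ArithmeticFunction.mul_apply,
    add_mul, ArithmeticFunction.add_apply, mul_assoc, mul_left_comm F W G]

lemma prod_log_of_conv {m : ℕ} {F V : ℕ → ArithmeticFunction ℂ}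
    (hF : ∀ i, ∀ n : ℕ, 1 ≤ n → F i n * Real.log n = (V i * F i) n) (n : ℕ) (hn : 1 ≤ n) :
    (∏ i ∈ range m, F i) n * Real.log n = ((∑ i ∈ range m, V i) * ∏ i ∈ range m, F i) n := by
  induction m generalizing n with
  | zero =>
    rcases Nat.lt_or_ge 1 n with h | h
    · simp [ArithmeticFunction.one_apply_ne (by omega : n ≠ 1)]
    · obtain rfl : n = 1 := by omega
      simp
  | succ m ih =>
    rw [prod_range_succ, sum_range_succ]
    exact mul_log_of_conv ih (hF m) n hn

open scoped ComplexOrder in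
lemma nonneg_of_log_conv {b W : ArithmeticFunction ℂ} (h1 : b 1 = 1) (hW : ∀ n, 0 ≤ W n) (hW1 : W 1 = 0)
    (hb : ∀ n : ℕ, 1 ≤ n → b n * Real.log n = (W * b) n) (n : ℕ) : 0 ≤ b n := by
  induction n using Nat.strong_induction_on with
  | _ n ih =>
    rcases Nat.eq_zero_or_pos n with rfl | hn
    · simp
    rcases Nat.lt_or_ge 1 n with hn1 | hn1
    swap
    · grind
    have hlog : 0 < Real.log n := Real.log_pos (by exact_mod_cast hn1)
    have h2 : 0 ≤ b n * Real.log n := by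
      rw [hb n hn, ArithmeticFunction.mul_apply]
      refine sum_nonneg fun x hx => ?_
      have hx0 := Nat.ne_zero_of_mem_divisorsAntidiagonal hx
      obtain ⟨hxn, -⟩ := Nat.mem_divisorsAntidiagonal.mp hx
      by_cases hx1 : x.1 = 1
      · rw [hx1, hW1, zero_mul]
      · refine mul_nonneg (hW _) (ih _ ?_)
        rw [← hxn]
        exact (Nat.lt_mul_iff_one_lt_left (by omega)).mpr (by omega)
    have h3 : b n = (b n * Real.log n) * ((Real.log n)⁻¹ : ℝ) := by
      rw [mul_assoc, ← ofReal_mul, mul_inv_cancel₀ hlog.ne']; simp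
    rw [h3]
    positivity

open scoped ComplexOrder in
lemma one_le_norm_LSeries {b : ℕ → ℂ} (h1 : b 1 = 1) (hb : ∀ n, 0 ≤ b n) {s : ℝ}
    (hs : LSeriesSummable b s) : 1 ≤ ‖LSeries b s‖ := by
  have hre : ∀ n, 0 ≤ (LSeries.term b s n).re := fun n =>
    (nonneg_iff.mp (LSeries.term_nonneg (hb n) s)).1
  have h2 : (LSeries.term b s 1).re ≤ (LSeries b s).re := by
    rw [LSeries, re_tsum hs]
    have hsum : Summable fun n => (LSeries.term b s n).re := (hasSum_re hs.hasSum).summable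
    exact hsum.le_tsum 1 fun n _ => hre n
  have h3 : (LSeries.term b s 1).re = 1 := by
    simp_all
  rw [h3] at h2
  exact h2.trans (re_le_norm _)

lemma LSeries_prod_range {m : ℕ} {F : ℕ → ArithmeticFunction ℂ} {s : ℂ}
    (hF : ∀ i < m, LSeriesSummable (fun n => F i n) s) :
    LSeriesSummable (fun n => (∏ i ∈ range m, F i) n) s ∧
      LSeries (fun n => (∏ i ∈ range m, F i) n) s = ∏ i ∈ range m, LSeries (fun n => F i n) s := by
  induction m with
  | zero =>
    simp only [range_zero, prod_empty, ArithmeticFunction.one_eq_delta]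
    refine ⟨?_, ?_⟩
    · refine summable_of_ne_finset_zero (s := {1}) fun n hn => ?_
      rw [LSeries.term_delta, if_neg (by simpa using hn)]
    · exact congrFun LSeries_delta s
  | succ m ih =>
    obtain ⟨h1, h2⟩ := ih fun i hi => hF i (by omega)
    rw [prod_range_succ, prod_range_succ, ← h2]
    exact ⟨ArithmeticFunction.LSeriesSummable_mul h1 (hF m (by omega)),
      ArithmeticFunction.LSeries_mul' h1 (hF m (by omega))⟩

lemma tendsto_sum_LSeries {f : ℕ → ℂ} {s : ℝ} (hs : LSeriesSummable f s) :
    Tendsto (fun N : ℕ => ∑ n ∈ Icc 1 N, f n * (((n : ℝ) ^ (-s) : ℝ) : ℂ)) atTop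
      (nhds (LSeries f s)) := by
  have h := (hs.hasSum.tendsto_sum_nat).comp (tendsto_add_atTop_nat 1)
  refine h.congr fun N => ?_
  simp only [Function.comp]
  rw [sum_range_succ', LSeries.term_zero, add_zero, range_eq_Ico, sum_Ico_add' (fun n => LSeries.term f s n) 0 N 1,
    zero_add]
  refine sum_congr rfl fun n hn => ?_
  have hn0 : n ≠ 0 := by simp at hn; omega
  rw [LSeries.term_of_ne_zero hn0, div_eq_mul_inv, ofReal_cpow (by positivity), ofReal_neg,
    cpow_neg]
  simp

lemma norm_LSeries_le {f : ℕ → ℂ} {s : ℝ} (hs : LSeriesSummable f s) {C : ℝ}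
    (h : ∀ N : ℕ, ‖∑ n ∈ Icc 1 N, f n * (((n : ℝ) ^ (-s) : ℝ) : ℂ)‖ ≤ C) : ‖LSeries f s‖ ≤ C :=
  le_of_tendsto (tendsto_sum_LSeries hs).norm (Eventually.of_forall h)

section

variable {f : ℕ → ℂ} {B c : ℝ} (hc0 : 0 < c) (hc1 : c ≤ 1) (hB : 0 ≤ B)
  (hF : ∀ N : ℕ, 1 ≤ N → ‖∑ n ∈ Icc 1 N, f n‖ ≤ B * (N : ℝ) ^ (1 - c))
include hc0 hc1 hB hF

lemma norm_LSeries_le_of_saving {s : ℝ} (hs1 : 1 ≤ s) (hs : LSeriesSummable f s) :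
    ‖LSeries f s‖ ≤ B * (7 + 4 / c ^ 2) := by
  have hcc : 3 + 1 / c ≤ 7 + 4 / c ^ 2 := by
    have : 1 / c ≤ 1 / c ^ 2 := by
      apply one_div_le_one_div_of_le (by positivity); nlinarith
    have h4 : 4 / c ^ 2 = 4 * (1 / c ^ 2) := by ring
    have : 0 < 1 / c ^ 2 := by positivity
    linarith
  refine norm_LSeries_le hs fun N => ?_
  rcases Nat.eq_zero_or_pos N with rfl | hN
  · simp; positivity
  rw [sum_Icc_one_eq_add _ hN]
  refine (norm_add_le _ _).trans ?_
  have h1 := norm_sum_Ioc_rpow_neg_le hc0 hc1 hB hF hs1 le_rfl N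
  have h2 := hF 1 le_rfl
  simp only [Icc_self, sum_singleton, Nat.cast_one, one_rpow, mul_one, ofReal_one] at h1 h2 ⊢
  nlinarith

lemma norm_LSeries_sub_limit_le {δ : ℝ} (hδ : 0 ≤ δ) (hs : LSeriesSummable f ((1 + δ : ℝ) : ℂ)) {L : ℂ}
    (hL : ∀ N : ℕ, 1 ≤ N →
      ‖∑ n ∈ Icc 1 N, f n * (((n : ℝ) ^ (-1 : ℝ) : ℝ) : ℂ) - L‖ ≤ B * (7 + 4 / c ^ 2) * (N : ℝ) ^ (-c)) :
    ‖LSeries f ((1 + δ : ℝ) : ℂ) - L‖ ≤ B * (7 + 4 / c ^ 2) * δ := by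
  have hL' : Tendsto (fun N : ℕ => ∑ n ∈ Icc 1 N, f n * (((n : ℝ) ^ (-1 : ℝ) : ℝ) : ℂ))
      atTop (nhds L) := by
    rw [tendsto_iff_norm_sub_tendsto_zero]
    have ht : Tendsto (fun N : ℕ => B * (7 + 4 / c ^ 2) * (N : ℝ) ^ (-c)) atTop (nhds 0) := by
      simpa using ((tendsto_rpow_neg_atTop hc0).comp
        (tendsto_natCast_atTop_atTop (R := ℝ))).const_mul (B * (7 + 4 / c ^ 2))
    exact squeeze_zero' (Eventually.of_forall fun _ => norm_nonneg _)
      (eventually_atTop.mpr ⟨1, hL⟩) ht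
  refine le_of_tendsto ((tendsto_sum_LSeries hs).sub hL').norm (Eventually.of_forall fun N => ?_)
  rw [norm_sub_rev, ← sum_sub_distrib]
  have h := norm_sum_log_weight_le hc0 hc1 hB hF
    (g := fun n => (n : ℝ) ^ (-1 : ℝ) - (n : ℝ) ^ (-(1 + δ))) hδ
    (fun n hn => sub_nonneg.mpr
      (rpow_le_rpow_of_exponent_le (by exact_mod_cast hn) (by linarith)))
    (rpow_neg_one_sub_antitone hδ) (fun n hn => by
      have hn' : (0 : ℝ) < n := by exact_mod_cast hn
      rw [neg_add, rpow_add hn', ← mul_one_sub, rpow_neg_one, rpow_def_of_pos hn']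
      have := Real.add_one_le_exp (Real.log n * -δ)
      rw [mul_div_assoc', div_eq_inv_mul]
      bound) N
  refine le_trans (le_of_eq ?_) h
  congr 1
  push_cast
  ring

end

open scoped ComplexOrder in
lemma one_le_prod_norm_LSeries {a v : ℕ → ℝ} {ν : ℕ → ℂ} {d : ℝ} {m : ℕ} (ha : IsLogFactor a v d) (hν1 : ν 1 = 1)
    (hνmul : ∀ x y, ν (x * y) = ν x * ν y) (hνm : ∀ n, ν n = 0 ∨ ν n ^ m = 1) {s : ℝ}
    (hs : ∀ i < m, LSeriesSummable (fun n => ν n ^ i * a n) s) :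
    1 ≤ ∏ i ∈ range m, ‖LSeries (fun n => ν n ^ i * a n) s‖ := by
  let F : ℕ → ArithmeticFunction ℂ := fun i => arithOf fun n => ν n ^ i * a n
  let V : ℕ → ArithmeticFunction ℂ := fun i => arithOf fun n => ν n ^ i * v n
  have hF : ∀ i, ∀ n : ℕ, 1 ≤ n → F i n * Real.log n = (V i * F i) n := by
    intro i n hn
    rw [arithOf_apply _ (by omega), mul_assoc, ← ofReal_mul, ha.conv n hn, ArithmeticFunction.mul_apply,
      ofReal_sum, mul_sum]
    refine sum_congr rfl fun x hx => ?_
    have hx0 := Nat.ne_zero_of_mem_divisorsAntidiagonal hx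
    obtain ⟨hxn, -⟩ := Nat.mem_divisorsAntidiagonal.mp hx
    rw [arithOf_apply _ hx0.1, arithOf_apply _ hx0.2, ← hxn, hνmul]
    push_cast
    ring
  have hFs : ∀ i, LSeries (fun n => F i n) s = LSeries (fun n => ν n ^ i * a n) s :=
    fun i => LSeries_congr (fun {n} hn => arithOf_apply _ hn) _
  have hFsum : ∀ i < m, LSeriesSummable (fun n => F i n) s := fun i hi =>
    (LSeriesSummable_congr _ (fun {n} hn => arithOf_apply _ hn)).mpr (hs i hi)
  obtain ⟨h1, h2⟩ := LSeries_prod_range hFsum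
  have hval : ∀ n : ℕ, n ≠ 0 → (∑ i ∈ range m, V i) n = v n * ∑ i ∈ range m, ν n ^ i := by
    intro n hn
    rw [mul_sum]
    have : ∀ k : ℕ, (∑ i ∈ range k, V i) n = ∑ i ∈ range k, v n * ν n ^ i := by
      intro k
      induction k with
      | zero => simp
      | succ k ih =>
        rw [sum_range_succ, sum_range_succ, ArithmeticFunction.add_apply, ih]
        rw [arithOf_apply _ hn, mul_comm]
    exact this m
  have hv1 : v 1 = 0 := le_antisymm (by simpa using ha.deriv_le 1) (ha.deriv_nonneg 1)
  have hb : ∀ n, 0 ≤ (∏ i ∈ range m, F i) n := by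
    refine nonneg_of_log_conv (W := ∑ i ∈ range m, V i) ?_ ?_ ?_ (prod_log_of_conv hF)
    · have : ∀ k : ℕ, (∏ i ∈ range k, F i) 1 = 1 := by
        intro k
        induction k with
        | zero => simp
        | succ k ih =>
          rw [prod_range_succ, ArithmeticFunction.mul_apply]
          simp only [Nat.divisorsAntidiagonal_one, sum_singleton, ih, one_mul, F]
          rw [arithOf_apply _ one_ne_zero, hν1, ha.one]
          simp
      exact this m
    · intro n
      rcases Nat.eq_zero_or_pos n with rfl | hn
      · simp
      rw [hval n hn.ne']
      refine mul_nonneg (by exact_mod_cast ha.deriv_nonneg n) ?_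
      rcases hνm n with h | h
      · positivity
      · by_cases h' : ν n = 1
        · rw [h']; simp
        · have := mul_neg_geom_sum (ν n) m
          rw [h, sub_self] at this
          rcases mul_eq_zero.mp this with h3 | h3
          · exact absurd (sub_eq_zero.mp h3).symm h'
          · rw [h3]
    · rw [hval 1 one_ne_zero, hv1]; simp
  have h3 : (∏ i ∈ range m, F i) 1 = 1 := by
    have : ∀ k : ℕ, (∏ i ∈ range k, F i) 1 = 1 := by
      intro k
      induction k with
      | zero => simp
      | succ k ih =>
        rw [prod_range_succ, ArithmeticFunction.mul_apply]
        simp only [Nat.divisorsAntidiagonal_one, sum_singleton, ih, one_mul, F]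
        rw [arithOf_apply _ one_ne_zero, hν1, ha.one]
        simp
    exact this m
  have h4 := one_le_norm_LSeries h3 hb h1
  simp_all

lemma LSeriesSummable_of_sum_le {a : ℕ → ℝ} {f : ℕ → ℂ} (ha : ∀ n, 0 ≤ a n) (hf : ∀ n, ‖f n‖ ≤ a n) {B : ℝ}
    (h0 : ∀ N : ℕ, 1 ≤ N → ∑ n ∈ Icc 1 N, a n ≤ B * N) {s : ℝ} (hs : 1 < s) : LSeriesSummable f s := by
  have h1 : LSeriesSummable (fun n => (a n : ℂ)) (s : ℂ) := by
    refine LSeriesSummable_of_sum_norm_bigO_and_nonneg (r := 1) ?_ ha zero_le_one (by simpa using hs)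
    refine Asymptotics.IsBigO.of_bound B (eventually_atTop.mpr ⟨1, fun N hN => ?_⟩)
    rw [norm_of_nonneg (sum_nonneg fun n _ => ha n), rpow_one, norm_of_nonneg (by positivity)]
    exact h0 N hN
  refine Summable.of_norm_bounded (summable_norm_iff.mpr h1) fun n => LSeries.norm_term_le _ ?_
  rw [norm_real, norm_of_nonneg (ha n)]
  exact hf n

lemma norm_LSeries_le_of_sum_le {a : ℕ → ℝ} (ha : ∀ n, 0 ≤ a n) {B : ℝ} (hB : 0 ≤ B)
    (h0 : ∀ N : ℕ, 1 ≤ N → ∑ n ∈ Icc 1 N, a n ≤ B * N) {δ : ℝ} (hδ : 0 < δ) (hδ1 : δ ≤ 1) :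
    ‖LSeries (fun n => (a n : ℂ)) ((1 + δ : ℝ) : ℂ)‖ ≤ 3 * B / δ := by
  have hs := LSeriesSummable_of_sum_le (f := fun n => (a n : ℂ)) ha
    (fun n => by rw [norm_real, norm_of_nonneg (ha n)]) h0 (s := 1 + δ) (by linarith)
  refine norm_LSeries_le hs fun N => ?_
  have hI : ∑ n ∈ Icc 1 N, (a n : ℂ) * (((n : ℝ) ^ (-(1 + δ)) : ℝ) : ℂ) =
      ∑ n ∈ Ioc 0 N, (a n : ℂ) * (((n : ℝ) ^ (-(1 + δ)) : ℝ) : ℂ) := rfl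
  refine (norm_sum_mul_antitone_le (f := fun n => (a n : ℂ)) (g := fun n => (n : ℝ) ^ (-(1 + δ)))
    le_rfl zero_le_one hB ?_ 0 N
    (fun n _ => by positivity) (fun n hn => rpow_le_rpow_of_nonpos (by norm_cast) (by push_cast; linarith)
      (by linarith))).trans ?_
  · intro N hN
    rw [← ofReal_sum, norm_real, norm_of_nonneg (sum_nonneg fun n _ => ha n)]
    simpa using h0 N hN
  · have h1 := sum_rpow_neg_le (M := 1) le_rfl N hδ
    have h2 : ∑ n ∈ Ioc (0 + 1) N, (n : ℝ) ^ (-0 : ℝ) * (n : ℝ) ^ (-(1 + δ)) ≤ 1 / δ := by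
      refine le_trans (le_of_eq (sum_congr rfl fun n _ => ?_)) (h1.trans (by simp))
      rw [neg_zero, rpow_zero, one_mul]; ring_nf
    have h3 : (1 : ℝ) ≤ 1 / δ := by rw [le_div_iff₀ hδ]; linarith
    have h4 : 3 * B / δ = B * (2 * (1 / δ) + 1 / δ) := by ring
    rw [h4]
    refine mul_le_mul_of_nonneg_left ?_ hB
    simp only [zero_add, Nat.cast_one, one_rpow] at h2 ⊢
    linarith

/-- Uniform bound for the logarithmic derivative of a Dirichlet series twisted by a multiplicative function of
order at least three. -/
theorem norm_sum_twist_le {a v : ℕ → ℝ} {ν : ℕ → ℂ} {d : ℝ} {m : ℕ} (ha : IsLogFactor a v d) (hν1 : ν 1 = 1)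
    (hνmul : ∀ x y, ν (x * y) = ν x * ν y) (hνm : ∀ n, ν n = 0 ∨ ν n ^ m = 1) (hm : 3 ≤ m)
    {B c CΛ : ℝ} (hc0 : 0 < c) (hc1 : c ≤ 1) (hB : 1 ≤ B) (hd : 0 ≤ d)
    (hΛ : ∀ N : ℕ, ∑ n ∈ Icc 1 N, ArithmeticFunction.vonMangoldt n * (n : ℝ) ^ (c - 1) ≤ CΛ * (N : ℝ) ^ c)
    (h0 : ∀ N : ℕ, 1 ≤ N → ∑ n ∈ Icc 1 N, a n ≤ B * N)
    (hi : ∀ i, 0 < i → i < m → ∀ N : ℕ, 1 ≤ N →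
      ‖∑ n ∈ Icc 1 N, ν n ^ i * (a n : ℂ)‖ ≤ B * (N : ℝ) ^ (1 - c)) (N : ℕ) :
    ‖∑ k ∈ Icc 1 N, (ν k * v k) * (((k : ℝ) ^ (-1 : ℝ) : ℝ) : ℂ)‖ ≤
      4 * (B * (7 + 4 / c ^ 2)) ^ m * (1 + 2 * d * CΛ) := by
  set D := B * (7 + 4 / c ^ 2) with hD
  have hc4 : 0 < 4 / c ^ 2 := by positivity
  have hD1 : 3 * B ≤ D := by nlinarith
  have hD0 : 1 ≤ D := by linarith
  have hνn : ∀ n, ‖ν n‖ ≤ 1 := by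
    intro n
    rcases hνm n with h | h
    · simp [h]
    · exact (norm_eq_one_of_pow_eq_one h (by omega)).le
  have hfn : ∀ i n, ‖ν n ^ i * (a n : ℂ)‖ ≤ a n := by
    intro i n
    rw [norm_mul, norm_pow, norm_real, norm_of_nonneg (ha.nonneg n)]
    exact mul_le_of_le_one_left (ha.nonneg n) (pow_le_one₀ (norm_nonneg _) (hνn n))
  have hsum : ∀ i, ∀ s : ℝ, 1 < s → LSeriesSummable (fun n => ν n ^ i * (a n : ℂ)) s :=
    fun i s hs => LSeriesSummable_of_sum_le ha.nonneg (hfn i) h0 hs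
  obtain ⟨L, hL⟩ := exists_limit_sum_div hc0 hc1 (by linarith : (0 : ℝ) ≤ B) (hi 1 one_pos (by omega))
  set δ : ℝ := (D ^ m)⁻¹ / 4 with hδ
  have hDm : 1 ≤ D ^ m := one_le_pow₀ hD0
  have hδ0 : 0 < δ := by positivity
  have hδ1 : δ ≤ 1 := by
    have : (D ^ m)⁻¹ ≤ 1 := inv_le_one_of_one_le₀ hDm
    linarith
  have hprod := one_le_prod_norm_LSeries ha hν1 hνmul hνm (s := 1 + δ)
    (fun i _ => hsum i _ (by linarith))
  set l : ℕ → ℝ := fun i => ‖LSeries (fun n => ν n ^ i * (a n : ℂ)) ((1 + δ : ℝ) : ℂ)‖ with hl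
  have hl0 : l 0 ≤ D / δ := by
    have h := norm_LSeries_le_of_sum_le ha.nonneg (by linarith) h0 hδ0 hδ1
    simp only [hl, pow_zero, one_mul]
    exact h.trans (by gcongr)
  have hli : ∀ i, 0 < i → i < m → l i ≤ D := fun i h1 h2 =>
    norm_LSeries_le_of_saving hc0 hc1 (by linarith) (hi i h1 h2) (by linarith) (hsum i _ (by linarith))
  have hconj : l (m - 1) = l 1 := by
    have h1 := tendsto_sum_LSeries (hsum 1 (1 + δ) (by linarith))
    have h2 := tendsto_sum_LSeries (hsum (m - 1) (1 + δ) (by linarith))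
    refine tendsto_nhds_unique h2.norm (h1.norm.congr fun N => ?_)
    rw [← norm_conj, map_sum]
    congr 1
    refine sum_congr rfl fun n _ => ?_
    rw [map_mul, map_mul, conj_ofReal, conj_ofReal, pow_one]
    congr 2
    rcases hνm n with h | h
    · rw [h, map_zero, zero_pow (by omega)]
    · have hn1 := norm_eq_one_of_pow_eq_one h (by omega)
      rw [← inv_eq_conj hn1]
      refine inv_eq_of_mul_eq_one_left ?_
      rw [← pow_succ, Nat.sub_add_cancel (by omega), h]
  have hlow : δ ≤ l 1 ^ 2 * D ^ (m - 2) := by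
    obtain ⟨k, rfl⟩ : ∃ k, m = k + 3 := ⟨m - 3, by omega⟩
    rw [prod_range_succ, prod_range_succ', prod_range_succ'] at hprod
    change 1 ≤ (∏ i ∈ range k, l (i + 1 + 1)) * l (0 + 1) * l 0 * l (k + 2) at hprod
    have hl2 : l (k + 2) = l 1 := hconj
    rw [hl2, zero_add] at hprod
    have hk : ∏ i ∈ range k, l (i + 1 + 1) ≤ D ^ k := by
      calc _ ≤ ∏ i ∈ range k, D := prod_le_prod (fun i _ => norm_nonneg _) fun i hi => hli _ (by omega) (by
            simp at hi; omega)
        _ = D ^ k := by simp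
    have h1 : 1 ≤ D ^ k * l 1 * (D / δ) * l 1 := hprod.trans (by
      gcongr)
    have h2 : D ^ k * l 1 * (D / δ) * l 1 = (l 1 ^ 2 * D ^ (k + 1)) / δ := by
      ring
    rw [h2, le_div_iff₀ hδ0, one_mul] at h1
    exact h1
  have hl1 : 2 * D * δ ≤ l 1 := by
    by_contra! hlt
    have h2 : l 1 ^ 2 * D ^ (m - 2) < (2 * D * δ) ^ 2 * D ^ (m - 2) := by gcongr
    have h3 : (2 * D * δ) ^ 2 * D ^ (m - 2) = 4 * D ^ m * δ * δ := by
      have : D ^ m = D ^ (m - 2) * D ^ 2 := by rw [← pow_add]; congr 1; omega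
      rw [this]; ring
    grind
  have hdiff := norm_LSeries_sub_limit_le hc0 hc1 (by linarith : (0 : ℝ) ≤ B) (hi 1 one_pos (by omega)) hδ0.le
    (hsum 1 _ (by linarith)) (by simpa using hL)
  have hLlow : D * δ ≤ ‖L‖ := by
    have : l 1 ≤ ‖LSeries (fun n => ν n ^ 1 * (a n : ℂ)) ((1 + δ : ℝ) : ℂ) - L‖ + ‖L‖ :=
      norm_le_norm_sub_add _ _
    linarith
  have hmain := norm_limit_mul_sum_le (f := fun n => ν n ^ 1 * (a n : ℂ)) (w := fun n => ν n * v n) hc0 hc1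
    (by linarith : (0 : ℝ) ≤ B) (hi 1 one_pos (by omega)) ?_ ?_ hd hΛ hL N
  · have h1 := (mul_le_mul_of_nonneg_right hLlow (norm_nonneg _)).trans hmain
    have h2 : D * δ * (4 * D ^ m) = D := by rw [hδ]; field_simp
    set P := ‖∑ k ∈ Icc 1 N, (ν k * v k) * (((k : ℝ) ^ (-1 : ℝ) : ℝ) : ℂ)‖
    have h3 : D * P ≤ D * (4 * D ^ m * (1 + 2 * d * CΛ)) := by
      calc D * P = D * δ * P * (4 * D ^ m) := by rw [mul_right_comm (D * δ) P, h2]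
        _ ≤ D * (1 + 2 * d * CΛ) * (4 * D ^ m) := by gcongr
        _ = _ := by ring
    exact le_of_mul_le_mul_left h3 (by linarith)
  · intro n hn
    rw [pow_one, mul_assoc, ← ofReal_mul, ha.conv n hn, ofReal_sum, mul_sum]
    refine sum_congr rfl fun x hx => ?_
    obtain ⟨rfl, -⟩ := Nat.mem_divisorsAntidiagonal.mp hx
    rw [hνmul]
    push_cast
    ring
  · intro n
    rw [norm_mul, norm_real, norm_of_nonneg (ha.deriv_nonneg n)]
    exact (mul_le_of_le_one_left (ha.deriv_nonneg n) (hνn n)).trans (ha.deriv_le n)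

end LowerBound

section RealCharacter

open Real Complex ArithmeticFunction

open Finset

lemma two_mul_sum_div_eq (d : ℕ) (hd : 0 < d) (N : ℕ) :
    2 * (d : ℤ) * ∑ n ∈ Icc 1 N, ((n / d : ℕ) : ℤ) =
      ((N : ℤ) + 1) ^ 2 - d * (N + 1) + ((N + 1) % d : ℕ) * (d - ((N + 1) % d : ℕ)) := by
  induction N with
  | zero =>
    rcases Nat.lt_or_ge 1 d with h | h
    · rw [Nat.mod_eq_of_lt (by simpa using h)]; simp
    · obtain rfl : d = 1 := by omega
      simp
  | succ N ih =>
    rw [sum_Icc_succ_top (by omega), mul_add, ih]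
    have h1 := Nat.div_add_mod (N + 1) d
    have hlt := Nat.mod_lt (N + 1) hd
    set q := (N + 1) / d
    set s := (N + 1) % d
    have hN : (N : ℤ) = d * q + s - 1 := by linarith
    rcases Nat.lt_or_ge (s + 1) d with h | h
    · have h2 : (N + 1 + 1) % d = s + 1 := by
        rw [← h1, add_assoc, Nat.mul_add_mod, Nat.mod_eq_of_lt h]
      rw [h2]
      push_cast
      rw [hN]
      ring
    · have h3 : s + 1 = d := by omega
      have h2 : (N + 1 + 1) % d = 0 := by
        rw [← h1, add_assoc, Nat.mul_add_mod, h3, Nat.mod_self]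
      rw [h2]
      have hd' : (d : ℤ) = s + 1 := by exact_mod_cast h3.symm
      push_cast
      rw [hN, hd']
      ring

lemma abs_sum_div_sub_le (d : ℕ) (hd : 0 < d) (N : ℕ) :
    |∑ n ∈ Icc 1 N, ((n / d : ℕ) : ℝ) - (((N : ℝ) + 1) ^ 2 / 2 * (d : ℝ)⁻¹ - ((N : ℝ) + 1) / 2)| ≤
      (d : ℝ) / 8 := by
  have h : 2 * (d : ℝ) * ∑ n ∈ Icc 1 N, ((n / d : ℕ) : ℝ) =
      ((N : ℝ) + 1) ^ 2 - d * (N + 1) + (((N + 1) % d : ℕ) : ℝ) * ((d : ℝ) - (((N + 1) % d : ℕ) : ℝ)) := by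
    have h := congrArg (fun z : ℤ => (z : ℝ)) (two_mul_sum_div_eq d hd N)
    push_cast at h ⊢
    exact h
  have hs : (((N + 1) % d : ℕ) : ℝ) ≤ d := by exact_mod_cast (Nat.mod_lt (N + 1) hd).le
  set s : ℝ := (((N + 1) % d : ℕ) : ℝ)
  have h2 : ∑ n ∈ Icc 1 N, ((n / d : ℕ) : ℝ) - (((N : ℝ) + 1) ^ 2 / 2 * (d : ℝ)⁻¹ - ((N : ℝ) + 1) / 2) =
      s * (d - s) / (2 * d) := by
    field_simp
    linarith
  rw [h2, abs_of_nonneg (by positivity), div_le_div_iff₀ (by positivity) (by norm_num)]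
  nlinarith [sq_nonneg ((d : ℝ) - 2 * s)]

lemma sum_div_le (d : ℕ) (hd : 0 < d) (N : ℕ) :
    ∑ n ∈ Icc 1 N, ((n / d : ℕ) : ℝ) ≤ ((N : ℝ) + 1) ^ 2 / 2 * (d : ℝ)⁻¹ := by
  calc ∑ n ∈ Icc 1 N, ((n / d : ℕ) : ℝ) ≤ ∑ n ∈ Icc 1 N, (n : ℝ) * (d : ℝ)⁻¹ :=
        sum_le_sum fun n _ => by exact Nat.cast_div_le
    _ = (∑ n ∈ Icc 1 N, (n : ℝ)) * (d : ℝ)⁻¹ := by rw [sum_mul]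
    _ ≤ _ := by
      refine mul_le_mul_of_nonneg_right ?_ (by positivity)
      have : ∀ N : ℕ, ∑ n ∈ Icc 1 N, (n : ℝ) ≤ ((N : ℝ) + 1) ^ 2 / 2 := by
        intro N
        induction N with
        | zero => simp
        | succ N ih => rw [sum_Icc_succ_top (by omega)]; push_cast; nlinarith
      exact this N

variable {ν : ℕ → ℝ}

lemma one_le_sum_divisors_sq (h1 : ν 1 = 1) (hmul : ∀ x y, ν (x * y) = ν x * ν y)
    (hval : ∀ n, ν n = 0 ∨ ν n = 1 ∨ ν n = -1) (n : ℕ) (hn : n ≠ 0) :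
    0 ≤ ∑ d ∈ n.divisors, ν d ∧ 1 ≤ ∑ d ∈ (n ^ 2).divisors, ν d := by
  have hpow : ∀ p k, ν (p ^ k) = ν p ^ k := by
    intro p k
    induction k with
    | zero => simp [h1]
    | succ k ih => rw [pow_succ, hmul, ih, pow_succ]
  have hmul' : ∀ a b : ℕ, a.Coprime b → ∑ d ∈ (a * b).divisors, ν d =
      (∑ d ∈ a.divisors, ν d) * ∑ d ∈ b.divisors, ν d := by
    intro a b hab
    let F : ArithmeticFunction ℝ := ⟨fun n => if n = 0 then 0 else ν n, by simp⟩
    have hF : ∀ n : ℕ, n ≠ 0 → F n = ν n := fun n hn => if_neg hn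
    have hFm : F.IsMultiplicative := by
      rw [IsMultiplicative.iff_ne_zero]
      simp_all
    have hs : ∀ n : ℕ, ∑ d ∈ n.divisors, ν d = (F * (zeta : ArithmeticFunction ℝ)) n := by
      intro n
      rw [coe_mul_zeta_apply]
      refine sum_congr rfl fun x hx => (hF x ?_).symm
      exact (Nat.pos_of_mem_divisors hx).ne'
    rw [hs, hs, hs]
    exact (hFm.mul isMultiplicative_zeta.natCast).map_mul_of_coprime hab
  induction n using Nat.recOnPosPrimePosCoprime with
  | zero => exact absurd rfl hn
  | one => simp [h1]
  | prime_pow p k hp hk =>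
    rw [Nat.sum_divisors_prime_pow hp, ← pow_mul, Nat.sum_divisors_prime_pow hp]
    simp only [hpow]
    rcases hval p with h | h | h
    · simp [h, sum_range_succ']
    · simp [h]
      positivity
    · rw [h, neg_one_geom_sum, neg_one_geom_sum]
      grind
  | coprime a b ha hb hab iha ihb =>
    have h3 := iha (by omega)
    have h4 := ihb (by omega)
    rw [mul_pow, hmul' _ _ hab, hmul' _ _ (hab.pow 2 2)]
    bound

/-- Effective lower bound for `L(1, ν)` for a real character `ν` with bounded partial sums. -/
theorem inv_le_norm_limit (h1 : ν 1 = 1) (hmul : ∀ x y, ν (x * y) = ν x * ν y)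
    (hval : ∀ n, ν n = 0 ∨ ν n = 1 ∨ ν n = -1) {Q : ℕ} (hQ : 1 ≤ Q)
    (hF : ∀ N : ℕ, |∑ n ∈ Icc 1 N, ν n| ≤ Q) {L : ℂ}
    (hL : ∀ N : ℕ, 1 ≤ N →
      ‖∑ n ∈ Icc 1 N, (ν n : ℂ) * (((n : ℝ) ^ (-1 : ℝ) : ℝ) : ℂ) - L‖ ≤ Q * (7 + 4 / (1 : ℝ) ^ 2) * (N : ℝ) ^ (-1 : ℝ)) :
    1 / (1000000 * (Q : ℝ) ^ 2) ≤ ‖L‖ := by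
  have hQ' : (1 : ℝ) ≤ Q := by exact_mod_cast hQ
  set T : ℕ := 100000 * Q ^ 2 with hT
  have hTr : (T : ℝ) = 100000 * (Q : ℝ) ^ 2 := by rw [hT]; push_cast; ring
  have hT1 : 1 ≤ T := by nlinarith
  have hT' : (1 : ℝ) ≤ T := by exact_mod_cast hT1
  obtain ⟨N, hN⟩ : ∃ N, N + 1 = 2 * T ^ 2 := by
    have : 0 < T ^ 2 := by positivity
    exact ⟨2 * T ^ 2 - 1, by omega⟩
  have hNr : (N : ℝ) + 1 = 2 * (T : ℝ) ^ 2 := by exact_mod_cast hN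
  set y : ℕ := 280 * Q * T with hy
  have hyr : (y : ℝ) = 280 * Q * T := by rw [hy]; push_cast; ring
  have hy1 : 1 ≤ y := by nlinarith
  have hyN : y ≤ N := by
    have : y + 1 ≤ 2 * T ^ 2 := by
      nlinarith
    omega
  set G : ℕ → ℝ := fun d => ∑ n ∈ Icc 1 N, ((n / d : ℕ) : ℝ) with hG
  -- the smoothed divisor sum
  have hR : (T : ℝ) ^ 3 ≤ ∑ d ∈ Icc 1 N, ν d * G d := by
    have e1 : ∑ d ∈ Icc 1 N, ν d * G d = ∑ n ∈ Icc 1 N, ∑ k ∈ Icc 1 n, ∑ d ∈ k.divisors, ν d := by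
      simp only [hG, mul_sum]
      rw [sum_comm]
      refine sum_congr rfl fun n hn => ?_
      have h2 := sum_sum_divisorsAntidiagonal_eq ν (fun _ => (1 : ℝ)) n
      simp only [mul_one, sum_const, Nat.card_Icc, nsmul_eq_mul, add_tsub_cancel_right] at h2
      have h3 : ∀ k : ℕ, ∑ x ∈ k.divisorsAntidiagonal, ν x.1 = ∑ d ∈ k.divisors, ν d :=
        fun k => Nat.sum_divisorsAntidiagonal (fun d _ => ν d)
      simp only [h3] at h2
      rw [h2]
      symm
      refine sum_subset (Icc_subset_Icc_right (by simp at hn; omega)) fun d hd hd' => ?_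
      simp_all
    rw [e1]
    have hnn : ∀ k : ℕ, 0 ≤ ∑ d ∈ k.divisors, ν d := fun k => by
      rcases Nat.eq_zero_or_pos k with rfl | hk
      · simp
      · exact (one_le_sum_divisors_sq h1 hmul hval k hk.ne').1
    have e2 : ∀ n ∈ Ico (T ^ 2) (2 * T ^ 2), (T : ℝ) ≤ ∑ k ∈ Icc 1 n, ∑ d ∈ k.divisors, ν d := by
      intro n hn
      have hn1 := (mem_Ico.mp hn).1
      calc (T : ℝ) = ∑ t ∈ Icc 1 T, (1 : ℝ) := by simp
        _ ≤ ∑ t ∈ Icc 1 T, ∑ d ∈ (t ^ 2).divisors, ν d := sum_le_sum fun t ht =>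
            (one_le_sum_divisors_sq h1 hmul hval t (by simp at ht; omega)).2
        _ = ∑ k ∈ (Icc 1 T).image (fun t => t ^ 2), ∑ d ∈ k.divisors, ν d := by
            rw [sum_image]
            simp
        _ ≤ _ := by
            refine sum_le_sum_of_subset_of_nonneg ?_ fun k _ _ => hnn k
            intro k hk
            obtain ⟨t, ht, rfl⟩ := mem_image.mp hk
            have ht' := mem_Icc.mp ht
            exact mem_Icc.mpr ⟨Nat.one_le_pow _ _ ht'.1, (Nat.pow_le_pow_left ht'.2 2).trans hn1⟩
    calc (T : ℝ) ^ 3 = ∑ n ∈ Ico (T ^ 2) (2 * T ^ 2), (T : ℝ) := by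
          rw [sum_const, Nat.card_Ico, nsmul_eq_mul, show 2 * T ^ 2 - T ^ 2 = T ^ 2 by omega]; push_cast; ring
      _ ≤ ∑ n ∈ Ico (T ^ 2) (2 * T ^ 2), ∑ k ∈ Icc 1 n, ∑ d ∈ k.divisors, ν d := sum_le_sum e2
      _ ≤ _ := by
        refine sum_le_sum_of_subset_of_nonneg (fun n hn => ?_) fun n _ _ => sum_nonneg fun k _ => hnn k
        grind
  have hFc : ∀ N : ℕ, 1 ≤ N → ‖∑ n ∈ Icc 1 N, (ν n : ℂ)‖ ≤ (Q : ℝ) * (N : ℝ) ^ (1 - 1 : ℝ) := by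
    intro N _
    rw [← ofReal_sum, norm_real]
    simpa using hF N
  have hGle : ∀ d, 1 ≤ d → G d ≤ ((N : ℝ) + 1) ^ 2 / 2 * (d : ℝ)⁻¹ := fun d hd => sum_div_le d hd N
  -- the tail
  have htail : |∑ d ∈ Ioc y N, ν d * G d| ≤ Q * (((N : ℝ) + 1) ^ 2 / 2) * (3 / y) := by
    have hyr0 : (0 : ℝ) < y := by exact_mod_cast hy1
    have h := norm_sum_mul_antitone_le (f := fun n => (ν n : ℂ)) (g := G) zero_le_one le_rfl (by positivity) hFc y N
      (fun n _ => sum_nonneg fun _ _ => by positivity)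
      (fun n hn => sum_le_sum fun k _ => by
        exact_mod_cast Nat.div_le_div_left (Nat.le_succ n) (by omega))
    have h2 : ∑ n ∈ Ioc y N, (ν n : ℂ) * (G n : ℂ) = ((∑ n ∈ Ioc y N, ν n * G n : ℝ) : ℂ) := by push_cast; rfl
    rw [h2, norm_real, norm_eq_abs] at h
    refine h.trans ?_
    rw [mul_assoc (Q : ℝ)]
    refine mul_le_mul_of_nonneg_left ?_ (by positivity)
    have hA : G (y + 1) ≤ ((N : ℝ) + 1) ^ 2 / 2 * (1 / y) := by
      refine (hGle _ (by omega)).trans (mul_le_mul_of_nonneg_left ?_ (by positivity))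
      rw [← one_div]
      bound
    have hB : ∑ n ∈ Ioc (y + 1) N, (n : ℝ) ^ (-1 : ℝ) * G n ≤ ((N : ℝ) + 1) ^ 2 / 2 * (1 / y) := by
      have hz := sum_rpow_neg_le hy1 N one_pos
      calc ∑ n ∈ Ioc (y + 1) N, (n : ℝ) ^ (-1 : ℝ) * G n
          ≤ ∑ n ∈ Ioc (y + 1) N, ((N : ℝ) + 1) ^ 2 / 2 * (n : ℝ) ^ (-1 - 1 : ℝ) := by
            refine sum_le_sum fun n hn => ?_
            have hn1 : 1 ≤ n := by simp at hn; omega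
            have hn0 : (0 : ℝ) < n := by exact_mod_cast hn1
            have h4 := hGle n hn1
            rw [rpow_sub_one hn0.ne', rpow_neg_one]
            calc (n : ℝ)⁻¹ * G n ≤ (n : ℝ)⁻¹ * (((N : ℝ) + 1) ^ 2 / 2 * (n : ℝ)⁻¹) :=
                  mul_le_mul_of_nonneg_left h4 (by positivity)
              _ = _ := by ring
        _ ≤ ∑ n ∈ Ioc y N, ((N : ℝ) + 1) ^ 2 / 2 * (n : ℝ) ^ (-1 - 1 : ℝ) :=
            sum_le_sum_of_subset_of_nonneg (Ioc_subset_Ioc_left (Nat.le_succ y)) fun _ _ _ => by positivity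
        _ ≤ _ := by
            rw [← mul_sum]
            refine mul_le_mul_of_nonneg_left (hz.trans (le_of_eq ?_)) (by positivity)
            rw [rpow_neg_one]; simp
    simp only [sub_self, rpow_zero, mul_one]
    grind
  -- the head
  have hhead : |∑ d ∈ Icc 1 y, ν d * G d| ≤
      ((N : ℝ) + 1) ^ 2 / 2 * (‖L‖ + 11 * Q / y) + ((N : ℝ) + 1) / 2 * Q + (y : ℝ) * (y / 8) := by
    have e : ∑ d ∈ Icc 1 y, ν d * G d = ((N : ℝ) + 1) ^ 2 / 2 * ∑ d ∈ Icc 1 y, ν d * (d : ℝ)⁻¹ -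
        ((N : ℝ) + 1) / 2 * ∑ d ∈ Icc 1 y, ν d +
        ∑ d ∈ Icc 1 y, ν d * (G d - (((N : ℝ) + 1) ^ 2 / 2 * (d : ℝ)⁻¹ - ((N : ℝ) + 1) / 2)) := by
      rw [mul_sum, mul_sum, ← sum_sub_distrib, ← sum_add_distrib]
      exact sum_congr rfl fun d _ => by ring
    rw [e]
    refine (abs_add_le _ _).trans (add_le_add ((abs_sub _ _).trans (add_le_add ?_ ?_)) ?_)
    · rw [abs_mul, abs_of_nonneg (by positivity : (0 : ℝ) ≤ ((N : ℝ) + 1) ^ 2 / 2)]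
      refine mul_le_mul_of_nonneg_left ?_ (by positivity)
      have h := hL y hy1
      have h2 : ∑ n ∈ Icc 1 y, (ν n : ℂ) * (((n : ℝ) ^ (-1 : ℝ) : ℝ) : ℂ) =
          ((∑ n ∈ Icc 1 y, ν n * (n : ℝ)⁻¹ : ℝ) : ℂ) := by
        push_cast
        exact sum_congr rfl fun n _ => by rw [rpow_neg_one]; push_cast; rfl
      rw [h2] at h
      have h3 := norm_le_norm_sub_add ((∑ n ∈ Icc 1 y, ν n * (n : ℝ)⁻¹ : ℝ) : ℂ) L
      rw [norm_real, norm_eq_abs] at h3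
      rw [rpow_neg_one] at h
      grind
    · rw [abs_mul, abs_of_nonneg (by positivity : (0 : ℝ) ≤ ((N : ℝ) + 1) / 2)]
      bound
    · refine (abs_sum_le_sum_abs _ _).trans ((sum_le_card_nsmul _ _ ((y : ℝ) / 8) fun d hd => ?_).trans (by simp))
      have hd' := mem_Icc.mp hd
      have h5 := abs_sum_div_sub_le d hd'.1 N
      have h6 : |ν d| ≤ 1 := by rcases hval d with h | h | h <;> simp [h]
      have h7 : (d : ℝ) ≤ y := by exact_mod_cast hd'.2
      rw [abs_mul]
      calc _ ≤ 1 * ((d : ℝ) / 8) := mul_le_mul h6 h5 (abs_nonneg _) zero_le_one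
        _ ≤ _ := by linarith
  have htot : (T : ℝ) ^ 3 ≤ ((N : ℝ) + 1) ^ 2 / 2 * (‖L‖ + 14 * Q / y) + ((N : ℝ) + 1) / 2 * Q + (y : ℝ) * (y / 8) := by
    have h := sum_Icc_one_eq_add (fun d => ν d * G d) hyN
    grind
  rw [hNr, hyr] at htot
  have h11 : (14 * (Q : ℝ) / (280 * Q * T)) = 1 / (20 * T) := by field_simp; norm_num
  rw [h11] at htot
  have h12 : (2 * (T : ℝ) ^ 2) ^ 2 / 2 * (‖L‖ + 1 / (20 * T)) = 2 * (T : ℝ) ^ 4 * ‖L‖ + (T : ℝ) ^ 3 / 10 := by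
    field_simp; ring
  rw [h12] at htot
  have h13 : 2 * (T : ℝ) ^ 2 / 2 * Q ≤ (T : ℝ) ^ 3 / 10 := by
    have : 10 * (Q : ℝ) ≤ T := by nlinarith
    nlinarith [sq_nonneg (T : ℝ)]
  have h14 : 280 * (Q : ℝ) * T * (280 * Q * T / 8) ≤ (T : ℝ) ^ 3 / 10 := by
    have h15 : 280 * (Q : ℝ) * T * (280 * Q * T / 8) = (T : ℝ) ^ 2 * (9800 * (Q : ℝ) ^ 2) := by ring
    nlinarith [sq_nonneg (T : ℝ)]
  have h17 : (T : ℝ) ^ 3 * 1 ≤ (T : ℝ) ^ 3 * (10 * T * ‖L‖) := by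
    grind
  have h19 := le_of_mul_le_mul_left h17 (by positivity)
  rw [hTr] at h19
  rw [div_le_iff₀ (by positivity)]
  linarith

end RealCharacter

section RationalCharacters

open Real Complex

open Finset ArithmeticFunction

lemma norm_sum_dirichletCharacter_le {Q : ℕ} [NeZero Q] {χ : DirichletCharacter ℂ Q} (hχ : χ ≠ 1) (N : ℕ) :
    ‖∑ n ∈ Icc 1 N, χ (n : ZMod Q)‖ ≤ Q := by
  have hzero : ∀ M : ℕ, ∑ i ∈ range Q, χ ((M + i : ℕ) : ZMod Q) = 0 := by
    intro M
    have h1 : ∑ a : ZMod Q, χ a = 0 := MulChar.sum_eq_zero_of_ne_one hχ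
    have h2 : ∑ a : ZMod Q, χ ((M : ZMod Q) + a) = 0 := by
      rw [← h1]
      exact Fintype.sum_equiv (Equiv.addLeft (M : ZMod Q)) _ _ fun _ => rfl
    rw [← h2]
    refine sum_bij (fun i _ => (i : ZMod Q)) (fun _ _ => mem_univ _) ?_ ?_ ?_
    · intro a ha b hb hab
      rw [ZMod.natCast_eq_natCast_iff'] at hab
      rwa [Nat.mod_eq_of_lt (mem_range.mp ha), Nat.mod_eq_of_lt (mem_range.mp hb)] at hab
    · intro b _
      exact ⟨b.val, mem_range.mpr (ZMod.val_lt b), ZMod.natCast_zmod_val b⟩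
    · intro a _
      push_cast; rfl
  have key : ∀ k M : ℕ, ‖∑ i ∈ range k, χ ((M + i : ℕ) : ZMod Q)‖ ≤ Q := by
    intro k
    induction k using Nat.strong_induction_on with
    | _ k ih =>
      intro M
      by_cases hk : k < Q
      · refine (norm_sum_le _ _).trans ((sum_le_card_nsmul _ _ 1 fun i _ => χ.norm_le_one _).trans ?_)
        simp only [card_range, nsmul_eq_mul, mul_one]
        exact_mod_cast hk.le
      · obtain ⟨j, rfl⟩ := Nat.exists_eq_add_of_le (not_lt.mp hk)
        have hQ := Nat.pos_of_ne_zero (NeZero.ne Q)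
        rw [sum_range_add, hzero, zero_add]
        simp_all
  have h := key N 1
  rw [← Ico_add_one_right_eq_Icc, sum_Ico_eq_sum_range]
  simpa using h

lemma isLogFactor_one_vonMangoldt : IsLogFactor (fun _ => 1) (fun n => vonMangoldt n) 1 where
  nonneg _ := zero_le_one
  one := rfl
  deriv_nonneg _ := vonMangoldt_nonneg
  deriv_le _ := by rw [one_mul]
  conv n _ := by
    rw [one_mul, ← vonMangoldt_sum, Nat.sum_divisorsAntidiagonal (fun d _ => vonMangoldt d * 1)]
    simp

/-- Twisted Mertens sums of nonprincipal Dirichlet characters are bounded polynomially in the modulus. -/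
theorem exists_norm_sum_dirichletCharacter_vonMangoldt_le : ∃ C : ℝ, 0 < C ∧ ∀ (Q : ℕ) [NeZero Q]
    (m : ℕ) (χ : DirichletCharacter ℂ Q), orderOf χ = m → 2 ≤ m → ∀ N : ℕ,
    ‖∑ k ∈ Icc 1 N, (χ (k : ZMod Q) * (vonMangoldt k : ℂ)) * (((k : ℝ) ^ (-1 : ℝ) : ℝ) : ℂ)‖ ≤
      C * (11 * (Q : ℝ)) ^ (m + 1) := by
  obtain ⟨CΛ, hC0, hΛ⟩ := exists_sum_vonMangoldt_rpow_le one_pos le_rfl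
  refine ⟨1000000 * (1 + 2 * 1 * CΛ), by positivity, fun Q _ m χ hm h2 N => ?_⟩
  have hQ1 : 1 ≤ Q := Nat.pos_of_ne_zero (NeZero.ne Q)
  have hQ : (1 : ℝ) ≤ Q := by exact_mod_cast hQ1
  have hmul : ∀ x y : ℕ, χ ((x * y : ℕ) : ZMod Q) = χ (x : ZMod Q) * χ (y : ZMod Q) := by
    intro x y; push_cast; rw [map_mul]
  have hpow : ∀ n : ℕ, χ (n : ZMod Q) = 0 ∨ χ (n : ZMod Q) ^ m = 1 := by
    intro n
    by_cases hu : IsUnit (n : ZMod Q)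
    · right
      have h3 : (χ ^ m) (n : ZMod Q) = 1 := by
        rw [← hm, pow_orderOf_eq_one, MulChar.one_apply hu]
      rwa [MulChar.pow_apply' _ (by omega)] at h3
    · left; exact MulChar.map_nonunit _ hu
  have hpart : ∀ i, 0 < i → i < m → ∀ N : ℕ, 1 ≤ N →
      ‖∑ n ∈ Icc 1 N, χ (n : ZMod Q) ^ i * ((1 : ℝ) : ℂ)‖ ≤ (Q : ℝ) * (N : ℝ) ^ (1 - 1 : ℝ) := by
    intro i hi0 him N _
    have hne : χ ^ i ≠ 1 := pow_ne_one_of_lt_orderOf hi0.ne' (hm ▸ him)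
    have h := norm_sum_dirichletCharacter_le hne N
    simp only [MulChar.pow_apply' _ hi0.ne'] at h
    simpa using h
  rcases h2.eq_or_lt with rfl | h3
  · have hF : ∀ N : ℕ, 1 ≤ N → ‖∑ n ∈ Icc 1 N, χ (n : ZMod Q)‖ ≤ (Q : ℝ) * (N : ℝ) ^ (1 - 1 : ℝ) := by
      intro N hN
      simpa using hpart 1 one_pos (by norm_num) N hN
    obtain ⟨L, hL⟩ := exists_limit_sum_div one_pos le_rfl (by positivity) hF
    have hval : ∀ n : ℕ, χ (n : ZMod Q) = 0 ∨ χ (n : ZMod Q) = 1 ∨ χ (n : ZMod Q) = -1 := by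
      grind
    have hre : ∀ n : ℕ, (((χ (n : ZMod Q)).re : ℝ) : ℂ) = χ (n : ZMod Q) := by
      intro n; rcases hval n with h | h | h <;> simp [h]
    have hlow := inv_le_norm_limit (ν := fun n => (χ (n : ZMod Q)).re) (by simp)
      (fun x y => by
        apply ofReal_injective
        rw [ofReal_mul, hre, hre, hre, hmul])
      (fun n => by rcases hval n with h | h | h <;> simp [h]) hQ1
      (fun N => by
        rw [← norm_eq_abs, ← norm_real, ofReal_sum]
        simp only [hre]
        have hne : χ ≠ 1 := by
          intro h; rw [h, orderOf_one] at hm; omega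
        exact norm_sum_dirichletCharacter_le hne N)
      (L := L) (fun N hN => by simp only [hre]; exact hL N hN)
    have hmain := norm_limit_mul_sum_le (w := fun n => χ (n : ZMod Q) * (vonMangoldt n : ℂ)) (d := 1) one_pos le_rfl (by positivity) hF
      (fun n hn => by
        rw [← vonMangoldt_sum, ← Nat.sum_divisorsAntidiagonal (fun d _ => vonMangoldt d), ofReal_sum, mul_sum]
        refine sum_congr rfl fun x hx => ?_
        rw [← (Nat.mem_divisorsAntidiagonal.mp hx).1, hmul]; ring)
      (fun n => by
        rw [norm_mul, norm_real, norm_of_nonneg vonMangoldt_nonneg]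
        exact mul_le_mul_of_nonneg_right (χ.norm_le_one _) vonMangoldt_nonneg)
      zero_le_one hΛ hL N
    set S := ‖∑ k ∈ Icc 1 N, (χ (k : ZMod Q) * (vonMangoldt k : ℂ)) * (((k : ℝ) ^ (-1 : ℝ) : ℝ) : ℂ)‖
    have h5 : 1 / (1000000 * (Q : ℝ) ^ 2) * S ≤ Q * (7 + 4 / 1 ^ 2) * (1 + 2 * 1 * CΛ) :=
      (mul_le_mul_of_nonneg_right hlow (norm_nonneg _)).trans hmain
    have h6 : S = 1000000 * (Q : ℝ) ^ 2 * (1 / (1000000 * (Q : ℝ) ^ 2) * S) := by field_simp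
    rw [h6]
    calc _ ≤ 1000000 * (Q : ℝ) ^ 2 * (Q * (7 + 4 / 1 ^ 2) * (1 + 2 * 1 * CΛ)) :=
          mul_le_mul_of_nonneg_left h5 (by positivity)
      _ = 1000000 * (1 + 2 * 1 * CΛ) * (11 * (Q : ℝ) ^ 3) := by ring
      _ ≤ 1000000 * (1 + 2 * 1 * CΛ) * (11 * (Q : ℝ)) ^ (2 + 1) := by
          refine mul_le_mul_of_nonneg_left ?_ (by positivity)
          have : (0 : ℝ) ≤ (Q : ℝ) ^ 3 := by positivity
          norm_num; linarith
  · have h := norm_sum_twist_le (ν := fun n => χ (n : ZMod Q)) isLogFactor_one_vonMangoldt (by simp) hmul hpow h3 one_pos le_rfl hQ zero_le_one hΛ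
      (fun N hN => by
        simp only [sum_const, Nat.card_Icc, nsmul_eq_mul, mul_one, add_tsub_cancel_right]
        nlinarith) hpart N
    refine h.trans ?_
    have h7 : (Q : ℝ) * (7 + 4 / 1 ^ 2) = 11 * Q := by ring
    rw [h7]
    calc 4 * (11 * (Q : ℝ)) ^ m * (1 + 2 * 1 * CΛ) = (4 * (1 + 2 * 1 * CΛ)) * ((11 * (Q : ℝ)) ^ m * 1) := by ring
      _ ≤ (1000000 * (1 + 2 * 1 * CΛ)) * ((11 * (Q : ℝ)) ^ m * (11 * (Q : ℝ))) := by
        bound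
      _ = _ := by rw [pow_succ]

end RationalCharacters

section PrimeSums

open Real Complex

open Finset ArithmeticFunction

/-- The weight `log p / p`, supported on primes. -/
noncomputable def primeWeight (n : ℕ) : ℝ := if n.Prime then Real.log n / n else 0

lemma primeWeight_nonneg (n : ℕ) : 0 ≤ primeWeight n := by
  unfold primeWeight
  positivity

lemma exists_sum_sub_primeWeight_le : ∃ C : ℝ, 0 < C ∧ ∀ N : ℕ,
    ∑ n ∈ Icc 1 N, (vonMangoldt n / n - primeWeight n) ≤ C := by
  have hs := vonMangoldt.summable_residueClass_non_primes_div (a := (0 : ZMod 1))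
  refine ⟨(∑' n : ℕ, (if n.Prime then 0 else vonMangoldt.residueClass (0 : ZMod 1) n) / n) + 1, ?_, fun N => ?_⟩
  · have : 0 ≤ ∑' n : ℕ, (if n.Prime then 0 else vonMangoldt.residueClass (0 : ZMod 1) n) / n :=
      tsum_nonneg fun n => by
        have := vonMangoldt.residueClass_nonneg (0 : ZMod 1) n
        split_ifs <;> positivity
    linarith
  · have h := hs.sum_le_tsum (Icc 1 N) fun n _ => by
      have := vonMangoldt.residueClass_nonneg (0 : ZMod 1) n
      split_ifs <;> positivity
    refine (le_of_eq (sum_congr rfl fun n _ => ?_)).trans (h.trans (by linarith))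
    have : vonMangoldt.residueClass (0 : ZMod 1) n = vonMangoldt n := by
      simp [vonMangoldt.residueClass, Subsingleton.elim _ (0 : ZMod 1)]
    unfold primeWeight
    split_ifs with hp
    · rw [vonMangoldt_apply_prime hp]; simp
    · rw [this]; simp

lemma IsLogFactor.deriv_prime {a v : ℕ → ℝ} {d : ℝ} (ha : IsLogFactor a v d) {p : ℕ} (hp : p.Prime) :
    v p = a p * Real.log p := by
  have h1 : v 1 = 0 := le_antisymm (by simpa using ha.deriv_le 1) (ha.deriv_nonneg 1)
  rw [ha.conv p hp.one_le, Nat.sum_divisorsAntidiagonal (fun x y => v x * a y), hp.sum_divisors,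
    Nat.div_self hp.pos, h1, ha.one]
  ring

lemma norm_sum_deriv_sub_primeWeight_le {a v : ℕ → ℝ} {d : ℝ} (ha : IsLogFactor a v d) {C : ℝ}
    (hC : ∀ N : ℕ, ∑ n ∈ Icc 1 N, (vonMangoldt n / n - primeWeight n) ≤ C) (hd : 0 ≤ d)
    {ν : ℕ → ℂ} (hν : ∀ n, ‖ν n‖ ≤ 1) (N : ℕ) :
    ‖∑ k ∈ Icc 1 N, (ν k * v k) * (((k : ℝ) ^ (-1 : ℝ) : ℝ) : ℂ) -
      ∑ p ∈ Icc 1 N, ν p * (a p : ℂ) * (primeWeight p : ℂ)‖ ≤ d * C := by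
  rw [← sum_sub_distrib]
  refine (norm_sum_le _ _).trans ?_
  calc _ ≤ ∑ n ∈ Icc 1 N, d * (vonMangoldt n / n - primeWeight n) := sum_le_sum fun n _ => ?_
    _ ≤ d * C := by rw [← mul_sum]; exact mul_le_mul_of_nonneg_left (hC N) hd
  have e : (ν n * v n) * (((n : ℝ) ^ (-1 : ℝ) : ℝ) : ℂ) - ν n * (a n : ℂ) * (primeWeight n : ℂ) =
      ν n * ((v n / n - a n * primeWeight n : ℝ) : ℂ) := by
    rw [rpow_neg_one]; push_cast; ring
  rw [e, norm_mul, norm_real, Real.norm_eq_abs]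
  have hle : |v n / n - a n * primeWeight n| ≤ d * (vonMangoldt n / n - primeWeight n) := by
    by_cases hp : n.Prime
    · rw [ha.deriv_prime hp]
      unfold primeWeight
      rw [if_pos hp, vonMangoldt_apply_prime hp]
      simp [mul_div_assoc]
    · have h1 := ha.deriv_le n
      have h0 := ha.deriv_nonneg n
      unfold primeWeight
      rw [if_neg hp, mul_zero, sub_zero, sub_zero, abs_of_nonneg (by positivity), ← mul_div_assoc]
      gcongr
  calc _ ≤ 1 * |v n / n - a n * primeWeight n| := mul_le_mul_of_nonneg_right (hν n) (abs_nonneg _)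
    _ ≤ _ := by rw [one_mul]; exact hle

lemma log_div_le_sum {n N : ℕ} (hn : 1 ≤ n) (hN : n ≤ N) :
    Real.log N - Real.log n ≤ ∑ m ∈ Ico n N, (m : ℝ)⁻¹ := by
  induction N, hN using Nat.le_induction with
  | base => simp
  | succ N hN ih =>
    rw [sum_Ico_succ_top hN]
    have h0 : (0 : ℝ) < N := by exact_mod_cast (by omega : 0 < N)
    have h1 : Real.log ((N + 1 : ℕ) : ℝ) - Real.log N ≤ (N : ℝ)⁻¹ := by
      rw [← Real.log_div (by positivity) h0.ne']
      refine (log_le_sub_one_of_pos (by positivity)).trans (le_of_eq ?_)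
      push_cast; field_simp; ring
    linarith

theorem exists_abs_sum_primeWeight_sub_log_le {a v : ℕ → ℝ} {d : ℝ} (ha : IsLogFactor a v d) (hd : 0 ≤ d)
    {κ B c : ℝ} (hκ : 0 < κ) (hB : 0 ≤ B) (hc0 : 0 < c) (hc1 : c ≤ 1)
    (hA : ∀ N : ℕ, 1 ≤ N → |∑ n ∈ Icc 1 N, a n - κ * N| ≤ B * (N : ℝ) ^ (1 - c)) :
    ∃ C : ℝ, 0 < C ∧ ∀ N : ℕ, 1 ≤ N → |∑ p ∈ Icc 1 N, a p * primeWeight p - Real.log N| ≤ C := by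
  obtain ⟨CΛ, hCΛ, hΛ⟩ := exists_sum_vonMangoldt_rpow_le hc0 hc1
  obtain ⟨C0, hC0, hP⟩ := exists_sum_sub_primeWeight_le
  refine ⟨((κ + B) * (d * CΛ) + (κ + B) + B / c) / κ + d * C0, by positivity, fun N hN => ?_⟩
  have hN0 : (0 : ℝ) < N := by exact_mod_cast hN
  have hle1 : ∀ M : ℕ, 1 ≤ M → ∑ n ∈ Icc 1 M, a n ≤ (κ + B) * M := by
    intro M hM
    have h1 := (abs_le.mp (hA M hM)).2
    have hM1 : (1 : ℝ) ≤ M := by exact_mod_cast hM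
    have h2 : (M : ℝ) ^ (1 - c) ≤ M := by
      simpa using rpow_le_rpow_of_exponent_le hM1 (by linarith : 1 - c ≤ 1)
    nlinarith [mul_le_mul_of_nonneg_left h2 hB]
  -- the convolution side
  have hconv : ∑ n ∈ Icc 1 N, a n * Real.log n = ∑ k ∈ Icc 1 N, v k * ∑ m ∈ Icc 1 (N / k), a m := by
    rw [← sum_sum_divisorsAntidiagonal_eq]
    exact sum_congr rfl fun n hn => ha.conv n (mem_Icc.mp hn).1
  have h1 : |∑ n ∈ Icc 1 N, a n * Real.log n - κ * N * ∑ k ∈ Icc 1 N, v k / k| ≤ (κ + B) * (d * CΛ) * N := by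
    rw [hconv, mul_sum, ← sum_sub_distrib]
    refine (abs_sum_le_sum_abs _ _).trans ?_
    calc _ ≤ ∑ k ∈ Icc 1 N, (κ + B) * (d * (N : ℝ) ^ (1 - c)) * (vonMangoldt k * (k : ℝ) ^ (c - 1)) :=
          sum_le_sum fun k hk => ?_
      _ = (κ + B) * (d * (N : ℝ) ^ (1 - c)) * ∑ k ∈ Icc 1 N, vonMangoldt k * (k : ℝ) ^ (c - 1) := by rw [mul_sum]
      _ ≤ (κ + B) * (d * (N : ℝ) ^ (1 - c)) * (CΛ * (N : ℝ) ^ c) := by gcongr; exact hΛ N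
      _ = (κ + B) * (d * CΛ) * ((N : ℝ) ^ (1 - c) * (N : ℝ) ^ c) := by ring
      _ = _ := by rw [← rpow_add hN0]; simp
    obtain ⟨hk1, hkN⟩ := mem_Icc.mp hk
    have hk0 : (0 : ℝ) < k := by exact_mod_cast hk1
    have hdiv1 : 1 ≤ N / k := Nat.div_pos hkN hk1
    have hfl : ((N / k : ℕ) : ℝ) ≤ (N : ℝ) / k := Nat.cast_div_le
    have hfl2 : (N : ℝ) / k ≤ ((N / k : ℕ) : ℝ) + 1 := by
      rw [div_le_iff₀ hk0]
      have := Nat.lt_div_mul_add hk1 (a := N)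
      exact_mod_cast (by nlinarith : N ≤ (N / k + 1) * k)
    have hNk : (1 : ℝ) ≤ (N : ℝ) / k := by
      rw [one_le_div hk0]; exact_mod_cast hkN
    have hp1 : (1 : ℝ) ≤ ((N : ℝ) / k) ^ (1 - c) := one_le_rpow hNk (by linarith)
    have hp2 : ((N / k : ℕ) : ℝ) ^ (1 - c) ≤ ((N : ℝ) / k) ^ (1 - c) :=
      rpow_le_rpow (by positivity) hfl (by linarith)
    have h3 := abs_le.mp (hA (N / k) hdiv1)
    have h4 : |∑ m ∈ Icc 1 (N / k), a m - κ * ((N : ℝ) / k)| ≤ (κ + B) * ((N : ℝ) / k) ^ (1 - c) := by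
      rw [abs_le]
      constructor <;> nlinarith
    have e : v k * ∑ m ∈ Icc 1 (N / k), a m - κ * N * (v k / k) =
        v k * (∑ m ∈ Icc 1 (N / k), a m - κ * ((N : ℝ) / k)) := by ring
    rw [e, abs_mul, abs_of_nonneg (ha.deriv_nonneg k)]
    calc _ ≤ (d * vonMangoldt k) * ((κ + B) * ((N : ℝ) / k) ^ (1 - c)) :=
          mul_le_mul (ha.deriv_le k) h4 (abs_nonneg _) (mul_nonneg hd vonMangoldt_nonneg)
      _ = _ := by
        rw [div_rpow hN0.le hk0.le, show c - 1 = -(1 - c) by ring, rpow_neg hk0.le]; ring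
  -- the direct side
  have h2 : |∑ n ∈ Icc 1 N, a n * Real.log n - κ * N * Real.log N| ≤ (κ + B) * N + B / c * N := by
    have h3 : 0 ≤ ∑ n ∈ Icc 1 N, a n * (Real.log N - Real.log n) := sum_nonneg fun n hn => by
      obtain ⟨hn1, hnN⟩ := mem_Icc.mp hn
      refine mul_nonneg (ha.nonneg n) (sub_nonneg.mpr (log_le_log ?_ ?_))
      · exact_mod_cast hn1
      · exact_mod_cast hnN
    have h4 : ∑ n ∈ Icc 1 N, a n * (Real.log N - Real.log n) ≤ (κ + B) * N := by
      calc _ ≤ ∑ n ∈ Icc 1 N, a n * ∑ m ∈ Ico n N, (m : ℝ)⁻¹ := sum_le_sum fun n hn => by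
            obtain ⟨hn1, hnN⟩ := mem_Icc.mp hn
            exact mul_le_mul_of_nonneg_left (log_div_le_sum hn1 hnN) (ha.nonneg n)
        _ = ∑ m ∈ Ico 1 N, (m : ℝ)⁻¹ * ∑ n ∈ Icc 1 m, a n := by
            simp only [mul_sum]
            rw [sum_comm' (t' := Ico 1 N) (s' := fun m => Icc 1 m)]
            · grind
            grind
        _ ≤ ∑ m ∈ Ico 1 N, (κ + B) := sum_le_sum fun m hm => by
            have hm1 := (mem_Ico.mp hm).1
            calc (m : ℝ)⁻¹ * ∑ n ∈ Icc 1 m, a n ≤ (m : ℝ)⁻¹ * ((κ + B) * m) :=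
                  mul_le_mul_of_nonneg_left (hle1 m hm1) (by positivity)
              _ = κ + B := by field_simp
        _ ≤ (κ + B) * N := by
            rw [sum_const, Nat.card_Ico, nsmul_eq_mul, mul_comm]
            gcongr; omega
    have h5 : |(∑ n ∈ Icc 1 N, a n - κ * N) * Real.log N| ≤ B / c * N := by
      have hl := log_natCast_nonneg N
      have hl2 : Real.log N ≤ (N : ℝ) ^ c / c := Real.log_le_rpow_div hN0.le hc0
      rw [abs_mul, abs_of_nonneg hl]
      calc _ ≤ (B * (N : ℝ) ^ (1 - c)) * ((N : ℝ) ^ c / c) := mul_le_mul (hA N hN) hl2 hl (by positivity)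
        _ = B / c * ((N : ℝ) ^ (1 - c) * (N : ℝ) ^ c) := by ring
        _ = _ := by rw [← rpow_add hN0]; simp
    have e : ∑ n ∈ Icc 1 N, a n * Real.log n - κ * N * Real.log N =
        (∑ n ∈ Icc 1 N, a n - κ * N) * Real.log N - ∑ n ∈ Icc 1 N, a n * (Real.log N - Real.log n) := by
      simp only [mul_sub, sum_sub_distrib, ← sum_mul]; ring
    grind
  have h6 : |∑ k ∈ Icc 1 N, v k / k - Real.log N| ≤ ((κ + B) * (d * CΛ) + (κ + B) + B / c) / κ := by
    rw [le_div_iff₀ hκ]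
    refine le_of_mul_le_mul_right ?_ hN0
    have e : |∑ k ∈ Icc 1 N, v k / k - Real.log N| * κ * N =
        |(∑ n ∈ Icc 1 N, a n * Real.log n - κ * N * Real.log N) -
          (∑ n ∈ Icc 1 N, a n * Real.log n - κ * N * ∑ k ∈ Icc 1 N, v k / k)| := by
      rw [sub_sub_sub_cancel_left, ← mul_sub, abs_mul, abs_of_nonneg (by positivity : 0 ≤ κ * N)]; ring
    grind
  have h7 := norm_sum_deriv_sub_primeWeight_le ha hP hd (ν := fun _ => 1) (by simp) N
  have e7 : ∑ k ∈ Icc 1 N, ((1 : ℂ) * v k) * (((k : ℝ) ^ (-1 : ℝ) : ℝ) : ℂ) -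
      ∑ p ∈ Icc 1 N, (1 : ℂ) * (a p : ℂ) * (primeWeight p : ℂ) =
      ((∑ k ∈ Icc 1 N, v k / k - ∑ p ∈ Icc 1 N, a p * primeWeight p : ℝ) : ℂ) := by
    push_cast
    congr 1
    · exact sum_congr rfl fun k _ => by rw [rpow_neg_one]; push_cast; ring
    · exact sum_congr rfl fun k _ => by ring
  rw [e7, norm_real, norm_eq_abs] at h7
  rw [abs_le] at *
  grind

end PrimeSums

section

open MeasureTheory Module Pointwise NumberField NumberField.InfinitePlace NumberField.Units
  NumberField.Units.dirichletUnitTheorem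
open scoped Classical NNReal ENNReal nonZeroDivisors

section DedekindLog

open Finset Real Ideal ArithmeticFunction

open UniqueFactorizationMonoid

variable (E : Type*) [Field E] [NumberField E]

noncomputable def idealsOfNorm (n : ℕ) : Finset (Ideal (𝓞 E)) := (finite_setOfPred_absNorm_eq n).toFinset

noncomputable def primesUpTo (n : ℕ) : Finset (Ideal (𝓞 E)) :=
  (finite_setOfPred_absNorm_le (S := 𝓞 E) n).toFinset.filter fun P => Prime P

/-- The von Mangoldt function of a number field, summed over ideals of norm `n`. -/
noncomputable def fieldVonMangoldt (n : ℕ) : ℝ :=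
  ∑ P ∈ primesUpTo E n, ∑ j ∈ Icc 1 n,
    if Ideal.absNorm P ^ j = n then Real.log (Ideal.absNorm P) else 0

variable {E}

lemma mem_idealsOfNorm {n : ℕ} {I : Ideal (𝓞 E)} : I ∈ idealsOfNorm E n ↔ absNorm I = n := by
  simp [idealsOfNorm]

lemma mem_primesUpTo {n : ℕ} {P : Ideal (𝓞 E)} :
    P ∈ primesUpTo E n ↔ absNorm P ≤ n ∧ Prime P := by
  simp [primesUpTo]

lemma idealCount_eq_card (n : ℕ) : idealCount E n = (idealsOfNorm E n).card := by
  exact Nat.subtype_card (idealsOfNorm E n) fun I => mem_idealsOfNorm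

lemma two_le_absNorm_of_prime {P : Ideal (𝓞 E)} (hP : Prime P) : 2 ≤ absNorm P := by
  have h0 : absNorm P ≠ 0 := by
    rw [Ne, absNorm_eq_zero_iff]; exact hP.ne_zero
  have h1 : absNorm P ≠ 1 := by
    rw [Ne, absNorm_eq_one_iff, ← one_eq_top]; exact hP.ne_one
  omega

lemma le_of_absNorm_pow_le {P : Ideal (𝓞 E)} (hP : Prime P) {j n : ℕ} (hj : 1 ≤ j)
    (h : absNorm P ^ j ≤ n) : absNorm P ≤ n ∧ j ≤ n := by
  have h2 := two_le_absNorm_of_prime hP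
  refine ⟨(Nat.le_self_pow (by omega) _).trans h, ?_⟩
  exact (Nat.lt_two_pow_self.le.trans (Nat.pow_le_pow_left h2 j)).trans h

lemma fieldVonMangoldt_eq {n N : ℕ} (hn : n ≤ N) : fieldVonMangoldt E n =
    ∑ P ∈ primesUpTo E N, ∑ j ∈ Icc 1 N,
      if Ideal.absNorm P ^ j = n then Real.log (Ideal.absNorm P) else 0 := by
  have h1 : ∀ P ∈ primesUpTo E N, ∑ j ∈ Icc 1 N,
      (if Ideal.absNorm P ^ j = n then Real.log (Ideal.absNorm P) else 0) =
      ∑ j ∈ Finset.Icc 1 n, if Ideal.absNorm P ^ j = n then Real.log (Ideal.absNorm P) else 0 := by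
    intro P hP
    symm
    refine sum_subset (Icc_subset_Icc_right hn) fun j hj hj' => if_neg fun h => hj' ?_
    have hj1 := (mem_Icc.mp hj).1
    exact mem_Icc.mpr ⟨hj1, (le_of_absNorm_pow_le (mem_primesUpTo.mp hP).2 hj1 h.le).2⟩
  rw [sum_congr rfl h1]
  refine sum_subset (fun P hP => ?_) fun P hP hP' => sum_eq_zero fun j hj => if_neg fun h => hP' ?_
  · rw [mem_primesUpTo] at *
    exact ⟨hP.1.trans hn, hP.2⟩
  · have h2 := (mem_primesUpTo.mp hP).2
    exact mem_primesUpTo.mpr ⟨(le_of_absNorm_pow_le h2 (mem_Icc.mp hj).1 h.le).1, h2⟩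

lemma log_absNorm_eq_sum {I : Ideal (𝓞 E)} {n : ℕ} (hn : n ≠ 0) (hI : Ideal.absNorm I = n) :
    Real.log n = ∑ P ∈ primesUpTo E n, ∑ j ∈ Finset.Icc 1 n,
      if P ^ j ∣ I then Real.log (Ideal.absNorm P) else 0 := by
  have hI0 : I ≠ 0 := by
    grind
  have h1 : Real.log n = ∑ P ∈ (normalizedFactors I).toFinset,
      (normalizedFactors I).count P • Real.log (Ideal.absNorm P) := by
    have h2 : (normalizedFactors I).prod = I := by
      rw [prod_normalizedFactors_eq hI0, normalize_eq]
    have h3 : (n : ℝ) = ∏ P ∈ (normalizedFactors I).toFinset,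
        (absNorm P : ℝ) ^ (normalizedFactors I).count P := by
      rw [← hI]
      conv_lhs => rw [← h2]
      rw [map_multiset_prod, prod_multiset_map_count]
      push_cast; rfl
    rw [h3, log_prod]
    · simp
    · intro P hP
      have h5 := prime_of_normalized_factor P (Multiset.mem_toFinset.mp hP)
      have h6 := two_le_absNorm_of_prime h5
      positivity
  have hle : ∀ {P : Ideal (𝓞 E)} {j : ℕ}, P ^ j ∣ I → absNorm P ^ j ≤ n := by
    intro P j h
    rw [← hI, ← map_pow]
    exact Nat.le_of_dvd (by omega) (map_dvd absNorm h)
  have hdvd : ∀ {P : Ideal (𝓞 E)} (_ : Prime P) (j : ℕ), P ^ j ∣ I ↔ j ≤ (normalizedFactors I).count P := by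
    intro P hP j
    rw [pow_dvd_iff_le_emultiplicity, emultiplicity_eq_count_normalizedFactors hP.irreducible hI0,
      normalize_eq]
    exact Nat.cast_le
  have h7 : ∀ P ∈ primesUpTo E n, (∑ j ∈ Icc 1 n,
      if P ^ j ∣ I then Real.log (Ideal.absNorm P) else 0) =
      (normalizedFactors I).count P • Real.log (Ideal.absNorm P) := by
    intro P hP
    have hP' := (mem_primesUpTo.mp hP).2
    rw [← sum_filter, sum_const]
    have : (Icc 1 n).filter (fun j => P ^ j ∣ I) = Icc 1 ((normalizedFactors I).count P) := by
      ext j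
      rw [mem_filter, mem_Icc, mem_Icc, hdvd hP']
      constructor
      · exact fun h => ⟨h.1.1, h.2⟩
      · exact fun h => ⟨⟨h.1, (le_of_absNorm_pow_le hP' h.1 (hle ((hdvd hP' j).mpr h.2))).2⟩, h.2⟩
    simp_all
  rw [h1, sum_congr rfl h7]
  refine sum_subset (fun P hP => ?_) fun P _ hP' => ?_
  · have hm := Multiset.mem_toFinset.mp hP
    have h5 := prime_of_normalized_factor P hm
    refine mem_primesUpTo.mpr ⟨?_, h5⟩
    have := hle (P := P) (j := 1) (by rw [pow_one]; exact dvd_of_mem_normalizedFactors hm)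
    simpa using this
  · rw [Multiset.mem_toFinset] at hP'
    simp_all

lemma sum_divisorsAntidiagonal_idealCount {n : ℕ} (hn : n ≠ 0) {B : Ideal (𝓞 E)} (hB : B ≠ 0) (c : ℝ) :
    ∑ x ∈ n.divisorsAntidiagonal, (if absNorm B = x.1 then c else 0) * (idealCount E x.2 : ℝ) =
      ∑ I ∈ idealsOfNorm E n, if B ∣ I then c else 0 := by
  have hB0 : absNorm B ≠ 0 := by rwa [Ne, absNorm_eq_zero_iff]
  by_cases h : absNorm B ∣ n
  · obtain ⟨k, hk⟩ := h
    rw [sum_eq_single (absNorm B, k)]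
    · rw [if_pos rfl, ← sum_filter, sum_const, nsmul_eq_mul, mul_comm]
      congr 2
      rw [idealCount_eq_card]
      refine card_bij (fun J _ => B * J) ?_ ?_ ?_
      · intro J hJ
        rw [mem_filter, mem_idealsOfNorm, map_mul, mem_idealsOfNorm.mp hJ]
        exact ⟨hk.symm, dvd_mul_right _ _⟩
      · simp_all
      · intro I hI
        rw [mem_filter, mem_idealsOfNorm] at hI
        obtain ⟨h1, J, rfl⟩ := hI
        refine ⟨J, ?_, rfl⟩
        rw [mem_idealsOfNorm]
        simp_all
    · intro x hx hne
      rw [if_neg, zero_mul]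
      intro h1
      apply hne
      have h2 := (Nat.mem_divisorsAntidiagonal.mp hx).1
      rw [← h1, hk] at h2
      exact Prod.ext h1.symm (Nat.eq_of_mul_eq_mul_left (Nat.pos_of_ne_zero hB0) h2)
    simp_all
  · rw [sum_eq_zero, sum_eq_zero]
    · intro I hI
      rw [if_neg]
      intro h1
      apply h
      rw [← mem_idealsOfNorm.mp hI]
      exact map_dvd absNorm h1
    · intro x hx
      rw [if_neg, zero_mul]
      intro h1
      exact h (h1 ▸ Dvd.intro _ (Nat.mem_divisorsAntidiagonal.mp hx).1)

lemma fieldVonMangoldt_le (n : ℕ) :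
    fieldVonMangoldt E n ≤ (finrank ℚ E : ℝ) * vonMangoldt n := by
  have hnn : 0 ≤ (finrank ℚ E : ℝ) * vonMangoldt n :=
    mul_nonneg (by positivity) vonMangoldt_nonneg
  by_cases hz : ∀ P ∈ primesUpTo E n, ∀ j ∈ Icc 1 n, absNorm P ^ j ≠ n
  · unfold fieldVonMangoldt
    rw [sum_eq_zero fun P hP => sum_eq_zero fun j hj => if_neg (hz P hP j hj)]
    exact hnn
  push Not at hz
  obtain ⟨P₀, hP₀, j₀, hj₀, hn⟩ := hz
  have hP₀' := (mem_primesUpTo.mp hP₀).2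
  have hj₀' := (mem_Icc.mp hj₀).1
  -- a prime below a prime ideal
  have hbelow : ∀ P : Ideal (𝓞 E), Prime P → ∃ p : ℕ, p.Prime ∧ P ∣ span {(p : 𝓞 E)} ∧
      ∃ f, f ≠ 0 ∧ absNorm P = p ^ f := by
    intro P hP
    have hPp : P.IsPrime := isPrime_of_prime hP
    have h2 := two_le_absNorm_of_prime hP
    have hmem := absNorm_mem P
    have : ∃ p : ℕ, p.Prime ∧ (p : 𝓞 E) ∈ P := by
      rw [← Nat.prod_primeFactorsList (by omega : absNorm P ≠ 0)] at hmem
      have h4 : ∀ l : List ℕ, ((l.prod : ℕ) : 𝓞 E) ∈ P → ∃ p ∈ l, (p : 𝓞 E) ∈ P := by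
        intro l
        induction l with
        | nil =>
          intro h
          simp only [List.prod_nil, Nat.cast_one] at h
          exact absurd ((eq_top_iff_one P).mpr h) hPp.ne_top
        | cons a l ih =>
          intro h
          rw [List.prod_cons, Nat.cast_mul] at h
          rcases hPp.mem_or_mem h with h | h
          · exact ⟨a, by simp, h⟩
          grind
      obtain ⟨p, hp, hp'⟩ := h4 _ hmem
      exact ⟨p, Nat.prime_of_mem_primeFactorsList hp, hp'⟩
    obtain ⟨p, hp, hpP⟩ := this
    have hdvd : P ∣ span {(p : 𝓞 E)} := by
      simp_all
    refine ⟨p, hp, hdvd, ?_⟩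
    have h5 := map_dvd absNorm hdvd
    rw [absNorm_span_natCast] at h5
    obtain ⟨f, _, hf⟩ := (Nat.dvd_prime_pow hp).mp h5
    bound
  obtain ⟨p, hp, _, f₀, hf₀, hNP₀⟩ := hbelow P₀ hP₀'
  have hnp : n = p ^ (f₀ * j₀) := by rw [← hn, hNP₀, pow_mul]
  have hfj : f₀ * j₀ ≠ 0 := by positivity
  have hΛ : ArithmeticFunction.vonMangoldt n = Real.log p := by
    rw [hnp, vonMangoldt_apply_pow hfj, vonMangoldt_apply_prime hp]
  set T := (primesUpTo E n).filter fun P => P ∣ span {(p : 𝓞 E)} with hT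
  have h1 : fieldVonMangoldt E n ≤ ∑ P ∈ T, Real.log (Ideal.absNorm P) := by
    rw [hT, sum_filter]
    refine sum_le_sum fun P hP => ?_
    have hP' := (mem_primesUpTo.mp hP).2
    have h2 := two_le_absNorm_of_prime hP'
    by_cases hex : ∃ j ∈ Icc 1 n, absNorm P ^ j = n
    · obtain ⟨j, hj, hjn⟩ := hex
      rw [sum_eq_single j]
      · rw [if_pos hjn]
        obtain ⟨q, hq, hqd, f, hf, hNP⟩ := hbelow P hP'
        have hpq : p = q := by
          have h6 : p ^ (f₀ * j₀) = q ^ (f * j) := by rw [← hnp, ← hjn, hNP, pow_mul]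
          have h7 : p ∣ q ^ (f * j) := by rw [← h6]; exact dvd_pow_self _ hfj
          exact (Nat.prime_dvd_prime_iff_eq hp hq).mp (hp.dvd_of_dvd_pow h7)
        rw [hpq, if_pos hqd]
      · intro i _ hij
        rw [if_neg]
        intro h
        exact hij (Nat.pow_right_injective h2 (h.trans hjn.symm))
      · intro h; exact absurd hj h
    · push Not at hex
      rw [Finset.sum_eq_zero fun j hj => if_neg (hex j hj)]
      positivity
  refine h1.trans ?_
  have hTpos : ∀ P ∈ T, (absNorm P : ℝ) ≠ 0 := by
    intro P hP
    have := two_le_absNorm_of_prime (mem_primesUpTo.mp (mem_filter.mp hP).1).2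
    positivity
  have hprod : ∏ P ∈ T, P ∣ span {(p : 𝓞 E)} :=
    prod_primes_dvd _ (fun P hP => (mem_primesUpTo.mp (mem_filter.mp hP).1).2)
      fun P hP => (mem_filter.mp hP).2
  have h8 := map_dvd absNorm hprod
  rw [absNorm_span_natCast, map_prod] at h8
  have h9 := Nat.le_of_dvd (pow_pos hp.pos _) h8
  have hrank : finrank ℤ (𝓞 E) = finrank ℚ E := RingOfIntegers.rank E
  rw [← log_prod hTpos, hΛ, ← hrank, ← log_pow]
  refine log_le_log ?_ (by exact_mod_cast h9)
  exact prod_pos fun P hP => lt_of_le_of_ne (by positivity) (hTpos P hP).symm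

theorem isLogFactor_idealCount :
    IsLogFactor (fun n => (idealCount E n : ℝ)) (fieldVonMangoldt E) (finrank ℚ E) where
  nonneg _ := by positivity
  one := by simp [idealCount_one]
  deriv_nonneg n := sum_nonneg fun P _ => Finset.sum_nonneg fun j _ => by
    positivity
  deriv_le := fieldVonMangoldt_le
  conv n hn := by
    have hn0 : n ≠ 0 := by omega
    have h1 : ∑ x ∈ n.divisorsAntidiagonal, fieldVonMangoldt E x.1 * (idealCount E x.2 : ℝ) =
        ∑ P ∈ primesUpTo E n, ∑ j ∈ Icc 1 n, ∑ x ∈ n.divisorsAntidiagonal,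
          (if Ideal.absNorm (P ^ j) = x.1 then Real.log (Ideal.absNorm P) else 0) * (idealCount E x.2 : ℝ) := by
      have h2 : ∀ x ∈ n.divisorsAntidiagonal, fieldVonMangoldt E x.1 * (idealCount E x.2 : ℝ) =
          ∑ P ∈ primesUpTo E n, ∑ j ∈ Icc 1 n,
          (if Ideal.absNorm (P ^ j) = x.1 then Real.log (Ideal.absNorm P) else 0) * (idealCount E x.2 : ℝ) := by
        intro x hx
        rw [fieldVonMangoldt_eq (Nat.le_of_dvd hn (Dvd.intro _ (Nat.mem_divisorsAntidiagonal.mp hx).1)), sum_mul]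
        refine sum_congr rfl fun P _ => ?_
        rw [sum_mul]
        simp
      rw [sum_congr rfl h2, sum_comm]
      refine sum_congr rfl fun P _ => ?_
      rw [sum_comm]
    rw [h1]
    have h3 : ∀ P ∈ primesUpTo E n, ∀ j ∈ Icc 1 n, ∑ x ∈ n.divisorsAntidiagonal,
          (if Ideal.absNorm (P ^ j) = x.1 then Real.log (Ideal.absNorm P) else 0) * (idealCount E x.2 : ℝ) =
        ∑ I ∈ idealsOfNorm E n, if P ^ j ∣ I then Real.log (Ideal.absNorm P) else 0 :=
      fun P hP j _ => sum_divisorsAntidiagonal_idealCount hn0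
        (pow_ne_zero _ (mem_primesUpTo.mp hP).2.ne_zero) _
    rw [sum_congr rfl fun P hP => sum_congr rfl (h3 P hP)]
    have h4 : ∑ P ∈ primesUpTo E n, ∑ j ∈ Icc 1 n, ∑ I ∈ idealsOfNorm E n,
        (if P ^ j ∣ I then Real.log (Ideal.absNorm P) else 0) =
        ∑ I ∈ idealsOfNorm E n, ∑ P ∈ primesUpTo E n, ∑ j ∈ Icc 1 n,
        if P ^ j ∣ I then Real.log (Ideal.absNorm P) else 0 := by
      rw [sum_comm]
      refine (sum_congr rfl fun P _ => sum_comm).trans ?_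
      rw [sum_comm]
      refine sum_congr rfl fun P _ => ?_
      exact sum_comm
    rw [h4, sum_congr rfl fun I hI => (log_absNorm_eq_sum hn0 (mem_idealsOfNorm.mp hI)).symm,
      sum_const, nsmul_eq_mul, idealCount_eq_card]

end DedekindLog

section FreeFrobenius

open Finset Ideal Fintype

variable {G B R : Type*} [Group G] [CommRing B] [MulSemiringAction G B]

/-- `φ` acts as `x ↦ x ^ p` modulo the prime `P` above `p`, and the inertia group of `P` is trivial. -/
structure IsFreeFrobenius (p : ℕ) (P : Ideal B) (φ : G) : Prop where
  isPrime : P.IsPrime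
  mem : (p : B) ∈ P
  frob : ∀ x, φ • x - x ^ p ∈ P
  free : ∀ g : G, (∀ x : B, g • x - x ∈ P) → g = 1

namespace IsFreeFrobenius

variable {p : ℕ} {P : Ideal B} {φ : G}

lemma conj (h : IsFreeFrobenius p P φ) (g : G) : IsFreeFrobenius p (g • P) (g * φ * g⁻¹) where
  isPrime := h.isPrime.smul g
  mem := by
    rw [mem_pointwise_smul_iff_inv_smul_mem]
    have h1 : g⁻¹ • (p : B) = p := map_natCast (MulSemiringAction.toRingHom G B g⁻¹) p
    rw [h1]
    exact h.mem
  frob x := by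
    rw [mem_pointwise_smul_iff_inv_smul_mem]
    simpa [smul_sub, mul_smul] using h.frob (g⁻¹ • x)
  free τ hτ := by
    have h1 : g⁻¹ * τ * g = 1 := by
      refine h.free _ fun x => ?_
      have := hτ (g • x)
      rw [mem_pointwise_smul_iff_inv_smul_mem] at this
      simpa [smul_sub, mul_smul] using this
    have h2 : τ = g * (g⁻¹ * τ * g) * g⁻¹ := by group
    rw [h2, h1]; group

lemma smul_eq (h : IsFreeFrobenius p P φ) [Finite G] : φ • P = P := by
  have h2 : φ • P ≤ P := by
    intro x hx
    rw [mem_pointwise_smul_iff_inv_smul_mem] at hx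
    have h3 := h.frob (φ⁻¹ • x)
    have h4 : (φ⁻¹ • x) ^ p ∈ P := by
      by_cases hp : p = 0
      · subst hp
        have := h.frob 0
        simp_all
      · exact pow_mem_of_mem _ hx _ (Nat.pos_of_ne_zero hp)
    simpa using add_mem h3 h4
  exact smul_eq_of_smul_le h2

variable [CommRing R] [Algebra R B] {H : Subgroup G} [Finite H] [SMulCommClass H R B]
  [Algebra.IsInvariant R B H]

lemma mem_of_forall_sub_mem (h : IsFreeFrobenius p P φ) {a : G} (ha : a • P = P)
    (hx : ∀ x : R, a • algebraMap R B x - algebraMap R B x ∈ P) : a ∈ H := by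
  have h0 := h.isPrime
  let e : B ⧸ P ≃+* B ⧸ P := quotientEquiv P P (MulSemiringAction.toRingEquiv G B a) ha.symm
  have he : ∀ x : B, e (Ideal.Quotient.mk P x) = Ideal.Quotient.mk P (a • x) := fun x => rfl
  let f : (B ⧸ P) ≃ₐ[R ⧸ P.under R] B ⧸ P := AlgEquiv.ofRingEquiv (f := e) (by
    intro r
    obtain ⟨r, rfl⟩ := Quotient.mk_surjective r
    change e (Ideal.Quotient.mk P (algebraMap R B r)) = Ideal.Quotient.mk P (algebraMap R B r)
    rw [he, Ideal.Quotient.eq]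
    exact hx r)
  obtain ⟨⟨b, hb⟩, hbf⟩ := Quotient.stabilizerHom_surjective H (P.under R) P f
  have h1 : ∀ x : B, (b⁻¹ * a : G) • x - x ∈ P := by
    intro x
    have h2 := DFunLike.congr_fun hbf (Ideal.Quotient.mk P x)
    have h3 : Ideal.Quotient.mk P (b • x) = Ideal.Quotient.mk P (a • x) := h2
    rw [Ideal.Quotient.eq] at h3
    have h4 : (b : G) • P = P := hb
    rw [← neg_mem_iff, neg_sub] at h3
    have h5 := Ideal.smul_mem_pointwise_smul (b⁻¹ : G) _ _ h3
    have h6 : (b⁻¹ : G) • P = P := by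
      rw [inv_smul_eq_iff, h4]
    rw [h6, smul_sub, ← mul_smul] at h5
    have h7 : (b⁻¹ : G) • (b • x) = x := inv_smul_smul (b : G) x
    rwa [h7] at h5
  have h2 := h.free _ h1
  have h3 : a = b := by
    have h4 : (b : G)⁻¹ * a = 1 := h2
    rw [inv_mul_eq_one] at h4; exact h4.symm
  rw [h3]; exact b.2

/-- Conjugates of `φ` lying in `H` are those fixing the residue field of `R` at the contraction. -/
lemma conj_mem_iff (h : IsFreeFrobenius p P φ) [Finite G] :
    φ ∈ H ↔ ∀ x : R, x ^ p - x ∈ P.under R := by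
  have key : ∀ x : R, (x ^ p - x ∈ P.under R ↔ φ • algebraMap R B x - algebraMap R B x ∈ P) := by
    intro x
    have h1 := h.frob (algebraMap R B x)
    constructor
    · intro h2
      simpa using add_mem h1 h2
    · intro h2
      simpa using sub_mem h2 h1
  constructor
  · intro hφ x
    rw [key]
    have h2 : (⟨φ, hφ⟩ : H) • algebraMap R B x = algebraMap R B x := smul_algebraMap _ _
    have h3 : φ • algebraMap R B x = algebraMap R B x := h2
    rw [h3, sub_self]; exact zero_mem _
  · intro hx
    exact h.mem_of_forall_sub_mem h.smul_eq fun x => (key x).mp (hx x)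

end IsFreeFrobenius

end FreeFrobenius

section PrimeNorm

variable {E : Type*} [Field E] [NumberField E] {p : ℕ}

lemma pow_sub_mem_of_absNorm_eq (hp : p.Prime) {P : Ideal (𝓞 E)} (h : Ideal.absNorm P = p) :
    P.IsPrime ∧ (p : 𝓞 E) ∈ P ∧ ∀ x, x ^ p - x ∈ P := by
  have h1 : P.IsPrime := Ideal.isPrime_of_irreducible_absNorm (by rw [h]; exact hp)
  refine ⟨h1, h ▸ Ideal.absNorm_mem P, fun x => ?_⟩
  have hP : P ≠ ⊥ := by
    rintro rfl
    rw [Ideal.absNorm_bot] at h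
    exact hp.ne_zero h.symm
  have h2 : P.IsMaximal := h1.isMaximal hP
  let _ : Field (𝓞 E ⧸ P) := Ideal.Quotient.field P
  have h3 : Nat.card (𝓞 E ⧸ P) = p := by rw [← h]; rfl
  have := Fintype.ofFinite (𝓞 E ⧸ P)
  rw [← Ideal.Quotient.eq, map_pow]
  have h4 := FiniteField.pow_card (Ideal.Quotient.mk P x)
  rwa [← Nat.card_eq_fintype_card, h3] at h4

lemma absNorm_eq_of_pow_sub_mem (hp : p.Prime) {P : Ideal (𝓞 E)} (h1 : P.IsPrime)
    (hpP : (p : 𝓞 E) ∈ P) (h : ∀ x, x ^ p - x ∈ P) : Ideal.absNorm P = p := by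
  have hP : P ≠ ⊥ := by
    rintro rfl
    rw [Ideal.mem_bot, Nat.cast_eq_zero] at hpP
    exact hp.ne_zero hpP
  have h2 : P.IsMaximal := h1.isMaximal hP
  let _ : Field (𝓞 E ⧸ P) := Ideal.Quotient.field P
  have h3 : Nat.card (𝓞 E ⧸ P) = Ideal.absNorm P := rfl
  have := Fintype.ofFinite (𝓞 E ⧸ P)
  have h4 : ((p : ℕ) : 𝓞 E ⧸ P) = 0 := by
    have := Ideal.Quotient.eq_zero_iff_mem.mpr hpP
    rwa [map_natCast] at this
  rw [← h3]
  apply le_antisymm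
  · have h5 : (Finset.univ : Finset (𝓞 E ⧸ P)).card ≤
        (Polynomial.X ^ p - Polynomial.X : Polynomial (𝓞 E ⧸ P)).natDegree := by
      apply Polynomial.card_le_degree_of_subset_roots
      intro x _
      rw [Polynomial.mem_roots (FiniteField.X_pow_card_sub_X_ne_zero _ hp.one_lt),
        Polynomial.IsRoot]
      obtain ⟨x, rfl⟩ := Ideal.Quotient.mk_surjective x
      have := Ideal.Quotient.eq.mpr (h x)
      simpa [sub_eq_zero] using this
    rw [FiniteField.X_pow_card_sub_X_natDegree_eq _ hp.one_lt, Finset.card_univ] at h5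
    rwa [Nat.card_eq_fintype_card]
  · have h6 : ringChar (𝓞 E ⧸ P) = p := CharP.ringChar_of_prime_eq_zero hp h4
    have h7 : ((Fintype.card (𝓞 E ⧸ P) : ℕ) : 𝓞 E ⧸ P) = 0 := Nat.cast_card_eq_zero _
    have h8 := ringChar.dvd h7
    rw [h6, ← Nat.card_eq_fintype_card] at h8
    exact Nat.le_of_dvd Nat.card_pos h8

lemma exists_sub_natCast_mem_of_absNorm_eq (hp : p.Prime) {P : Ideal (𝓞 E)}
    (h : Ideal.absNorm P = p) (x : 𝓞 E) : ∃ n : ℕ, x - n ∈ P := by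
  have hpr := pow_sub_mem_of_absNorm_eq hp h
  have h3 : Nat.card (𝓞 E ⧸ P) = p := by rw [← h]; rfl
  have : Finite (𝓞 E ⧸ P) := Nat.finite_of_card_ne_zero (by rw [h3]; exact hp.ne_zero)
  have := Fintype.ofFinite (𝓞 E ⧸ P)
  have h1 := hpr.1
  have h4 : ((p : ℕ) : 𝓞 E ⧸ P) = 0 := by
    have := Ideal.Quotient.eq_zero_iff_mem.mpr hpr.2.1
    rwa [map_natCast] at this
  have h6 : ringChar (𝓞 E ⧸ P) = p := CharP.ringChar_of_prime_eq_zero hp h4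
  have h7 : CharP (𝓞 E ⧸ P) p := (ringChar.eq_iff).mp h6
  rw [Nat.card_eq_fintype_card] at h3
  obtain ⟨z, hz⟩ := (ZMod.castHom_bijective (𝓞 E ⧸ P) h3).2 (Ideal.Quotient.mk P x)
  have : NeZero p := ⟨hp.ne_zero⟩
  refine ⟨z.val, ?_⟩
  rw [← Ideal.Quotient.eq, ← hz, map_natCast, ← ZMod.natCast_zmod_val z]
  simp

end PrimeNorm

section FixedCount

variable {G B : Type*} [Group G] [Finite G] [CommRing B] [MulSemiringAction G B]
  [Algebra.IsInvariant ℤ B G] {p : ℕ} {P : Ideal B} {φ : G}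

lemma IsFreeFrobenius.exists_eq_smul (h : IsFreeFrobenius p P φ) (hp : p.Prime) {Q : Ideal B}
    (hQ : Q.IsPrime) (hpQ : (p : B) ∈ Q) : ∃ g : G, Q = g • P := by
  have h0 := h.isPrime
  refine Algebra.IsInvariant.exists_smul_of_under_eq ℤ B G P Q ?_
  have key : ∀ I : Ideal B, I.IsPrime → (p : B) ∈ I → I.under ℤ = Ideal.span {(p : ℤ)} := by
    intro I hI hpI
    have hmax : (Ideal.span {(p : ℤ)}).IsMaximal :=
      PrincipalIdealRing.isMaximal_of_irreducible (Nat.prime_iff_prime_int.mp hp).irreducible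
    refine (hmax.eq_of_le (Ideal.IsPrime.under ℤ I).ne_top ?_).symm
    simpa using hpI
  rw [key P h0 h.mem, key Q hQ hpQ]

variable {E : Type*} [Field E] [NumberField E] [Algebra (𝓞 E) B] {H : Subgroup G}
  [SMulCommClass H (𝓞 E) B] [Algebra.IsInvariant (𝓞 E) B H] [FaithfulSMul (𝓞 E) B]

/-- The number of ideals of prime norm in a fixed field, in terms of Frobenius conjugates. -/
theorem IsFreeFrobenius.idealCount_mul_card (h : IsFreeFrobenius p P φ) (hp : p.Prime) :
    idealCount E p * Nat.card H = Nat.card {g : G // g * φ * g⁻¹ ∈ H} := by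
  have := Fintype.ofFinite G
  set A : Finset G := Finset.univ.filter fun g => g * φ * g⁻¹ ∈ H with hA
  have hAcard : Nat.card {g : G // g * φ * g⁻¹ ∈ H} = A.card :=
    Nat.subtype_card A fun g => by rw [hA, Finset.mem_filter]; simp
  rw [hAcard, idealCount_eq_card]
  have hu : ∀ g : G, ∀ x : 𝓞 E, x ∈ (g • P).under (𝓞 E) ↔ algebraMap (𝓞 E) B x ∈ g • P :=
    fun g x => Iff.rfl
  have hpu : ∀ g : G, (p : 𝓞 E) ∈ (g • P).under (𝓞 E) := by
    intro g
    rw [hu, map_natCast]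
    exact (h.conj g).mem
  have hmaps : ∀ g ∈ A, (g • P).under (𝓞 E) ∈ idealsOfNorm E p := by
    intro g hg
    have hc := h.conj g
    have := hc.isPrime
    rw [mem_idealsOfNorm]
    refine absNorm_eq_of_pow_sub_mem hp (Ideal.IsPrime.under _ _) (hpu g) ?_
    exact (hc.conj_mem_iff (R := 𝓞 E) (H := H)).mp (Finset.mem_filter.mp hg).2
  rw [Finset.card_eq_sum_card_fiberwise hmaps, ← smul_eq_mul, ← Finset.sum_const]
  refine Finset.sum_congr rfl fun I hI => ?_
  rw [mem_idealsOfNorm] at hI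
  obtain ⟨hI1, hI2, hI3⟩ := pow_sub_mem_of_absNorm_eq hp hI
  have hI0 : I ≠ ⊥ := by
    rintro rfl
    rw [Ideal.mem_bot, Nat.cast_eq_zero] at hI2
    exact hp.ne_zero hI2
  have hImax : I.IsMaximal := hI1.isMaximal hI0
  have hint : Algebra.IsIntegral (𝓞 E) B := Algebra.IsInvariant.isIntegral (𝓞 E) B H
  obtain ⟨Q, hQ, hQI⟩ := Ideal.exists_maximal_ideal_liesOver_of_isIntegral I (S := B)
  have hQu : Q.under (𝓞 E) = I := hQI.over.symm
  have hpQ : (p : B) ∈ Q := by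
    have : (p : 𝓞 E) ∈ Q.under (𝓞 E) := by rw [hQu]; exact hI2
    rw [Ideal.mem_comap, map_natCast] at this
    exact this
  obtain ⟨g, rfl⟩ := h.exists_eq_smul hp hQ.isPrime hpQ
  have hc := h.conj g
  symm
  have hgH : g * φ * g⁻¹ ∈ H := (hc.conj_mem_iff (R := 𝓞 E) (H := H)).mpr (by rwa [hQu])
  rw [Nat.card_eq_fintype_card, ← Finset.card_univ]
  symm
  refine Finset.card_bij (fun (k : H) _ => (k : G) * g) ?_ ?_ ?_
  · intro k _
    rw [Finset.mem_filter, hA, Finset.mem_filter]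
    refine ⟨⟨Finset.mem_univ _, ?_⟩, ?_⟩
    · have h1 : (k : G) * g * φ * ((k : G) * g)⁻¹ = k * (g * φ * g⁻¹) * (k : G)⁻¹ := by group
      rw [h1]
      bound
    · rw [mul_smul, ← hQu]
      exact Ideal.under_smul (𝓞 E) (g • P) k
  · simp
  · intro g' hg'
    rw [Finset.mem_filter] at hg'
    have hc' := h.conj g'
    have hcp' := hc'.isPrime
    obtain ⟨k, hk⟩ := Algebra.IsInvariant.exists_smul_of_under_eq (𝓞 E) B H (g • P) (g' • P)
      (hQu.trans hg'.2.symm)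
    have hk' : g' • P = (k : G) • g • P := hk
    have hb : ((k : G) * g * g'⁻¹) • (g' • P) = g' • P := by
      rw [mul_smul, inv_smul_smul, mul_smul, ← hk']
    have hbH : (k : G) * g * g'⁻¹ ∈ H := by
      refine hc'.mem_of_forall_sub_mem (R := 𝓞 E) hb fun x => ?_
      obtain ⟨n, hn⟩ := exists_sub_natCast_mem_of_absNorm_eq hp hI x
      rw [← hg'.2, Ideal.mem_comap, map_sub, map_natCast] at hn
      have h2 := Ideal.smul_mem_pointwise_smul ((k : G) * g * g'⁻¹) _ _ hn
      have h3 : ((k : G) * g * g'⁻¹) • (n : B) = n :=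
        map_natCast (MulSemiringAction.toRingHom G B _) n
      rw [hb, smul_sub, h3] at h2
      simpa using sub_mem h2 hn
    refine ⟨⟨g' * g⁻¹, ?_⟩, Finset.mem_univ _, by simp⟩
    have h1 : g' * g⁻¹ = ((k : G) * g * g'⁻¹)⁻¹ * k := by group
    rw [h1]
    exact H.mul_mem (H.inv_mem hbH) k.2

end FixedCount

section GaloisField

open Ideal

variable {L : Type*} [Field L] [NumberField L]

lemma coe_smul_ringOfIntegers (σ : L ≃ₐ[ℚ] L) (x : 𝓞 L) : ((σ • x : 𝓞 L) : L) = σ (x : L) := rfl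

instance isInvariant_int_ringOfIntegers [IsGalois ℚ L] :
    Algebra.IsInvariant ℤ (𝓞 L) (L ≃ₐ[ℚ] L) where
  isInvariant b hb := by
    have h1 : ∃ q : ℚ, algebraMap ℚ L q = (b : L) := by
      rw [← Set.mem_range, IsGalois.mem_range_algebraMap_iff_fixed]
      intro σ
      rw [← coe_smul_ringOfIntegers, hb]
    obtain ⟨q, hq⟩ := h1
    have h2 : IsIntegral ℤ q := by
      have h3 : IsIntegral ℤ (algebraMap ℚ L q) := by rw [hq]; exact b.2
      exact (isIntegral_algebraMap_iff (algebraMap ℚ L).injective).mp h3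
    obtain ⟨z, hz⟩ := IsIntegrallyClosed.isIntegral_iff.mp h2
    refine ⟨z, ?_⟩
    ext
    rw [← hq, ← hz]
    simp

variable (H : Subgroup (L ≃ₐ[ℚ] L))

instance smulCommClass_fixedField : SMulCommClass H (𝓞 (IntermediateField.fixedField H)) (𝓞 L) where
  smul_comm h r x := by
    ext
    have h1 : (h : L ≃ₐ[ℚ] L) (r : L) = (r : L) := (r : IntermediateField.fixedField H).2 h
    change (h : L ≃ₐ[ℚ] L) (((r • x : 𝓞 L)) : L) = ((r • (h • x : 𝓞 L) : 𝓞 L) : L)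
    have h2 : ∀ y : 𝓞 L, ((r • y : 𝓞 L) : L) = (r : L) * (y : L) := fun y => by
      rfl
    rw [h2, h2, map_mul, h1]
    rfl

instance isInvariant_fixedField :
    Algebra.IsInvariant (𝓞 (IntermediateField.fixedField H)) (𝓞 L) H where
  isInvariant b hb := by
    have h1 : (b : L) ∈ IntermediateField.fixedField H := by
      intro h
      have := congrArg (fun x : 𝓞 L => (x : L)) (hb h)
      exact this
    have h2 : IsIntegral ℤ (⟨(b : L), h1⟩ : IntermediateField.fixedField H) := by
      have h3 : IsIntegral ℤ (algebraMap (IntermediateField.fixedField H) L ⟨(b : L), h1⟩) := b.2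
      exact (isIntegral_algebraMap_iff (algebraMap (IntermediateField.fixedField H) L).injective).mp h3
    refine ⟨⟨_, h2⟩, ?_⟩
    rfl

instance faithfulSMul_fixedField :
    FaithfulSMul (𝓞 (IntermediateField.fixedField H)) (𝓞 L) := by
  rw [faithfulSMul_iff_algebraMap_injective]
  intro x y hxy
  simp_all

/-- The number of ideals of prime norm in a fixed field, in terms of Frobenius conjugates. -/
theorem idealCount_fixedField_mul_card {p : ℕ} {P : Ideal (𝓞 L)} [IsGalois ℚ L] {φ : L ≃ₐ[ℚ] L}
    (h : IsFreeFrobenius p P φ) (hp : p.Prime) :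
    idealCount (IntermediateField.fixedField H) p * Nat.card H =
      Nat.card {g : L ≃ₐ[ℚ] L // g * φ * g⁻¹ ∈ H} :=
  h.idealCount_mul_card hp

lemma eq_one_of_forall_smul_eq {g : L ≃ₐ[ℚ] L} (h : ∀ x : 𝓞 L, g • x = x) : g = 1 := by
  ext x
  obtain ⟨a, b, hb, rfl⟩ := IsFractionRing.div_surjective (A := 𝓞 L) x
  rw [map_div₀, ← RingOfIntegers.coe_eq_algebraMap, ← RingOfIntegers.coe_eq_algebraMap,
    ← coe_smul_ringOfIntegers, ← coe_smul_ringOfIntegers, h, h]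
  rfl

lemma exists_isArithFrobAt [IsGalois ℚ L] {p : ℕ} (hp : p.Prime) {P : Ideal (𝓞 L)}
    (hP : P.IsPrime) (hpP : (p : 𝓞 L) ∈ P) : Nat.card (ℤ ⧸ P.under ℤ) = p ∧
      ∃ σ : L ≃ₐ[ℚ] L, IsArithFrobAt ℤ σ P := by
  have hP0 : P ≠ ⊥ := by
    rintro rfl
    rw [mem_bot, Nat.cast_eq_zero] at hpP
    exact hp.ne_zero hpP
  have hfin : Finite (𝓞 L ⧸ P) := finiteQuotientOfFreeOfNeBot P hP0
  refine ⟨?_, IsArithFrobAt.exists_of_isInvariant ℤ (L ≃ₐ[ℚ] L) P⟩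
  have hmax' : (span {(p : ℤ)}).IsMaximal :=
    PrincipalIdealRing.isMaximal_of_irreducible (Nat.prime_iff_prime_int.mp hp).irreducible
  have h1 : span {(p : ℤ)} = P.under ℤ := by
    refine hmax'.eq_of_le (IsPrime.under ℤ P).ne_top ?_
    simpa using hpP
  rw [← h1, Nat.card_congr (Int.quotientSpanNatEquivZMod p).toEquiv, Nat.card_zmod]

/-- Away from the discriminant, Frobenius elements exist and inertia is trivial. -/
theorem exists_isFreeFrobenius [IsGalois ℚ L] {p : ℕ}
    (hp : p.Prime) (hd : ¬ (p : ℤ) ∣ discr L) :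
    ∃ (P : Ideal (𝓞 L)) (σ : L ≃ₐ[ℚ] L), IsFreeFrobenius p P σ := by
  have hpu : ¬ IsUnit (p : 𝓞 L) := by
    intro h
    have h1 := h.map (Algebra.norm ℤ)
    have h2 : (p : 𝓞 L) = algebraMap ℤ (𝓞 L) p := by simp
    rw [h2, Algebra.norm_algebraMap, isUnit_pow_iff Module.finrank_pos.ne'] at h1
    simp_all
  obtain ⟨P, hP, hpP⟩ := exists_max_ideal_of_mem_nonunits hpu
  have hPp := hP.isPrime
  obtain ⟨hc, σ, hσ⟩ := exists_isArithFrobAt hp hPp hpP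
  have hunr : Algebra.IsUnramifiedAt ℤ P :=
    (not_dvd_discr_iff_forall_mem L (𝓞 L) (Nat.prime_iff_prime_int.mp hp)).mp hd P hPp
      (by simpa using hpP)
  have hσ' : ∀ x, σ • x - x ^ p ∈ P := fun x => by have := hσ x; rwa [hc] at this
  refine ⟨P, σ, hPp, hpP, hσ', fun g hg => ?_⟩
  have h1 : IsArithFrobAt ℤ (g * σ) P := by
    intro x
    rw [hc]
    have h2 := hg (σ • x)
    have h3 := add_mem h2 (hσ' x)
    rw [sub_add_sub_cancel, ← mul_smul] at h3
    exact h3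
  have h2 := AlgHom.IsArithFrobAt.eq_of_isUnramifiedAt h1 hσ (fun x hx =>
    mem_nonZeroDivisors_of_ne_zero (by rintro rfl; exact hx (zero_mem _)))
  refine eq_one_of_forall_smul_eq fun x => ?_
  have h3 : (g * σ) • (σ⁻¹ • x) = σ • (σ⁻¹ • x) := DFunLike.congr_fun h2 (σ⁻¹ • x)
  rwa [mul_smul, smul_inv_smul] at h3

lemma IsFreeFrobenius.eq_of_forall_sub_pow_mem {p : ℕ} {P : Ideal (𝓞 L)} {σ τ : L ≃ₐ[ℚ] L}
    (h : IsFreeFrobenius p P σ) (hτ : ∀ x, τ • x - x ^ p ∈ P) : τ = σ := by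
  rw [← mul_inv_eq_one]
  refine h.free _ fun x => ?_
  have := sub_mem (hτ (σ⁻¹ • x)) (h.frob (σ⁻¹ • x))
  rwa [sub_sub_sub_cancel_right, smul_inv_smul, ← mul_smul] at this

/-- Frobenius elements lift to a Galois extension obtained by adjoining a root of unity of order
prime to `p`. -/
theorem IsFreeFrobenius.exists_lift {K : Type*} [Field K] [NumberField K] [Algebra K L]
    [IsGalois ℚ K] [IsGalois ℚ L] {Q : ℕ} {ζ : L} (hζ : ζ ^ Q = 1)
    (hgen : ∀ g : L ≃ₐ[ℚ] L, AlgEquiv.restrictNormalHom K g = 1 → g ζ = ζ → g = 1)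
    {p : ℕ} (hp : p.Prime) (hpQ : ¬ p ∣ Q) {P : Ideal (𝓞 K)} {σ : K ≃ₐ[ℚ] K}
    (h : IsFreeFrobenius p P σ) :
    ∃ (P' : Ideal (𝓞 L)) (τ : L ≃ₐ[ℚ] L), IsFreeFrobenius p P' τ ∧
      AlgEquiv.restrictNormalHom K τ = σ ∧ τ ζ = ζ ^ p := by
  have hP := h.isPrime
  have hP0 : P ≠ ⊥ := by
    rintro rfl
    have := h.mem
    rw [mem_bot, Nat.cast_eq_zero] at this
    exact hp.ne_zero this
  have hmax := hP.isMaximal hP0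
  obtain ⟨P', hP', hl⟩ := exists_maximal_ideal_liesOver_of_isIntegral P (S := 𝓞 L)
  have hP'p := hP'.isPrime
  have hmem : ∀ x : 𝓞 K, x ∈ P ↔ algebraMap (𝓞 K) (𝓞 L) x ∈ P' := by
    intro x
    rw [hl.over]; rfl
  have hpP' : (p : 𝓞 L) ∈ P' := by
    have := (hmem p).mp h.mem
    rwa [map_natCast] at this
  obtain ⟨hc, τ, hτ⟩ := exists_isArithFrobAt hp hP'p hpP'
  have hτ' : ∀ x, τ • x - x ^ p ∈ P' := fun x => by have := hτ x; rwa [hc] at this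
  have hres : ∀ (g : L ≃ₐ[ℚ] L) (x : 𝓞 K),
      algebraMap (𝓞 K) (𝓞 L) (AlgEquiv.restrictNormalHom K g • x) = g • algebraMap (𝓞 K) (𝓞 L) x := by
    intro g x
    ext
    exact AlgEquiv.restrictNormal_commutes g K (x : K)
  have hQ : (Q : 𝓞 L) ∉ P' := by
    intro hQ
    have h1 : ((1 : ℕ) : 𝓞 L) ∈ P' := by
      have h2 : Nat.Coprime p Q := (Nat.Prime.coprime_iff_not_dvd hp).mpr hpQ
      have h3 : IsCoprime (p : ℤ) (Q : ℤ) := Nat.isCoprime_iff_coprime.mpr h2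
      obtain ⟨a, b, hab⟩ := h3
      have h4 := congrArg (fun z : ℤ => (z : 𝓞 L)) hab
      push_cast at h4
      rw [Nat.cast_one, ← h4]
      exact add_mem (mul_mem_left _ _ hpP') (mul_mem_left _ _ hQ)
    rw [Nat.cast_one] at h1
    exact hP'p.ne_top ((eq_top_iff_one _).mpr h1)
  have hQ0 : Q ≠ 0 := by rintro rfl; simp at hQ
  have hζi : IsIntegral ℤ ζ := by
    refine IsIntegral.of_pow (Nat.pos_of_ne_zero hQ0) ?_
    rw [hζ]; exact isIntegral_one
  set z : 𝓞 L := ⟨ζ, hζi⟩ with hz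
  have hzQ : z ^ Q = 1 := by ext; exact hζ
  have hfz : ∀ g : L ≃ₐ[ℚ] L, (∀ x, g • x - x ^ p ∈ P') → g • z = z ^ p := by
    intro g hg
    have h1 : IsArithFrobAt ℤ g P' := fun x => by rw [hc]; exact hg x
    have h2 := AlgHom.IsArithFrobAt.apply_of_pow_eq_one h1 hzQ hQ
    rwa [hc] at h2
  refine ⟨P', τ, ⟨hP'p, hpP', hτ', fun g hg => ?_⟩, ?_, ?_⟩
  · apply hgen
    · refine h.free _ fun x => ?_
      rw [hmem, map_sub, hres]
      exact hg _
    · have h3 : ∀ x, (g⁻¹ * (g * τ) * g) • x - x ^ p ∈ P' := by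
        intro x
        have h4 : g⁻¹ * (g * τ) * g = τ * g := by group
        rw [h4, mul_smul]
        have h5 := hτ' (g • x)
        have h6 : (g • x) ^ p - x ^ p ∈ P' := by
          have := mem_of_dvd P' (sub_dvd_pow_sub_pow (g • x) x p) (hg x)
          exact this
        simpa using add_mem h5 h6
      have h4 := hfz _ h3
      have h5 : g⁻¹ * (g * τ) * g = τ * g := by group
      rw [h5, mul_smul, ← hfz τ hτ'] at h4
      have h6 := MulAction.injective τ h4
      exact congrArg (fun x : 𝓞 L => (x : L)) h6
  · refine h.eq_of_forall_sub_pow_mem fun x => ?_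
    rw [hmem, map_sub, hres, map_pow]
    exact hτ' _
  · exact congrArg (fun x : 𝓞 L => (x : L)) (hfz τ hτ')

end GaloisField

section Compositum

variable {K L : Type*} [Field K] [NumberField K] [IsGalois ℚ K] [Field L] [NumberField L]
  [Algebra K L] {Q : ℕ} [NeZero Q] [IsCyclotomicExtension {Q} K L]

variable (K) in
/-- The image of `K` in `L` as an intermediate field. -/
noncomputable abbrev baseField (L : Type*) [Field L] [NumberField L] [Algebra K L] :
    IntermediateField ℚ L := (IsScalarTower.toAlgHom ℚ K L).fieldRange

lemma baseField_sup_adjoin {ζ : L} (hζ : IsPrimitiveRoot ζ Q) :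
    baseField K L ⊔ IntermediateField.adjoin ℚ {ζ} = ⊤ := by
  rw [eq_top_iff]
  intro x _
  have hx : x ∈ Algebra.adjoin K {ζ} := by
    rw [IsCyclotomicExtension.adjoin_primitive_root_eq_top hζ]; trivial
  induction hx using Algebra.adjoin_induction with
  | mem x hx =>
    rw [hx]
    exact (le_sup_right : _ ≤ baseField K L ⊔ _) (IntermediateField.mem_adjoin_simple_self ℚ ζ)
  | algebraMap r => exact (le_sup_left : _ ≤ baseField K L ⊔ _) ⟨r, rfl⟩
  | add x y _ _ hx hy => exact add_mem (hx trivial) (hy trivial)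
  | mul x y _ _ hx hy => exact mul_mem (hx trivial) (hy trivial)

lemma isGalois_baseField : IsGalois ℚ (baseField K L) :=
  IsGalois.of_algEquiv (AlgEquiv.ofInjectiveField (IsScalarTower.toAlgHom ℚ K L))

lemma isGalois_adjoin {ζ : L} (hζ : IsPrimitiveRoot ζ Q) :
    IsGalois ℚ (IntermediateField.adjoin ℚ {ζ}) := by
  have : IsCyclotomicExtension {Q} ℚ (IntermediateField.adjoin ℚ {ζ}) :=
    hζ.intermediateField_adjoin_isCyclotomicExtension ℚ
  exact IsCyclotomicExtension.isGalois {Q} ℚ (IntermediateField.adjoin ℚ {ζ})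

/-- Adjoining roots of unity to a Galois number field gives a Galois number field. -/
theorem isGalois_of_isCyclotomicExtension (K : Type*) {L : Type*} [Field K] [NumberField K]
    [IsGalois ℚ K] [Field L] [NumberField L] [Algebra K L] (Q : ℕ) [NeZero Q]
    [IsCyclotomicExtension {Q} K L] : IsGalois ℚ L := by
  have hζ := IsCyclotomicExtension.zeta_spec Q K L
  have h1 : IsGalois ℚ (baseField K L) := isGalois_baseField
  have h2 := isGalois_adjoin hζ
  have h3 : Normal ℚ ((baseField K L ⊔ IntermediateField.adjoin ℚ
    {IsCyclotomicExtension.zeta Q K L} : IntermediateField ℚ L)) := by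
    have h5 := h1.to_normal
    have h6 := h2.to_normal
    exact @IntermediateField.normal_sup ℚ L _ _ _ _ _ h5 h6
  rw [baseField_sup_adjoin hζ] at h3
  have h4 : Normal ℚ L := @Normal.of_algEquiv ℚ _ _ _ _ _ _ _ h3 (IntermediateField.topEquiv (F := ℚ) (E := L))
  exact ⟨⟩

lemma eq_one_of_restrict_eq_one {ζ : L} (hζ : IsPrimitiveRoot ζ Q) (g : L ≃ₐ[ℚ] L)
    (h : AlgEquiv.restrictNormalHom K g = 1) (hg : g ζ = ζ) : g = 1 := by
  have hK : ∀ r : K, g (algebraMap K L r) = algebraMap K L r := by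
    intro r
    rw [← AlgEquiv.restrictNormal_commutes g K r]
    have := congrArg (fun e : K ≃ₐ[ℚ] K => e r) h
    exact congrArg _ this
  ext x
  have hx : x ∈ Algebra.adjoin K {ζ} := by
    rw [IsCyclotomicExtension.adjoin_primitive_root_eq_top hζ]; trivial
  induction hx using Algebra.adjoin_induction with
  | mem x hx =>
    rw [hx]
    exact hg
  | algebraMap r => exact hK r
  | add x y _ _ hx hy => rw [map_add, hx, hy]; rfl
  | mul x y _ _ hx hy => rw [map_mul, hx, hy]; rfl

open Nat in
theorem finrank_eq_mul_totient (hQ : Q.Coprime (discr K).natAbs) :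
    finrank ℚ L = finrank ℚ K * Nat.totient Q := by
  have hζ := IsCyclotomicExtension.zeta_spec Q K L
  set F := IntermediateField.adjoin ℚ {IsCyclotomicExtension.zeta Q K L}
  have h1 : IsGalois ℚ (baseField K L) := isGalois_baseField
  have h3 : IsCyclotomicExtension {Q} ℚ F := hζ.intermediateField_adjoin_isCyclotomicExtension ℚ
  have e : K ≃ₐ[ℚ] baseField K L :=
    AlgEquiv.ofInjectiveField (IsScalarTower.toAlgHom ℚ K L)
  have h_cpr : IsCoprime (discr (baseField K L)) (discr F) := by
    rw [← discr_eq_discr_of_algEquiv K e, Int.isCoprime_iff_nat_coprime,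
      IsCyclotomicExtension.Rat.natAbs_discr Q F]
    refine Coprime.coprime_div_right ?_
      (prod_primeFactors_pow_totient_ediv_dvd (NeZero.pos _))
    exact Coprime.pow_right _ hQ.symm
  have h_disj : (baseField K L).LinearDisjoint F := by
    apply linearDisjoint_of_isGalois_isCoprime_discr
    exact h_cpr
  have h4 := h_disj.finrank_sup
  rw [baseField_sup_adjoin hζ, IntermediateField.finrank_top',
    IsCyclotomicExtension.finrank (n := Q) F (Polynomial.cyclotomic.irreducible_rat (NeZero.pos Q)),
    ← e.toLinearEquiv.finrank_eq] at h4
  exact h4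

variable (K) in
/-- Restriction to `K` together with the cyclotomic character. -/
noncomputable def splitHom {ζ : L} (hζ : IsPrimitiveRoot ζ Q) :
    (L ≃ₐ[ℚ] L) →* (K ≃ₐ[ℚ] K) × (ZMod Q)ˣ :=
  (AlgEquiv.restrictNormalHom K).prod (hζ.autToPow ℚ)

lemma splitHom_bijective [IsGalois ℚ L] {ζ : L} (hζ : IsPrimitiveRoot ζ Q)
    (hQ : Q.Coprime (discr K).natAbs) : Function.Bijective (splitHom K hζ) := by
  rw [Nat.bijective_iff_injective_and_card]
  constructor
  · rw [injective_iff_map_eq_one]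
    intro g hg
    have h1 : AlgEquiv.restrictNormalHom K g = 1 := congrArg Prod.fst hg
    have h2 : hζ.autToPow ℚ g = 1 := congrArg Prod.snd hg
    refine eq_one_of_restrict_eq_one hζ g h1 ?_
    have h3 := hζ.autToPow_spec ℚ g
    have h4 := hζ.autToPow_spec ℚ (1 : L ≃ₐ[ℚ] L)
    simp_all
  · rw [Nat.card_prod, IsGalois.card_aut_eq_finrank, IsGalois.card_aut_eq_finrank,
      finrank_eq_mul_totient hQ (K := K), Nat.card_eq_fintype_card, ZMod.card_units_eq_totient]

lemma autToPow_eq_of_apply_eq {ζ : L} (hζ : IsPrimitiveRoot ζ Q) {τ : L ≃ₐ[ℚ] L} {p : ℕ}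
    (h : τ ζ = ζ ^ p) : ((hζ.autToPow ℚ τ : (ZMod Q)ˣ) : ZMod Q) = p := by
  have h1 := hζ.autToPow_spec ℚ τ
  rw [h] at h1
  have h2 := (hζ.isOfFinOrder (NeZero.ne Q)).pow_eq_pow_iff_modEq.mp h1
  rw [← hζ.eq_orderOf] at h2
  rw [← ZMod.natCast_eq_natCast_iff, ZMod.natCast_zmod_val] at h2
  exact h2

end Compositum

section BoundedBasis

open Finset Fintype

/-- A number field spanned by bounded integers has a bounded integral basis. -/
lemma exists_bounded_basis_of_span {E : Type*} [Field E] [NumberField E] {T : ℝ} (s : Set E)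
    (hs : ⊤ ≤ Submodule.span ℚ s) (hint : ∀ x ∈ s, IsIntegral ℤ x)
    (hT : ∀ x ∈ s, ∀ w : InfinitePlace E, w x ≤ T) :
    ∃ θ : Basis (Fin (finrank ℚ E)) ℚ E, (∀ i, IsIntegral ℤ (θ i)) ∧
      ∀ i, ∀ w : InfinitePlace E, w (θ i) ≤ T := by
  set b := Basis.ofSpan hs
  have hcard := Module.finrank_eq_card_basis b
  have e := Fintype.equivFinOfCardEq hcard.symm
  have hmem : ∀ i, b.reindex e i ∈ s := fun i => by
    rw [Basis.reindex_apply]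
    exact Basis.ofSpan_subset hs ⟨_, rfl⟩
  exact ⟨b.reindex e, fun i => hint _ (hmem i), fun i => hT _ (hmem i)⟩

variable {L : Type*} [Field L] [NumberField L] (H : Subgroup (L ≃ₐ[ℚ] L))

lemma sum_smul_mem_fixedField (x : L) :
    ∑ h : H, (h : L ≃ₐ[ℚ] L) x ∈ IntermediateField.fixedField H := by
  intro g
  change (g : L ≃ₐ[ℚ] L) (∑ h : H, (h : L ≃ₐ[ℚ] L) x) = _
  rw [map_sum]
  exact sum_equiv (Equiv.mulLeft g) _ _ (fun h => rfl)

/-- The sum of conjugates, with values in the fixed field. -/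
noncomputable def traceFixed : L →ₗ[ℚ] IntermediateField.fixedField H where
  toFun x := ⟨∑ h : H, (h : L ≃ₐ[ℚ] L) x, sum_smul_mem_fixedField H x⟩
  map_add' x y := by
    simp [sum_add_distrib]
  map_smul' c x := by
    simp [smul_sum, map_rat_smul]

lemma traceFixed_surjective : Function.Surjective (traceFixed H) := by
  intro e
  have hc : (Fintype.card H : ℚ) ≠ 0 := by exact_mod_cast Fintype.card_ne_zero
  refine ⟨(card H : ℚ)⁻¹ • (e : L), ?_⟩
  rw [map_smul]
  ext
  change (card H : ℚ)⁻¹ • (∑ h : H, (h : L ≃ₐ[ℚ] L) (e : L)) = e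
  have h1 : ∀ h : H, (h : L ≃ₐ[ℚ] L) (e : L) = e := fun h => e.2 h
  rw [sum_congr rfl (fun h _ => h1 h), sum_const, card_univ,
    ← Nat.cast_smul_eq_nsmul ℚ, smul_smul, inv_mul_cancel₀ hc, one_smul]

theorem exists_bounded_basis_fixedField {T : ℝ} (s : Set L)
    (hs : ⊤ ≤ Submodule.span ℚ s) (hint : ∀ x ∈ s, IsIntegral ℤ x)
    (hT : ∀ x ∈ s, ∀ w : InfinitePlace L, w x ≤ T) :
    ∃ θ : Basis (Fin (finrank ℚ (IntermediateField.fixedField H))) ℚ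
        (IntermediateField.fixedField H), (∀ i, IsIntegral ℤ (θ i)) ∧
      ∀ i, ∀ w : InfinitePlace (IntermediateField.fixedField H), w (θ i) ≤ Nat.card H * T := by
  refine exists_bounded_basis_of_span (traceFixed H '' s) ?_ ?_ ?_
  · have h1 := Submodule.map_span (traceFixed H) s
    rw [top_le_iff] at hs
    rw [hs, Submodule.map_top, LinearMap.range_eq_top.mpr (traceFixed_surjective H)] at h1
    exact h1.le
  · rintro _ ⟨x, hx, rfl⟩
    have h3 : IsIntegral ℤ (algebraMap (IntermediateField.fixedField H) L (traceFixed H x)) := by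
      exact IsIntegral.sum _ fun h _ => (hint x hx).map (h : L ≃ₐ[ℚ] L).toIntAlgEquiv
    exact (isIntegral_algebraMap_iff (algebraMap (IntermediateField.fixedField H) L).injective).mp h3
  · rintro _ ⟨x, hx, rfl⟩ w
    obtain ⟨w', rfl⟩ := InfinitePlace.comap_surjective (K := L) w
    calc w' (∑ h : H, (h : L ≃ₐ[ℚ] L) x) ≤ ∑ h : H, w' ((h : L ≃ₐ[ℚ] L) x) :=
          w'.1.sum_le _ _
      _ ≤ ∑ h : H, T := sum_le_sum fun h _ => hT x hx (w'.comap (h : L ≃ₐ[ℚ] L).toRingHom)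
      _ = _ := by simp

end BoundedBasis

section CyclotomicSpan

variable (K : Type*) [Field K] [NumberField K]

/-- The number field `L = K(ζ)` is spanned over `ℚ` by integers bounded independently of `ζ`. -/
theorem exists_bounded_span : ∃ T : ℝ, 1 ≤ T ∧ ∀ (L : Type*) [Field L] [NumberField L] [Algebra K L]
    (Q : ℕ) [NeZero Q] [IsCyclotomicExtension {Q} K L],
    ∃ s : Set L, ⊤ ≤ Submodule.span ℚ s ∧ (∀ x ∈ s, IsIntegral ℤ x) ∧
      ∀ x ∈ s, ∀ w : InfinitePlace L, w x ≤ T := by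
  have hbd : ∃ T : ℝ, 1 ≤ T ∧ ∀ i, ∀ w : InfinitePlace K, w (integralBasis K i) ≤ T := by
    refine ⟨1 + ∑ i, ∑ w : InfinitePlace K, w (integralBasis K i), ?_, fun i w => ?_⟩
    · have : 0 ≤ ∑ i, ∑ w : InfinitePlace K, w (integralBasis K i) :=
        Finset.sum_nonneg fun i _ => Finset.sum_nonneg fun w _ => apply_nonneg _ _
      linarith
    · have h1 := Finset.single_le_sum (f := fun i => ∑ w : InfinitePlace K, w (integralBasis K i))
        (fun i _ => Finset.sum_nonneg fun w _ => apply_nonneg _ _) (Finset.mem_univ i)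
      have h2 := Finset.single_le_sum (f := fun w : InfinitePlace K => w (integralBasis K i))
        (fun w _ => apply_nonneg _ _) (Finset.mem_univ w)
      linarith
  obtain ⟨T, hT1, hT⟩ := hbd
  refine ⟨T, hT1, ?_⟩
  intro L _ _ _ Q _ _
  have hζ := IsCyclotomicExtension.zeta_spec Q K L
  set ζ := IsCyclotomicExtension.zeta Q K L
  refine ⟨Set.range fun ij : (Free.ChooseBasisIndex ℤ (𝓞 K)) × ℕ =>
    algebraMap K L (integralBasis K ij.1) * ζ ^ ij.2, ?_, ?_, ?_⟩
  · set s := Set.range fun ij : (Free.ChooseBasisIndex ℤ (𝓞 K)) × ℕ =>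
      algebraMap K L (integralBasis K ij.1) * ζ ^ ij.2
    have h1 : ∀ (r : K) (j : ℕ), algebraMap K L r * ζ ^ j ∈ Submodule.span ℚ s := by
      intro r j
      rw [← (integralBasis K).sum_repr r, map_sum, Finset.sum_mul]
      refine Submodule.sum_mem _ fun i _ => ?_
      rw [Algebra.smul_def, map_mul, mul_assoc, ← IsScalarTower.algebraMap_apply, ← Algebra.smul_def]
      exact Submodule.smul_mem _ _ (Submodule.subset_span ⟨(i, j), rfl⟩)
    intro x _
    have hx : x ∈ Algebra.adjoin K {ζ} := by
      rw [IsCyclotomicExtension.adjoin_primitive_root_eq_top hζ]; trivial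
    obtain ⟨f, rfl⟩ := Algebra.adjoin_singleton_eq_range_aeval K ζ ▸ hx
    change Polynomial.aeval ζ f ∈ _
    rw [Polynomial.aeval_eq_sum_range]
    refine Submodule.sum_mem _ fun j _ => ?_
    rw [Algebra.smul_def]
    exact h1 _ _
  · rintro _ ⟨⟨i, j⟩, rfl⟩
    have h1 : IsIntegral ℤ (integralBasis K i) := by
      rw [integralBasis_apply]; exact (RingOfIntegers.basis K i).2
    have h2 : IsIntegral ℤ (algebraMap K L (integralBasis K i)) :=
      h1.map (IsScalarTower.toAlgHom ℤ K L)
    exact h2.mul ((hζ.isIntegral (NeZero.pos Q)).pow j)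
  · rintro _ ⟨⟨i, j⟩, rfl⟩ w
    have h1 : w ζ = 1 := by
      have h2 : w ζ ^ Q = 1 := by rw [← map_pow, hζ.pow_eq_one, map_one]
      exact (pow_eq_one_iff_of_nonneg (apply_nonneg _ _) (NeZero.ne Q)).mp h2
    simp only [map_mul, map_pow, h1, one_pow, mul_one]
    exact hT i (w.comap (algebraMap K L))

end CyclotomicSpan

section TwistGroup

open Finset Fintype

open scoped Classical

variable {Γ U : Type*} [Group Γ] [Fintype Γ] [CommGroup U] [Fintype U] {C : Subgroup Γ}

/-- A character of a subgroup, extended by zero. -/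
noncomputable def extChar (χ : C →* ℂ) (g : Γ) : ℂ := if h : g ∈ C then χ ⟨g, h⟩ else 0

/-- The unnormalised induced character. -/
noncomputable def indChar (χ : C →* ℂ) (γ : Γ) : ℂ := ∑ g : Γ, extChar χ (g * γ * g⁻¹)

lemma extChar_of_mem (χ : C →* ℂ) {g : Γ} (h : g ∈ C) : extChar χ g = χ ⟨g, h⟩ := dif_pos h

lemma extChar_of_notMem (χ : C →* ℂ) {g : Γ} (h : g ∉ C) : extChar χ g = 0 := dif_neg h

lemma norm_char_eq_one (χ : C →* ℂ) (c : C) : ‖χ c‖ = 1 := by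
  have h1 : χ c ^ card C = 1 := by rw [← map_pow, pow_card_eq_one, map_one]
  exact Complex.norm_eq_one_of_pow_eq_one h1 card_ne_zero

lemma norm_extChar_le (χ : C →* ℂ) (g : Γ) : ‖extChar χ g‖ ≤ 1 := by
  by_cases h : g ∈ C
  · rw [extChar_of_mem χ h, norm_char_eq_one]
  · rw [extChar_of_notMem χ h, norm_zero]; exact zero_le_one

lemma norm_indChar_le (χ : C →* ℂ) (γ : Γ) : ‖indChar χ γ‖ ≤ card Γ := by
  refine (norm_sum_le _ _).trans ?_
  calc ∑ g : Γ, ‖extChar χ (g * γ * g⁻¹)‖ ≤ ∑ _g : Γ, (1 : ℝ) :=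
        sum_le_sum fun g _ => norm_extChar_le χ _
    _ = _ := by simp

lemma sum_pow_eq_ite {n : ℕ} {z : ℂ} (hz : z ^ n = 1) :
    ∑ i ∈ range n, z ^ i = if z = 1 then (n : ℂ) else 0 := by
  by_cases h : z = 1
  · simp [h]
  · rw [if_neg h, geom_sum_eq h, hz, sub_self, zero_div]

lemma sum_mul_extChar_pow {χ : C →* ℂ} {n : ℕ} (hχ : χ ^ n = 1) {z : ℂ}
    (hz : z ^ n = 1) (g : Γ) : ∑ i ∈ range n, z ^ i * extChar (χ ^ i) g =
      if extChar χ g * z = 1 then (n : ℂ) else 0 := by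
  by_cases h : g ∈ C
  · have h1 : χ ⟨g, h⟩ ^ n = 1 := by rw [← MonoidHom.pow_apply, hχ, MonoidHom.one_apply]
    rw [← sum_pow_eq_ite (by rw [extChar_of_mem χ h, mul_pow, h1, hz, one_mul])]
    refine sum_congr rfl fun i _ => ?_
    rw [extChar_of_mem χ h, extChar_of_mem _ h, MonoidHom.pow_apply, mul_pow, mul_comm]
  · simp [extChar_of_notMem _ h]

lemma card_extChar_conj_mul {χ : C →* ℂ} {n : ℕ} (hχ : χ ^ n = 1) {z : ℂ}
    (hz : z ^ n = 1) (γ : Γ) :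
    (Nat.card {g : Γ // extChar χ (g * γ * g⁻¹) * z = 1} : ℂ) * n =
      ∑ i ∈ range n, z ^ i * indChar (χ ^ i) γ := by
  simp only [indChar, mul_sum]
  rw [sum_comm, sum_congr rfl fun g _ => sum_mul_extChar_pow hχ hz _,
    ← sum_filter, sum_const, nsmul_eq_mul, Nat.card_eq_fintype_card,
    Fintype.card_subtype]

lemma sum_extChar (χ : C →* ℂ) : ∑ g : Γ, extChar χ g = if χ = 1 then (Nat.card C : ℂ) else 0 := by
  have h1 : ∑ g : Γ, extChar χ g = ∑ c : C, χ c := by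
    rw [← sum_subset (subset_univ (univ.filter (· ∈ C)))
      (fun g _ hg => extChar_of_notMem χ (by simpa using hg)),
      sum_subtype (p := (· ∈ C)) _ (by simp)]
    exact sum_congr rfl fun c _ => extChar_of_mem χ c.2
  rw [h1]
  by_cases h : χ = 1
  · rw [if_pos h, h]; simp
  · rw [if_neg h, sum_hom_units_eq_zero χ h]

lemma sum_indChar (χ : C →* ℂ) :
    ∑ γ : Γ, indChar χ γ = if χ = 1 then (Nat.card Γ : ℂ) * Nat.card C else 0 := by
  simp only [indChar]
  rw [sum_comm]
  have h1 : ∀ g : Γ, ∑ γ : Γ, extChar χ (g * γ * g⁻¹) = ∑ γ : Γ, extChar χ γ := fun g =>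
    sum_equiv (MulAut.conj g).toEquiv _ _ fun γ => rfl
  simp only [h1, sum_extChar, sum_const, card_univ, nsmul_eq_mul]
  simp

lemma card_extChar_mul {χ : C →* ℂ} {n : ℕ} (hn : 0 < n) (hχ : orderOf χ = n) {z : ℂ}
    (hz : z ^ n = 1) : Nat.card {g : Γ // extChar χ g * z = 1} * n = Nat.card C := by
  have hχ1 : χ ^ n = 1 := hχ ▸ pow_orderOf_eq_one χ
  have h1 : (Nat.card {g : Γ // extChar χ g * z = 1} : ℂ) * n = Nat.card C := by
    have h2 : (Nat.card {g : Γ // extChar χ g * z = 1} : ℂ) * n =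
        ∑ g : Γ, ∑ i ∈ range n, z ^ i * extChar (χ ^ i) g := by
      rw [sum_congr rfl fun g _ => sum_mul_extChar_pow hχ1 hz g,
        ← sum_filter, sum_const, nsmul_eq_mul, Nat.card_eq_fintype_card,
        Fintype.card_subtype]
    rw [h2, sum_comm]
    simp only [← mul_sum, sum_extChar]
    rw [sum_eq_single_of_mem 0 (mem_range.mpr hn)]
    · simp
    · intro i hi hi0
      rw [if_neg, mul_zero]
      rw [mem_range] at hi
      exact pow_ne_one_of_lt_orderOf hi0 (by omega)
  exact_mod_cast h1

/-- The subgroup of `Γ × U` where the product of the two characters is trivial. -/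
noncomputable def twistSubgroup (χ : C →* ℂ) (ℓ : U →* ℂ) : Subgroup (Γ × U) where
  carrier := {x | extChar χ x.1 * ℓ x.2 = 1}
  one_mem' := by
    change extChar χ 1 * ℓ 1 = 1
    rw [extChar_of_mem χ C.one_mem, map_one, mul_one]
    exact map_one χ
  mul_mem' := by
    intro x y hx hy
    change extChar χ (x.1 * y.1) * ℓ (x.2 * y.2) = 1
    change extChar χ x.1 * ℓ x.2 = 1 at hx
    change extChar χ y.1 * ℓ y.2 = 1 at hy
    have hxC : x.1 ∈ C := by
      by_contra h; rw [extChar_of_notMem χ h, zero_mul] at hx; exact zero_ne_one hx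
    have hyC : y.1 ∈ C := by
      by_contra h; rw [extChar_of_notMem χ h, zero_mul] at hy; exact zero_ne_one hy
    rw [extChar_of_mem χ (C.mul_mem hxC hyC), map_mul]
    rw [extChar_of_mem χ hxC] at hx
    rw [extChar_of_mem χ hyC] at hy
    have h1 : χ ⟨x.1 * y.1, C.mul_mem hxC hyC⟩ = χ ⟨x.1, hxC⟩ * χ ⟨y.1, hyC⟩ :=
      map_mul χ ⟨x.1, hxC⟩ ⟨y.1, hyC⟩
    rw [h1, mul_mul_mul_comm, hx, hy, one_mul]
  inv_mem' := by
    intro x hx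
    change extChar χ x.1⁻¹ * ℓ x.2⁻¹ = 1
    change extChar χ x.1 * ℓ x.2 = 1 at hx
    have hxC : x.1 ∈ C := by
      by_contra h; rw [extChar_of_notMem χ h, zero_mul] at hx; exact zero_ne_one hx
    rw [extChar_of_mem χ hxC] at hx
    rw [extChar_of_mem χ (C.inv_mem hxC)]
    have h1 : χ ⟨x.1⁻¹, C.inv_mem hxC⟩ * χ ⟨x.1, hxC⟩ = 1 := by
      rw [← map_mul, ← map_one χ]; congr 1; simp
    grind

lemma mem_twistSubgroup {χ : C →* ℂ} {ℓ : U →* ℂ} {x : Γ × U} :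
    x ∈ twistSubgroup χ ℓ ↔ extChar χ x.1 * ℓ x.2 = 1 := Iff.rfl

lemma card_twistSubgroup_mul {χ : C →* ℂ} {n : ℕ} (hn : 0 < n) (hχ : orderOf χ = n) {ℓ : U →* ℂ}
    (hℓ : ∀ u, ℓ u ^ n = 1) :
    Nat.card (twistSubgroup χ ℓ) * n = Nat.card C * Nat.card U := by
  have e : twistSubgroup χ ℓ ≃ Σ u : U, {g : Γ // extChar χ g * ℓ u = 1} :=
    { toFun := fun x => ⟨x.1.2, x.1.1, x.2⟩
      invFun := fun y => ⟨(y.2.1, y.1), y.2.2⟩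
      left_inv := fun x => rfl
      right_inv := fun y => rfl }
  rw [Nat.card_congr e, Nat.card_sigma, sum_mul,
    sum_congr rfl fun u _ => card_extChar_mul hn hχ (hℓ u), sum_const,
    card_univ, smul_eq_mul, Nat.card_eq_fintype_card (α := U), mul_comm]

lemma card_conj_mem_twistSubgroup (χ : C →* ℂ) (ℓ : U →* ℂ) (x : Γ × U) :
    Nat.card {g : Γ × U // g * x * g⁻¹ ∈ twistSubgroup χ ℓ} =
      Nat.card U * Nat.card {g : Γ // extChar χ (g * x.1 * g⁻¹) * ℓ x.2 = 1} := by
  rw [← Nat.card_prod]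
  refine Nat.card_congr ?_
  have h : ∀ g : Γ × U, g * x * g⁻¹ ∈ twistSubgroup χ ℓ ↔
      extChar χ (g.1 * x.1 * g.1⁻¹) * ℓ x.2 = 1 := by
    intro g
    change extChar χ (g.1 * x.1 * g.1⁻¹) * ℓ (g.2 * x.2 * g.2⁻¹) = 1 ↔ _
    rw [mul_comm g.2, mul_inv_cancel_right]
  exact
    { toFun := fun y => (y.1.2, ⟨y.1.1, (h _).mp y.2⟩)
      invFun := fun y => ⟨(y.2.1, y.1), (h _).mpr y.2.2⟩
      left_inv := fun y => rfl
      right_inv := fun y => rfl }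

end TwistGroup

section Mertens

open Finset Real Ideal Filter

/-- Mertens' theorem for the degree one primes of a number field. -/
theorem exists_abs_sum_idealCount_primeWeight_sub_log_le (E : Type*) [Field E] [NumberField E] :
    ∃ C > 0, ∀ N : ℕ, 1 ≤ N →
      |∑ p ∈ Icc 1 N, (idealCount E p : ℝ) * primeWeight p - log N| ≤ C := by
  have hbd : ∃ T : ℝ, 1 ≤ T ∧ ∀ i, ∀ w : InfinitePlace E, w (integralBasis E i) ≤ T := by
    refine ⟨1 + ∑ i, ∑ w : InfinitePlace E, w (integralBasis E i), ?_, fun i w => ?_⟩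
    · have : 0 ≤ ∑ i, ∑ w : InfinitePlace E, w (integralBasis E i) :=
        sum_nonneg fun i _ => sum_nonneg fun w _ => apply_nonneg _ _
      linarith
    · have h1 := single_le_sum (f := fun i => ∑ w : InfinitePlace E, w (integralBasis E i))
        (fun i _ => sum_nonneg fun w _ => apply_nonneg _ _) (mem_univ i)
      have h2 := single_le_sum (f := fun w : InfinitePlace E => w (integralBasis E i))
        (fun w _ => apply_nonneg _ _) (mem_univ w)
      linarith
  obtain ⟨T, hT1, hT⟩ := hbd
  obtain ⟨κ, hκ, -, h1, -⟩ := ideal_count (integralBasis E)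
    (fun i => by rw [integralBasis_apply]; exact (RingOfIntegers.basis E i).2) hT1 hT 1
  have hd : 0 < finrank ℚ E := Module.finrank_pos
  exact exists_abs_sum_primeWeight_sub_log_le isLogFactor_idealCount (Nat.cast_nonneg _) hκ
    (countBound_pos _ _ _).le (saving_pos hd) (saving_lt_one hd).le h1

lemma abs_sum_Icc_le_of_support {g : ℕ → ℝ} {D : ℕ} (hD : D ≠ 0) (hg : ∀ n, ¬ n ∣ D → g n = 0)
    (N : ℕ) : |∑ n ∈ Icc 1 N, g n| ≤ ∑ n ∈ D.divisors, |g n| := by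
  rw [← sum_filter_of_ne (p := fun n => n ∣ D)
    (fun n _ hn => by by_contra h; exact hn (hg n h))]
  refine (abs_sum_le_sum_abs _ _).trans (sum_le_sum_of_subset_of_nonneg ?_
    fun _ _ _ => abs_nonneg _)
  grind

lemma eq_zero_of_mul_log_le {a C : ℝ} (h : ∀ N : ℕ, 1 ≤ N → |a * log N| ≤ C) : a = 0 := by
  by_contra ha
  have h1 : Tendsto (fun N : ℕ => |a| * log N) atTop atTop :=
    (tendsto_log_atTop.comp tendsto_natCast_atTop_atTop).const_mul_atTop (abs_pos.mpr ha)
  obtain ⟨N, hN, hN1⟩ := ((h1.eventually_gt_atTop C).and (eventually_ge_atTop 1)).exists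
  have h2 := h N hN1
  rw [abs_mul, abs_of_nonneg (log_natCast_nonneg N)] at h2
  exact absurd h2 (not_le.mpr hN)

end Mertens

section TwistField

variable {K : Type*} [Field K] [NumberField K] [IsGalois ℚ K]

/-- A choice of Frobenius element at each unramified prime. -/
def IsFrobeniusChoice (frob : ℕ → K ≃ₐ[ℚ] K) : Prop :=
  ∀ p : ℕ, p.Prime → ¬ (p : ℤ) ∣ discr K → ∃ P : Ideal (𝓞 K), IsFreeFrobenius p P (frob p)

variable (K) in
lemma exists_isFrobeniusChoice : ∃ frob : ℕ → K ≃ₐ[ℚ] K, IsFrobeniusChoice frob := by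
  have h : ∀ p : ℕ, ∃ σ : K ≃ₐ[ℚ] K, p.Prime → ¬ (p : ℤ) ∣ discr K →
      ∃ P : Ideal (𝓞 K), IsFreeFrobenius p P σ := by
    intro p
    by_cases hp : p.Prime
    · by_cases hd : (p : ℤ) ∣ discr K
      · exact ⟨1, fun _ h => absurd hd h⟩
      · obtain ⟨P, σ, h⟩ := exists_isFreeFrobenius (L := K) hp hd
        exact ⟨σ, fun _ _ => ⟨P, h⟩⟩
    · exact ⟨1, fun h => absurd h hp⟩
  choose frob hf using h
  exact ⟨frob, hf⟩

variable {L : Type*} [Field L] [NumberField L]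
  [Algebra K L] {Q : ℕ} [NeZero Q] [IsCyclotomicExtension {Q} K L]

/-- The subfield of `K(ζ)` fixed by a subgroup of the product Galois group. -/
noncomputable abbrev twistField {ζ : L} (hζ : IsPrimitiveRoot ζ Q)
    (W : Subgroup ((K ≃ₐ[ℚ] K) × (ZMod Q)ˣ)) : IntermediateField ℚ L :=
  IntermediateField.fixedField (W.comap (splitHom K hζ))

variable {ζ : L} (hζ : IsPrimitiveRoot ζ Q) (hQ : Q.Coprime (discr K).natAbs)
  (W : Subgroup ((K ≃ₐ[ℚ] K) × (ZMod Q)ˣ))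

include hQ in
lemma card_comap_splitHom [IsGalois ℚ L] : Nat.card (W.comap (splitHom K hζ)) = Nat.card W := by
  exact Nat.card_congr ((Equiv.ofBijective _ (splitHom_bijective hζ hQ)).subtypeEquiv
    fun _ => Iff.rfl)

include hQ in
lemma finrank_twistField_mul [IsGalois ℚ L] : finrank ℚ (twistField hζ W) * Nat.card W =
    Nat.card (K ≃ₐ[ℚ] K) * Nat.card (ZMod Q)ˣ := by
  rw [← card_comap_splitHom hζ hQ, ← Nat.card_prod,
    ← Nat.card_congr (Equiv.ofBijective _ (splitHom_bijective hζ hQ)),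
    IsGalois.card_aut_eq_finrank, ← IntermediateField.finrank_fixedField_eq_card, mul_comm,
    mul_comm]
  exact Module.finrank_mul_finrank ℚ (twistField hζ W) L

include hQ in
/-- The number of ideals of prime norm in a twist field. -/
theorem idealCount_twistField_mul_card [IsGalois ℚ L] {frob : ℕ → K ≃ₐ[ℚ] K}
    (hfrob : IsFrobeniusChoice frob) {p : ℕ} (hp : p.Prime) (hpd : ¬ (p : ℤ) ∣ discr K)
    {u : (ZMod Q)ˣ} (hu : (u : ZMod Q) = p) :
    idealCount (twistField hζ W) p * Nat.card W =
      Nat.card {g : (K ≃ₐ[ℚ] K) × (ZMod Q)ˣ // g * (frob p, u) * g⁻¹ ∈ W} := by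
  obtain ⟨P, hP⟩ := hfrob p hp hpd
  have hpQ : ¬ p ∣ Q := by
    intro h
    have h1 : IsUnit (p : ZMod Q) := hu ▸ u.isUnit
    rw [ZMod.isUnit_iff_coprime] at h1
    exact hp.one_lt.ne' (Nat.eq_one_of_dvd_coprimes h1 dvd_rfl h)
  obtain ⟨P', τ, hτ, hτ1, hτ2⟩ := hP.exists_lift (L := L) hζ.pow_eq_one
    (fun g => eq_one_of_restrict_eq_one hζ g) hp hpQ
  have hs : splitHom K hζ τ = (frob p, u) := by
    refine Prod.ext hτ1 (Units.ext ?_)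
    change ((hζ.autToPow ℚ τ : (ZMod Q)ˣ) : ZMod Q) = u
    rw [hu, autToPow_eq_of_apply_eq hζ hτ2]
  rw [← card_comap_splitHom hζ hQ, idealCount_fixedField_mul_card _ hτ hp]
  refine Nat.card_congr ((Equiv.ofBijective _ (splitHom_bijective hζ hQ)).subtypeEquiv fun g => ?_)
  simp_all

include hQ in
/-- Some ideal norm detects a given Dirichlet character which is nontrivial on `W`. -/
theorem exists_ideal_apply_ne_one [IsGalois ℚ L] (ψ : DirichletCharacter ℂ Q)
    (hψ : ∃ w ∈ W, ψ (w.2 : ZMod Q) ≠ 1) :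
    ∃ B : Ideal (𝓞 (twistField hζ W)), B ≠ ⊥ ∧ (Ideal.absNorm B).Coprime Q ∧
      ψ (Ideal.absNorm B : ZMod Q) ≠ 1 := by
  by_contra hcon
  push Not at hcon
  obtain ⟨frob, hfrob⟩ := exists_isFrobeniusChoice K
  let k : ((K ≃ₐ[ℚ] K) × (ZMod Q)ˣ) →* ℂ :=
    (ψ.toMonoidHom.comp (Units.coeHom (ZMod Q))).comp (MonoidHom.snd _ _)
  have hk : ∀ w, k w = ψ (w.2 : ZMod Q) := fun w => rfl
  let W' := W ⊓ k.ker
  have hW' : ∀ w, w ∈ W' ↔ w ∈ W ∧ ψ (w.2 : ZMod Q) = 1 := fun w => Iff.rfl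
  have key : ∀ p : ℕ, p.Prime → ¬ p ∣ Q * (discr K).natAbs →
      idealCount (twistField hζ W) p * Nat.card W =
        idealCount (twistField hζ W') p * Nat.card W' := by
    intro p hp hpd
    have hp1 : ¬ p ∣ Q := fun h => hpd (h.mul_right _)
    have hp2 : ¬ (p : ℤ) ∣ discr K := fun h => hpd ((Int.natCast_dvd.mp h).mul_left _)
    have hcop : p.Coprime Q := (Nat.Prime.coprime_iff_not_dvd hp).mpr hp1
    have hu : ((ZMod.unitOfCoprime p hcop : (ZMod Q)ˣ) : ZMod Q) = p := ZMod.coe_unitOfCoprime p hcop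
    have e1 := idealCount_twistField_mul_card hζ hQ W hfrob hp hp2 hu
    have e2 := idealCount_twistField_mul_card hζ hQ W' hfrob hp hp2 hu
    by_cases h1 : ψ (p : ZMod Q) = 1
    · rw [e1, e2]
      refine Nat.card_congr (Equiv.subtypeEquivRight fun g => ?_)
      rw [hW', iff_self_and]
      intro _
      rw [← hk, map_mul, mul_comm, ← map_mul, inv_mul_cancel_left, hk, hu, h1]
    · have h2 : idealCount (twistField hζ W) p = 0 := by
        rw [idealCount, Nat.card_eq_zero]
        left
        refine ⟨fun I => h1 ?_⟩
        have h3 := hcon I.1 (by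
          intro h
          have h4 := I.2
          rw [h, Ideal.absNorm_bot] at h4
          exact hp.ne_zero h4.symm) (by rw [I.2]; exact hcop)
        rwa [I.2] at h3
      have h3 : Nat.card {g : (K ≃ₐ[ℚ] K) × (ZMod Q)ˣ //
          g * (frob p, ZMod.unitOfCoprime p hcop) * g⁻¹ ∈ W'} = 0 := by
        rw [Nat.card_eq_zero]
        left
        refine ⟨fun g => h1 ?_⟩
        have h4 := ((hW' _).mp g.2).2
        rw [← hk, map_mul, mul_comm, ← map_mul, inv_mul_cancel_left, hk, hu] at h4
        exact h4
      rw [e2, h3, h2, zero_mul]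
  obtain ⟨C, hC, h1⟩ := exists_abs_sum_idealCount_primeWeight_sub_log_le (twistField hζ W)
  obtain ⟨C', hC', h2⟩ := exists_abs_sum_idealCount_primeWeight_sub_log_le (twistField hζ W')
  set g : ℕ → ℝ := fun p => ((idealCount (twistField hζ W) p : ℝ) * Nat.card W -
    (idealCount (twistField hζ W') p : ℝ) * Nat.card W') * primeWeight p with hg
  have hD : Q * (discr K).natAbs ≠ 0 :=
    mul_ne_zero (NeZero.ne Q) (Int.natAbs_ne_zero.mpr (discr_ne_zero K))
  have hg0 : ∀ n, ¬ n ∣ Q * (discr K).natAbs → g n = 0 := by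
    intro n hn
    by_cases hp : n.Prime
    · have h3 : (idealCount (twistField hζ W) n : ℝ) * Nat.card W =
        (idealCount (twistField hζ W') n : ℝ) * Nat.card W' := by exact_mod_cast key n hp hn
      grind
    · rw [hg]
      simp [primeWeight, hp]
  have h3 : ∀ N : ℕ, 1 ≤ N → |((Nat.card W : ℝ) - Nat.card W') * Real.log N| ≤
      ∑ n ∈ (Q * (discr K).natAbs).divisors, |g n| + Nat.card W * C + Nat.card W' * C' := by
    intro N hN
    have e1 := h1 N hN
    have e2 := h2 N hN
    have e3 := abs_sum_Icc_le_of_support hD hg0 N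
    have e4 : ((Nat.card W : ℝ) - Nat.card W') * Real.log N = ∑ n ∈ Finset.Icc 1 N, g n -
        Nat.card W * (∑ p ∈ Finset.Icc 1 N, (idealCount (twistField hζ W) p : ℝ) * primeWeight p -
          Real.log N) + Nat.card W' * (∑ p ∈ Finset.Icc 1 N,
          (idealCount (twistField hζ W') p : ℝ) * primeWeight p - Real.log N) := by
      have e5 : ∑ n ∈ Finset.Icc 1 N, g n = Nat.card W * ∑ p ∈ Finset.Icc 1 N,
          (idealCount (twistField hζ W) p : ℝ) * primeWeight p - Nat.card W' *
          ∑ p ∈ Finset.Icc 1 N, (idealCount (twistField hζ W') p : ℝ) * primeWeight p := by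
        rw [Finset.mul_sum, Finset.mul_sum, ← Finset.sum_sub_distrib]
        refine Finset.sum_congr rfl fun n _ => ?_
        ring
      rw [e5]
      ring
    rw [e4]
    refine (abs_add_le _ _).trans (add_le_add ((abs_sub _ _).trans (add_le_add e3 ?_)) ?_)
    · rw [abs_mul, Nat.abs_cast]
      gcongr
    · rw [abs_mul, Nat.abs_cast]
      gcongr
  have h4 := sub_eq_zero.mp (eq_zero_of_mul_log_le h3)
  have h5 : Nat.card W = Nat.card W' := by exact_mod_cast h4
  have h6 : W' = W := Subgroup.eq_of_le_of_card_ge inf_le_left h5.le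
  obtain ⟨w, hw, hw1⟩ := hψ
  grind

end TwistField

section FieldTwist

open Finset Real Ideal

lemma saving_anti {d D : ℕ} (hd : 0 < d) (h : d ≤ D) : saving D ≤ saving d := by
  rw [saving, saving, div_div, div_div]
  have h3 : (2 : ℝ) ^ d ≤ 2 ^ D := pow_le_pow_right₀ (by norm_num) h
  exact one_div_le_one_div_of_le (by positivity) (by gcongr)

lemma countBound_le {d D Q : ℕ} (hdD : d ≤ D) (hQ : 1 ≤ Q) {T : ℝ} (hT : 1 ≤ T) :
    countBound d Q (T * Q) ≤ 12 * (4 * ((1 + 6 * (D : ℝ) ^ 2 * T ^ 2) * (Q : ℝ) ^ 3) ^ D) ^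
      (D ^ 3 + D ^ 2 + 2 * D + 2) := by
  have hQ1 : (1 : ℝ) ≤ Q := by exact_mod_cast hQ
  have hQ3 : (1 : ℝ) ≤ (Q : ℝ) ^ 3 := one_le_pow₀ hQ1
  have h1 : 1 + 6 * (d : ℝ) ^ 2 * (T * Q) ^ 2 * Q ≤ (1 + 6 * (D : ℝ) ^ 2 * T ^ 2) * (Q : ℝ) ^ 3 := by
    have : 6 * (d : ℝ) ^ 2 * (T * Q) ^ 2 * Q ≤ 6 * (D : ℝ) ^ 2 * T ^ 2 * (Q : ℝ) ^ 3 := by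
      have e : 6 * (d : ℝ) ^ 2 * (T * Q) ^ 2 * Q = 6 * (d : ℝ) ^ 2 * T ^ 2 * (Q : ℝ) ^ 3 := by ring
      rw [e]
      gcongr
    linarith
  have h0 : (1 : ℝ) ≤ 1 + 6 * (d : ℝ) ^ 2 * (T * Q) ^ 2 * Q := by
    bound
  have h2 : levelBound d Q (T * Q) ≤
      4 * ((1 + 6 * (D : ℝ) ^ 2 * T ^ 2) * (Q : ℝ) ^ 3) ^ D := by
    refine mul_le_mul_of_nonneg_left ?_ (by norm_num)
    calc (1 + 6 * (d : ℝ) ^ 2 * (T * Q) ^ 2 * Q) ^ d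
        ≤ (1 + 6 * (d : ℝ) ^ 2 * (T * Q) ^ 2 * Q) ^ D := pow_le_pow_right₀ h0 hdD
      _ ≤ _ := pow_le_pow_left₀ (by linarith) h1 D
  have h4 := four_le_levelBound d Q (T * Q)
  refine mul_le_mul_of_nonneg_left ?_ (by norm_num)
  calc levelBound d Q (T * Q) ^ (d ^ 3 + d ^ 2 + 2 * d + 2)
      ≤ levelBound d Q (T * Q) ^ (D ^ 3 + D ^ 2 + 2 * D + 2) :=
        pow_le_pow_right₀ (by linarith) (by gcongr)
    _ ≤ _ := pow_le_pow_left₀ (by linarith) h2 _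

lemma dirichletCharacter_eq_zero_or_pow_eq_one {Q : ℕ} (χ : DirichletCharacter ℂ Q) {m : ℕ}
    (hm : χ ^ m = 1) (a : ZMod Q) : χ a = 0 ∨ χ a ^ m = 1 := by
  by_cases h : IsUnit a
  · right
    obtain ⟨u, rfl⟩ := h
    rw [← MulChar.pow_apply_coe, hm, MulChar.one_apply_coe]
  · left
    exact χ.map_nonunit h

/-- Uniform bound for twisted prime sums of a number field of bounded degree. -/
theorem exists_norm_sum_prime_twist_le (D n : ℕ) (hD : 0 < D) {T : ℝ} (hT : 1 ≤ T) :
    ∃ A > 0, ∃ k : ℕ, ∀ (E : Type*) [Field E] [NumberField E] (Q : ℕ) [NeZero Q],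
      finrank ℚ E ≤ D → ∀ θ : Basis (Fin (finrank ℚ E)) ℚ E, (∀ i, IsIntegral ℤ (θ i)) →
      (∀ i, ∀ w : InfinitePlace E, w (θ i) ≤ T * Q) →
      ∀ χ : DirichletCharacter ℂ Q, χ.Even → 3 ≤ orderOf χ → orderOf χ ≤ n →
      (∀ i, χ ^ i ≠ 1 → ∃ B : Ideal (𝓞 E), B ≠ ⊥ ∧ (absNorm B).Coprime Q ∧
        (χ ^ i) (absNorm B : ZMod Q) ≠ 1) →
      ∀ N : ℕ, ‖∑ p ∈ Icc 1 N, χ (p : ZMod Q) * ((idealCount E p : ℝ) : ℂ) *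
        (primeWeight p : ℂ)‖ ≤ A * (Q : ℝ) ^ k := by
  set c := saving D with hc
  have hc0 : 0 < c := saving_pos hD
  have hc1 : c ≤ 1 := (saving_lt_one hD).le
  obtain ⟨CΛ, hCΛ0, hCΛ⟩ := exists_sum_vonMangoldt_rpow_le hc0 hc1
  obtain ⟨C, hC0, hC⟩ := exists_sum_sub_primeWeight_le
  set e := D ^ 3 + D ^ 2 + 2 * D + 2 with he
  set a := 1 + 6 * (D : ℝ) ^ 2 * T ^ 2 with ha
  have ha1 : 1 ≤ a := by
    nlinarith
  have ha0 : 0 < a := by linarith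
  set κ := 7 + 4 / c ^ 2 with hκ
  have hκ1 : 1 ≤ κ := by
    have : 0 ≤ 4 / c ^ 2 := by positivity
    linarith
  refine ⟨4 * (24 * (4 * a ^ D) ^ e * κ) ^ n * (1 + 2 * D * CΛ) + D * C, by positivity,
    3 * D * e * n, ?_⟩
  intro E _ _ Q _ hE θ hθ hθT χ hχe hχ3 hχn hB N
  have hQ1 : 1 ≤ Q := NeZero.pos Q
  have hQ1' : (1 : ℝ) ≤ Q := by exact_mod_cast hQ1
  have hd : 0 < finrank ℚ E := Module.finrank_pos
  have hTQ : 1 ≤ T * Q := by nlinarith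
  obtain ⟨κ', hκ'0, hκ', h1, h2⟩ := ideal_count θ hθ hTQ hθT Q
  set B0 := countBound (finrank ℚ E) Q (T * Q) with hB0
  have hB0pos : 0 < B0 := countBound_pos _ _ _
  set B := 24 * (4 * (a * (Q : ℝ) ^ 3) ^ D) ^ e with hBdef
  have hB0B : 2 * B0 ≤ B := by
    have := countBound_le hE hQ1 hT
    linarith
  have hB1 : 1 ≤ B := by
    bound
  have hpow : ∀ N : ℕ, 1 ≤ N → (N : ℝ) ^ (1 - saving (finrank ℚ E)) ≤ (N : ℝ) ^ (1 - c) := by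
    intro N hN
    exact rpow_le_rpow_of_exponent_le (by exact_mod_cast hN)
      (by linarith [saving_anti hd hE])
  have hm0 : χ ^ orderOf χ = 1 := pow_orderOf_eq_one χ
  have hlog := isLogFactor_idealCount (E := E)
  have key := norm_sum_twist_le hlog (ν := fun n => χ (n : ZMod Q)) (m := orderOf χ)
    (by simp) (fun x y => by push_cast; exact map_mul χ _ _)
    (fun n => dirichletCharacter_eq_zero_or_pow_eq_one χ hm0 _) hχ3 hc0 hc1 hB1
    (Nat.cast_nonneg _) hCΛ (fun N hN => by
      have h3 := h1 N hN
      have hN1 : (1 : ℝ) ≤ N := by exact_mod_cast hN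
      have h4 : (N : ℝ) ^ (1 - saving (finrank ℚ E)) ≤ N := by
        conv_rhs => rw [← rpow_one (N : ℝ)]
        exact rpow_le_rpow_of_exponent_le hN1 (by linarith [saving_pos hd])
      have h5 := (abs_le.mp h3).2
      have h6 : κ' * N ≤ B0 * N := mul_le_mul_of_nonneg_right hκ' (by linarith)
      have h7 : B0 * (N : ℝ) ^ (1 - saving (finrank ℚ E)) ≤ B0 * N :=
        mul_le_mul_of_nonneg_left h4 hB0pos.le
      have h8 : 2 * B0 * N ≤ B * N := mul_le_mul_of_nonneg_right hB0B (by linarith)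
      linarith)
    (fun i hi him N hN => by
      have h3 : χ ^ i ≠ 1 := pow_ne_one_of_lt_orderOf hi.ne' him
      have h4 : (χ ^ i).Even := by
        change (χ ^ i) (-1) = 1
        rw [MulChar.pow_apply' _ hi.ne', hχe, one_pow]
      have h5 := h2 (χ ^ i) h4 (hB i h3) N hN
      have h6 : ∑ n ∈ Icc 1 N, χ (n : ZMod Q) ^ i * ((idealCount E n : ℝ) : ℂ) =
          ∑ n ∈ Icc 1 N, (χ ^ i) (n : ZMod Q) * (idealCount E n : ℂ) := by
        refine sum_congr rfl fun n _ => ?_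
        rw [MulChar.pow_apply' _ hi.ne', Complex.ofReal_natCast]
      rw [h6]
      refine h5.trans ?_
      exact mul_le_mul (by linarith) (hpow N hN) (by positivity) (by linarith)) N
  have hnorm : ∀ n : ℕ, ‖χ (n : ZMod Q)‖ ≤ 1 := fun n => χ.norm_le_one _
  have key2 := norm_sum_deriv_sub_primeWeight_le hlog hC (Nat.cast_nonneg _) hnorm N
  have h3 : 4 * (B * κ) ^ orderOf χ * (1 + 2 * (finrank ℚ E : ℝ) * CΛ) ≤
      4 * (B * κ) ^ n * (1 + 2 * D * CΛ) := by
    have h4 : 1 ≤ B * κ := by nlinarith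
    gcongr
  have h4 : (B * κ) ^ n = (24 * (4 * a ^ D) ^ e * κ) ^ n * (Q : ℝ) ^ (3 * D * e * n) := by
    rw [hBdef, mul_pow a, ← mul_assoc (4 : ℝ), mul_pow (4 * a ^ D), ← pow_mul, ← pow_mul,
      ← mul_assoc, mul_right_comm, ← mul_assoc 3, mul_pow _ ((Q : ℝ) ^ (3 * D * e)), ← pow_mul]
  have h5 : (finrank ℚ E : ℝ) * C ≤ D * C * (Q : ℝ) ^ (3 * D * e * n) := by
    have h6 : (1 : ℝ) ≤ (Q : ℝ) ^ (3 * D * e * n) := one_le_pow₀ hQ1'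
    calc (finrank ℚ E : ℝ) * C ≤ D * C := by gcongr
      _ ≤ _ := le_mul_of_one_le_right (by positivity) h6
  have h6 := norm_le_insert' (∑ p ∈ Icc 1 N, χ (p : ZMod Q) * ((idealCount E p : ℝ) : ℂ) *
        (primeWeight p : ℂ)) (∑ k ∈ Icc 1 N, χ (k : ZMod Q) * (fieldVonMangoldt E k : ℂ) *
        (((k : ℝ) ^ (-1 : ℝ) : ℝ) : ℂ))
  rw [norm_sub_rev] at h6
  have h7 := key.trans h3
  rw [h4] at h7
  grind

end FieldTwist

section KeyChar

open Finset Real Complex Fintype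

lemma idealCount_prime_le (E : Type*) [Field E] [NumberField E] {p : ℕ} (hp : p.Prime) :
    idealCount E p ≤ finrank ℚ E := by
  have h := isLogFactor_idealCount (E := E)
  have h1 := h.deriv_le p
  rw [h.deriv_prime hp, ArithmeticFunction.vonMangoldt_apply_prime hp] at h1
  have h2 : 0 < Real.log p := Real.log_pos (by exact_mod_cast hp.one_lt)
  exact_mod_cast le_of_mul_le_mul_right h1 h2

lemma primeWeight_le_one (n : ℕ) : primeWeight n ≤ 1 := by
  rw [primeWeight]
  split_ifs with h
  · rw [div_le_one (by exact_mod_cast h.pos)]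
    exact (log_le_sub_one_of_pos (by exact_mod_cast h.pos)).trans (by linarith)
  · exact zero_le_one

variable {K : Type*} [Field K] [NumberField K] [IsGalois ℚ K]

/-- A Dirichlet character as a character of the unit group. -/
noncomputable def unitChar {Q : ℕ} (l : DirichletCharacter ℂ Q) : (ZMod Q)ˣ →* ℂ :=
  l.toMonoidHom.comp (Units.coeHom (ZMod Q))

lemma unitChar_apply {Q : ℕ} (l : DirichletCharacter ℂ Q) (u : (ZMod Q)ˣ) :
    unitChar l u = l (u : ZMod Q) := rfl

lemma unitChar_pow_eq_one {Q n : ℕ} {l : DirichletCharacter ℂ Q} (hl : l ^ n = 1) (u : (ZMod Q)ˣ) :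
    unitChar l u ^ n = 1 := by
  rw [unitChar_apply, ← MulChar.pow_apply_coe, hl, MulChar.one_apply_coe]

variable {C : Subgroup (K ≃ₐ[ℚ] K)} {χ : C →* ℂ}

lemma orderOf_char_pos (χ : C →* ℂ) : 0 < orderOf χ := by
  refine orderOf_pos_iff.mpr (isOfFinOrder_iff_pow_eq_one.mpr ⟨card C, card_pos, ?_⟩)
  ext c
  rw [MonoidHom.pow_apply, ← map_pow, pow_card_eq_one, map_one, MonoidHom.one_apply]

variable {L : Type*} [Field L] [NumberField L]
  [Algebra K L] {Q : ℕ} [NeZero Q] [IsCyclotomicExtension {Q} K L]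
  {ζ : L} (hζ : IsPrimitiveRoot ζ Q) (hQ : Q.Coprime (discr K).natAbs)

include hQ in
/-- Ideals of prime norm in terms of induced characters. -/
theorem card_mul_idealCount_twistField [IsGalois ℚ L] {frob : ℕ → K ≃ₐ[ℚ] K}
    (hfrob : IsFrobeniusChoice frob) {l : DirichletCharacter ℂ Q} (hl : l ^ orderOf χ = 1)
    {p : ℕ} (hp : p.Prime) (hpd : ¬ (p : ℤ) ∣ discr K) (hpQ : p.Coprime Q) :
    (Nat.card C : ℂ) * idealCount (twistField hζ (twistSubgroup χ (unitChar l))) p =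
      ∑ i ∈ range (orderOf χ), l (p : ZMod Q) ^ i * indChar (χ ^ i) (frob p) := by
  have hn := orderOf_char_pos χ
  set W := twistSubgroup χ (unitChar l)
  have hu : ((ZMod.unitOfCoprime p hpQ : (ZMod Q)ˣ) : ZMod Q) = p := ZMod.coe_unitOfCoprime p hpQ
  have h1 := idealCount_twistField_mul_card hζ hQ W hfrob hp hpd hu
  rw [card_conj_mem_twistSubgroup] at h1
  have h2 := card_twistSubgroup_mul hn rfl (unitChar_pow_eq_one hl) (χ := χ)
  have h3 := card_extChar_conj_mul (pow_orderOf_eq_one χ) (unitChar_pow_eq_one hl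
    (ZMod.unitOfCoprime p hpQ)) (frob p)
  rw [unitChar_apply, hu] at h3
  rw [← h3]
  have hU : (Nat.card (ZMod Q)ˣ : ℂ) ≠ 0 := by
    exact_mod_cast Nat.card_pos.ne'
  have h1' : (idealCount (twistField hζ W) p : ℂ) * Nat.card W = Nat.card (ZMod Q)ˣ *
      Nat.card {g : K ≃ₐ[ℚ] K // extChar χ (g * frob p * g⁻¹) * l (p : ZMod Q) = 1} := by
    rw [← Nat.cast_mul, h1, unitChar_apply, hu, Nat.cast_mul]
  have h2' : (Nat.card W : ℂ) * orderOf χ = Nat.card C * Nat.card (ZMod Q)ˣ := by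
    exact_mod_cast h2
  grind

include hQ in
lemma finrank_twistField_le [IsGalois ℚ L] {l : DirichletCharacter ℂ Q} (hl : l ^ orderOf χ = 1) :
    finrank ℚ (twistField hζ (twistSubgroup χ (unitChar l))) ≤ Nat.card (K ≃ₐ[ℚ] K) := by
  have hn := orderOf_char_pos χ
  have h1 := finrank_twistField_mul hζ hQ (twistSubgroup χ (unitChar l))
  have h2 := card_twistSubgroup_mul hn rfl (unitChar_pow_eq_one hl) (χ := χ)
  have h3 := card_extChar_mul hn (χ := χ) rfl (one_pow _)
  have h4 : orderOf χ ≤ Nat.card C := by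
    rw [← h3]
    refine Nat.le_mul_of_pos_left _ (Nat.pos_of_ne_zero fun h => ?_)
    rw [h, zero_mul] at h3
    exact Nat.card_pos.ne h3
  have hU : 0 < Nat.card (ZMod Q)ˣ := Nat.card_pos
  have hC : 0 < Nat.card C := Nat.card_pos
  refine Nat.le_of_mul_le_mul_right ?_ (Nat.mul_pos hC hU)
  calc _ = finrank ℚ (twistField hζ (twistSubgroup χ (unitChar l))) *
        Nat.card (twistSubgroup χ (unitChar l)) * orderOf χ := by rw [← h2, mul_assoc]
    _ = Nat.card (K ≃ₐ[ℚ] K) * (orderOf χ * Nat.card (ZMod Q)ˣ) := by rw [h1]; ring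
    _ ≤ _ := by gcongr

lemma exists_mem_twistSubgroup_apply_ne_one {l : DirichletCharacter ℂ Q} (hl : l ^ orderOf χ = 1)
    {ψ : DirichletCharacter ℂ Q} (hψ : ψ ≠ 1) :
    ∃ w ∈ twistSubgroup χ (unitChar l), ψ (w.2 : ZMod Q) ≠ 1 := by
  obtain ⟨u, hu⟩ := MulChar.ne_one_iff.mp hψ
  have h1 := card_extChar_mul (orderOf_char_pos χ) (χ := χ) rfl (unitChar_pow_eq_one hl u)
  have h2 : Nat.card {g : K ≃ₐ[ℚ] K // extChar χ g * unitChar l u = 1} ≠ 0 := by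
    intro h
    rw [h, zero_mul] at h1
    exact Nat.card_pos.ne h1
  rw [Nat.card_ne_zero] at h2
  obtain ⟨⟨g, hg⟩⟩ := h2.1
  exact ⟨(g, u), hg, hu⟩

lemma norm_sum_dvd_le {D : ℕ} (hD : D ≠ 0) {g : ℕ → ℂ} {B : ℝ} (hB : ∀ n, ‖g n‖ ≤ B) (N : ℕ) :
    ‖∑ n ∈ Icc 1 N, (if n ∣ D then g n else 0)‖ ≤ D.divisors.card * B := by
  have hB0 : 0 ≤ B := (norm_nonneg _).trans (hB 0)
  rw [← sum_filter]
  refine (norm_sum_le_of_le _ fun n _ => hB n).trans ?_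
  rw [sum_const, nsmul_eq_mul]
  refine mul_le_mul_of_nonneg_right (Nat.cast_le.mpr (card_le_card fun n hn => ?_)) hB0
  grind

end KeyChar

section KeyBound

variable {K : Type*} [Field K] [NumberField K] [IsGalois ℚ K] {C : Subgroup (K ≃ₐ[ℚ] K)}

/-- Sums over primes of a sum of induced characters, by Mertens' theorem. -/
theorem exists_norm_sum_indChar_sub_log_le (χ : C →* ℂ) {frob : ℕ → K ≃ₐ[ℚ] K}
    (hfrob : IsFrobeniusChoice frob) : ∃ A > 0, ∀ N : ℕ, 1 ≤ N →
    ‖∑ p ∈ Finset.Icc 1 N, (if p ∣ (discr K).natAbs then 0 else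
      ∑ i ∈ Finset.range (orderOf χ), indChar (χ ^ i) (frob p)) * (primeWeight p : ℂ) -
        (Nat.card C : ℂ) * (Real.log N : ℂ)‖ ≤ A := by
  have hD : (discr K).natAbs ≠ 0 := Int.natAbs_ne_zero.mpr (discr_ne_zero K)
  have hG := isGalois_of_isCyclotomicExtension K (L := CyclotomicField 1 K) 1
  have hζ := IsCyclotomicExtension.zeta_spec 1 K (CyclotomicField 1 K)
  have hQ : Nat.Coprime 1 (discr K).natAbs := Nat.coprime_one_left _
  have hl : (1 : DirichletCharacter ℂ 1) ^ orderOf χ = 1 := one_pow _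
  set E := twistField hζ (twistSubgroup χ (unitChar 1)) with hE
  obtain ⟨A, hA, h⟩ := exists_abs_sum_idealCount_primeWeight_sub_log_le E
  set g : ℕ → ℂ := fun p => (Nat.card C : ℂ) * (idealCount E p : ℂ) * (primeWeight p : ℂ) with hg
  have hgB : ∀ n, ‖g n‖ ≤ Nat.card C * finrank ℚ E := by
    intro n
    rw [hg]
    by_cases hp : n.Prime
    · simp only [norm_mul, Complex.norm_natCast, Complex.norm_real]
      rw [Real.norm_of_nonneg (primeWeight_nonneg n)]
      have h1 : (idealCount E n : ℝ) ≤ finrank ℚ E := by exact_mod_cast idealCount_prime_le E hp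
      calc (Nat.card C : ℝ) * idealCount E n * primeWeight n ≤ Nat.card C * finrank ℚ E * 1 :=
            mul_le_mul (by gcongr) (primeWeight_le_one n) (primeWeight_nonneg n) (by positivity)
        _ = _ := mul_one _
    · simp only [primeWeight, hp, if_false, Complex.ofReal_zero, mul_zero, norm_zero]
      positivity
  refine ⟨Nat.card C * A + (discr K).natAbs.divisors.card * (Nat.card C * finrank ℚ E),
    by have : 0 < Nat.card C := Nat.card_pos
       positivity, fun N hN => ?_⟩
  have h1 : ∑ p ∈ Finset.Icc 1 N, (if p ∣ (discr K).natAbs then 0 else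
      ∑ i ∈ Finset.range (orderOf χ), indChar (χ ^ i) (frob p)) * (primeWeight p : ℂ) =
      ∑ p ∈ Finset.Icc 1 N, g p -
        ∑ p ∈ Finset.Icc 1 N, (if p ∣ (discr K).natAbs then g p else 0) := by
    rw [← Finset.sum_sub_distrib]
    refine Finset.sum_congr rfl fun p _ => ?_
    by_cases hp : p.Prime
    · by_cases hpd : p ∣ (discr K).natAbs
      · grind
      · rw [if_neg hpd, if_neg hpd, sub_zero, hg]
        simp only
        rw [hE, card_mul_idealCount_twistField hζ hQ hfrob hl hp
          (fun h => hpd (Int.natCast_dvd.mp h)) (Nat.coprime_one_right p)]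
        congr 1
        refine Finset.sum_congr rfl fun i _ => ?_
        rw [MulChar.one_apply (isUnit_of_subsingleton _), one_pow, one_mul]
    · simp [hg, primeWeight, hp]
  have h2 : ∑ p ∈ Finset.Icc 1 N, g p - (Nat.card C : ℂ) * (Real.log N : ℂ) = (Nat.card C : ℂ) *
      ((∑ p ∈ Finset.Icc 1 N, (idealCount E p : ℝ) * primeWeight p - Real.log N : ℝ) : ℂ) := by
    rw [hg]
    push_cast
    rw [mul_sub, Finset.mul_sum]
    simp only [mul_assoc]
  rw [h1, sub_right_comm, h2]
  refine (norm_sub_le _ _).trans (add_le_add ?_ (norm_sum_dvd_le hD hgB N))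
  rw [norm_mul, Complex.norm_natCast, Complex.norm_real]
  bound

/-- The key twisted bound, uniform in the twisting character. -/
theorem exists_norm_sum_twist_indChar_le (χ : C →* ℂ) {frob : ℕ → K ≃ₐ[ℚ] K}
    (hfrob : IsFrobeniusChoice frob) : ∃ A > 0, ∃ k : ℕ, ∀ (Q : ℕ) [NeZero Q],
    Q.Coprime (discr K).natAbs → ∀ l : DirichletCharacter ℂ Q, l.Even → l ^ orderOf χ = 1 →
    l ^ 2 ≠ 1 → ∀ N : ℕ, ‖∑ p ∈ Finset.Icc 1 N, (if p ∣ (discr K).natAbs then 0 else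
      l⁻¹ (p : ZMod Q) * ∑ i ∈ Finset.range (orderOf χ), l (p : ZMod Q) ^ i *
        indChar (χ ^ i) (frob p)) * (primeWeight p : ℂ)‖ ≤ A * (Q : ℝ) ^ k := by
  have hD : (discr K).natAbs ≠ 0 := Int.natAbs_ne_zero.mpr (discr_ne_zero K)
  obtain ⟨T0, hT01, hT0⟩ := exists_bounded_span K
  set G := Nat.card (K ≃ₐ[ℚ] K) with hGdef
  have hG0 : 0 < G := Nat.card_pos
  have hG1 : (1 : ℝ) ≤ G := by exact_mod_cast hG0
  obtain ⟨A, hA, k, h⟩ := exists_norm_sum_prime_twist_le G (orderOf χ) hG0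
    (T := G * T0) (by nlinarith)
  refine ⟨Nat.card C * A + (discr K).natAbs.divisors.card * (Nat.card C * G),
    by have : 0 < Nat.card C := Nat.card_pos
       positivity, k, ?_⟩
  intro Q _ hQ l hle hl hl2 N
  have hQ1 : (1 : ℝ) ≤ Q := by exact_mod_cast NeZero.pos Q
  have hG := isGalois_of_isCyclotomicExtension K (L := CyclotomicField Q K) Q
  have hζ := IsCyclotomicExtension.zeta_spec Q K (CyclotomicField Q K)
  set W := twistSubgroup χ (unitChar l) with hW
  set E := twistField hζ W with hE
  have hEG : finrank ℚ E ≤ G := finrank_twistField_le hζ hQ hl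
  obtain ⟨s, hs1, hs2, hs3⟩ := hT0 (CyclotomicField Q K) Q
  obtain ⟨θ, hθ, hθT⟩ := exists_bounded_basis_fixedField (W.comap (splitHom K hζ)) s hs1 hs2 hs3
  have hcardW : (Nat.card (W.comap (splitHom K hζ)) : ℝ) ≤ G * Q := by
    rw [card_comap_splitHom hζ hQ]
    have h1 : Nat.card W ≤ Nat.card ((K ≃ₐ[ℚ] K) × (ZMod Q)ˣ) := Subgroup.card_le_card_group W
    have h2 : Nat.card (ZMod Q)ˣ ≤ Q := by
      rw [Nat.card_eq_fintype_card, ZMod.card_units_eq_totient]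
      exact Nat.totient_le Q
    rw [Nat.card_prod] at h1
    have h3 : Nat.card W ≤ G * Q := h1.trans (by gcongr)
    exact_mod_cast h3
  have hinv : l⁻¹ ^ orderOf χ = 1 := by rw [inv_pow, hl, inv_one]
  have hord : orderOf l⁻¹ ∣ orderOf χ := orderOf_dvd_of_pow_eq_one hinv
  have hord3 : 3 ≤ orderOf l⁻¹ := by
    have h0 : 0 < orderOf l⁻¹ := Nat.pos_of_dvd_of_pos hord (orderOf_char_pos χ)
    have h1 : ¬ orderOf l⁻¹ ∣ 2 := by
      rw [orderOf_dvd_iff_pow_eq_one, inv_pow, inv_eq_one]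
      exact hl2
    by_contra h2
    interval_cases h3 : orderOf l⁻¹
    · exact h1 (one_dvd _)
    · exact h1 dvd_rfl
  have hbound := h E Q hEG θ hθ (fun i w => (hθT i w).trans (by
    nlinarith)) l⁻¹ (by
      change l⁻¹ (-1) = 1
      rw [MulChar.inv_apply, show Ring.inverse (-1 : ZMod Q) = -1 by
        rw [← Units.val_one, ← Units.val_neg, Ring.inverse_unit, inv_neg_one]]
      exact hle) hord3 (Nat.le_of_dvd (orderOf_char_pos χ) hord)
    (fun i hi => exists_ideal_apply_ne_one hζ hQ W (l⁻¹ ^ i)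
      (exists_mem_twistSubgroup_apply_ne_one hl hi)) N
  set g : ℕ → ℂ := fun p => (Nat.card C : ℂ) * (l⁻¹ (p : ZMod Q) * (idealCount E p : ℂ) *
    (primeWeight p : ℂ)) with hg
  have hgB : ∀ n, ‖g n‖ ≤ Nat.card C * G := by
    intro n
    rw [hg]
    by_cases hp : n.Prime
    · simp only [norm_mul, Complex.norm_natCast, Complex.norm_real]
      rw [Real.norm_of_nonneg (primeWeight_nonneg n)]
      have h1 : (idealCount E n : ℝ) ≤ G := by
        exact_mod_cast (idealCount_prime_le E hp).trans hEG
      have h2 : ‖l⁻¹ (n : ZMod Q)‖ ≤ 1 := l⁻¹.norm_le_one _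
      refine mul_le_mul_of_nonneg_left ?_ (Nat.cast_nonneg _)
      calc ‖l⁻¹ (n : ZMod Q)‖ * idealCount E n * primeWeight n ≤ 1 * G * 1 :=
            mul_le_mul (by gcongr) (primeWeight_le_one n) (primeWeight_nonneg n) (by positivity)
        _ = _ := by ring
    · simp only [primeWeight, hp, if_false, Complex.ofReal_zero, mul_zero, norm_zero]
      positivity
  have h1 : ∑ p ∈ Finset.Icc 1 N, (if p ∣ (discr K).natAbs then 0 else
      l⁻¹ (p : ZMod Q) * ∑ i ∈ Finset.range (orderOf χ), l (p : ZMod Q) ^ i *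
        indChar (χ ^ i) (frob p)) * (primeWeight p : ℂ) =
      ∑ p ∈ Finset.Icc 1 N, g p -
        ∑ p ∈ Finset.Icc 1 N, (if p ∣ (discr K).natAbs then g p else 0) := by
    rw [← Finset.sum_sub_distrib]
    refine Finset.sum_congr rfl fun p _ => ?_
    by_cases hp : p.Prime
    · by_cases hpd : p ∣ (discr K).natAbs
      · bound
      · rw [if_neg hpd, if_neg hpd, sub_zero, hg]
        simp only
        by_cases hpQ : p.Coprime Q
        · rw [← card_mul_idealCount_twistField hζ hQ hfrob hl hp
            (fun h => hpd (Int.natCast_dvd.mp h)) hpQ]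
          ring
        · rw [MulChar.map_nonunit _ (fun h => hpQ ((ZMod.isUnit_iff_coprime p Q).mp h))]
          simp
    · simp [hg, primeWeight, hp]
  rw [h1]
  have hQk : (1 : ℝ) ≤ (Q : ℝ) ^ k := one_le_pow₀ hQ1
  have h2 : ‖∑ p ∈ Finset.Icc 1 N, g p‖ ≤ Nat.card C * A * (Q : ℝ) ^ k := by
    rw [hg, ← Finset.mul_sum, norm_mul, Complex.norm_natCast, mul_assoc]
    bound
  have h3 := norm_sum_dvd_le hD hgB N
  have h4 : ((discr K).natAbs.divisors.card : ℝ) * (Nat.card C * G) ≤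
      (discr K).natAbs.divisors.card * (Nat.card C * G) * (Q : ℝ) ^ k :=
    le_mul_of_one_le_right (by positivity) hQk
  rw [add_mul]
  exact (norm_sub_le _ _).trans (add_le_add h2 (h3.trans h4))

end KeyBound

end

section AvgTwist

open Real Complex

open Finset

lemma norm_sum_mul_le_of_average {ι : Type*} [Fintype ι] {P P₀ : Finset ℕ} {n : ℕ} (hn : 2 ≤ n)
    {w : ℕ → ℝ} (hw : ∀ p, 0 ≤ w p) {X : ℕ → ℕ → ℂ} {B : ℝ} (hX : ∀ i p, ‖X i p‖ ≤ B)
    {z : ι → ℕ → ℂ} (hz : ∀ p ∈ P, p ∉ P₀ → ∀ e, z e p ^ n = 1) (hz0 : ∀ p ∈ P₀, ∀ e, z e p = 0)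
    (hpos : ∀ j p, ∃ t : ℝ, 0 ≤ t ∧ ∑ e, z e p ^ j = t) {E : ℕ → Finset ι} {δ R : ℝ}
    (hE : ∀ j, ¬ n ∣ j → (#(E j) : ℝ) ≤ δ * Fintype.card ι) (hR : 0 ≤ R) (hn2 : ¬ n ∣ 2)
    (hT : ∀ e ∉ E 2, ‖∑ p ∈ P, (z e p ^ (n - 1) * ∑ i ∈ range n, z e p ^ i * X i p) * (w p : ℂ)‖ ≤ R)
    (hψ : ∀ j, ¬ n ∣ j → ∀ e ∉ E j, ‖∑ p ∈ P, z e p ^ j * (w p : ℂ)‖ ≤ R) :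
    Fintype.card ι * ‖∑ p ∈ P, X 1 p * (w p : ℂ)‖ ≤
      Fintype.card ι * ((n * B + 1) * (δ * ∑ p ∈ P, w p + R) + n * B * (δ * ∑ p ∈ P, w p) + B * ∑ p ∈ P ∩ P₀, w p) := by
  classical
  have hB : 0 ≤ B := (norm_nonneg _).trans (hX 0 0)
  set W := ∑ p ∈ P, w p with hW
  have hW0 : 0 ≤ W := sum_nonneg fun p _ => hw p
  have hz1 : ∀ p ∈ P, ∀ e, ‖z e p‖ ≤ 1 := fun p hp e => by
    by_cases h : p ∈ P₀
    · rw [hz0 p h e]; simp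
    · exact (norm_eq_one_of_pow_eq_one (hz p hp h e) (by omega)).le
  have key : ∀ (F : ι → ℂ) (j : ℕ) (V : ℝ), 0 ≤ V → ¬ n ∣ j → (∀ e ∉ E j, ‖F e‖ ≤ R) →
      (∀ e, ‖F e‖ ≤ V) → ‖∑ e, F e‖ ≤ Fintype.card ι * (δ * V + R) := by
    intro F j V hV hj h1 h2
    refine (norm_sum_le _ _).trans ?_
    calc ∑ e, ‖F e‖ ≤ ∑ e, ((if e ∈ E j then V else 0) + R) := sum_le_sum fun e _ => by
          grind
      _ = #(E j) * V + Fintype.card ι * R := by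
          rw [sum_add_distrib, sum_ite_mem, univ_inter, sum_const, sum_const, card_univ, nsmul_eq_mul,
            nsmul_eq_mul]
      _ ≤ δ * Fintype.card ι * V + Fintype.card ι * R := by gcongr; exact hE j hj
      _ = _ := by ring
  -- the twisted sums
  have h1 := key (fun e => ∑ p ∈ P, (z e p ^ (n - 1) * ∑ i ∈ range n, z e p ^ i * X i p) * (w p : ℂ)) 2
    (n * B * W) (by positivity) hn2 hT fun e => by
      rw [hW, mul_sum]
      refine (norm_sum_le _ _).trans (sum_le_sum fun p hp => ?_)
      rw [norm_mul, norm_mul, norm_real, norm_of_nonneg (hw p), norm_pow]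
      refine mul_le_mul_of_nonneg_right ?_ (hw p)
      have : ‖∑ i ∈ range n, z e p ^ i * X i p‖ ≤ n * B := by
        refine (norm_sum_le _ _).trans ?_
        calc _ ≤ ∑ _i ∈ range n, B := sum_le_sum fun i _ => by
              rw [norm_mul, norm_pow]
              exact (mul_le_mul (pow_le_one₀ (norm_nonneg _) (hz1 p hp e)) (hX i p) (norm_nonneg _)
                zero_le_one).trans (one_mul B).le
          _ = n * B := by simp
      exact (mul_le_mul (pow_le_one₀ (norm_nonneg _) (hz1 p hp e)) this (norm_nonneg _)
                zero_le_one).trans (one_mul _).le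
  -- the other terms
  have h2 : ∀ i ∈ (range n).erase 1, ‖∑ p ∈ P, (∑ e, z e p ^ (n - 1 + i)) * X i p * (w p : ℂ)‖ ≤
      B * (Fintype.card ι * (δ * W + R)) := by
    intro i hi
    obtain ⟨hi1, hin⟩ := mem_erase.mp hi
    rw [mem_range] at hin
    have hj : ¬ n ∣ n - 1 + i := by
      rintro ⟨k, hk⟩
      have : k ≤ 0 ∨ k = 1 ∨ 2 ≤ k := by omega
      rcases this with h | h | h
      · grind
      · subst h; omega
      · nlinarith [Nat.mul_le_mul_left n h, Nat.sub_add_cancel (by omega : 1 ≤ n)]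
    have h3 := key (fun e => ∑ p ∈ P, z e p ^ (n - 1 + i) * (w p : ℂ)) (n - 1 + i) W hW0 hj
      (hψ _ hj) fun e => by
        refine (norm_sum_le _ _).trans (sum_le_sum fun p hp => ?_)
        rw [norm_mul, norm_pow, norm_real, norm_of_nonneg (hw p)]
        exact (mul_le_mul_of_nonneg_right (pow_le_one₀ (norm_nonneg _) (hz1 p hp e)) (hw p)).trans (one_mul _).le
    choose t ht0 ht using hpos (n - 1 + i)
    have h4 : ∑ e, ∑ p ∈ P, z e p ^ (n - 1 + i) * (w p : ℂ) = ((∑ p ∈ P, t p * w p : ℝ) : ℂ) := by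
      rw [sum_comm]
      push_cast
      exact sum_congr rfl fun p _ => by rw [← sum_mul, ht]
    rw [h4, norm_real, norm_of_nonneg (sum_nonneg fun p _ => mul_nonneg (ht0 p) (hw p))] at h3
    refine le_trans ?_ (mul_le_mul_of_nonneg_left h3 hB)
    rw [mul_sum]
    refine (norm_sum_le _ _).trans (sum_le_sum fun p _ => ?_)
    rw [ht, norm_mul, norm_mul, norm_real, norm_real, norm_of_nonneg (hw p),
      norm_of_nonneg (ht0 p)]
    have := mul_le_mul_of_nonneg_left (hX i p) (mul_nonneg (ht0 p) (hw p))
    linarith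
  have h5 : (Fintype.card ι : ℂ) * ∑ p ∈ P, X 1 p * (w p : ℂ) =
      ∑ e, ∑ p ∈ P, (z e p ^ (n - 1) * ∑ i ∈ range n, z e p ^ i * X i p) * (w p : ℂ) -
      ∑ i ∈ (range n).erase 1, ∑ p ∈ P, (∑ e, z e p ^ (n - 1 + i)) * X i p * (w p : ℂ) +
      Fintype.card ι * ∑ p ∈ P ∩ P₀, X 1 p * (w p : ℂ) := by
    rw [sum_comm, sum_comm (s := (range n).erase 1), mul_sum, mul_sum, ← sum_ite_mem P P₀, ← sum_sub_distrib,
      ← sum_add_distrib]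
    refine sum_congr rfl fun p hp => ?_
    rw [← sum_mul, ← sum_mul, ← sub_mul]
    by_cases h : p ∈ P₀
    · have e1 : ∀ j, 0 < j → ∑ e, z e p ^ j = 0 := fun j hj => sum_eq_zero fun e _ => by
        rw [hz0 p h e, zero_pow hj.ne']
      rw [if_pos h, sum_eq_zero, sum_eq_zero]
      · ring
      · intro i _; rw [e1 _ (by omega), zero_mul]
      · intro e _; rw [hz0 p h e, zero_pow (by omega), zero_mul]
    · rw [if_neg h, add_zero, ← mul_assoc]
      have e1 : ∑ e, z e p ^ (n - 1) * ∑ i ∈ range n, z e p ^ i * X i p =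
          ∑ i ∈ range n, (∑ e, z e p ^ (n - 1 + i)) * X i p := by
        simp only [mul_sum, sum_mul]
        rw [sum_comm]
        grind
      rw [e1, ← add_sum_erase _ _ (mem_range.mpr (by omega : 1 < n)), add_sub_cancel_right,
        Nat.sub_add_cancel (by omega), sum_congr rfl fun e _ => hz p hp h e]
      simp
  have h6 : ‖∑ p ∈ P ∩ P₀, X 1 p * (w p : ℂ)‖ ≤ B * ∑ p ∈ P ∩ P₀, w p := by
    rw [mul_sum]
    refine (norm_sum_le _ _).trans (sum_le_sum fun p _ => ?_)
    rw [norm_mul, norm_real, norm_of_nonneg (hw p)]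
    bound
  have h7 : (Fintype.card ι : ℝ) * ‖∑ p ∈ P, X 1 p * (w p : ℂ)‖ =
      ‖(Fintype.card ι : ℂ) * ∑ p ∈ P, X 1 p * (w p : ℂ)‖ := by rw [norm_mul, Complex.norm_natCast]
  rw [h7, h5]
  refine (norm_add_le _ _).trans ((add_le_add_left (norm_sub_le _ _) _).trans ?_)
  have h8 : ‖∑ i ∈ (range n).erase 1, ∑ p ∈ P, (∑ e, z e p ^ (n - 1 + i)) * X i p * (w p : ℂ)‖ ≤
      n * (B * (Fintype.card ι * (δ * W + R))) := by
    refine (norm_sum_le_of_le _ h2).trans ?_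
    rw [sum_const, nsmul_eq_mul]
    have h0 : 0 ≤ B * (Fintype.card ι * (δ * W + R)) := by
      refine (norm_nonneg _).trans (h2 0 (mem_erase.mpr ⟨by omega, mem_range.mpr (by omega)⟩))
    refine mul_le_mul_of_nonneg_right ?_ h0
    exact_mod_cast (card_erase_le).trans (card_range n).le
  rw [norm_mul, Complex.norm_natCast]
  have h9 := mul_le_mul_of_nonneg_left h6 (Nat.cast_nonneg (α := ℝ) (Fintype.card ι))
  have hcW : 0 ≤ (Fintype.card ι : ℝ) * (δ * W) := by
    have := hE 2 hn2
    nlinarith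
  grind

end AvgTwist

section

open MeasureTheory Module Pointwise NumberField NumberField.InfinitePlace NumberField.Units
  NumberField.Units.dirichletUnitTheorem
open scoped Classical NNReal ENNReal nonZeroDivisors

section Interval

open Finset

open Real Complex ArithmeticFunction Fintype

lemma exists_abs_sum_primeWeight_sub_log : ∃ C > 0, ∀ N : ℕ, 1 ≤ N →
    |∑ p ∈ Icc 1 N, primeWeight p - Real.log N| ≤ C := by
  obtain ⟨C, hC, h⟩ := exists_abs_sum_primeWeight_sub_log_le isLogFactor_one_vonMangoldt zero_le_one
    (κ := 1) (B := 1) (c := 1) one_pos zero_le_one one_pos le_rfl fun N _ => by simp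
  exact ⟨C, hC, by simpa using h⟩

lemma sum_Ioc_eq_sub {β : Type*} [AddCommGroup β] {f : ℕ → β} {y x : ℕ} (h : y ≤ x) :
    ∑ p ∈ Ioc y x, f p = ∑ p ∈ Icc 1 x, f p - ∑ p ∈ Icc 1 y, f p := by
  have e : ∀ N, Icc 1 N = Ioc 0 N := fun N => rfl
  rw [eq_sub_iff_add_eq', e, e, sum_Ioc_consecutive _ (Nat.zero_le _) h]

/-- The primes in `(y, x]` not dividing `D`. -/
noncomputable def primesIoc (D y x : ℕ) : Finset ℕ := (Ioc y x).filter fun p => p.Prime ∧ ¬ p ∣ D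

lemma sum_primesIoc {D y x : ℕ} (h : y ≤ x) (g : ℕ → ℂ) :
    ∑ p ∈ primesIoc D y x, g p * (primeWeight p : ℂ) =
      ∑ p ∈ Icc 1 x, (if p ∣ D then 0 else g p) * (primeWeight p : ℂ) -
      ∑ p ∈ Icc 1 y, (if p ∣ D then 0 else g p) * (primeWeight p : ℂ) := by
  rw [← sum_Ioc_eq_sub h, primesIoc, sum_filter]
  refine sum_congr rfl fun p _ => ?_
  by_cases hp : p.Prime <;> by_cases hd : p ∣ D <;> simp [hp, hd, primeWeight]

lemma norm_sum_primesIoc_le {D y x : ℕ} (h : y ≤ x) {g : ℕ → ℂ} {R : ℝ}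
    (hg : ∀ N : ℕ, ‖∑ p ∈ Icc 1 N, (if p ∣ D then 0 else g p) * (primeWeight p : ℂ)‖ ≤ R) :
    ‖∑ p ∈ primesIoc D y x, g p * (primeWeight p : ℂ)‖ ≤ 2 * R := by
  rw [sum_primesIoc h]
  exact (norm_sub_le _ _).trans (by linarith [hg x, hg y])

lemma norm_sum_ite_dvd_le {D : ℕ} (hD : D ≠ 0) {g : ℕ → ℂ} (hg1 : ∀ n, ‖g n‖ ≤ 1) {R : ℝ} {N : ℕ}
    (hg : ‖∑ p ∈ Icc 1 N, g p * (primeWeight p : ℂ)‖ ≤ R) :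
    ‖∑ p ∈ Icc 1 N, (if p ∣ D then 0 else g p) * (primeWeight p : ℂ)‖ ≤ R + #D.divisors := by
  have h1 : ∑ p ∈ Icc 1 N, (if p ∣ D then 0 else g p) * (primeWeight p : ℂ) =
      ∑ p ∈ Icc 1 N, g p * (primeWeight p : ℂ) -
        ∑ p ∈ Icc 1 N, (if p ∣ D then g p * (primeWeight p : ℂ) else 0) := by
    rw [← sum_sub_distrib]
    grind
  rw [h1]
  refine (norm_sub_le _ _).trans (add_le_add hg ?_)
  refine (norm_sum_dvd_le hD (B := 1) (fun n => ?_) N).trans (mul_one _).le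
  rw [norm_mul, norm_real, norm_of_nonneg (primeWeight_nonneg n)]
  exact mul_le_one₀ (hg1 n) (primeWeight_nonneg n) (primeWeight_le_one n)

lemma exists_norm_sum_dirichletCharacter_primeWeight_le : ∃ A > 0, ∀ (Q : ℕ) [NeZero Q] (n : ℕ)
    (l : DirichletCharacter ℂ Q), 0 < n → l ^ n = 1 → l ≠ 1 →
    ∀ N : ℕ, ‖∑ p ∈ Icc 1 N, l p * (primeWeight p : ℂ)‖ ≤ A * (11 * (Q : ℝ)) ^ (n + 1) := by
  obtain ⟨C, hC, h⟩ := exists_norm_sum_dirichletCharacter_vonMangoldt_le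
  obtain ⟨C0, hC0, h0⟩ := exists_sum_sub_primeWeight_le
  refine ⟨C + C0, by positivity, fun Q _ n l hn hl hl1 N => ?_⟩
  have hQ : (1 : ℝ) ≤ 11 * Q := by
    have : (1 : ℝ) ≤ Q := by exact_mod_cast NeZero.one_le
    linarith
  have hm : orderOf l ≤ n := Nat.le_of_dvd hn (orderOf_dvd_of_pow_eq_one hl)
  have hm2 : 2 ≤ orderOf l := by
    have h1 : orderOf l ≠ 1 := fun h => hl1 (orderOf_eq_one_iff.mp h)
    have h2 : 0 < orderOf l := orderOf_pos_iff.mpr (isOfFinOrder_iff_pow_eq_one.mpr ⟨n, hn, hl⟩)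
    omega
  have h1 := h Q _ l rfl hm2 N
  have h2 := norm_sum_deriv_sub_primeWeight_le isLogFactor_one_vonMangoldt h0 zero_le_one
    (ν := fun k => l k) (fun k => l.norm_le_one k) N
  simp only [ofReal_one, mul_one] at h2
  have h3 := norm_sub_le (∑ k ∈ Icc 1 N, (l k * ((vonMangoldt k : ℝ) : ℂ)) * (((k : ℝ) ^ (-1 : ℝ) : ℝ) : ℂ))
    (∑ k ∈ Icc 1 N, (l k * ((vonMangoldt k : ℝ) : ℂ)) * (((k : ℝ) ^ (-1 : ℝ) : ℝ) : ℂ) - ∑ p ∈ Icc 1 N, l p * (primeWeight p : ℂ))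
  rw [sub_sub_cancel] at h3
  have h4 : C * (11 * (Q : ℝ)) ^ (orderOf l + 1) ≤ C * (11 * (Q : ℝ)) ^ (n + 1) :=
    mul_le_mul_of_nonneg_left (pow_le_pow_right₀ hQ (by omega)) hC.le
  have h5 : C0 * 1 ≤ C0 * (11 * (Q : ℝ)) ^ (n + 1) :=
    mul_le_mul_of_nonneg_left (one_le_pow₀ hQ) hC0.le
  linarith

variable {K : Type*} [Field K] [NumberField K] [IsGalois ℚ K] {C : Subgroup (K ≃ₐ[ℚ] K)}

set_option maxHeartbeats 1000000 in
theorem exists_norm_sum_primesIoc_indChar_le (χ : C →* ℂ) {frob : ℕ → K ≃ₐ[ℚ] K}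
    (hfrob : IsFrobeniusChoice frob) (hn : 3 ≤ orderOf χ) : ∃ A > 0, ∃ k : ℕ, ∀ (Q : ℕ) [NeZero Q],
    Q.Coprime (discr K).natAbs → ∀ (ι : Type) [Fintype ι] [Nonempty ι] (l : ι → DirichletCharacter ℂ Q)
    (δ : ℝ), 0 ≤ δ → (∀ e, (l e).Even) → (∀ e, l e ^ orderOf χ = 1) →
    (∀ j, ¬ orderOf χ ∣ j → (#{e | l e ^ j = 1} : ℝ) ≤ δ * card ι) →
    (∀ (j p : ℕ), ∃ t : ℝ, 0 ≤ t ∧ ∑ e, l e p ^ j = t) → ∀ y x : ℕ, 1 ≤ y → y ≤ x →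
    ‖∑ p ∈ primesIoc (discr K).natAbs y x, indChar χ (frob p) * (primeWeight p : ℂ)‖ ≤
      A * (δ * (Real.log x - Real.log y + 1) + (Q : ℝ) ^ k) := by
  have hD : (discr K).natAbs ≠ 0 := Int.natAbs_ne_zero.mpr (discr_ne_zero K)
  set D := (discr K).natAbs with hDdef
  obtain ⟨A, hA, k, hT⟩ := exists_norm_sum_twist_indChar_le χ hfrob
  obtain ⟨A', hA', hψ⟩ := exists_norm_sum_dirichletCharacter_primeWeight_le
  obtain ⟨M, hM, hW⟩ := exists_abs_sum_primeWeight_sub_log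
  set n := orderOf χ with hndef
  set B : ℝ := (card (K ≃ₐ[ℚ] K) : ℝ) with hB
  have hB0 : 0 ≤ B := Nat.cast_nonneg _
  set R₀ : ℝ := 2 * A + 2 * (A' * 11 ^ (n + 1) + #D.divisors) with hR₀
  have hR₀0 : 0 ≤ R₀ := by positivity
  refine ⟨(n * B + 1) * (2 * M + 1 + R₀) + n * B * (2 * M + 1) + B + 1, by positivity, k + n + 2,
    fun Q _ hQ ι _ _ l δ hδ heven hln hE hpos y x hy hyx => ?_⟩
  have hQ1 : (1 : ℝ) ≤ Q := by exact_mod_cast NeZero.one_le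
  have hpw : ∀ j : ℕ, j ≤ k + n + 2 → (Q : ℝ) ^ j ≤ (Q : ℝ) ^ (k + n + 2) := fun j hj =>
    pow_le_pow_right₀ hQ1 hj
  set Y := (Q : ℝ) ^ (k + n + 2) with hY
  have hY1 : 1 ≤ Y := one_le_pow₀ hQ1
  have hprime : ∀ p ∈ primesIoc D y x, p.Prime := fun p hp => (mem_filter.mp hp).2.1
  have key := norm_sum_mul_le_of_average (ι := ι) (P := primesIoc D y x) (P₀ := Q.primeFactors) (n := n)
    (by omega) (w := primeWeight) primeWeight_nonneg (X := fun i p => indChar (χ ^ i) (frob p)) (B := B)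
    (fun i p => norm_indChar_le _ _) (z := fun e p => l e p) (fun p hp hp0 e => by
      have hu : IsUnit (p : ZMod Q) := by
        rw [ZMod.isUnit_iff_coprime, (hprime p hp).coprime_iff_not_dvd]
        exact fun h => hp0 (Nat.mem_primeFactors.mpr ⟨hprime p hp, h, NeZero.ne Q⟩)
      rw [← MulChar.pow_apply' _ (by omega), hln, MulChar.one_apply hu])
    (fun p hp0 e => MulChar.map_nonunit _ fun hu => by
      have hp := Nat.mem_primeFactors.mp hp0
      rw [ZMod.isUnit_iff_coprime, hp.1.coprime_iff_not_dvd] at hu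
      exact hu hp.2.1) hpos (E := fun j => {e | l e ^ j = 1}) (δ := δ) (R := R₀ * Y) hE (by positivity)
    (fun h => by have := Nat.le_of_dvd two_pos h; omega)
    (fun e he => by
      have he : l e ^ 2 ≠ 1 := by simpa using he
      refine (norm_sum_primesIoc_le hyx (R := A * (Q : ℝ) ^ k) fun N => ?_).trans ?_
      · have h1 := hT Q hQ (l e) (heven e) (hln e) he N
        have h2 : (l e)⁻¹ = l e ^ (n - 1) := by
          rw [inv_eq_iff_mul_eq_one, ← pow_succ', Nat.sub_add_cancel (by omega), hln]
        rw [h2] at h1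
        simp only [MulChar.pow_apply' _ (by omega : n - 1 ≠ 0)] at h1
        exact h1
      · have := hpw k (by omega)
        have h3 : 0 ≤ A' * 11 ^ (n + 1) + #D.divisors := by positivity
        nlinarith)
    (fun j hj e he => by
      have he : l e ^ j ≠ 1 := by simpa using he
      have hj0 : j ≠ 0 := fun h => hj (h ▸ dvd_zero n)
      simp only [← MulChar.pow_apply' _ hj0]
      refine (norm_sum_primesIoc_le hyx (R := A' * (11 * (Q : ℝ)) ^ (n + 1) + #D.divisors) fun N =>
        norm_sum_ite_dvd_le hD (fun p => (l e ^ j).norm_le_one p) (hψ Q n (l e ^ j) (by omega) ?_ he N)).trans ?_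
      · rw [← pow_mul, mul_comm, pow_mul, hln, one_pow]
      · have := hpw (n + 1) (by omega)
        rw [mul_pow]
        have h2 : A' * (11 ^ (n + 1) * (Q : ℝ) ^ (n + 1)) ≤ A' * 11 ^ (n + 1) * Y := by
          rw [← mul_assoc]; gcongr
        nlinarith)
  have hc : (0 : ℝ) < Fintype.card ι := by exact_mod_cast Fintype.card_pos
  have key := le_of_mul_le_mul_left key hc
  simp only [pow_one] at key
  refine key.trans ?_
  have hL : 0 ≤ Real.log x - Real.log y :=
    sub_nonneg.mpr (Real.log_le_log (by exact_mod_cast hy) (by exact_mod_cast hyx))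
  have hWle : ∑ p ∈ primesIoc D y x, primeWeight p ≤ (2 * M + 1) * (Real.log x - Real.log y + 1) := by
    have h1 : ∑ p ∈ primesIoc D y x, primeWeight p ≤ ∑ p ∈ Ioc y x, primeWeight p :=
      sum_le_sum_of_subset_of_nonneg (filter_subset _ _) fun p _ _ => primeWeight_nonneg p
    rw [sum_Ioc_eq_sub hyx] at h1
    have h2 := abs_le.mp (hW x (hy.trans hyx))
    have h3 := abs_le.mp (hW y hy)
    nlinarith [mul_nonneg hM.le hL]
  have hP0 : ∑ p ∈ primesIoc D y x ∩ Q.primeFactors, primeWeight p ≤ Y := by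
    calc _ ≤ ∑ p ∈ primesIoc D y x ∩ Q.primeFactors, (1 : ℝ) := sum_le_sum fun p _ => primeWeight_le_one p
      _ = #(primesIoc D y x ∩ Q.primeFactors) := by simp
      _ ≤ #Q.divisors := by
          exact_mod_cast card_le_card (inter_subset_right.trans fun p hp =>
            Nat.mem_divisors.mpr ⟨Nat.dvd_of_mem_primeFactors hp, NeZero.ne Q⟩)
      _ ≤ (Q : ℝ) ^ 1 := by rw [pow_one]; exact_mod_cast Nat.card_divisors_le_self Q
      _ ≤ Y := hpw 1 (by omega)
  set L := Real.log x - Real.log y + 1 with hLdef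
  have hL0 : 0 ≤ L := by linarith
  have h1 : δ * ∑ p ∈ primesIoc D y x, primeWeight p ≤ (2 * M + 1) * (δ * L) := by
    have := mul_le_mul_of_nonneg_left hWle hδ
    linarith
  have hδL : 0 ≤ δ * L := mul_nonneg hδ hL0
  have h2 : δ * ∑ p ∈ primesIoc D y x, primeWeight p + R₀ * Y ≤ (2 * M + 1 + R₀) * (δ * L + Y) := by
    nlinarith [mul_nonneg hR₀0 hδL, mul_nonneg hM.le (zero_le_one.trans hY1)]
  have h3 : δ * ∑ p ∈ primesIoc D y x, primeWeight p ≤ (2 * M + 1) * (δ * L + Y) := by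
    nlinarith [mul_nonneg hM.le (zero_le_one.trans hY1)]
  have h4 := mul_le_mul_of_nonneg_left h2 (by positivity : (0 : ℝ) ≤ n * B + 1)
  have h5 := mul_le_mul_of_nonneg_left h3 (by positivity : (0 : ℝ) ≤ n * B)
  have h6 := mul_le_mul_of_nonneg_left hP0 hB0
  have h7 : B * Y ≤ (B + 1) * (δ * L + Y) := by
    linarith [mul_nonneg hB0 hδL]
  linarith

end Interval

section PrimeSupply

open Finset

open Real Ideal

/-- There are many small primes congruent to `1` modulo `n` avoiding a given modulus. -/
theorem exists_primes_modEq_one {n D : ℕ} (hn : 0 < n) (hD : D ≠ 0) : ∃ C > 0, ∀ r : ℕ, ∃ s : Finset ℕ,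
    #s = r ∧ ∀ q ∈ s, q.Prime ∧ ¬ q ∣ D ∧ n ∣ q - 1 ∧ (q : ℝ) ≤ exp (C * (r + 1)) := by
  have : NeZero n := ⟨hn.ne'⟩
  let E := CyclotomicField n ℚ
  have hd : 0 < finrank ℚ E := finrank_pos
  obtain ⟨M, hM, h⟩ := exists_abs_sum_idealCount_primeWeight_sub_log_le E
  set T := Units.torsionOrder E with hT
  have hcyc := CyclotomicField.isCyclotomicExtension n ℚ
  have hnT : n ∣ T := Units.dvd_torsionOrder_of_isPrimitiveRoot
    (@IsCyclotomicExtension.exists_isPrimitiveRoot _ _ _ _ _ _ hcyc _ (Set.mem_singleton n) hn.ne').choose_spec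
  have hTD : T * D ≠ 0 := mul_ne_zero (NeZero.ne _) hD
  set d := finrank ℚ E
  refine ⟨M + d * (1 + #(T * D).divisors) + 1, by positivity, fun r => ?_⟩
  set Y := exp ((M + d * (1 + #(T * D).divisors) + 1) * (r + 1)) with hY
  set N := ⌊Y⌋₊ with hN
  set P := (Icc 1 N).filter fun q => q.Prime ∧ ¬ q ∣ D ∧ n ∣ q - 1 with hP
  have hN1 : 1 ≤ N := Nat.le_floor (by rw [Nat.cast_one]; exact one_le_exp (by positivity))
  have hlog : log Y ≤ log N + 1 := by
    have h1 : Y ≤ 2 * N := by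
      have := Nat.lt_floor_add_one Y
      have h2 : (1 : ℝ) ≤ N := by exact_mod_cast hN1
      linarith
    have h2 : (0 : ℝ) < N := by exact_mod_cast hN1
    have h3 := log_le_log (exp_pos _) h1
    rw [log_mul two_ne_zero h2.ne'] at h3
    have h4 : log 2 ≤ 1 := by linarith [log_two_lt_d9]
    linarith
  have hle : ∑ p ∈ Icc 1 N, (idealCount E p : ℝ) * primeWeight p ≤ d * #P + d * #(T * D).divisors := by
    calc _ ≤ ∑ p ∈ Icc 1 N, ((if p ∈ P then (d : ℝ) else 0) + if p ∣ T * D then (d : ℝ) else 0) :=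
          sum_le_sum fun p hp => ?_
      _ = d * #P + d * #((Icc 1 N).filter (· ∣ T * D)) := by
          rw [sum_add_distrib, sum_ite_mem, inter_eq_right.mpr (filter_subset _ _), ← sum_filter]
          simp only [sum_const, nsmul_eq_mul]
          ring
      _ ≤ _ := by
          gcongr
          grind
    have hd0 : (0 : ℝ) ≤ d := Nat.cast_nonneg _
    by_cases hpp : p.Prime
    · have h1 : (idealCount E p : ℝ) * primeWeight p ≤ d := by
        have h2 : (idealCount E p : ℝ) ≤ d := by exact_mod_cast idealCount_prime_le E hpp
        calc _ ≤ (d : ℝ) * 1 := mul_le_mul h2 (primeWeight_le_one p) (primeWeight_nonneg p) hd0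
          _ = d := mul_one _
      by_cases hdv : p ∣ T * D
      · grind
      · rw [if_neg hdv, add_zero]
        by_cases h0 : idealCount E p = 0
        · rw [h0, Nat.cast_zero, zero_mul]; split_ifs <;> linarith
        rw [if_pos]
        · exact h1
        rw [hP, mem_filter]
        refine ⟨hp, hpp, fun hh => hdv (hh.mul_left _), hnT.trans ?_⟩
        rw [idealCount, ← ne_eq, Nat.card_ne_zero] at h0
        obtain ⟨⟨I, hI⟩⟩ := h0.1
        have hprime : I.IsPrime := isPrime_of_irreducible_absNorm (by rw [hI]; exact hpp)
        have := torsionOrder_dvd_absNorm_sub_one (K := E) (P := I)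
          (fun hb => by rw [hb, absNorm_bot] at hI; exact hpp.ne_zero hI.symm) hprime
          (by rw [hI, hpp.coprime_iff_not_dvd]; exact fun hh => hdv (hh.mul_right _))
        rwa [hI] at this
    · simp only [primeWeight, hpp, if_false, mul_zero]
      split_ifs <;> linarith
  have hcard : r ≤ #P := by
    have h1 := (abs_le.mp (h N hN1)).1
    rw [hY, log_exp] at hlog
    by_contra! hlt
    have h4 : (d : ℝ) * #P ≤ d * r := by gcongr
    have h5 : (1 : ℝ) ≤ d := by exact_mod_cast hd
    have h6 : (0 : ℝ) ≤ r := Nat.cast_nonneg _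
    have h7 : (0 : ℝ) ≤ #(T * D).divisors := Nat.cast_nonneg _
    have h8 : (0 : ℝ) ≤ M * r := by positivity
    have h9 : (0 : ℝ) ≤ d * #(T * D).divisors * r := by positivity
    nlinarith
  obtain ⟨s, hs, hsr⟩ := exists_subset_card_eq hcard
  refine ⟨s, hsr, fun q hq => ?_⟩
  obtain ⟨h1, h2, h3, h4⟩ := mem_filter.mp (hs hq)
  exact ⟨h2, h3, h4, (Nat.cast_le.mpr (mem_Icc.mp h1).2).trans (Nat.floor_le (exp_pos _).le)⟩

end PrimeSupply

section Family

open Finset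

/-- Evaluation of Dirichlet characters at a unit. -/
noncomputable def evalUnit {Q : ℕ} (a : (ZMod Q)ˣ) : DirichletCharacter ℂ Q →* ℂ where
  toFun χ := χ a
  map_one' := MulChar.one_apply_coe a
  map_mul' χ ψ := by simp

lemma card_filter_dvd_mul_le {n j : ℕ} (hj : ¬ n ∣ j) :
    2 * #{k : Fin n | n ∣ k * j} ≤ n := by
  have hle : #{k : Fin n | n ∣ k * j} ≤ #{k : Fin n | ¬ n ∣ k * j} := by
    have h1 : ∀ k : Fin n, n ∣ k * j → (k : ℕ) + 1 < n := fun k hk => by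
      by_contra! h
      have h2 : (k : ℕ) + 1 = n := le_antisymm k.2 h
      refine hj ((Nat.dvd_add_right hk).mp ?_)
      rw [← Nat.succ_mul, Nat.succ_eq_add_one, h2]
      exact Nat.dvd_mul_right n j
    refine card_le_card_of_injOn (fun k => if h : (k : ℕ) + 1 < n then ⟨k + 1, h⟩ else k)
      (fun k hk => ?_) fun k hk k' hk' hkk => ?_
    · simp only [coe_filter, mem_univ, true_and, Set.mem_ofPred_eq] at hk ⊢
      rw [dif_pos (h1 k hk)]
      intro h
      rw [Nat.succ_mul] at h
      exact hj ((Nat.dvd_add_right hk).mp h)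
    grind
  have := card_filter_add_card_filter_not (s := (univ : Finset (Fin n))) (p := fun k : Fin n => n ∣ k * j)
  rw [card_univ, Fintype.card_fin] at this
  omega

lemma exists_even_dirichletCharacter {n q : ℕ} (hn : 0 < n) (hq : q.Prime) (h : 2 * n ∣ q - 1) :
    ∃ l : DirichletCharacter ℂ q, l.Even ∧ orderOf l = n := by
  have : Fact q.Prime := ⟨hq⟩
  obtain ⟨μ, hμ⟩ := MulChar.exists_mulChar_orderOf (ZMod q) (R := ℂ) (n := 2 * n) (by rwa [ZMod.card])
    (Complex.isPrimitiveRoot_exp (2 * n) (by omega))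
  refine ⟨μ ^ 2, ?_, ?_⟩
  · rw [DirichletCharacter.Even, MulChar.pow_apply' _ two_ne_zero, ← map_pow, neg_one_sq, map_one]
  · rw [orderOf_pow_of_dvd two_ne_zero (hμ ▸ Dvd.intro n rfl), hμ, Nat.mul_div_cancel_left _ two_pos]

theorem exists_character_family {n : ℕ} (hn : 0 < n) {s : Finset ℕ}
    (hs : ∀ q ∈ s, q.Prime ∧ 2 * n ∣ q - 1) :
    ∃ l : (s → Fin n) → DirichletCharacter ℂ (∏ q ∈ s, q),
    (∀ e, (l e).Even) ∧ (∀ e, l e ^ n = 1) ∧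
    (∀ j, ¬ n ∣ j → (#{e | l e ^ j = 1} : ℝ) ≤ (1 / 2) ^ #s * Fintype.card (s → Fin n)) ∧
    ∀ (j p : ℕ), ∃ t : ℝ, 0 ≤ t ∧ ∑ e, l e p ^ j = t := by
  choose lam heven hord using fun q : s => exists_even_dirichletCharacter hn (hs q q.2).1 (hs q q.2).2
  set Q := ∏ q ∈ s, q with hQ
  have hdvd : ∀ q : s, (q : ℕ) ∣ Q := fun q => dvd_prod_of_mem _ q.2
  set l : (s → Fin n) → DirichletCharacter ℂ Q := fun e =>
    ∏ q : s, DirichletCharacter.changeLevel (hdvd q) (lam q) ^ (e q : ℕ) with hl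
  have hpow : ∀ q, lam q ^ n = 1 := fun q => by rw [← hord q, pow_orderOf_eq_one]
  have heval : ∀ e (a : ℤ), IsCoprime a Q → l e a = ∏ q : s, lam q a ^ (e q : ℕ) := by
    intro e a ha
    have h2 : l e a = evalUnit (ZMod.unitOfIsCoprime a ha) (l e) := by
      simp [evalUnit, ZMod.coe_unitOfIsCoprime]
    rw [h2, hl, map_prod]
    refine prod_congr rfl fun q _ => ?_
    rw [map_pow]
    rw [← DirichletCharacter.changeLevel_eq_cast_of_dvd' _ (hdvd q) ha]
    simp [evalUnit, ZMod.coe_unitOfIsCoprime]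
  have hln : ∀ e, l e ^ n = 1 := fun e => by
    rw [hl, ← prod_pow]
    refine prod_eq_one fun q _ => ?_
    rw [← pow_mul, mul_comm, pow_mul, ← map_pow, hpow, map_one, one_pow]
  refine ⟨l, fun e => ?_, hln, fun j hj => ?_, fun j p => ?_⟩
  · have := heval e (-1) (isCoprime_one_left.neg_left)
    push_cast at this
    rw [DirichletCharacter.Even, this]
    refine prod_eq_one fun q _ => ?_
    have := heven q
    rw [this, one_pow]
  · have hcop : Set.Pairwise (s : Set ℕ) (Function.onFun Nat.Coprime id) := fun q hq q' hq' h =>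
      (Nat.coprime_primes (hs q hq).1 (hs q' hq').1).mpr h
    have hsub : ({e | l e ^ j = 1} : Finset (s → Fin n)) ⊆
        Fintype.piFinset fun _ : s => {k : Fin n | n ∣ k * j} := by
      intro e he
      have he : l e ^ j = 1 := by simpa using he
      rw [Fintype.mem_piFinset]
      intro q
      rw [mem_filter]
      refine ⟨mem_univ _, ?_⟩
      suffices h : orderOf (lam q) ∣ e q * j by rwa [hord q] at h
      refine orderOf_dvd_of_pow_eq_one (MulChar.ext fun u => ?_)
      have : NeZero (q : ℕ) := ⟨(hs q q.2).1.ne_zero⟩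
      obtain ⟨a, ha⟩ := Nat.chineseRemainderOfFinset (fun i : ℕ => if i = (q : ℕ) then (u : ZMod q).val else 1) id s
        (fun i hi => (hs i hi).1.ne_zero) hcop
      have haq : (a : ZMod q) = u := by
        have := (ZMod.natCast_eq_natCast_iff _ _ _).mpr (ha q q.2)
        simpa using this
      have haq' : ∀ i : s, i ≠ q → (a : ZMod i) = 1 := fun i hi => by
        have := (ZMod.natCast_eq_natCast_iff _ _ _).mpr (ha i i.2)
        rw [if_neg (fun h => hi (Subtype.ext h))] at this
        simpa using this
      have hac : Nat.Coprime a Q := Nat.Coprime.prod_right fun i hi => by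
        rw [← ZMod.isUnit_iff_coprime]
        by_cases h : i = q
        · subst h; rw [haq]; exact u.isUnit
        · rw [haq' ⟨i, hi⟩ (fun h' => h (congrArg Subtype.val h'))]; exact isUnit_one
      have h1 := heval e a (Nat.isCoprime_iff_coprime.mpr hac)
      have h2 : (l e ^ j) (a : ZMod Q) = 1 := by
        rw [he, MulChar.one_apply ((ZMod.isUnit_iff_coprime _ _).mpr hac)]
      have hj0 : j ≠ 0 := fun h => hj (h ▸ dvd_zero n)
      simp only [Int.cast_natCast] at h1
      rw [MulChar.pow_apply' _ hj0, h1, prod_eq_single q (fun i _ hi => by rw [haq' i hi, map_one, one_pow])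
        (fun h => absurd (mem_univ _) h), haq, ← pow_mul] at h2
      rw [MulChar.pow_apply_coe, h2, MulChar.one_apply_coe]
    have hcard := card_le_card hsub
    rw [Fintype.card_piFinset, prod_const, card_univ, Fintype.card_coe] at hcard
    have h1 : (#{k : Fin n | n ∣ k * j} : ℝ) ≤ n / 2 := by
      rw [le_div_iff₀ two_pos, mul_comm]
      exact_mod_cast card_filter_dvd_mul_le hj
    calc (#{e | l e ^ j = 1} : ℝ) ≤ (#{k : Fin n | n ∣ k * j} : ℝ) ^ #s := by
          exact_mod_cast hcard
      _ ≤ (n / 2 : ℝ) ^ #s := by gcongr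
      _ = _ := by rw [Fintype.card_fun, Fintype.card_coe, Fintype.card_fin]; push_cast; ring
  · by_cases hj : j = 0
    · exact ⟨Fintype.card (s → Fin n), Nat.cast_nonneg _, by simp [hj]⟩
    by_cases hp : p.Coprime Q
    · have h1 : ∀ e, l e p ^ j = ∏ q : s, (lam q p ^ j) ^ (e q : ℕ) := fun e => by
        have := heval e p (Nat.isCoprime_iff_coprime.mpr hp)
        simp only [Int.cast_natCast] at this
        rw [this, ← prod_pow]
        exact prod_congr rfl fun q _ => by rw [← pow_mul, ← pow_mul, mul_comm]
      have h2 : ∑ e, l e p ^ j = ∏ q : s, ∑ k : Fin n, (lam q p ^ j) ^ (k : ℕ) := by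
        rw [prod_univ_sum, Fintype.piFinset_univ]
        exact sum_congr rfl fun e _ => h1 e
      refine ⟨∏ q : s, if lam q p ^ j = 1 then (n : ℝ) else 0, prod_nonneg fun q _ => by positivity, ?_⟩
      rw [h2]
      push_cast
      refine prod_congr rfl fun q _ => ?_
      have hu : IsUnit (p : ZMod q) := (ZMod.isUnit_iff_coprime _ _).mpr (hp.coprime_dvd_right (hdvd q))
      rw [Fin.sum_univ_eq_sum_range (fun k => (lam q p ^ j) ^ k), sum_pow_eq_ite]
      · split_ifs <;> simp
      · rw [← pow_mul, mul_comm, pow_mul, ← MulChar.pow_apply' _ hn.ne', hpow, MulChar.one_apply hu, one_pow]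
    · refine ⟨0, le_rfl, ?_⟩
      refine sum_eq_zero fun e _ => ?_
      rw [MulChar.map_nonunit _ (fun h => hp ((ZMod.isUnit_iff_coprime _ _).mp h)), zero_pow hj]

end Family

section Equidistribution

open Finset

open Real

variable {K : Type*} [Field K] [NumberField K] [IsGalois ℚ K] {C : Subgroup (K ≃ₐ[ℚ] K)}

/-- The shape of the error term in the equidistribution of Frobenius elements. -/
noncomputable def equiError (B : ℝ) (r y x : ℕ) : ℝ :=
  B * ((1 / 2) ^ r * (log x - log y + 1) + exp (B * (r + 1) ^ 2))

lemma equiError_mono {B B' : ℝ} (h0 : 0 ≤ B) (h : B ≤ B') (r : ℕ) {y x : ℕ} (hy : 1 ≤ y) (hyx : y ≤ x) :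
    equiError B r y x ≤ equiError B' r y x := by
  have hL : 0 ≤ log x - log y :=
    sub_nonneg.mpr (log_le_log (by exact_mod_cast hy) (by exact_mod_cast hyx))
  unfold equiError
  have h1 : 0 ≤ B' := h0.trans h
  gcongr

lemma le_equiError {B : ℝ} (h0 : 0 ≤ B) (r : ℕ) {y x : ℕ} (hy : 1 ≤ y) (hyx : y ≤ x) :
    B ≤ equiError B r y x := by
  have hL : 0 ≤ log x - log y :=
    sub_nonneg.mpr (log_le_log (by exact_mod_cast hy) (by exact_mod_cast hyx))
  unfold equiError
  have h2 : 1 ≤ exp (B * (r + 1) ^ 2) := one_le_exp (by positivity)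
  have h3 : 0 ≤ (1 / 2 : ℝ) ^ r * (log x - log y + 1) := by positivity
  nlinarith

/-- Equidistribution of Frobenius elements with respect to `g`, with the logarithmic weight. -/
def IsEquidistributed (frob : ℕ → K ≃ₐ[ℚ] K) (g : (K ≃ₐ[ℚ] K) → ℂ) : Prop :=
  ∃ B > 0, ∀ r y x : ℕ, 1 ≤ y → y ≤ x →
    ‖∑ p ∈ primesIoc (discr K).natAbs y x, g (frob p) * (primeWeight p : ℂ) -
      (∑ γ, g γ) / Nat.card (K ≃ₐ[ℚ] K) * ((log x - log y : ℝ) : ℂ)‖ ≤ equiError B r y x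

lemma IsEquidistributed.add {frob : ℕ → K ≃ₐ[ℚ] K} {g h : (K ≃ₐ[ℚ] K) → ℂ}
    (hg : IsEquidistributed frob g) (hh : IsEquidistributed frob h) :
    IsEquidistributed frob (fun γ => g γ + h γ) := by
  obtain ⟨B, hB, hg⟩ := hg
  obtain ⟨B', hB', hh⟩ := hh
  refine ⟨B + B', by positivity, fun r y x hy hyx => ?_⟩
  have h3 : equiError B r y x + equiError B' r y x ≤ equiError (B + B') r y x := by
    unfold equiError
    have h4 : exp (B * (r + 1) ^ 2) ≤ exp ((B + B') * (r + 1) ^ 2) := by gcongr; linarith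
    have h5 : exp (B' * (r + 1) ^ 2) ≤ exp ((B + B') * (r + 1) ^ 2) := by gcongr; linarith
    nlinarith
  refine le_trans ?_ ((add_le_add (hg r y x hy hyx) (hh r y x hy hyx)).trans h3)
  refine le_trans (le_of_eq ?_) (norm_add_le _ _)
  simp only [add_mul, sum_add_distrib, add_div]
  ring

lemma IsEquidistributed.const_mul {frob : ℕ → K ≃ₐ[ℚ] K} {g : (K ≃ₐ[ℚ] K) → ℂ}
    (hg : IsEquidistributed frob g) (c : ℂ) : IsEquidistributed frob (fun γ => c * g γ) := by
  obtain ⟨B, hB, hg⟩ := hg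
  refine ⟨(‖c‖ + 1) * B, by positivity, fun r y x hy hyx => ?_⟩
  have hL : 0 ≤ log x - log y :=
    sub_nonneg.mpr (log_le_log (by exact_mod_cast hy) (by exact_mod_cast hyx))
  have h1 : ‖c‖ * equiError B r y x ≤ equiError ((‖c‖ + 1) * B) r y x := by
    unfold equiError
    have h4 : exp (B * (r + 1) ^ 2) ≤ exp ((‖c‖ + 1) * B * (r + 1) ^ 2) := by
      gcongr; nlinarith [norm_nonneg c]
    rw [← mul_assoc]
    gcongr
    linarith
  refine le_trans (le_of_eq ?_) ((mul_le_mul_of_nonneg_left (hg r y x hy hyx) (norm_nonneg c)).trans h1)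
  rw [← norm_mul]
  simp only [mul_sub, mul_sum, sum_div, sum_mul, mul_assoc, mul_div_assoc]

lemma IsEquidistributed.sum {frob : ℕ → K ≃ₐ[ℚ] K} {ι : Type*} (s : Finset ι)
    {g : ι → (K ≃ₐ[ℚ] K) → ℂ} (hg : ∀ i ∈ s, IsEquidistributed frob (g i)) :
    IsEquidistributed frob (fun γ => ∑ i ∈ s, g i γ) := by
  induction s using Finset.induction_on with
  | empty =>
    refine ⟨1, one_pos, fun r y x hy hyx => ?_⟩
    have := le_equiError zero_le_one r hy hyx
    simp only [sum_empty, zero_mul, sum_const_zero, zero_div, sub_zero, norm_zero]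
    linarith
  | insert i s hi ih =>
    simp only [sum_insert hi]
    exact (hg i (mem_insert_self i s)).add (ih fun j hj => hg j (mem_insert_of_mem hj))

lemma isEquidistributed_of_abs_le {frob : ℕ → K ≃ₐ[ℚ] K} {g : (K ≃ₐ[ℚ] K) → ℂ} {c : ℂ} {A : ℝ}
    (hc : c = (∑ γ, g γ) / Nat.card (K ≃ₐ[ℚ] K))
    (h : ∀ N : ℕ, 1 ≤ N → ‖∑ p ∈ Icc 1 N, (if p ∣ (discr K).natAbs then 0 else g (frob p)) *
      (primeWeight p : ℂ) - c * (log N : ℂ)‖ ≤ A) : IsEquidistributed frob g := by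
  have hA : 0 ≤ A := (norm_nonneg _).trans (h 1 le_rfl)
  refine ⟨2 * A + 1, by positivity, fun r y x hy hyx => ?_⟩
  refine le_trans ?_ (le_equiError (by positivity) r hy hyx)
  rw [sum_primesIoc hyx, ← hc]
  refine le_trans (le_of_eq ?_) ((norm_sub_le _ _).trans
    ((add_le_add (h x (hy.trans hyx)) (h y hy)).trans (by linarith)))
  push_cast
  ring

theorem isEquidistributed_indChar_one {frob : ℕ → K ≃ₐ[ℚ] K} (hfrob : IsFrobeniusChoice frob) :
    IsEquidistributed frob (indChar (1 : C →* ℂ)) := by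
  obtain ⟨A, _, h⟩ := exists_norm_sum_indChar_sub_log_le (1 : C →* ℂ) hfrob
  refine isEquidistributed_of_abs_le (c := Nat.card C) (A := A) ?_ (by simpa using h)
  rw [sum_indChar, if_pos rfl, mul_div_cancel_left₀]
  exact_mod_cast Nat.card_pos.ne'

theorem isEquidistributed_indChar (χ : C →* ℂ) {frob : ℕ → K ≃ₐ[ℚ] K} (hfrob : IsFrobeniusChoice frob) :
    IsEquidistributed frob (indChar χ) := by
  have hpos := orderOf_char_pos χ
  have hcases : orderOf χ = 1 ∨ orderOf χ = 2 ∨ 3 ≤ orderOf χ := by omega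
  rcases hcases with h1 | h2 | h3
  · rw [orderOf_eq_one_iff.mp h1]
    exact isEquidistributed_indChar_one hfrob
  · obtain ⟨A, _, h⟩ := exists_norm_sum_indChar_sub_log_le χ hfrob
    have hχ : χ ≠ 1 := fun h => by rw [h, orderOf_one] at h2; omega
    have h4 : IsEquidistributed frob (fun γ => indChar (1 : C →* ℂ) γ + indChar χ γ) := by
      refine isEquidistributed_of_abs_le (c := Nat.card C) (A := A) ?_ ?_
      · rw [sum_add_distrib, sum_indChar, sum_indChar, if_pos rfl, if_neg hχ, add_zero, mul_div_cancel_left₀]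
        exact_mod_cast Nat.card_pos.ne'
      · simpa [h2, sum_range_succ] using h
    simpa using h4.add ((isEquidistributed_indChar_one (C := C) hfrob).const_mul (-1))
  · obtain ⟨A, hA, k, h⟩ := exists_norm_sum_primesIoc_indChar_le χ hfrob h3
    have hD : (discr K).natAbs ≠ 0 := Int.natAbs_ne_zero.mpr (discr_ne_zero K)
    obtain ⟨B, hB, hs⟩ := exists_primes_modEq_one (n := 2 * orderOf χ) (by omega) hD
    have hχ : χ ≠ 1 := fun h => by rw [h, orderOf_one] at h3; omega
    refine ⟨A + B * k + 1, by positivity, fun r y x hy hyx => ?_⟩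
    rw [sum_indChar, if_neg hχ, zero_div, zero_mul, sub_zero]
    obtain ⟨s, hsr, hsq⟩ := hs r
    have hfam := exists_character_family hpos fun q hq => ⟨(hsq q hq).1, (hsq q hq).2.2.1⟩
    obtain ⟨Q, hQ⟩ : ∃ Q, Q = ∏ q ∈ s, q := ⟨_, rfl⟩
    rw [← hQ] at hfam
    obtain ⟨l, hl1, hl2, hl3, hl4⟩ := hfam
    have hQ0 : NeZero Q := ⟨hQ ▸ prod_ne_zero_iff.mpr fun q hq => (hsq q hq).1.ne_zero⟩
    have hcop : Q.Coprime (discr K).natAbs := hQ ▸ Nat.Coprime.prod_left fun q hq =>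
      ((hsq q hq).1.coprime_iff_not_dvd).mpr (hsq q hq).2.1
    have : Nonempty (s → Fin (orderOf χ)) := ⟨fun _ => ⟨0, hpos⟩⟩
    refine (h Q hcop _ l ((1 / 2) ^ r) (by positivity) hl1 hl2 (fun j hj => by rw [← hsr]; convert hl3 j hj) hl4 y x hy hyx).trans ?_
    have hQle : (Q : ℝ) ^ k ≤ exp ((A + B * k + 1) * (r + 1) ^ 2) := by
      have h5 : (Q : ℝ) ≤ exp (B * (r + 1)) ^ r := by
        rw [hQ, Nat.cast_prod, ← hsr]
        refine (prod_le_prod (fun q _ => Nat.cast_nonneg q) fun q hq => (hsq q hq).2.2.2).trans ?_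
        rw [prod_const, hsr]
      calc (Q : ℝ) ^ k ≤ (exp (B * (r + 1)) ^ r) ^ k := by gcongr
        _ = exp (k * (r * (B * (r + 1)))) := by rw [← exp_nat_mul, ← exp_nat_mul]
        _ ≤ _ := by
          refine exp_le_exp.mpr ?_
          have h7 : (0 : ℝ) ≤ B * k := by positivity
          nlinarith
    have hL : 0 ≤ log x - log y :=
      sub_nonneg.mpr (log_le_log (by exact_mod_cast hy) (by exact_mod_cast hyx))
    unfold equiError
    have h9 : 0 ≤ B * k := by positivity
    gcongr
    linarith

end Equidistribution

section ClassFunction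

open Finset

open Real

variable {K : Type*} [Field K] [NumberField K] [IsGalois ℚ K]

lemma isEquidistributed_conj {frob : ℕ → K ≃ₐ[ℚ] K} (hfrob : IsFrobeniusChoice frob) (σ : K ≃ₐ[ℚ] K) :
    IsEquidistributed frob fun γ => ∑ g : K ≃ₐ[ℚ] K, if g * γ * g⁻¹ = σ then (1 : ℂ) else 0 := by
  let _ : CommGroup (Subgroup.zpowers σ) := { (inferInstance : Group (Subgroup.zpowers σ)) with
    mul_comm := fun a b => (inferInstance : IsMulCommutative (Subgroup.zpowers σ)).is_comm.comm a b }
  set s : Subgroup.zpowers σ := ⟨σ, Subgroup.mem_zpowers σ⟩ with hs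
  let toChar : AddChar (Additive (Subgroup.zpowers σ)) ℂ → (Subgroup.zpowers σ →* ℂ) := fun ψ =>
    { toFun := fun c => ψ (Additive.ofMul c)
      map_one' := ψ.map_zero_eq_one
      map_mul' := fun a b => ψ.map_add_eq_mul _ _ }
  have key := IsEquidistributed.sum (frob := frob) univ (g := fun (ψ : AddChar (Additive (Subgroup.zpowers σ)) ℂ) γ =>
    ((Fintype.card (Subgroup.zpowers σ) : ℂ)⁻¹ * ψ (Additive.ofMul s⁻¹)) * indChar (toChar ψ) γ)
    fun ψ _ => (isEquidistributed_indChar (toChar ψ) hfrob).const_mul _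
  convert key using 1
  funext γ
  simp only [indChar, mul_sum]
  rw [sum_comm]
  refine sum_congr rfl fun g _ => ?_
  by_cases h : g * γ * g⁻¹ ∈ Subgroup.zpowers σ
  · have h1 : ∀ ψ : AddChar (Additive (Subgroup.zpowers σ)) ℂ,
        (Fintype.card (Subgroup.zpowers σ) : ℂ)⁻¹ * ψ (Additive.ofMul s⁻¹) * extChar (toChar ψ) (g * γ * g⁻¹) =
        (Fintype.card (Subgroup.zpowers σ) : ℂ)⁻¹ * ψ (Additive.ofMul (s⁻¹ * ⟨g * γ * g⁻¹, h⟩)) := by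
      intro ψ
      rw [extChar_of_mem _ h, mul_assoc, ofMul_mul, ψ.map_add_eq_mul]
      rfl
    rw [sum_congr rfl fun ψ _ => h1 ψ, ← mul_sum, AddChar.sum_apply_eq_ite]
    have h2 : (Additive.ofMul (s⁻¹ * ⟨g * γ * g⁻¹, h⟩) = 0) ↔ g * γ * g⁻¹ = σ := by
      rw [ofMul_eq_zero, inv_mul_eq_one, hs, Subtype.mk.injEq, eq_comm]
    have h3 : (Fintype.card (Subgroup.zpowers σ) : ℂ) ≠ 0 := by exact_mod_cast Fintype.card_ne_zero
    by_cases h4 : g * γ * g⁻¹ = σ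
    · rw [if_pos h4, if_pos (h2.mpr h4), Fintype.card_additive, inv_mul_cancel₀ h3]
    · rw [if_neg h4, if_neg (fun h5 => h4 (h2.mp h5)), mul_zero]
  · rw [if_neg fun h1 : g * γ * g⁻¹ = σ => h (h1.symm ▸ Subgroup.mem_zpowers σ)]
    exact (sum_eq_zero fun ψ _ => by rw [extChar_of_notMem _ h, mul_zero]).symm

/-- Class functions are equidistributed on Frobenius elements. -/
theorem exists_abs_sum_frob_sub_le {frob : ℕ → K ≃ₐ[ℚ] K} (hfrob : IsFrobeniusChoice frob)
    {f : (K ≃ₐ[ℚ] K) → ℝ} (hf : ∀ γ τ, f (τ * γ * τ⁻¹) = f γ) :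
    ∃ B > 0, ∀ r y x : ℕ, 1 ≤ y → y ≤ x →
    |∑ p ∈ primesIoc (discr K).natAbs y x, f (frob p) * primeWeight p -
      (1 / (Nat.card (K ≃ₐ[ℚ] K) : ℝ)) * (∑ γ, f γ) * (log x - log y)| ≤ equiError B r y x := by
  have hcard : (Fintype.card (K ≃ₐ[ℚ] K) : ℂ) ≠ 0 := by exact_mod_cast Fintype.card_ne_zero
  have key : IsEquidistributed frob (fun γ => (f γ : ℂ)) := by
    have h := IsEquidistributed.sum (frob := frob) univ (g := fun σ γ =>
      ((Fintype.card (K ≃ₐ[ℚ] K) : ℂ)⁻¹ * (f σ : ℂ)) * ∑ g : K ≃ₐ[ℚ] K, if g * γ * g⁻¹ = σ then (1 : ℂ) else 0)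
      fun σ _ => (isEquidistributed_conj hfrob σ).const_mul _
    convert h using 1
    funext γ
    simp only [mul_sum, mul_ite, mul_one, mul_zero]
    rw [sum_comm]
    simp only [sum_ite_eq, mem_univ, if_true, hf, sum_const, card_univ, nsmul_eq_mul]
    rw [mul_inv_cancel_left₀ hcard]
  obtain ⟨B, hB, h⟩ := key
  refine ⟨B, hB, fun r y x hy hyx => le_trans (le_of_eq ?_) (h r y x hy hyx)⟩
  rw [← norm_eq_abs, ← Complex.norm_real]
  push_cast
  ring

end ClassFunction

end

section Transfer

open Real

open NumberField Finset
open scoped Classical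

/-- `ρ` takes the value `m` on average at the primes, with logarithmic weight. -/
def HasPrimeMean (ρ : ℕ → ℝ) (m : ℝ) : Prop :=
  ∃ B > 0, ∀ r y x : ℕ, 1 ≤ y → y ≤ x →
    |∑ p ∈ Ioc y x, ρ p * primeWeight p - m * (log x - log y)| ≤ equiError B r y x

lemma IsFreeFrobenius.isFrobeniusAt {K : Type*} [Field K] [NumberField K] {p : ℕ} (hp : p.Prime) {P : Ideal (𝓞 K)}
    {σ : K ≃ₐ[ℚ] K} (h : IsFreeFrobenius p P σ) : IsFrobeniusAt K σ p := by
  have hP := h.isPrime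
  refine ⟨P, hP.isMaximal ?_, h.mem, fun x => ⟨σ • x, rfl, h.frob x⟩⟩
  rintro rfl
  have := h.mem
  rw [Ideal.mem_bot] at this
  exact hp.ne_zero (by exact_mod_cast this)

lemma HasPrimeMean.of_frobenian {K : Type} [Field K] [NumberField K] [IsGalois ℚ K] {ρ : ℕ → ℝ} (S T : Finset ℕ)
    (hρ : ∀ n, |ρ n| ≤ 1) (hram : ∀ p : ℕ, p.Prime → (p : ℤ) ∣ discr K → p ∈ S) {φ : (K ≃ₐ[ℚ] K) → ℝ}
    (hclass : ∀ γ τ : K ≃ₐ[ℚ] K, φ (τ * γ * τ⁻¹) = φ γ)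
    (hfrob : ∀ p : ℕ, p.Prime → p ∉ S → p ∉ T → ∀ σ : K ≃ₐ[ℚ] K, IsFrobeniusAt K σ p → ρ p = φ σ) :
    HasPrimeMean ρ ((1 / (Nat.card (K ≃ₐ[ℚ] K) : ℝ)) * ∑ γ : K ≃ₐ[ℚ] K, φ γ) := by
  obtain ⟨frob, hfr⟩ := exists_isFrobeniusChoice K
  obtain ⟨B, hB, h⟩ := exists_abs_sum_frob_sub_le hfr hclass
  set D := (discr K).natAbs
  obtain ⟨Φ, hΦ⟩ : ∃ Φ : ℝ, ∀ γ, |φ γ| ≤ Φ := ⟨∑ γ, |φ γ|, fun γ =>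
    single_le_sum (f := fun γ => |φ γ|) (fun _ _ => abs_nonneg _) (mem_univ γ)⟩
  have hΦ0 : 0 ≤ Φ := (abs_nonneg _).trans (hΦ 1)
  set E : ℝ := (S ∪ T).card * (1 + Φ)
  have hE : 0 ≤ E := by positivity
  refine ⟨B + E, by positivity, fun r y x hy hyx => ?_⟩
  have hdiff : |∑ p ∈ Ioc y x, ρ p * primeWeight p - ∑ p ∈ primesIoc D y x, φ (frob p) * primeWeight p| ≤ E := by
    unfold primesIoc
    rw [sum_filter, ← sum_sub_distrib]
    calc _ ≤ ∑ p ∈ Ioc y x, |ρ p * primeWeight p -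
          if p.Prime ∧ ¬ p ∣ D then φ (frob p) * primeWeight p else 0| := abs_sum_le_sum_abs _ _
      _ ≤ ∑ p ∈ Ioc y x, if p ∈ S ∪ T then (1 + Φ) else 0 := by
          refine sum_le_sum fun p _ => ?_
          have hw := primeWeight_le_one p
          have hw0 := primeWeight_nonneg p
          by_cases hpS : p ∈ S ∪ T
          · rw [if_pos hpS]
            have h1 : |ρ p * primeWeight p| ≤ 1 := by
              rw [abs_mul, abs_of_nonneg hw0]
              exact mul_le_one₀ (hρ p) hw0 hw
            have h2 : |(if p.Prime ∧ ¬ p ∣ D then φ (frob p) * primeWeight p else 0)| ≤ Φ := by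
              split_ifs
              · rw [abs_mul, abs_of_nonneg hw0]
                nlinarith [hΦ (frob p)]
              · simpa using hΦ0
            exact (abs_sub _ _).trans (add_le_add h1 h2)
          · rw [if_neg hpS]
            rw [mem_union, not_or] at hpS
            by_cases hp : p.Prime
            · have hpD : ¬ (p : ℤ) ∣ discr K := fun hd => hpS.1 (hram p hp hd)
              obtain ⟨P, hP⟩ := hfr p hp hpD
              rw [if_pos ⟨hp, fun hd => hpD (Int.natCast_dvd.mpr hd)⟩,
                hfrob p hp hpS.1 hpS.2 _ (hP.isFrobeniusAt hp), sub_self, abs_zero]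
            · simp [primeWeight, hp]
      _ ≤ E := by
          rw [← sum_filter, sum_const, nsmul_eq_mul]
          refine mul_le_mul_of_nonneg_right ?_ (by positivity)
          exact_mod_cast card_le_card fun p hp => (mem_filter.mp hp).2
  have h1 := h r y x hy hyx
  have h2 : equiError B r y x + E ≤ equiError (B + E) r y x := by
    have hL : 0 ≤ log x - log y :=
      sub_nonneg.mpr (log_le_log (by exact_mod_cast hy) (by exact_mod_cast hyx))
    have h4 : 1 ≤ exp ((B + E) * (r + 1) ^ 2) := one_le_exp (by positivity)
    have h5 : exp (B * (r + 1) ^ 2) ≤ exp ((B + E) * (r + 1) ^ 2) := by gcongr; linarith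
    have h6 : 0 ≤ (1 / 2 : ℝ) ^ r * (log x - log y + 1) := by positivity
    unfold equiError
    nlinarith
  rw [abs_le] at *
  constructor <;> linarith

end Transfer

section MeanSum

open Real

open Finset

lemma exists_equiError_exp_le {B : ℝ} (hB : 0 < B) : ∃ C > 0, ∀ u : ℝ, 0 ≤ u → ∃ r : ℕ,
    B * ((1 / 2) ^ r * (exp u + 1) + exp (B * (r + 1) ^ 2)) ≤ C * (exp u / (1 + u) ^ 2) := by
  set δ : ℝ := 1 / (2 * sqrt B) with hδ
  have hsB : 0 < sqrt B := sqrt_pos.mpr hB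
  have hδ0 : 0 < δ := by positivity
  have hδB : B * δ ^ 2 = 1 / 4 := by
    grind
  have hl2 : 0 < log 2 := log_pos (by norm_num)
  set a : ℝ := log 2 * δ with ha
  have ha0 : 0 < a := by positivity
  refine ⟨B * (4 * (2 + 48 / a ^ 4) + exp (2 * B) * 16), by positivity, fun u hu => ⟨⌊δ * sqrt u⌋₊, ?_⟩⟩
  set r := ⌊δ * sqrt u⌋₊
  have hsu := sq_sqrt hu
  have hsu0 := sqrt_nonneg u
  have hr1 : (r : ℝ) ≤ δ * sqrt u := Nat.floor_le (by positivity)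
  have hr2 : δ * sqrt u < r + 1 := Nat.lt_floor_add_one _
  have h1 : B * ((r : ℝ) + 1) ^ 2 ≤ u / 2 + 2 * B := by
    have h2 : ((r : ℝ) + 1) ^ 2 ≤ 2 * ((δ * sqrt u) ^ 2 + 1) := by
      nlinarith [sq_nonneg ((r : ℝ) - 1)]
    nlinarith
  have h2 : exp (u / 2) * (1 + u) ^ 2 ≤ 16 * exp u := by
    have h3 : 1 + u ≤ 4 * exp (u / 4) := by linarith [add_one_le_exp (u / 4)]
    have h4 : exp u = exp (u / 2) * exp (u / 4) ^ 2 := by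
      rw [← exp_nat_mul, ← exp_add]; ring_nf
    rw [h4, show 16 * (exp (u / 2) * exp (u / 4) ^ 2) = exp (u / 2) * (4 * exp (u / 4)) ^ 2 by ring]
    gcongr
  have h3 : (1 / 2 : ℝ) ^ r * (1 + u) ^ 2 ≤ 2 * (2 + 48 / a ^ 4) := by
    have h4 : (1 / 2 : ℝ) ^ r = exp (-(log 2 * r)) := by
      rw [one_div, inv_pow, exp_neg, mul_comm, exp_nat_mul, exp_log (by norm_num)]
    have h5 : exp (-(log 2 * r)) ≤ 2 * exp (-(a * sqrt u)) := by
      have : -(log 2 * r) ≤ log 2 + -(a * sqrt u) := by nlinarith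
      calc _ ≤ exp (log 2 + -(a * sqrt u)) := exp_le_exp.mpr this
        _ = _ := by rw [exp_add, exp_log (by norm_num)]
    have h6 : (1 + u) ^ 2 ≤ (2 + 48 / a ^ 4) * exp (a * sqrt u) := by
      have h7 := pow_div_factorial_le_exp (a * sqrt u) (by positivity) 4
      have h8 : (1 : ℝ) ≤ exp (a * sqrt u) := one_le_exp (by positivity)
      have h9 : (a * sqrt u) ^ 4 = a ^ 4 * u ^ 2 := by
        grind
      rw [h9, show ((Nat.factorial 4 : ℕ) : ℝ) = 24 by norm_num [Nat.factorial]] at h7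
      have h10 : u ^ 2 ≤ 24 / a ^ 4 * exp (a * sqrt u) := by
        rw [div_mul_eq_mul_div, le_div_iff₀ (by positivity)]
        linarith
      have : 48 / a ^ 4 = 2 * (24 / a ^ 4) := by ring
      nlinarith [sq_nonneg (u - 1)]
    rw [h4]
    calc _ ≤ (2 * exp (-(a * sqrt u))) * ((2 + 48 / a ^ 4) * exp (a * sqrt u)) := by gcongr
      _ = 2 * (2 + 48 / a ^ 4) * (exp (-(a * sqrt u)) * exp (a * sqrt u)) := by ring
      _ = _ := by rw [← exp_add]; simp
  have hpos : 0 < (1 + u) ^ 2 := by positivity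
  rw [← mul_div_assoc, le_div_iff₀ hpos, mul_assoc, mul_assoc]
  refine mul_le_mul_of_nonneg_left ?_ hB.le
  have h4 : exp (B * (r + 1) ^ 2) ≤ exp (2 * B) * exp (u / 2) := by
    rw [← exp_add]; exact exp_le_exp.mpr (by linarith)
  have h5 : (1 : ℝ) ≤ exp u := one_le_exp hu
  calc _ = ((1 / 2 : ℝ) ^ r * (1 + u) ^ 2) * (exp u + 1) + exp (B * (r + 1) ^ 2) * (1 + u) ^ 2 := by ring
    _ ≤ (2 * (2 + 48 / a ^ 4)) * (2 * exp u) + exp (2 * B) * exp (u / 2) * (1 + u) ^ 2 := by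
        gcongr; linarith
    _ ≤ (2 * (2 + 48 / a ^ 4)) * (2 * exp u) + exp (2 * B) * (16 * exp u) := by
        rw [mul_assoc (exp (2 * B))]; gcongr
    _ = _ := by ring

variable {ρ : ℕ → ℝ} {m : ℝ}

lemma HasPrimeMean.exists_abs_sub_le (h : HasPrimeMean ρ m) {ε : ℝ} (hε : 0 < ε) : ∃ D, ∀ y x : ℕ, 1 ≤ y → y ≤ x →
    |∑ p ∈ Ioc y x, ρ p * primeWeight p - m * (log x - log y)| ≤ ε * (log x - log y) + D := by
  obtain ⟨B, hB, h⟩ := h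
  obtain ⟨r, hr⟩ := exists_pow_lt_of_lt_one (show 0 < ε / B by positivity) (show (1 / 2 : ℝ) < 1 by norm_num)
  refine ⟨B * ((1 / 2) ^ r + exp (B * (r + 1) ^ 2)), fun y x hy hyx => (h r y x hy hyx).trans ?_⟩
  have hL : 0 ≤ log x - log y :=
    sub_nonneg.mpr (log_le_log (by exact_mod_cast hy) (by exact_mod_cast hyx))
  rw [lt_div_iff₀ hB] at hr
  unfold equiError
  nlinarith

lemma HasPrimeMean.nonneg (h : HasPrimeMean ρ m) (h0 : ∀ n, 0 ≤ ρ n) : 0 ≤ m := by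
  by_contra! hm
  obtain ⟨D, hD⟩ := h.exists_abs_sub_le (show 0 < -m / 2 by linarith)
  obtain ⟨N, hN⟩ := exists_nat_gt (exp ((|D| + 1) / (-m / 2)))
  have hN0 : (0 : ℝ) < N := (exp_pos _).trans hN
  have h1 := hD 1 N le_rfl (by exact_mod_cast hN0)
  have h2 : 0 ≤ ∑ p ∈ Ioc 1 N, ρ p * primeWeight p :=
    sum_nonneg fun p _ => mul_nonneg (h0 p) (primeWeight_nonneg p)
  have h3 := (lt_log_iff_exp_lt hN0).mpr hN
  rw [div_lt_iff₀ (by linarith)] at h3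
  simp only [Nat.cast_one, log_one, sub_zero] at h1
  grind

lemma HasPrimeMean.exists_le_theta (h : HasPrimeMean ρ m) (hm : 0 < m) (h0 : ∀ n, 0 ≤ ρ n) : ∃ c > 0, ∃ A : ℕ, 0 < A ∧
    ∀ N, A ≤ N → c * N ≤ ∑ p ∈ Icc 1 N, ρ p * (p * primeWeight p) := by
  obtain ⟨D, hD⟩ := h.exists_abs_sub_le (half_pos hm)
  obtain ⟨A, hA⟩ := exists_nat_gt (exp ((|D| + 1) / (m / 2)))
  have hA0 : (0 : ℝ) < A := (exp_pos _).trans hA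
  have hA1 : 0 < A := by exact_mod_cast hA0
  refine ⟨1 / (2 * A), by positivity, A, hA1, fun N hN => ?_⟩
  set y := N / A with hy
  have hy1 : 1 ≤ y := (Nat.one_le_div_iff hA1).mpr hN
  have hyN : A * y ≤ N := Nat.mul_div_le N A
  have hy0 : (0 : ℝ) < y := by exact_mod_cast hy1
  have h1 := hD y (A * y) hy1 (Nat.le_mul_of_pos_left y hA1)
  have h3 := (lt_log_iff_exp_lt hA0).mpr hA
  rw [div_lt_iff₀ (by linarith)] at h3
  rw [Nat.cast_mul, log_mul hA0.ne' hy0.ne', add_sub_cancel_right] at h1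
  have h4 := (abs_le.mp h1).1
  have h5 : 1 ≤ ∑ p ∈ Ioc y (A * y), ρ p * primeWeight p := by linarith [le_abs_self D]
  calc 1 / (2 * A) * (N : ℝ) ≤ y := by
        rw [one_div, inv_mul_le_iff₀ (by positivity)]
        have : N < A * (y + 1) := Nat.lt_mul_div_succ N hA1
        have : (N : ℝ) ≤ A * (y + 1) := by exact_mod_cast this.le
        have : (1 : ℝ) ≤ y := by exact_mod_cast hy1
        nlinarith
    _ ≤ y * ∑ p ∈ Ioc y (A * y), ρ p * primeWeight p := le_mul_of_one_le_right hy0.le h5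
    _ ≤ ∑ p ∈ Ioc y (A * y), ρ p * (p * primeWeight p) := by
        rw [mul_sum]
        refine sum_le_sum fun p hp => ?_
        have : (y : ℝ) ≤ p := by exact_mod_cast (mem_Ioc.mp hp).1.le
        rw [mul_left_comm]
        have := primeWeight_nonneg p
        have := h0 p
        gcongr
    _ ≤ _ := by
        refine sum_le_sum_of_subset_of_nonneg (fun p hp => ?_) fun p _ _ =>
          mul_nonneg (h0 p) (mul_nonneg p.cast_nonneg (primeWeight_nonneg p))
        grind

lemma one_le_log_natCast {N : ℕ} (hN : 3 ≤ N) : 1 ≤ log N := by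
  rw [le_log_iff_exp_le (by positivity)]
  exact exp_one_lt_three.le.trans (by exact_mod_cast hN)

/-- Partial summation for a nonnegative weight whose sums grow at most like `k log N`. -/
lemma sum_div_log_le {a : ℕ → ℝ} (h0 : ∀ n, 0 ≤ a n) {k C : ℝ} (hC : 0 ≤ C)
    (hA : ∀ N, 3 ≤ N → ∑ n ∈ Icc 1 N, a n ≤
      log N * (k + C / (1 + log (log N)) ^ 2)) {N : ℕ} (hN : 3 ≤ N) :
    ∑ n ∈ Icc 3 N, a n / log n ≤ (∑ n ∈ Icc 1 N, a n) / log N +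
      k * (log (log N) - log (log 3)) + 2 * C * (1 - 1 / (1 + log (log N))) := by
  induction N, hN using Nat.le_induction with
  | base =>
    have hl := one_le_log_natCast le_rfl
    push_cast at hl
    have hL := log_nonneg hl
    have h1 : a 3 ≤ ∑ n ∈ Icc 1 3, a n := single_le_sum (fun n _ => h0 n) (by simp)
    have h2 : 1 / (1 + log (log 3)) ≤ 1 := by rw [div_le_one (by positivity)]; linarith
    have h3 : 0 ≤ 2 * C * (1 - 1 / (1 + log (log 3))) := mul_nonneg (by positivity) (by linarith)
    simp only [Icc_self, sum_singleton, Nat.cast_ofNat, sub_self, mul_zero, add_zero]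
    have : a 3 / log 3 ≤ (∑ n ∈ Icc 1 3, a n) / log 3 := by gcongr
    linarith
  | succ N hN ih =>
    rw [sum_Icc_succ_top (by omega), sum_Icc_succ_top (by omega) a]
    set A := ∑ n ∈ Icc 1 N, a n
    have hA0 : 0 ≤ A := sum_nonneg fun n _ => h0 n
    have hAN := hA N hN
    have hl := one_le_log_natCast hN
    have hl' := one_le_log_natCast (show 3 ≤ N + 1 by omega)
    have hN0 : (3 : ℝ) ≤ N := by exact_mod_cast hN
    have hll : log ((N + 1 : ℕ) : ℝ) ≤ 2 * log N := by
      rw [show 2 * log N = log ((N : ℝ) ^ 2) by norm_num]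
      refine log_le_log (by positivity) ?_
      push_cast
      nlinarith
    set l := log N
    set l' := log ((N + 1 : ℕ) : ℝ)
    have hL := log_nonneg hl
    have hL' := log_nonneg hl'
    have hl0 : 0 < l := by linarith
    have hl0' : 0 < l' := by linarith
    have hLL : log l' ≤ 1 + log l := by
      have h1 := log_le_log hl0' hll
      rw [log_mul (by norm_num) hl0.ne'] at h1
      linarith [log_two_lt_d9]
    have hmono : l ≤ l' := log_le_log (by positivity) (by push_cast; linarith)
    have hstep : 1 - l / l' ≤ log l' - log l := by
      have := log_le_sub_one_of_pos (div_pos hl0 hl0')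
      rw [log_div hl0.ne' hl0'.ne'] at this
      linarith
    have hdiff : 0 ≤ 1 - l / l' := by
      bound
    set L := log l
    set L' := log l'
    have hfac : 0 ≤ k + C / (1 + L) ^ 2 := by
      nlinarith
    have h1 : A / l - A / l' ≤ (k + C / (1 + L) ^ 2) * (L' - L) := by
      calc A / l - A / l' = A / l * (1 - l / l') := by field_simp
        _ ≤ (k + C / (1 + L) ^ 2) * (1 - l / l') := by
            gcongr
            rw [div_le_iff₀ hl0]
            linarith
        _ ≤ _ := by gcongr
    have h2 : C / (1 + L) ^ 2 * (L' - L) ≤ 2 * C * (1 / (1 + L) - 1 / (1 + L')) := by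
      have h3 : 0 ≤ L' - L := hdiff.trans hstep
      rw [div_sub_div _ _ (by positivity) (by positivity), div_mul_eq_mul_div, ← mul_div_assoc,
        div_le_div_iff₀ (by positivity) (by positivity)]
      have h4 : 1 + L' ≤ 2 * (1 + L) := by linarith
      have h5 := mul_le_mul_of_nonneg_left h4 (show 0 ≤ C * (L' - L) * (1 + L) by positivity)
      nlinarith
    rw [add_div]
    linarith

lemma HasPrimeMean.exists_sum_one_sub_le (h : HasPrimeMean ρ m) (h0 : ∀ n, 0 ≤ ρ n) (h1 : ∀ n, ρ n ≤ 1) :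
    ∃ C, ∀ N : ℕ, 3 ≤ N →
    ∑ p ∈ Icc 1 N, (if p.Prime then (1 - ρ p) / p else 0) ≤ (1 - m) * log (log N) + C := by
  obtain ⟨C₁, hC₁, hM⟩ := exists_abs_sum_primeWeight_sub_log
  obtain ⟨B, hB, h⟩ := h
  obtain ⟨C, hC, hE⟩ := exists_equiError_exp_le (show 0 < B + C₁ by positivity)
  set a : ℕ → ℝ := fun n => (1 - ρ n) * primeWeight n with ha
  have ha0 : ∀ n, 0 ≤ a n := fun n => mul_nonneg (sub_nonneg.mpr (h1 n)) (primeWeight_nonneg n)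
  have hA : ∀ N, 3 ≤ N → ∑ n ∈ Icc 1 N, a n ≤
      log N * ((1 - m) + C / (1 + log (log N)) ^ 2) := by
    intro N hN
    have hl := one_le_log_natCast hN
    obtain ⟨r, hr⟩ := hE (log (log N)) (log_nonneg hl)
    rw [exp_log (by linarith)] at hr
    have h2 := (abs_le.mp (h r 1 N le_rfl (by omega))).1
    have h3 := (abs_le.mp (hM N (by omega))).2
    have h4 : C₁ + equiError B r 1 N ≤ equiError (B + C₁) r 1 N := by
      have h7 : 1 ≤ exp ((B + C₁) * (r + 1) ^ 2) := one_le_exp (by positivity)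
      have h5 : exp (B * (r + 1) ^ 2) ≤ exp ((B + C₁) * (r + 1) ^ 2) := by gcongr; linarith
      have h6 : 0 ≤ (1 / 2 : ℝ) ^ r * (log N + 1) := by positivity
      simp only [equiError, Nat.cast_one, log_one, sub_zero]
      nlinarith
    have h5 : ∑ n ∈ Icc 1 N, a n = ∑ p ∈ Icc 1 N, primeWeight p - ∑ p ∈ Ioc 1 N, ρ p * primeWeight p := by
      rw [sum_Ioc_eq_sub (by omega)]
      simp only [ha, sub_mul, one_mul, sum_sub_distrib]
      simp [primeWeight]
    simp only [equiError, Nat.cast_one, log_one, sub_zero] at h2 h4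
    grind
  refine ⟨1 / 2 + (|1 - m| + C) + |1 - m| * log (log 3) + 2 * C, fun N hN => ?_⟩
  have h2 := sum_div_log_le ha0 hC.le hA hN
  have hl := one_le_log_natCast hN
  have hl3 := one_le_log_natCast (le_refl 3)
  have hL := log_nonneg hl
  have hL3 := log_nonneg hl3
  have h3 : (∑ n ∈ Icc 1 N, a n) / log N ≤ |1 - m| + C := by
    rw [div_le_iff₀' (by linarith)]
    refine (hA N hN).trans (mul_le_mul_of_nonneg_left (add_le_add (le_abs_self _) ?_) (by linarith))
    bound
  have h4 : 2 * C * (1 - 1 / (1 + log (log N))) ≤ 2 * C :=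
    mul_le_of_le_one_right (by positivity) (sub_le_self _ (by positivity))
  have h5 : -(1 - m) * log (log 3) ≤ |1 - m| * log (log 3) := by
    gcongr; exact neg_le_abs _
  have h6 : ∑ p ∈ Icc 1 N, (if p.Prime then (1 - ρ p) / p else 0) ≤ 1 / 2 + ∑ n ∈ Icc 3 N, a n / log n := by
    obtain ⟨k, rfl⟩ := Nat.exists_eq_add_of_le' hN
    have h7 : Icc 1 (k + 3) = insert 1 (insert 2 (Icc 3 (k + 3))) := by
      ext n; simp only [mem_insert, mem_Icc]; omega
    rw [h7, sum_insert (by simp), sum_insert (by simp), if_neg Nat.not_prime_one, if_pos Nat.prime_two, zero_add]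
    refine add_le_add ?_ (le_of_eq (sum_congr rfl fun n hn => ?_))
    · linarith [h0 2]
    · have hn := one_le_log_natCast (mem_Icc.mp hn).1
      simp only [ha, primeWeight]
      split_ifs
      · field_simp
      · simp
  linarith

end MeanSum

section LowerBound

open Real

open Finset ArithmeticFunction

/-- Completely multiplicative functions with values in `[0, 1]`. -/
structure IsUnitCompMul (ρ : ℕ → ℝ) : Prop where
  nonneg : ∀ n, 0 ≤ ρ n
  le_one : ∀ n, ρ n ≤ 1
  one : ρ 1 = 1
  mul : ∀ a b : ℕ, 0 < a → 0 < b → ρ (a * b) = ρ a * ρ b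

variable {ρ : ℕ → ℝ} {m : ℝ}

lemma IsUnitCompMul.pow (h : IsUnitCompMul ρ) {p : ℕ} (hp : 0 < p) (k : ℕ) : ρ (p ^ k) = ρ p ^ k := by
  induction k with
  | zero => simp [h.one]
  | succ k ih => rw [pow_succ, h.mul _ _ (pow_pos hp k) hp, ih, pow_succ]

/-- The arithmetic function `ρ(n) / n`. -/
noncomputable def harmonicWeight (ρ : ℕ → ℝ) : ArithmeticFunction ℝ := ⟨fun n => ρ n / n, by simp⟩

/-- The arithmetic function `n⁻¹ ∏_{p ∣ n} (1 - ρ(p))`. -/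
noncomputable def coWeight (ρ : ℕ → ℝ) : ArithmeticFunction ℝ :=
  ⟨fun n => (∏ p ∈ n.primeFactors, (1 - ρ p)) / n, by simp⟩

lemma IsUnitCompMul.isMultiplicative_harmonicWeight (h : IsUnitCompMul ρ) : (harmonicWeight ρ).IsMultiplicative := by
  rw [IsMultiplicative.iff_ne_zero]
  refine ⟨by simp [harmonicWeight, h.one], fun {a b} ha hb _ => ?_⟩
  simp only [harmonicWeight, coe_mk, h.mul a b (Nat.pos_of_ne_zero ha) (Nat.pos_of_ne_zero hb)]
  push_cast
  exact mul_div_mul_comm _ _ _ _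

lemma isMultiplicative_coWeight : (coWeight ρ).IsMultiplicative := by
  rw [IsMultiplicative.iff_ne_zero]
  refine ⟨by simp [coWeight], fun {a b} ha hb hab => ?_⟩
  simp only [coWeight, coe_mk]
  rw [hab.primeFactors_mul, prod_union hab.disjoint_primeFactors]
  push_cast
  exact mul_div_mul_comm _ _ _ _

lemma coWeight_prime_pow {p : ℕ} (hp : p.Prime) (k : ℕ) :
    coWeight ρ (p ^ k) = (1 - ρ p) * (p : ℝ)⁻¹ ^ k + if k = 0 then ρ p else 0 := by
  rcases Nat.eq_zero_or_pos k with rfl | hk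
  · simp [coWeight]
  · simp [coWeight, Nat.primeFactors_prime_pow hk.ne' hp, hk.ne', div_eq_mul_inv]

lemma IsUnitCompMul.harmonicWeight_mul_coWeight (h : IsUnitCompMul ρ) :
    harmonicWeight ρ * coWeight ρ = harmonicWeight fun _ => 1 := by
  have h1 : IsUnitCompMul fun _ => 1 := ⟨by simp, by simp, rfl, by simp⟩
  refine ((h.isMultiplicative_harmonicWeight.mul isMultiplicative_coWeight).eq_iff_eq_on_prime_powers _ _
    h1.isMultiplicative_harmonicWeight).mpr fun p k hp => ?_
  rw [mul_apply, Nat.sum_divisorsAntidiagonal fun a b => harmonicWeight ρ a * coWeight ρ b,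
    Nat.sum_divisors_prime_pow hp]
  have h2 : ∀ i ∈ range (k + 1), harmonicWeight ρ (p ^ i) * coWeight ρ (p ^ k / p ^ i) =
      ((p : ℝ)⁻¹ ^ k) * (ρ p ^ i * (1 - ρ p) + if i = k then ρ p ^ i * ρ p else 0) := by
    intro i hi
    have hik : i ≤ k := Nat.lt_succ_iff.mp (mem_range.mp hi)
    rw [Nat.pow_div hik hp.pos, coWeight_prime_pow hp]
    simp only [harmonicWeight, coe_mk, h.pow hp.pos, Nat.cast_pow, div_eq_mul_inv, ← inv_pow]
    obtain ⟨j, rfl⟩ := Nat.exists_eq_add_of_le hik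
    grind
  rw [sum_congr rfl h2, ← mul_sum, sum_add_distrib, sum_ite_eq' (range (k + 1)), if_pos (by simp), ← sum_mul,
    mul_comm _ (1 - ρ p), mul_neg_geom_sum]
  simp [harmonicWeight, pow_succ]

lemma IsUnitCompMul.log_le (h : IsUnitCompMul ρ) {N : ℕ} (hN : 0 < N) :
    Real.log N ≤ (∑ n ∈ Ioc 0 N, harmonicWeight ρ n) * ∑ n ∈ Ioc 0 N, coWeight ρ n := by
  have h0 : ∀ n, 0 ≤ harmonicWeight ρ n := fun n => div_nonneg (h.nonneg n) n.cast_nonneg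
  have h1 : ∀ n, 0 ≤ coWeight ρ n := fun n =>
    div_nonneg (prod_nonneg fun p _ => sub_nonneg.mpr (h.le_one p)) n.cast_nonneg
  calc Real.log N ≤ Real.log (N + 1 : ℕ) := Real.log_le_log (by exact_mod_cast hN) (by push_cast; linarith)
    _ ≤ harmonic N := log_add_one_le_harmonic N
    _ = ∑ n ∈ Ioc 0 N, (harmonicWeight ρ * coWeight ρ) n := by
        rw [h.harmonicWeight_mul_coWeight, harmonic_eq_sum_Icc]
        push_cast
        refine sum_congr (by ext; simp; omega) fun n _ => ?_
        simp [harmonicWeight]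
    _ ≤ _ := by
        rw [sum_Ioc_mul_eq_sum_prod_filter, sum_mul_sum, ← sum_product']
        exact sum_le_sum_of_subset_of_nonneg (filter_subset _ _) fun x _ _ => mul_nonneg (h0 _) (h1 _)

lemma IsUnitCompMul.exists_sum_coWeight_le : ∃ D, ∀ ρ : ℕ → ℝ, IsUnitCompMul ρ → ∀ N : ℕ,
    ∑ n ∈ Ioc 0 N, coWeight ρ n ≤
      exp (∑ p ∈ Icc 1 N, (if p.Prime then (1 - ρ p) / p else 0) + D) := by
  have hs : Summable fun n : ℕ => 2 * (1 / (n : ℝ) ^ 2) := (summable_one_div_nat_pow.mpr one_lt_two).mul_left 2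
  refine ⟨∑' n : ℕ, 2 * (1 / (n : ℝ) ^ 2), fun ρ h N => ?_⟩
  have h1 : ∀ n, 0 ≤ coWeight ρ n := fun n =>
    div_nonneg (prod_nonneg fun p _ => sub_nonneg.mpr (h.le_one p)) n.cast_nonneg
  have hsum : ∀ {p : ℕ}, p.Prime → HasSum (fun k => coWeight ρ (p ^ k)) (1 + (1 - ρ p) / (p - 1)) := by
    intro p hp
    have hp1 : (1 : ℝ) < p := by exact_mod_cast hp.one_lt
    have h2 := ((hasSum_geometric_of_lt_one (r := (p : ℝ)⁻¹) (by positivity) (inv_lt_one_of_one_lt₀ hp1)).mul_left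
      (1 - ρ p)).add (hasSum_ite_eq (0 : ℕ) (ρ p))
    simp only [coWeight_prime_pow hp]
    grind
  obtain ⟨hE1, hE2⟩ := EulerProduct.summable_and_hasSum_smoothNumbers_prod_primesBelow_tsum (f := coWeight ρ)
    isMultiplicative_coWeight.1 (fun hab => isMultiplicative_coWeight.2 hab)
    (fun hp => (hsum hp).summable.norm) (N + 1)
  have h2 : ∑ n ∈ Ioc 0 N, coWeight ρ n ≤ ∏ p ∈ (N + 1).primesBelow, ∑' k : ℕ, coWeight ρ (p ^ k) := by
    rw [← hE2.tsum_eq]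
    have h3 := hE2.summable.sum_le_tsum ((Ioc 0 N).attach.image fun n => (⟨n.1, Nat.mem_smoothNumbers_of_lt
      (mem_Ioc.mp n.2).1 (Nat.lt_succ_of_le (mem_Ioc.mp n.2).2)⟩ : (N + 1).smoothNumbers)) fun n _ => h1 n
    refine le_trans (le_of_eq ?_) h3
    rw [sum_image (fun a _ b _ hab => Subtype.ext (Subtype.mk.inj hab))]
    exact (sum_attach (Ioc 0 N) fun n => coWeight ρ n).symm
  refine h2.trans ?_
  have h3 : (N + 1).primesBelow = (Icc 1 N).filter Nat.Prime := by
    ext p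
    simp only [Nat.mem_primesBelow, mem_filter, mem_Icc]
    exact ⟨fun ⟨ha, hb⟩ => ⟨⟨hb.one_le, by omega⟩, hb⟩, fun ⟨ha, hb⟩ => ⟨by omega, hb⟩⟩
  rw [h3, ← sum_filter]
  calc _ ≤ ∏ p ∈ (Icc 1 N).filter Nat.Prime, exp ((1 - ρ p) / p + 2 * (1 / (p : ℝ) ^ 2)) := by
        refine prod_le_prod (fun p _ => tsum_nonneg fun k => h1 _) fun p hp => ?_
        have hp := (mem_filter.mp hp).2
        have hp2 : (2 : ℝ) ≤ p := by exact_mod_cast hp.two_le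
        rw [(hsum hp).tsum_eq]
        refine le_trans ?_ (add_one_le_exp _)
        rw [add_comm]
        refine add_le_add_left ?_ 1
        have hρ0 := h.nonneg p
        rw [div_add' _ _ _ (by positivity), div_le_div_iff₀ (by linarith) (by positivity)]
        have h4 : 2 * (1 / (p : ℝ) ^ 2) * p = 2 / p := by field_simp
        have h5 : 2 / (p : ℝ) * (p - 1) = 2 - 2 / p := by field_simp
        nlinarith
    _ = exp (∑ p ∈ (Icc 1 N).filter Nat.Prime, ((1 - ρ p) / p + 2 * (1 / (p : ℝ) ^ 2))) := (exp_sum _ _).symm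
    _ ≤ _ := by
        rw [sum_add_distrib]
        refine exp_le_exp.mpr (add_le_add_right ?_ _)
        exact hs.sum_le_tsum _ fun n _ => by positivity

lemma IsUnitCompMul.exists_le_sum_harmonicWeight (h : IsUnitCompMul ρ) (hm : HasPrimeMean ρ m) : ∃ c > 0, ∀ N : ℕ, 3 ≤ N →
    c * Real.log N ^ m ≤ ∑ n ∈ Ioc 0 N, harmonicWeight ρ n := by
  obtain ⟨D, hD⟩ := exists_sum_coWeight_le
  obtain ⟨C, hC⟩ := hm.exists_sum_one_sub_le h.nonneg h.le_one
  refine ⟨exp (-(C + D)), exp_pos _, fun N hN => ?_⟩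
  have hl : 0 < Real.log N := zero_lt_one.trans_le (one_le_log_natCast hN)
  have h1 := h.log_le (show 0 < N by omega)
  have h2 : ∑ n ∈ Ioc 0 N, coWeight ρ n ≤ Real.exp ((1 - m) * Real.log (Real.log N) + C + D) :=
    (hD ρ h N).trans (Real.exp_le_exp.mpr (by linarith [hC N hN]))
  have h3 : 0 ≤ ∑ n ∈ Ioc 0 N, harmonicWeight ρ n := sum_nonneg fun n _ => div_nonneg (h.nonneg n) n.cast_nonneg
  have h4 := h1.trans (mul_le_mul_of_nonneg_left h2 h3)
  rw [← div_le_iff₀ (exp_pos _)] at h4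
  refine le_trans (le_of_eq ?_) h4
  conv_rhs => rw [← exp_log hl]
  rw [rpow_def_of_pos hl, ← exp_add, log_exp, ← exp_sub]
  ring

lemma IsUnitCompMul.sum_theta_le (h : IsUnitCompMul ρ) (N : ℕ) :
    ∑ a ∈ Ioc 0 N, ρ a * ∑ p ∈ Icc 1 (N / a), ρ p * (p * primeWeight p) ≤ (∑ n ∈ Icc 1 N, ρ n) * Real.log N := by
  let f : ArithmeticFunction ℝ := ⟨fun n => if n = 0 then 0 else ρ n, by simp⟩
  let g : ArithmeticFunction ℝ := ⟨fun n => ρ n * (n * primeWeight n), by simp⟩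
  have h1 := sum_Ioc_mul_eq_sum_sum f g N
  calc _ = ∑ n ∈ Ioc 0 N, f n * ∑ k ∈ Ioc 0 (N / n), g k := by
        refine sum_congr rfl fun a ha => ?_
        have : a ≠ 0 := (mem_Ioc.mp ha).1.ne'
        simp only [f, g, coe_mk, if_neg this]
        rfl
    _ = ∑ n ∈ Ioc 0 N, (f * g) n := h1.symm
    _ ≤ ∑ n ∈ Ioc 0 N, ρ n * Real.log N := by
        refine sum_le_sum fun n hn => ?_
        obtain ⟨hn0, hnN⟩ := mem_Ioc.mp hn
        have h2 : (f * g) n = ρ n * ∑ b ∈ n.divisors, b * primeWeight b := by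
          rw [mul_apply, Nat.sum_divisorsAntidiagonal' fun a b => f a * g b, mul_sum]
          refine sum_congr rfl fun b hb => ?_
          have hbn := Nat.dvd_of_mem_divisors hb
          have hb0 := Nat.pos_of_dvd_of_pos hbn hn0
          have h3 : 0 < n / b := Nat.div_pos (Nat.le_of_dvd hn0 hbn) hb0
          simp only [f, g, coe_mk, if_neg h3.ne']
          rw [← mul_assoc, ← h.mul _ _ h3 hb0, Nat.div_mul_cancel hbn]
        rw [h2]
        refine mul_le_mul_of_nonneg_left ?_ (h.nonneg n)
        calc _ ≤ ∑ b ∈ n.divisors, vonMangoldt b := by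
              refine sum_le_sum fun b _ => ?_
              unfold primeWeight
              split_ifs with hb
              · rw [vonMangoldt_apply_prime hb, mul_div_cancel₀ _ (by exact_mod_cast hb.ne_zero)]
              · simp
          _ = Real.log n := vonMangoldt_sum
          _ ≤ _ := Real.log_le_log (by exact_mod_cast hn0) (by exact_mod_cast hnN)
    _ = _ := by rw [← sum_mul]; rfl

lemma half_log_le_log_div {A N : ℕ} (hA : 0 < A) (hN : 4 * A ^ 2 ≤ N) :
    Real.log N / 2 ≤ Real.log ((N / A : ℕ) : ℝ) := by
  have hA0 : (0 : ℝ) < A := by exact_mod_cast hA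
  have hN1 : (4 : ℝ) * A ^ 2 ≤ N := by exact_mod_cast hN
  have hN0 : (0 : ℝ) < N := by nlinarith
  have h2 : 1 ≤ N / A := (Nat.one_le_div_iff hA).mpr (by nlinarith)
  have h1 : (N : ℝ) ≤ 2 * A * (N / A : ℕ) := by
    have h3 : N < A * (N / A + 1) := Nat.lt_mul_div_succ N hA
    have h4 : (N : ℝ) ≤ A * ((N / A : ℕ) + 1) := by exact_mod_cast h3.le
    have h5 : (1 : ℝ) ≤ (N / A : ℕ) := by exact_mod_cast h2
    nlinarith
  have h6 : (N : ℝ) ≤ ((N / A : ℕ) : ℝ) ^ 2 := by nlinarith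
  have h7 := log_le_log hN0 h6
  rw [Real.log_pow] at h7
  linarith

lemma IsUnitCompMul.exists_le_sum (h : IsUnitCompMul ρ) (hρ : HasPrimeMean ρ m) (hm : 0 < m) : ∃ c > 0, ∃ N₀ : ℕ,
    ∀ N, N₀ ≤ N → c * N * Real.log N ^ m ≤ (∑ n ∈ Icc 1 N, ρ n) * Real.log N := by
  obtain ⟨c, hc, A, hA, hθ⟩ := hρ.exists_le_theta hm h.nonneg
  obtain ⟨d, hd, hT⟩ := h.exists_le_sum_harmonicWeight hρ
  refine ⟨c / 2 * (d * (1 / 2) ^ m), by positivity, 4 * A ^ 2, fun N hN => ?_⟩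
  have hN4 : 4 * A ≤ N := le_trans (by nlinarith) hN
  have hNA : 3 ≤ N / A := (Nat.le_div_iff_mul_le hA).mpr (by omega)
  have hl : 0 ≤ Real.log N := Real.log_natCast_nonneg N
  have h1 : d * (1 / 2) ^ m * Real.log N ^ m ≤ ∑ n ∈ Ioc 0 (N / A), harmonicWeight ρ n := by
    refine le_trans ?_ (hT _ hNA)
    rw [mul_assoc, ← mul_rpow (by norm_num) hl]
    have := half_log_le_log_div hA hN
    gcongr
    linarith
  calc _ = c / 2 * N * (d * (1 / 2) ^ m * Real.log N ^ m) := by ring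
    _ ≤ c / 2 * N * ∑ n ∈ Ioc 0 (N / A), harmonicWeight ρ n := by gcongr
    _ ≤ ∑ a ∈ Ioc 0 (N / A), ρ a * ∑ p ∈ Icc 1 (N / a), ρ p * (p * primeWeight p) := by
        rw [mul_sum]
        refine sum_le_sum fun a ha => ?_
        obtain ⟨ha0, haN⟩ := mem_Ioc.mp ha
        have h2 : A ≤ N / a := by
          rw [Nat.le_div_iff_mul_le ha0, mul_comm]
          exact (Nat.le_div_iff_mul_le hA).mp haN
        have h3 : (N : ℝ) / (2 * a) ≤ (N / a : ℕ) := by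
          rw [div_le_iff₀ (by positivity)]
          have h4 : N < a * (N / a + 1) := Nat.lt_mul_div_succ N ha0
          have h5 : (N : ℝ) ≤ a * ((N / a : ℕ) + 1) := by exact_mod_cast h4.le
          have h6 : (1 : ℝ) ≤ (N / a : ℕ) := by exact_mod_cast hA.trans_le h2
          nlinarith
        calc c / 2 * N * harmonicWeight ρ a = ρ a * (c * (N / (2 * a))) := by
              simp only [harmonicWeight, coe_mk]; field_simp
          _ ≤ ρ a * (c * (N / a : ℕ)) := by
              have := h.nonneg a
              gcongr
          _ ≤ _ := mul_le_mul_of_nonneg_left (hθ _ h2) (h.nonneg a)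
    _ ≤ ∑ a ∈ Ioc 0 N, ρ a * ∑ p ∈ Icc 1 (N / a), ρ p * (p * primeWeight p) := by
        refine sum_le_sum_of_subset_of_nonneg (Ioc_subset_Ioc_right (Nat.div_le_self N A)) fun a _ _ => ?_
        exact mul_nonneg (h.nonneg a) (sum_nonneg fun p _ =>
          mul_nonneg (h.nonneg p) (mul_nonneg p.cast_nonneg (primeWeight_nonneg p)))
    _ ≤ _ := h.sum_theta_le N

end LowerBound

section Residue

open Real

open Finset

/-- Restriction of `ρ` to the integers coprime to `M`. -/
noncomputable def coprimePart (M : ℕ) (ρ : ℕ → ℝ) (n : ℕ) : ℝ := if n.Coprime M then ρ n else 0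

variable {ρ : ℕ → ℝ} {M : ℕ}

lemma IsUnitCompMul.isUnitCompMul_coprimePart (h : IsUnitCompMul ρ) (M : ℕ) : IsUnitCompMul (coprimePart M ρ) where
  nonneg n := by unfold coprimePart; split_ifs; exacts [h.nonneg n, le_rfl]
  le_one n := by unfold coprimePart; split_ifs; exacts [h.le_one n, zero_le_one]
  one := by simp [coprimePart, h.one]
  mul a b ha hb := by
    unfold coprimePart
    simp only [Nat.coprime_mul_iff_left, h.mul a b ha hb]
    split_ifs <;> simp_all

/-- The numbers `n` in the class of `c` are moved into the class of `1` by multiplying with a suitable `Q`. -/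
lemma IsUnitCompMul.exists_sum_class_le (h : IsUnitCompMul ρ) [NeZero M] (c : ZMod M) : ∃ Q : ℕ, 0 < Q ∧ ∃ D > 0, ∀ N : ℕ,
    (∑ n ∈ Icc 1 (N / Q), if (n : ZMod M) = c then coprimePart M ρ n else 0) ≤
      D * ∑ n ∈ Icc 1 N, if (n : ZMod M) = 1 then ρ n else 0 := by
  have hpos : ∀ N : ℕ, 0 ≤ ∑ n ∈ Icc 1 N, if (n : ZMod M) = 1 then ρ n else 0 := fun N =>
    sum_nonneg fun n _ => by split_ifs; exacts [h.nonneg n, le_rfl]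
  by_cases hc : ∃ k : ℕ, 0 < k ∧ (k : ZMod M) = c ∧ k.Coprime M ∧ 0 < ρ k
  · obtain ⟨k, hk, hkc, hkM, hρk⟩ := hc
    have hφ : 0 < M.totient := Nat.totient_pos.mpr (NeZero.pos M)
    set Q := k ^ (M.totient - 1) with hQ
    have hQ0 : 0 < Q := pow_pos hk _
    have hρQ : 0 < ρ Q := by rw [hQ, h.pow hk]; positivity
    have hQc : (Q : ZMod M) * c = 1 := by
      have h1 := (ZMod.natCast_eq_natCast_iff _ _ _).mpr (Nat.ModEq.pow_totient hkM)
      rw [← hkc, ← Nat.cast_mul, hQ, ← pow_succ, Nat.sub_add_cancel hφ, h1, Nat.cast_one]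
    refine ⟨Q, hQ0, (ρ Q)⁻¹, by positivity, fun N => ?_⟩
    rw [← div_eq_inv_mul, le_div_iff₀ hρQ, sum_mul]
    calc _ ≤ ∑ n ∈ Icc 1 (N / Q), if ((Q * n : ℕ) : ZMod M) = 1 then ρ (Q * n) else 0 := by
          refine sum_le_sum fun n hn => ?_
          by_cases hn' : (n : ZMod M) = c
          · rw [if_pos hn', if_pos (by rw [Nat.cast_mul, hn', hQc]), h.mul Q n hQ0 (mem_Icc.mp hn).1, mul_comm]
            refine mul_le_mul_of_nonneg_left ?_ hρQ.le
            unfold coprimePart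
            split_ifs
            exacts [le_rfl, h.nonneg n]
          · rw [if_neg hn', zero_mul]
            grind
      _ = ∑ n ∈ (Icc 1 (N / Q)).image (Q * ·), if (n : ZMod M) = 1 then ρ n else 0 :=
          (sum_image (f := fun n : ℕ => if (n : ZMod M) = 1 then ρ n else 0) fun a _ b _ hab => Nat.eq_of_mul_eq_mul_left hQ0 hab).symm
      _ ≤ _ := by
          refine sum_le_sum_of_subset_of_nonneg (fun x hx => ?_) fun n _ _ => by
            split_ifs; exacts [h.nonneg n, le_rfl]
          obtain ⟨n, hn, rfl⟩ := mem_image.mp hx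
          rw [mem_Icc] at hn ⊢
          exact ⟨Nat.mul_pos hQ0 hn.1, by rw [mul_comm]; exact (Nat.le_div_iff_mul_le hQ0).mp hn.2⟩
  · refine ⟨1, one_pos, 1, one_pos, fun N => ?_⟩
    rw [one_mul]
    refine le_trans (le_of_eq (sum_eq_zero fun n hn => ?_)) (hpos N)
    split_ifs with hn'
    · unfold coprimePart
      split_ifs with hnM
      · by_contra hne
        exact hc ⟨n, (mem_Icc.mp hn).1, hn', hnM, lt_of_le_of_ne (h.nonneg n) (Ne.symm hne)⟩
      · rfl
    · rfl

lemma IsUnitCompMul.exists_sum_coprimePart_le (h : IsUnitCompMul ρ) (hM : 0 < M) : ∃ Q : ℕ, 0 < Q ∧ ∃ D > 0, ∀ N : ℕ,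
    ∑ n ∈ Icc 1 (N / Q), coprimePart M ρ n ≤ D * ∑ n ∈ Icc 1 N, if (n : ZMod M) = 1 then ρ n else 0 := by
  have : NeZero M := ⟨hM.ne'⟩
  choose Q hQ D hD hQD using fun c : ZMod M => h.exists_sum_class_le c
  refine ⟨∏ c, Q c, prod_pos fun c _ => hQ c, ∑ c, D c, sum_pos (fun c _ => hD c) univ_nonempty, fun N => ?_⟩
  rw [sum_mul]
  calc _ = ∑ c : ZMod M, ∑ n ∈ Icc 1 (N / ∏ c, Q c), if (n : ZMod M) = c then coprimePart M ρ n else 0 := by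
        rw [sum_comm]
        simp
    _ ≤ _ := by
        refine sum_le_sum fun c _ => le_trans ?_ (hQD c N)
        refine sum_le_sum_of_subset_of_nonneg (Icc_subset_Icc_right (Nat.div_le_div_left
          (Nat.le_of_dvd (prod_pos fun c _ => hQ c) (dvd_prod_of_mem Q (mem_univ c))) (hQ c))) fun n _ _ => ?_
        split_ifs
        exacts [(h.isUnitCompMul_coprimePart M).nonneg n, le_rfl]

lemma IsUnitCompMul.exists_le_sum_one_mod (h : IsUnitCompMul ρ) (hM : 0 < M) {m : ℝ}
    (hρ : HasPrimeMean (coprimePart M ρ) m) (hm : 0 < m) :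
    ∃ c : ℝ, 0 < c ∧ ∃ x₀ : ℝ, ∀ x : ℝ, x₀ ≤ x →
      c * x * log x ^ (m - 1) ≤ ∑ n ∈ Icc 1 ⌊x⌋₊, if (n : ZMod M) = 1 then ρ n else 0 := by
  obtain ⟨c, hc, N₀, hN₀⟩ := (h.isUnitCompMul_coprimePart M).exists_le_sum hρ hm
  obtain ⟨Q, hQ, D, hD, hS⟩ := h.exists_sum_coprimePart_le hM
  refine ⟨c / (4 * Q) * (1 / 4) ^ m / D, by positivity, ((4 * Q ^ 2 + Q * (N₀ + 1) + 3 : ℕ) : ℝ), fun x hx => ?_⟩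
  set N := ⌊x⌋₊ with hN
  have hx0 : 0 ≤ x := (Nat.cast_nonneg _).trans hx
  have hN1 : 4 * Q ^ 2 + Q * (N₀ + 1) + 3 ≤ N := Nat.le_floor hx
  have hNx : (N : ℝ) ≤ x := Nat.floor_le hx0
  have hxN : x < N + 1 := Nat.lt_floor_add_one x
  have hN3 : 3 ≤ N := by omega
  have hN3' : (3 : ℝ) ≤ N := by exact_mod_cast hN3
  have hlN := one_le_log_natCast hN3
  have hlx : log N ≤ log x := log_le_log (by linarith) hNx
  have hl2 : log x ≤ 2 * log N := by
    have h1 : x ≤ (N : ℝ) ^ 2 := by nlinarith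
    have h2 := log_le_log (by linarith) h1
    simp_all
  set k := N / Q with hk
  have hkN : N₀ + 1 ≤ k := (Nat.le_div_iff_mul_le hQ).mpr (by rw [mul_comm]; omega)
  have hlk := half_log_le_log_div hQ (show 4 * Q ^ 2 ≤ N by omega)
  have hk1 : (1 : ℝ) ≤ k := by exact_mod_cast (show 1 ≤ k by omega)
  have hkx : x / (4 * Q) ≤ k := by
    have h1 : N < Q * (k + 1) := Nat.lt_mul_div_succ N hQ
    have h2 : (N : ℝ) ≤ Q * (k + 1) := by exact_mod_cast h1.le
    rw [div_le_iff₀ (by positivity)]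
    nlinarith
  have hkN' : log k ≤ log x :=
    (log_le_log (by linarith) (by exact_mod_cast Nat.div_le_self N Q)).trans hlx
  have hlx0 : 0 < log x := by linarith
  have h1 := hN₀ k (by omega)
  have h2 : (∑ n ∈ Icc 1 k, coprimePart M ρ n) * log k ≤
      D * (∑ n ∈ Icc 1 N, if (n : ZMod M) = 1 then ρ n else 0) * log x := by
    have h3 : 0 ≤ ∑ n ∈ Icc 1 k, coprimePart M ρ n := sum_nonneg fun n _ => (h.isUnitCompMul_coprimePart M).nonneg n
    exact mul_le_mul (hS N) hkN' (by linarith) (h3.trans (hS N))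
  have h3 : c * (x / (4 * Q)) * ((1 / 4) ^ m * log x ^ m) ≤ c * k * log k ^ m := by
    rw [← mul_rpow (by norm_num) hlx0.le]
    have : 1 / 4 * log x ≤ log k := by linarith
    gcongr
  rw [rpow_sub_one hlx0.ne', mul_div_assoc', div_le_iff₀ hlx0]
  have h5 : c / (4 * Q) * (1 / 4) ^ m / D * x * log x ^ m =
      c * (x / (4 * Q)) * ((1 / 4) ^ m * log x ^ m) / D := by ring
  rw [h5, div_le_iff₀ hD]
  linarith

lemma le_one_of_growth (h1 : ρ 1 = 1) (hmul : ∀ a b : ℕ, 0 < a → 0 < b → ρ (a * b) = ρ a * ρ b)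
    (hgrowth : ∀ ε : ℝ, 0 < ε → ∃ Cε : ℝ, ∀ n : ℕ, 0 < n → |ρ n| ≤ Cε * (n : ℝ) ^ ε) {n : ℕ} (hn : 0 < n) :
    ρ n ≤ 1 := by
  by_contra! hlt
  obtain ⟨ε, hε, hε1⟩ : ∃ ε : ℝ, 0 < ε ∧ (n : ℝ) ^ ε < ρ n := by
    have hcont : Filter.Tendsto (fun ε : ℝ => (n : ℝ) ^ ε) (nhdsWithin 0 (Set.Ioi 0)) (nhds ((n : ℝ) ^ (0 : ℝ))) :=
      (continuousAt_const_rpow (by positivity)).tendsto.mono_left nhdsWithin_le_nhds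
    rw [rpow_zero] at hcont
    obtain ⟨ε, h1, h2⟩ := ((hcont.eventually (gt_mem_nhds hlt)).and self_mem_nhdsWithin).exists
    exact ⟨ε, h2, h1⟩
  obtain ⟨C, hC⟩ := hgrowth ε hε
  have hpow : ∀ k : ℕ, ρ (n ^ k) = ρ n ^ k := by
    intro k
    induction k with
    | zero => simp [h1]
    | succ k ih => grind
  have hq : 1 < ρ n / (n : ℝ) ^ ε := (one_lt_div (by positivity)).mpr hε1
  obtain ⟨k, hk⟩ := pow_unbounded_of_one_lt C hq
  have h2 := (le_abs_self _).trans (hC (n ^ k) (pow_pos hn k))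
  rw [hpow, Nat.cast_pow, ← rpow_natCast_mul (by positivity), mul_comm (k : ℝ), rpow_mul_natCast (by positivity)] at h2
  rw [div_pow, lt_div_iff₀ (by positivity)] at hk
  linarith

end Residue

/-- Let `M ≥ 1` and let `ρ : ℕ → ℝ` be a nonnegative completely multiplicative
function which is frobenian (with data `K`, `S`, `φ` as in the paper) with mean
`m ≠ 0`. Then there are `c > 0` and `x₀` such that for all `x ≥ x₀`,
`∑_{n ≤ x, n ≡ 1 (mod M)} ρ(n) ≥ c·x·(log x)^{m−1}`. -/
theorem stmt_0 (M : ℕ) (hM : 0 < M)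
    (ρ : ℕ → ℝ) (hnonneg : ∀ n, 0 ≤ ρ n)
    (hone : ρ 1 = 1) (hmul : ∀ m n : ℕ, 0 < m → 0 < n → ρ (m * n) = ρ m * ρ n)
    (hgrowth : ∀ ε : ℝ, 0 < ε → ∃ Cε : ℝ, ∀ n : ℕ, 0 < n → |ρ n| ≤ Cε * (n : ℝ) ^ ε)
    (H : ℕ) (hH : ∀ p k : ℕ, p.Prime → 1 ≤ k → |ρ (p ^ k)| ≤ (H : ℝ) ^ k)
    (K : Type) [Field K] [NumberField K] [IsGalois ℚ K]
    (S : Finset ℕ)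
    (hram : ∀ p : ℕ, p.Prime → (p : ℤ) ∣ NumberField.discr K → p ∈ S)
    (φ : (K ≃ₐ[ℚ] K) → ℝ)
    (hclass : ∀ γ τ : K ≃ₐ[ℚ] K, φ (τ * γ * τ⁻¹) = φ γ)
    (hfrob : ∀ p : ℕ, p.Prime → p ∉ S →
      ∀ σ : K ≃ₐ[ℚ] K, IsFrobeniusAt K σ p → ρ p = φ σ)
    (m : ℝ)
    (hm : m = (1 / (Nat.card (K ≃ₐ[ℚ] K) : ℝ)) * ∑ γ : K ≃ₐ[ℚ] K, φ γ)
    (hm0 : m ≠ 0) :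
    ∃ c : ℝ, 0 < c ∧ ∃ x₀ : ℝ, ∀ x : ℝ, x₀ ≤ x →
      c * x * Real.log x ^ (m - 1) ≤
        ∑ n ∈ Finset.Icc 1 ⌊x⌋₊, if (n : ZMod M) = 1 then ρ n else 0 := by
  set ρ' : ℕ → ℝ := fun n => if n = 0 then 0 else ρ n with hρ'
  have h : IsUnitCompMul ρ' := by
    refine ⟨fun n => ?_, fun n => ?_, by simp [hρ', hone], fun a b ha hb => ?_⟩
    · grind
    · simp only [hρ']
      split_ifs with hn
      exacts [zero_le_one, le_one_of_growth hone hmul hgrowth (Nat.pos_of_ne_zero hn)]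
    · simp only [hρ', if_neg ha.ne', if_neg hb.ne', if_neg (Nat.mul_pos ha hb).ne', hmul a b ha hb]
  have hmean : HasPrimeMean (coprimePart M ρ') m := by
    rw [hm]
    refine HasPrimeMean.of_frobenian S M.primeFactors (fun n => ?_) hram hclass fun p hp hpS hpM σ hσ => ?_
    · rw [abs_of_nonneg ((h.isUnitCompMul_coprimePart M).nonneg n)]
      exact (h.isUnitCompMul_coprimePart M).le_one n
    · rw [← hfrob p hp hpS σ hσ, coprimePart, if_pos, hρ']
      · exact if_neg hp.ne_zero
      · exact (Nat.Prime.coprime_iff_not_dvd hp).mpr fun hd => hpM (Nat.mem_primeFactors.mpr ⟨hp, hd, hM.ne'⟩)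
  have hmpos : 0 < m := lt_of_le_of_ne (hmean.nonneg (h.isUnitCompMul_coprimePart M).nonneg) hm0.symm
  obtain ⟨c, hc, x₀, hx₀⟩ := h.exists_le_sum_one_mod hM hmean hmpos
  refine ⟨c, hc, x₀, fun x hx => (hx₀ x hx).trans (le_of_eq ?_)⟩
  refine Finset.sum_congr rfl fun n hn => ?_
  have hn0 : n ≠ 0 := by have := (Finset.mem_Icc.mp hn).1; omega
  simp only [hρ', if_neg hn0]
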